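/- There exists a constant C > 0 such that for every sufficiently large Fermi momentum k_F (with N, ℏ, κ, E_N, E_HF as in the context) the correlation energy satisfies (E_N − E_HF)/ℏ ≤ κ · Σ_{k ∈ ℤ³} |k| · [ (1/π) ∫_0^∞ log( 1 + V̂(k) · κ · 2π · (1 − λ · arctan(1/λ)) ) dλ − V̂(k) · κπ/2 ] + C · N^{−1/27}. -/

import Mathlib

open scoped Real BigOperators
open MeasureTheory

noncomputable section

/-- The Euclidean norm of a lattice point `k ∈ ℤ³`. -/
def znorm (k : Fin 3 → ℤ) : ℝ := Real.sqrt (∑ i, ((k i : ℝ)) ^ 2)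

/-- The number of lattice points in the Fermi ball of radius `k_F`. -/
def numParticles (kF : ℝ) : ℕ := Set.ncard {k : Fin 3 → ℤ | znorm k ≤ kF}

/-- The interaction potential `V(x) = Σ_k V̂(k) e^{i k·x}` (a finite sum;
it is real-valued since `V̂` is even, so we take the real part). -/
def potential (Vhat : (Fin 3 → ℤ) → ℝ) (x : Fin 3 → ℝ) : ℝ :=
  (∑ᶠ k : Fin 3 → ℤ,
    (Vhat k : ℂ) * Complex.exp (Complex.I * (∑ i, (k i : ℝ) * x i))).re

/-- The fundamental domain `[0, 2π)³` of the torus. -/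
def box1 : Set (Fin 3 → ℝ) := Set.univ.pi fun _ => Set.Ico 0 (2 * π)

/-- The fundamental domain `[0, 2π)^{3N}` for `N` particles. -/
def boxN (N : ℕ) : Set (Fin N → Fin 3 → ℝ) := Set.univ.pi fun _ => box1

/-- A smooth, `(2πℤ)³`-periodic (in each particle variable), antisymmetric,
`L²`-normalized `N`-particle wave function. -/
structure IsAdmissible (N : ℕ) (ψ : (Fin N → Fin 3 → ℝ) → ℂ) : Prop where
  smooth : ContDiff ℝ (⊤ : ℕ∞) ψ
  periodic : ∀ (x : Fin N → Fin 3 → ℝ) (j : Fin N) (m : Fin 3 → ℤ),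
    ψ (Function.update x j (x j + fun i => 2 * π * (m i : ℝ))) = ψ x
  antisymm : ∀ (x : Fin N → Fin 3 → ℝ) (σ : Equiv.Perm (Fin N)),
    ψ (x ∘ σ) = ((Equiv.Perm.sign σ : ℤ) : ℂ) * ψ x
  normalized : ∫ x in boxN N, ‖ψ x‖ ^ 2 = 1

/-- The energy `E[ψ] = Σ_i ℏ² ∫ |∇_{x_i} ψ|² + (1/N) Σ_{i<j} ∫ V(x_i−x_j)|ψ|²`,
with `ℏ = N^{-1/3}`. -/
def energy (Vhat : (Fin 3 → ℤ) → ℝ) (N : ℕ) (ψ : (Fin N → Fin 3 → ℝ) → ℂ) : ℝ :=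
  (∑ j : Fin N, (((N : ℝ) ^ ((1 : ℝ) / 3))⁻¹) ^ 2 *
      ∫ x in boxN N, ∑ i : Fin 3,
        ‖fderiv ℝ ψ x (Pi.single j (Pi.single i (1 : ℝ)))‖ ^ 2) +
  (1 / (N : ℝ)) *
    ∑ p ∈ Finset.univ.filter (fun p : Fin N × Fin N => p.1 < p.2),
      ∫ x in boxN N, potential Vhat (x p.1 - x p.2) * ‖ψ x‖ ^ 2

/-- `ψ` is the Slater determinant built from smooth periodic orthonormal
orbitals `f_1, …, f_N`. -/
def IsSlater (N : ℕ) (ψ : (Fin N → Fin 3 → ℝ) → ℂ) : Prop :=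
  ∃ f : Fin N → (Fin 3 → ℝ) → ℂ,
    (∀ j, ContDiff ℝ (⊤ : ℕ∞) (f j)) ∧
    (∀ j (y : Fin 3 → ℝ) (m : Fin 3 → ℤ),
      f j (y + fun i => 2 * π * (m i : ℝ)) = f j y) ∧
    (∀ j l, ∫ y in box1, (starRingEnd ℂ) (f j y) * f l y =
      if j = l then 1 else 0) ∧
    (∀ x, ψ x = ((Real.sqrt (Nat.factorial N) : ℂ))⁻¹ *
      ∑ σ : Equiv.Perm (Fin N),
        ((Equiv.Perm.sign σ : ℤ) : ℂ) * ∏ j, f j (x (σ j)))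

/-- The many-body ground state energy `E_N`. -/
def groundEnergy (Vhat : (Fin 3 → ℤ) → ℝ) (N : ℕ) : ℝ :=
  sInf {E : ℝ | ∃ ψ, IsAdmissible N ψ ∧ E = energy Vhat N ψ}

/-- The Hartree–Fock energy `E_HF`. -/
def hartreeFockEnergy (Vhat : (Fin 3 → ℤ) → ℝ) (N : ℕ) : ℝ :=
  sInf {E : ℝ | ∃ ψ, IsAdmissible N ψ ∧ IsSlater N ψ ∧ E = energy Vhat N ψ}

/-- `κ = (3/(4π))^{1/3}`. -/
def κ : ℝ := (3 / (4 * π)) ^ ((1 : ℝ) / 3)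

/-- The Gell-Mann–Brueckner correlation energy
`κ Σ_k |k| [ (1/π) ∫_0^∞ log(1 + V̂(k) κ 2π (1 − λ arctan(1/λ))) dλ − V̂(k) κπ/2 ]`. -/
def rpaEnergy (Vhat : (Fin 3 → ℤ) → ℝ) : ℝ :=
  κ * ∑ᶠ k : Fin 3 → ℤ, znorm k *
    ((1 / π) * (∫ lam in Set.Ioi (0 : ℝ),
        Real.log (1 + Vhat k * κ * (2 * π) * (1 - lam * Real.arctan (1 / lam))))
      - Vhat k * (κ * π / 2))

end

/-! ### Module M: the matrix lemma -/

theorem mm_spectral {I : Type*} [Fintype I] [DecidableEq I] (A : Matrix I I ℝ)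
    (hA : A.transpose = A) :
    ∃ (O : Matrix I I ℝ) (μ : I → ℝ), O * O.transpose = 1 ∧ O.transpose * O = 1 ∧
      A = O * Matrix.diagonal μ * O.transpose := by
  have hH : A.IsHermitian := by
    rw [Matrix.IsHermitian, Matrix.conjTranspose_eq_transpose_of_trivial]; exact hA
  refine ⟨hH.eigenvectorUnitary, hH.eigenvalues, ?_, ?_, ?_⟩
  · have := Matrix.mem_unitaryGroup_iff.mp hH.eigenvectorUnitary.2
    rwa [Matrix.star_eq_conjTranspose, Matrix.conjTranspose_eq_transpose_of_trivial] at this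
  · have := Matrix.mem_unitaryGroup_iff'.mp hH.eigenvectorUnitary.2
    rwa [Matrix.star_eq_conjTranspose, Matrix.conjTranspose_eq_transpose_of_trivial] at this
  · have := hH.spectral_theorem
    rw [Unitary.conjStarAlgAut_apply, Matrix.star_eq_conjTranspose, Matrix.conjTranspose_eq_transpose_of_trivial] at this
    exact this

theorem mm_log_integral_aux (x y : ℝ) (hx : 0 < x) (hy : 0 < y) (hyx : y ≤ x) :
    IntegrableOn (fun t : ℝ => Real.log (x ^ 2 + t ^ 2) - Real.log (y ^ 2 + t ^ 2)) (Set.Ioi 0) ∧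
    ∫ t in Set.Ioi (0:ℝ), (Real.log (x ^ 2 + t ^ 2) - Real.log (y ^ 2 + t ^ 2)) = π * (x - y) := by
  set A : ℝ → ℝ := fun t => t * (Real.log (x ^ 2 + t ^ 2) - Real.log (y ^ 2 + t ^ 2))
    + 2 * x * Real.arctan (t / x) - 2 * y * Real.arctan (t / y) with hA
  have hder : ∀ t : ℝ, HasDerivAt A (Real.log (x ^ 2 + t ^ 2) - Real.log (y ^ 2 + t ^ 2)) t := by
    intro t
    have hx2 : 0 < x ^ 2 + t ^ 2 := by positivity
    have hy2 : 0 < y ^ 2 + t ^ 2 := by positivity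
    have h0 : ∀ z : ℝ, HasDerivAt (fun t : ℝ => z ^ 2 + t ^ 2) (2 * t) t := by
      intro z
      have := ((hasDerivAt_pow 2 t).const_add (z ^ 2))
      simpa using this
    have h1 := (hasDerivAt_id t).mul (((h0 x).log hx2.ne').sub ((h0 y).log hy2.ne'))
    have h2 := (((hasDerivAt_id t).div_const x).arctan).const_mul (2 * x)
    have h3 := (((hasDerivAt_id t).div_const y).arctan).const_mul (2 * y)
    have h4 := (h1.add h2).sub h3
    refine (h4.congr_deriv ?_).congr_of_eventuallyEq (Filter.Eventually.of_forall fun s => ?_)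
    · simp only [id, Pi.sub_apply]
      have : 1 + (t / x) ^ 2 = (x ^ 2 + t ^ 2) / x ^ 2 := by field_simp
      have h' : 1 + (t / y) ^ 2 = (y ^ 2 + t ^ 2) / y ^ 2 := by field_simp
      rw [this, h']
      field_simp
      ring
    · simp [hA]
  have hnn : ∀ t ∈ Set.Ioi (0:ℝ), 0 ≤ Real.log (x ^ 2 + t ^ 2) - Real.log (y ^ 2 + t ^ 2) := by
    intro t _
    rw [sub_nonneg]
    apply Real.log_le_log (by positivity)
    gcongr
  have hlim : Filter.Tendsto A Filter.atTop (nhds (π * (x - y))) := by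
    have l1 : Filter.Tendsto (fun t : ℝ => t * (Real.log (x ^ 2 + t ^ 2) - Real.log (y ^ 2 + t ^ 2))) Filter.atTop (nhds 0) := by
      have hup : Filter.Tendsto (fun t : ℝ => (x ^ 2 - y ^ 2) * t⁻¹) Filter.atTop (nhds 0) := by
        simpa using tendsto_inv_atTop_zero.const_mul (x ^ 2 - y ^ 2)
      refine tendsto_of_tendsto_of_tendsto_of_le_of_le' tendsto_const_nhds hup ?_ ?_
      · filter_upwards [Filter.eventually_gt_atTop 0] with t ht
        exact mul_nonneg ht.le (hnn t ht)
      · filter_upwards [Filter.eventually_gt_atTop 0] with t ht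
        have hx2 : 0 < x ^ 2 + t ^ 2 := by positivity
        have hy2 : 0 < y ^ 2 + t ^ 2 := by positivity
        rw [← Real.log_div hx2.ne' hy2.ne']
        have h1 := Real.log_le_sub_one_of_pos (div_pos hx2 hy2)
        have h2 : (x ^ 2 + t ^ 2) / (y ^ 2 + t ^ 2) - 1 = (x ^ 2 - y ^ 2) / (y ^ 2 + t ^ 2) := by field_simp; ring
        have h5 : 0 ≤ x ^ 2 - y ^ 2 := by nlinarith
        have h3 : (x ^ 2 - y ^ 2) / (y ^ 2 + t ^ 2) ≤ (x ^ 2 - y ^ 2) / t ^ 2 := by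
          gcongr; nlinarith
        calc _ ≤ t * ((x ^ 2 - y ^ 2) / t ^ 2) := by gcongr; linarith
          _ = _ := by field_simp
    have l2 : ∀ z : ℝ, 0 < z → Filter.Tendsto (fun t : ℝ => 2 * z * Real.arctan (t / z)) Filter.atTop (nhds (2 * z * (π / 2))) := by
      intro z hz
      apply Filter.Tendsto.const_mul
      have h1 := Real.tendsto_arctan_atTop.mono_right nhdsWithin_le_nhds
      exact h1.comp (Filter.tendsto_id.atTop_div_const hz)
    have := (l1.add (l2 x hx)).sub (l2 y hy)
    convert this using 2
    ring
  have h0 : A 0 = 0 := by simp [hA]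
  refine ⟨integrableOn_Ioi_deriv_of_nonneg (hder 0).continuousAt.continuousWithinAt (fun t _ => hder t) hnn hlim, ?_⟩
  rw [integral_Ioi_of_hasDerivAt_of_nonneg (hder 0).continuousAt.continuousWithinAt (fun t _ => hder t) hnn hlim, h0, sub_zero]

theorem mm_log_integral (x y : ℝ) (hx : 0 < x) (hy : 0 < y) :
    IntegrableOn (fun t : ℝ => Real.log (x ^ 2 + t ^ 2) - Real.log (y ^ 2 + t ^ 2)) (Set.Ioi 0) ∧
    ∫ t in Set.Ioi (0:ℝ), (Real.log (x ^ 2 + t ^ 2) - Real.log (y ^ 2 + t ^ 2)) = π * (x - y) := by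
  rcases le_total y x with h | h
  · exact mm_log_integral_aux x y hx hy h
  · obtain ⟨h1, h2⟩ := mm_log_integral_aux y x hy hx h
    have e : (fun t : ℝ => Real.log (x ^ 2 + t ^ 2) - Real.log (y ^ 2 + t ^ 2))
        = fun t => -(Real.log (y ^ 2 + t ^ 2) - Real.log (x ^ 2 + t ^ 2)) := by
      ext t; ring
    constructor
    · rw [e]; exact h1.neg
    · rw [e, integral_neg, h2]; ring

theorem mm_main {I : Type*} [Fintype I] [DecidableEq I] (h : I → ℝ) (hpos : ∀ p, 0 < h p)
    (c : ℝ) (hc : 0 ≤ c) :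
    ∃ (kp : I → ℝ) (φ : I → I → ℝ), (∀ i, 0 ≤ kp i) ∧
      (∀ i j, ∑ p, φ i p * φ j p = if i = j then 1 else 0) ∧
      (∑ i, kp i ≤ c / 4 * ∑ p, 1 / h p) ∧
      (∀ hm > 0, (∀ p, hm ≤ h p) → ∀ p, ∑ i, kp i ^ 2 * φ i p ^ 2 ≤ c / (4 * hm)) ∧
      ∑ i, (Real.cosh (2 * kp i) - 1) * ∑ p, h p * φ i p ^ 2
        + c / 2 * (∑ i, Real.exp (-2 * kp i) * (∑ p, φ i p) ^ 2 - Fintype.card I)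
      = (1 / π) * (∫ t in Set.Ioi (0:ℝ), Real.log (1 + c * ∑ p, h p / (h p ^ 2 + t ^ 2)))
        - c / 2 * Fintype.card I := by
  classical
  set w : I → ℝ := fun p => √(h p) with hw
  have hwpos : ∀ p, 0 < w p := fun p => Real.sqrt_pos.mpr (hpos p)
  have hww : ∀ p, w p * w p = h p := fun p => Real.mul_self_sqrt (hpos p).le
  set M : Matrix I I ℝ := Matrix.diagonal (fun p => h p ^ 2) + Matrix.of (fun p q => c * (w p * w q)) with hM
  have hMT : M.transpose = M := by
    ext p q
    simp only [hM, Matrix.transpose_apply, Matrix.add_apply, Matrix.diagonal_apply, Matrix.of_apply]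
    by_cases hpq : p = q
    · simp [hpq]
    · simp [hpq, Ne.symm hpq, mul_comm]
  obtain ⟨O, μ, hO1, hO2, hMO⟩ := mm_spectral M hMT
  -- quadratic form of M
  have hMq : ∀ v : I → ℝ, dotProduct v (M.mulVec v) = ∑ p, (h p * v p) ^ 2 + c * (∑ p, w p * v p) ^ 2 := by
    intro v
    rw [hM, Matrix.add_mulVec, dotProduct_add]
    congr 1
    · simp only [dotProduct, Matrix.mulVec_diagonal]
      exact Finset.sum_congr rfl fun p _ => by ring
    · simp only [dotProduct, Matrix.mulVec, Matrix.of_apply]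
      rw [sq, Finset.sum_mul_sum, Finset.mul_sum]
      refine Finset.sum_congr rfl fun p _ => ?_
      rw [Finset.mul_sum, Finset.mul_sum]
      exact Finset.sum_congr rfl fun q _ => by ring
  have hOc : ∀ i j, ∑ p, O p i * O p j = if i = j then 1 else 0 := by
    intro i j
    have := congrFun (congrFun hO2 i) j
    simpa [Matrix.mul_apply, Matrix.one_apply] using this
  have hμ : ∀ i, μ i = dotProduct (O.col i) (M.mulVec (O.col i)) := by
    intro i
    have : O.transpose * M * O = Matrix.diagonal μ := by
      rw [hMO]
      calc O.transpose * (O * Matrix.diagonal μ * O.transpose) * O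
          = (O.transpose * O) * Matrix.diagonal μ * (O.transpose * O) := by simp only [Matrix.mul_assoc]
        _ = _ := by simp [hO2]
    have h2 := congrFun (congrFun this i) i
    rw [Matrix.diagonal_apply_eq] at h2
    rw [← h2, Matrix.mul_assoc, Matrix.mul_apply]
    rfl
  have hμpos : ∀ i, 0 < μ i := by
    intro i
    rw [hμ, hMq]
    have h1 : 0 ≤ c * (∑ p, w p * O.col i p) ^ 2 := by positivity
    have h2 : 0 < ∑ p, (h p * O.col i p) ^ 2 := by
      by_contra hcon
      have hz : ∑ p, (h p * O.col i p) ^ 2 = 0 := le_antisymm (not_lt.mp hcon) (Finset.sum_nonneg fun p _ => sq_nonneg _)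
      rw [Finset.sum_eq_zero_iff_of_nonneg (fun p _ => sq_nonneg _)] at hz
      have h3 := hOc i i
      simp only [if_true] at h3
      have : ∑ p, O p i * O p i = 0 := Finset.sum_eq_zero fun p _ => by
        have := hz p (Finset.mem_univ p)
        have h4 : h p * O p i = 0 := by simpa using this
        rcases mul_eq_zero.mp h4 with h5 | h5
        · exact absurd h5 (hpos p).ne'
        · simp [h5]
      linarith
    linarith
  set W : Matrix I I ℝ := O * Matrix.diagonal (fun i => √(μ i)) * O.transpose with hWdef
  set W' : Matrix I I ℝ := O * Matrix.diagonal (fun i => (√(μ i))⁻¹) * O.transpose with hW'def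
  have hsq : ∀ i, √(μ i) * √(μ i) = μ i := fun i => Real.mul_self_sqrt (hμpos i).le
  have hspos : ∀ i, 0 < √(μ i) := fun i => Real.sqrt_pos.mpr (hμpos i)
  have hprod : ∀ a b : I → ℝ, (O * Matrix.diagonal a * O.transpose) * (O * Matrix.diagonal b * O.transpose)
      = O * Matrix.diagonal (fun i => a i * b i) * O.transpose := by
    intro a b
    calc _ = O * Matrix.diagonal a * (O.transpose * O) * Matrix.diagonal b * O.transpose := by simp only [Matrix.mul_assoc]
      _ = _ := by rw [hO2, Matrix.mul_one, Matrix.mul_assoc O, Matrix.diagonal_mul_diagonal]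
  have hWW : W * W = M := by
    rw [hWdef, hprod, hMO]; simp only [hsq]
  have hWW' : W * W' = 1 := by
    rw [hWdef, hW'def, hprod]
    simp only [mul_inv_cancel₀ (hspos _).ne']
    rw [Matrix.diagonal_one, Matrix.mul_one, hO1]
  have hMW' : M * W' = W := by rw [← hWW, Matrix.mul_assoc, hWW', Matrix.mul_one]
  have hWT : W.transpose = W := by
    rw [hWdef]; simp [Matrix.transpose_mul, Matrix.mul_assoc]
  have hWsymm : ∀ p q, W p q = W q p := fun p q => by rw [← Matrix.transpose_apply W, hWT]
  have hWtr : W.trace = ∑ i, √(μ i) := by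
    rw [hWdef, Matrix.trace_mul_comm, ← Matrix.mul_assoc, hO2, Matrix.one_mul, Matrix.trace_diagonal]
  have hWpsd : ∀ v : I → ℝ, v ≠ 0 → 0 < dotProduct v (W.mulVec v) := by
    intro v hv
    have e1 : dotProduct v (W.mulVec v) = ∑ i, √(μ i) * (O.transpose.mulVec v i) ^ 2 := by
      rw [hWdef, ← Matrix.mulVec_mulVec, ← Matrix.mulVec_mulVec, Matrix.dotProduct_mulVec,
        ← Matrix.mulVec_transpose]
      simp only [dotProduct, Matrix.mulVec_diagonal]
      exact Finset.sum_congr rfl fun p _ => by ring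
    rw [e1]
    by_contra hcon
    have hz := le_antisymm (not_lt.mp hcon) (Finset.sum_nonneg fun p _ => mul_nonneg (hspos p).le (sq_nonneg _))
    rw [Finset.sum_eq_zero_iff_of_nonneg (fun p _ => mul_nonneg (hspos p).le (sq_nonneg _))] at hz
    have : O.transpose.mulVec v = 0 := by
      ext i
      have := hz i (Finset.mem_univ i)
      rcases mul_eq_zero.mp this with h5 | h5
      · exact absurd h5 (hspos i).ne'
      · simpa using h5
    apply hv
    rw [← Matrix.one_mulVec v, ← hO1, ← Matrix.mulVec_mulVec, this, Matrix.mulVec_zero]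
  -- Z
  set Z : Matrix I I ℝ := Matrix.of (fun p q => W p q / (w p * w q)) with hZdef
  have hZT : Z.transpose = Z := by
    ext p q
    simp only [hZdef, Matrix.transpose_apply, Matrix.of_apply]
    rw [hWsymm, mul_comm]
  obtain ⟨P, ζ, hP1, hP2, hZP⟩ := mm_spectral Z hZT
  have hPr : ∀ p q, ∑ i, P p i * P q i = if p = q then 1 else 0 := by
    intro i j
    have := congrFun (congrFun hP1 i) j
    simpa [Matrix.mul_apply, Matrix.one_apply] using this
  have hPc : ∀ i j, ∑ p, P p i * P p j = if i = j then 1 else 0 := by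
    intro i j
    have := congrFun (congrFun hP2 i) j
    simpa [Matrix.mul_apply, Matrix.one_apply] using this
  have hentry : ∀ (a : I → ℝ) (p q : I), (P * Matrix.diagonal a * P.transpose) p q = ∑ i, a i * (P p i * P q i) := by
    intro a p q
    rw [Matrix.mul_apply]
    exact Finset.sum_congr rfl fun i _ => by rw [Matrix.mul_diagonal, Matrix.transpose_apply]; ring
  have hZe : ∀ p q, W p q = (w p * w q) * ∑ i, ζ i * (P p i * P q i) := by
    intro p q
    rw [← hentry, ← hZP, hZdef, Matrix.of_apply]
    have := (hwpos p).ne'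
    have := (hwpos q).ne'
    field_simp
  -- eigenvector eq
  have hZmul : Z * P = P * Matrix.diagonal ζ := by
    rw [hZP, Matrix.mul_assoc, hP2, Matrix.mul_one]
  -- u i = P p i / w p ; W u = ζ H u
  have hWu : ∀ i, W.mulVec (fun p => P p i / w p) = fun p => ζ i * (h p * (P p i / w p)) := by
    intro i
    ext p
    have h1 := congrFun (congrFun hZmul p) i
    rw [Matrix.mul_apply, Matrix.mul_diagonal] at h1
    have h2 : W.mulVec (fun p => P p i / w p) p = w p * ∑ q, Z p q * P q i := by
      rw [Matrix.mulVec, dotProduct, Finset.mul_sum]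
      refine Finset.sum_congr rfl fun q _ => ?_
      rw [hZdef, Matrix.of_apply]
      have := (hwpos p).ne'
      have := (hwpos q).ne'
      field_simp
    rw [h2, h1, ← hww p]
    have := (hwpos p).ne'
    field_simp
  have hζ : ∀ i, 1 ≤ ζ i := by
    intro i
    set u : I → ℝ := fun p => P p i / w p with hu
    have hune : u ≠ 0 := by
      intro h0
      have h3 := hPc i i
      simp only [if_true] at h3
      have : ∑ p, P p i * P p i = 0 := Finset.sum_eq_zero fun p _ => by
        have := congrFun h0 p
        simp only [hu, Pi.zero_apply, div_eq_zero_iff, (hwpos p).ne', or_false] at this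
        simp [this]
      linarith
    have hHu : 0 < ∑ p, (h p * u p) ^ 2 := by
      obtain ⟨p, hp⟩ := Function.ne_iff.mp hune
      refine Finset.sum_pos' (fun p _ => sq_nonneg _) ⟨p, Finset.mem_univ p, ?_⟩
      have : h p * u p ≠ 0 := mul_ne_zero (hpos p).ne' hp
      positivity
    have h1 : 0 < ζ i := by
      have h4 := hWpsd u hune
      rw [hWu] at h4
      have : dotProduct u (fun p => ζ i * (h p * (P p i / w p))) = ζ i * ∑ p, h p * u p ^ 2 := by
        rw [dotProduct, Finset.mul_sum]
        exact Finset.sum_congr rfl fun p _ => by rw [hu]; ring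
      rw [this] at h4
      by_contra hcon
      have : 0 ≤ ∑ p, h p * u p ^ 2 := Finset.sum_nonneg fun p _ => mul_nonneg (hpos p).le (sq_nonneg _)
      nlinarith
    have h2 : dotProduct (W.mulVec u) (W.mulVec u) = dotProduct u (M.mulVec u) := by
      have e : M.mulVec u = W.mulVec (W.mulVec u) := by rw [Matrix.mulVec_mulVec, hWW]
      rw [e, Matrix.dotProduct_mulVec u W, ← Matrix.mulVec_transpose, hWT]
    rw [hMq, hWu] at h2
    have h3 : dotProduct (fun p => ζ i * (h p * (P p i / w p))) (fun p => ζ i * (h p * (P p i / w p)))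
        = ζ i ^ 2 * ∑ p, (h p * u p) ^ 2 := by
      rw [dotProduct, Finset.mul_sum]
      exact Finset.sum_congr rfl fun p _ => by rw [hu]; ring
    rw [h3] at h2
    have h4 : 0 ≤ c * (∑ p, w p * u p) ^ 2 := by positivity
    have h5 : 1 ≤ ζ i ^ 2 := by
      by_contra hcon
      nlinarith
    nlinarith
  have hζpos : ∀ i, 0 < ζ i := fun i => lt_of_lt_of_le one_pos (hζ i)
  -- diag identities
  have hWrow : ∀ p, ∑ q, W p q ^ 2 = h p ^ 2 + c * h p := by
    intro p
    have h1 := congrFun (congrFun hWW p) p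
    rw [Matrix.mul_apply] at h1
    have h2 : M p p = h p ^ 2 + c * h p := by
      rw [hM, Matrix.add_apply, Matrix.diagonal_apply_eq, Matrix.of_apply, hww]
    rw [← h2, ← h1]
    exact Finset.sum_congr rfl fun q _ => by rw [hWsymm q p]; ring
  have hYrow : ∀ p, ∑ q, (W p q - if p = q then h p else 0) ^ 2 = c * h p - 2 * h p * (W p p - h p) := by
    intro p
    have : ∀ q, (W p q - if p = q then h p else 0) ^ 2 = W p q ^ 2 + (if p = q then (h p ^ 2 - 2 * W p q * h p) else 0) := by
      intro q; split_ifs <;> ring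
    simp only [this]
    rw [Finset.sum_add_distrib, hWrow]
    simp
    ring
  have hWpp1 : ∀ p, W p p - h p ≤ c / 2 := by
    intro p
    have h1 : 0 ≤ ∑ q, (W p q - if p = q then h p else 0) ^ 2 := Finset.sum_nonneg fun q _ => sq_nonneg _
    rw [hYrow] at h1
    have := hpos p
    by_contra hcon
    nlinarith
  have hWpp0 : ∀ p, h p ≤ W p p := by
    intro p
    rw [hZe, hww]
    have : 1 ≤ ∑ i, ζ i * (P p i * P p i) := by
      have h1 := hPr p p
      simp only [if_true] at h1
      rw [← h1]
      exact Finset.sum_le_sum fun i _ => by nlinarith [hζ i, mul_self_nonneg (P p i)]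
    nlinarith [hpos p]
  have hXe : ∀ p q, (W p q - if p = q then h p else 0) = (w p * w q) * ∑ i, (ζ i - 1) * (P p i * P q i) := by
    intro p q
    simp only [sub_mul, one_mul]
    rw [Finset.sum_sub_distrib, hPr, mul_sub, ← hZe]
    split_ifs with hpq
    · subst hpq; rw [mul_one, hww]
    · simp
  have hklog : ∀ i, 1 / 2 * Real.log (ζ i) ≤ (ζ i - 1) / 2 := fun i => by
    have := Real.log_le_sub_one_of_pos (hζpos i); linarith
  have hk0 : ∀ i, 0 ≤ 1 / 2 * Real.log (ζ i) := fun i => by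
    have := Real.log_nonneg (hζ i); linarith
  refine ⟨fun i => 1 / 2 * Real.log (ζ i), fun i p => P p i, hk0, hPc, ?_, ?_, ?_⟩
  · calc ∑ i, 1 / 2 * Real.log (ζ i) ≤ ∑ i, (ζ i - 1) / 2 := Finset.sum_le_sum fun i _ => hklog i
      _ = 1 / 2 * ∑ i, (ζ i - 1) * ∑ p, P p i * P p i := by
          rw [Finset.mul_sum]; refine Finset.sum_congr rfl fun i _ => ?_
          rw [hPc, if_pos rfl]; ring
      _ = 1 / 2 * ∑ p, (W p p - h p) / h p := by
          congr 1
          simp only [Finset.mul_sum]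
          rw [Finset.sum_comm]
          refine Finset.sum_congr rfl fun p _ => ?_
          have := hXe p p
          rw [if_pos rfl, hww] at this
          rw [this, mul_div_cancel_left₀ _ (hpos p).ne']
      _ ≤ 1 / 2 * ∑ p, (c / 2) * (1 / h p) := by
          gcongr with p
          rw [mul_one_div]
          exact div_le_div_of_nonneg_right (hWpp1 p) (hpos p).le
      _ = c / 4 * ∑ p, 1 / h p := by rw [← Finset.mul_sum]; ring
  · intro hm hm0 hhm p
    have step1 : ∑ i, (1 / 2 * Real.log (ζ i)) ^ 2 * P p i ^ 2 ≤ ∑ i, ((ζ i - 1) / 2) ^ 2 * P p i ^ 2 :=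
      Finset.sum_le_sum fun i _ => mul_le_mul_of_nonneg_right (pow_le_pow_left₀ (hk0 i) (hklog i) 2) (sq_nonneg _)
    have step2 : ∑ i, ((ζ i - 1) / 2) ^ 2 * P p i ^ 2 = 1 / 4 * ∑ q, (∑ i, (ζ i - 1) * (P p i * P q i)) ^ 2 := by
      have hX := hprod
      have : ∀ q, (∑ i, (ζ i - 1) * (P p i * P q i)) ^ 2 = ∑ i, ∑ j, ((ζ i - 1) * (ζ j - 1) * P p i * P p j) * (P q i * P q j) := by
        intro q
        rw [sq, Finset.sum_mul_sum]
        exact Finset.sum_congr rfl fun i _ => Finset.sum_congr rfl fun j _ => by ring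
      simp only [this]
      rw [Finset.sum_comm, Finset.mul_sum]
      refine Finset.sum_congr rfl fun i _ => ?_
      rw [Finset.sum_comm]
      simp only [← Finset.mul_sum, hPc]
      simp
      ring
    have step3 : ∑ q, (∑ i, (ζ i - 1) * (P p i * P q i)) ^ 2 ≤ ∑ q, (W p q - if p = q then h p else 0) ^ 2 / (h p * hm) := by
      refine Finset.sum_le_sum fun q _ => ?_
      rw [hXe, mul_pow, mul_pow, sq (w p), sq (w q), hww, hww, le_div_iff₀ (mul_pos (hpos p) hm0)]
      have := hhm q
      have h1 := hpos p
      have : h p * hm ≤ h p * h q := by gcongr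
      nlinarith [mul_le_mul_of_nonneg_right this (sq_nonneg (∑ i, (ζ i - 1) * (P p i * P q i)))]
    have step4 : ∑ q, (W p q - if p = q then h p else 0) ^ 2 / (h p * hm) ≤ c / hm := by
      rw [← Finset.sum_div, hYrow, div_le_div_iff₀ (mul_pos (hpos p) hm0) hm0]
      have : 0 ≤ 2 * h p * (W p p - h p) * hm := by
        have := hWpp0 p
        have := hpos p
        apply mul_nonneg (mul_nonneg (by linarith) (by linarith)) hm0.le
      nlinarith
    calc _ ≤ _ := step1
      _ = _ := step2
      _ ≤ 1 / 4 * (c / hm) := by linarith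
      _ = c / (4 * hm) := by field_simp
  · -- energy identity
    have hcosh : ∀ i, Real.cosh (2 * (1 / 2 * Real.log (ζ i))) = (ζ i + (ζ i)⁻¹) / 2 := by
      intro i
      rw [show 2 * (1 / 2 * Real.log (ζ i)) = Real.log (ζ i) by ring, Real.cosh_log (hζpos i)]
    have hexp : ∀ i, Real.exp (-2 * (1 / 2 * Real.log (ζ i))) = (ζ i)⁻¹ := by
      intro i
      rw [show -2 * (1 / 2 * Real.log (ζ i)) = - Real.log (ζ i) by ring, Real.exp_neg, Real.exp_log (hζpos i)]
    simp only [hcosh, hexp]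
    -- inverse of W
    set V : Matrix I I ℝ := Matrix.of (fun p q => (∑ i, (ζ i)⁻¹ * (P p i * P q i)) / (w p * w q)) with hVdef
    have hWV : W * V = 1 := by
      ext p q
      rw [Matrix.mul_apply, Matrix.one_apply]
      have : ∀ r, W p r * V r q = w p / w q * ∑ i, ∑ j, (ζ i * (ζ j)⁻¹ * P p i * P q j) * (P r i * P r j) := by
        intro r
        rw [hZe, hVdef, Matrix.of_apply]
        have h1 : (∑ i, ζ i * (P p i * P r i)) * (∑ i, (ζ i)⁻¹ * (P r i * P q i)) = ∑ i, ∑ j, (ζ i * (ζ j)⁻¹ * P p i * P q j) * (P r i * P r j) := by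
          rw [Finset.sum_mul_sum]
          exact Finset.sum_congr rfl fun i _ => Finset.sum_congr rfl fun j _ => by ring
        rw [← h1]
        have := (hwpos r).ne'
        have := (hwpos q).ne'
        field_simp
      simp only [this]
      rw [← Finset.mul_sum, Finset.sum_comm]
      have : ∀ i, ∑ r, ∑ j, (ζ i * (ζ j)⁻¹ * P p i * P q j) * (P r i * P r j) = P p i * P q i := by
        intro i
        rw [Finset.sum_comm]
        simp only [← Finset.mul_sum, hPc]
        simp
        rw [mul_inv_cancel₀ (hζpos i).ne', one_mul]
        exact Or.inl rfl
      simp only [this]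
      rw [hPr]
      split_ifs with hpq
      · subst hpq; rw [mul_one, div_self (hwpos p).ne']
      · simp
    have hVW' : V = W' := by
      have h1 : W' * W = 1 := by
        exact mul_eq_one_comm.mp hWW'
      calc V = (W' * W) * V := by rw [h1, Matrix.one_mul]
        _ = W' := by rw [Matrix.mul_assoc, hWV, Matrix.mul_one]
    have htrMV : (M * V).trace = W.trace := by rw [hVW', hMW']
    have htrMV2 : (M * V).trace = ∑ i, (ζ i)⁻¹ * ∑ p, h p * P p i ^ 2 + c * ∑ i, (ζ i)⁻¹ * (∑ p, P p i) ^ 2 := by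
      rw [hM, Matrix.add_mul, Matrix.trace_add]
      congr 1
      · simp only [Matrix.trace, Matrix.diag_apply, Matrix.diagonal_mul, hVdef, Matrix.of_apply, hww, Finset.mul_sum]
        rw [Finset.sum_comm]
        refine Finset.sum_congr rfl fun p _ => ?_
        rw [← Finset.sum_congr rfl fun i _ => show h p * ((ζ i)⁻¹ * (P p i * P p i)) = (ζ i)⁻¹ * (h p * P p i ^ 2) by ring,
          ← Finset.mul_sum]
        have := (hpos p).ne'
        field_simp
      · simp only [Matrix.trace, Matrix.diag_apply, Matrix.mul_apply, hVdef, Matrix.of_apply]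
        have : ∀ p q, c * (w p * w q) * ((∑ i, (ζ i)⁻¹ * (P q i * P p i)) / (w q * w p)) = c * ∑ i, (ζ i)⁻¹ * (P q i * P p i) := by
          intro p q
          have := (hwpos p).ne'
          have := (hwpos q).ne'
          field_simp
        simp only [this, ← Finset.mul_sum]
        congr 1
        have : ∀ p, ∑ q, ∑ i, (ζ i)⁻¹ * (P q i * P p i) = ∑ i, ∑ q, (ζ i)⁻¹ * (P q i * P p i) := fun p => Finset.sum_comm
        simp only [this]
        rw [Finset.sum_comm]
        refine Finset.sum_congr rfl fun i _ => ?_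
        simp only [← Finset.mul_sum]
        rw [sq, Finset.sum_mul_sum, Finset.sum_comm]
    have htrW : W.trace = ∑ i, ζ i * ∑ p, h p * P p i ^ 2 := by
      simp only [Matrix.trace, Matrix.diag_apply, hZe, hww, Finset.mul_sum]
      rw [Finset.sum_comm]
      exact Finset.sum_congr rfl fun p _ => Finset.sum_congr rfl fun i _ => by ring
    have htrh : ∑ p, h p = ∑ i, ∑ p, h p * P p i ^ 2 := by
      rw [Finset.sum_comm]
      refine Finset.sum_congr rfl fun p _ => ?_
      rw [← Finset.mul_sum]
      have := hPr p p
      simp only [if_true, ← sq] at this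
      rw [this, mul_one]
    have hLHS : ∑ i, ((ζ i + (ζ i)⁻¹) / 2 - 1) * ∑ p, h p * P p i ^ 2 + c / 2 * (∑ i, (ζ i)⁻¹ * (∑ p, P p i) ^ 2 - Fintype.card I)
        = W.trace - ∑ p, h p - c / 2 * Fintype.card I := by
      have e1 : ∑ i, ((ζ i + (ζ i)⁻¹) / 2 - 1) * ∑ p, h p * P p i ^ 2
          = 1 / 2 * ∑ i, ζ i * ∑ p, h p * P p i ^ 2 + 1 / 2 * ∑ i, (ζ i)⁻¹ * ∑ p, h p * P p i ^ 2 - ∑ i, ∑ p, h p * P p i ^ 2 := by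
        rw [Finset.mul_sum, Finset.mul_sum, ← Finset.sum_add_distrib, ← Finset.sum_sub_distrib]
        exact Finset.sum_congr rfl fun i _ => by ring
      rw [e1, ← htrW, ← htrh]
      have := htrMV2
      rw [htrMV] at this
      linarith
    rw [hLHS, hWtr]
    congr 1
    -- integral
    have hIg : ∀ t : ℝ, Real.log (1 + c * ∑ p, h p / (h p ^ 2 + t ^ 2)) = ∑ i, (Real.log (√(μ i) ^ 2 + t ^ 2) - Real.log (h i ^ 2 + t ^ 2)) := by
      intro t
      have hd : ∀ p, 0 < h p ^ 2 + t ^ 2 := fun p => by have := hpos p; positivity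
      have hm' : ∀ p, 0 < √(μ p) ^ 2 + t ^ 2 := fun p => by have := hspos p; positivity
      have d1 : (M + Matrix.diagonal (fun _ => t ^ 2)).det = ∏ i, (√(μ i) ^ 2 + t ^ 2) := by
        have : M + Matrix.diagonal (fun _ => t ^ 2) = O * Matrix.diagonal (fun i => √(μ i) ^ 2 + t ^ 2) * O.transpose := by
          have e : Matrix.diagonal (fun _ : I => t ^ 2) = O * Matrix.diagonal (fun _ => t ^ 2) * O.transpose := by
            have : Matrix.diagonal (fun _ : I => t ^ 2) = (t ^ 2) • (1 : Matrix I I ℝ) := by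
              ext i j; simp [Matrix.diagonal_apply, Matrix.one_apply]
            rw [this, Matrix.mul_smul, Matrix.mul_one, Matrix.smul_mul, hO1]
          rw [e, hMO, ← Matrix.add_mul, ← Matrix.mul_add, Matrix.diagonal_add]
          congr 3
          ext i
          rw [sq (√(μ i)), hsq]
        rw [this, Matrix.det_mul, Matrix.det_mul, Matrix.det_diagonal, mul_comm, ← mul_assoc, ← Matrix.det_mul, hO2, Matrix.det_one, one_mul]
      have d2 : (M + Matrix.diagonal (fun _ => t ^ 2)).det = (∏ p, (h p ^ 2 + t ^ 2)) * (1 + c * ∑ p, h p / (h p ^ 2 + t ^ 2)) := by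
        have : M + Matrix.diagonal (fun _ => t ^ 2) = Matrix.diagonal (fun p => h p ^ 2 + t ^ 2) *
            (1 + Matrix.replicateCol Unit (fun p => c * w p / (h p ^ 2 + t ^ 2)) * Matrix.replicateRow Unit w) := by
          ext p q
          rw [Matrix.diagonal_mul, Matrix.add_apply, Matrix.add_apply, hM, Matrix.add_apply, Matrix.mul_apply]
          simp only [Matrix.diagonal_apply, Matrix.of_apply, Matrix.one_apply, Matrix.replicateCol_apply, Matrix.replicateRow_apply, Finset.univ_unique, Finset.sum_singleton]
          have := (hd p).ne'
          split_ifs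
          · field_simp; ring
          · field_simp; ring
        rw [this, Matrix.det_mul, Matrix.det_diagonal, Matrix.det_one_add_replicateCol_mul_replicateRow]
        congr 2
        rw [dotProduct, Finset.mul_sum]
        refine Finset.sum_congr rfl fun p _ => ?_
        rw [← hww p]; ring
      have hpd : 0 < ∏ p, (h p ^ 2 + t ^ 2) := Finset.prod_pos fun p _ => hd p
      have hq : 0 < 1 + c * ∑ p, h p / (h p ^ 2 + t ^ 2) := by
        have : 0 ≤ ∑ p, h p / (h p ^ 2 + t ^ 2) := Finset.sum_nonneg fun p _ => div_nonneg (hpos p).le (hd p).le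
        have := mul_nonneg hc this
        linarith
      have h3 := d1.symm.trans d2
      have h4 := congrArg Real.log h3
      rw [Real.log_mul hpd.ne' hq.ne', Real.log_prod (fun i _ => (hm' i).ne'), Real.log_prod (fun i _ => (hd i).ne')] at h4
      rw [Finset.sum_sub_distrib]
      linarith
    simp only [hIg]
    rw [integral_finset_sum _ (fun i _ => (mm_log_integral _ _ (hspos i) (hpos i)).1)]
    simp only [(mm_log_integral _ _ (hspos _) (hpos _)).2]
    rw [← Finset.mul_sum, Finset.sum_sub_distrib]
    field_simp

/-! ### Module F: fermionic Fock space over a finite set of modes -/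

noncomputable section

abbrev Fock (Λ : Type*) [Fintype Λ] : Type _ := EuclideanSpace ℝ (Finset Λ)

abbrev FOp (Λ : Type*) [Fintype Λ] : Type _ := Fock Λ →L[ℝ] Fock Λ

variable {Λ : Type*} [Fintype Λ] [DecidableEq Λ]

theorem fmul_apply (A B : FOp Λ) (x : Fock Λ) : (A * B) x = A (B x) := rfl
theorem fadd_apply (A B : FOp Λ) (x : Fock Λ) : (A + B) x = A x + B x := rfl
theorem fsub_apply (A B : FOp Λ) (x : Fock Λ) : (A - B) x = A x - B x := rfl
theorem fneg_apply (A : FOp Λ) (x : Fock Λ) : (-A) x = -(A x) := rfl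
theorem fsmul_apply (c : ℝ) (A : FOp Λ) (x : Fock Λ) : (c • A) x = c • A x := rfl
theorem fone_apply (x : Fock Λ) : (1 : FOp Λ) x = x := rfl
theorem fzero_apply (x : Fock Λ) : (0 : FOp Λ) x = 0 := rfl
theorem fsum_apply {ι : Type*} (s : Finset ι) (A : ι → FOp Λ) (x : Fock Λ) :
    (∑ i ∈ s, A i) x = ∑ i ∈ s, A i x := by
  classical
  induction s using Finset.induction_on with
  | empty => simp
  | insert a s ha ih => rw [Finset.sum_insert ha, Finset.sum_insert ha, fadd_apply, ih]

theorem fsmul_mul (c : ℝ) (A B : FOp Λ) : (c • A) * B = c • (A * B) := rfl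
theorem fmul_smul (c : ℝ) (A B : FOp Λ) : A * (c • B) = c • (A * B) := by
  ext1 x; exact A.map_smul c (B x)
theorem fstar_smul (c : ℝ) (A : FOp Λ) : star (c • A) = c • star A := by
  rw [ContinuousLinearMap.star_eq_adjoint, ContinuousLinearMap.star_eq_adjoint]; symm
  rw [ContinuousLinearMap.eq_adjoint_iff]
  intro x y
  rw [fsmul_apply, fsmul_apply, inner_smul_left, inner_smul_right, ContinuousLinearMap.adjoint_inner_left]; rfl

theorem fstar_neg (A : FOp Λ) : star (-A) = - star A := star_neg A
theorem fstar_add (A B : FOp Λ) : star (A + B) = star A + star B := star_add A B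
theorem fstar_sub (A B : FOp Λ) : star (A - B) = star A - star B := star_sub A B
theorem fstar_mul (A B : FOp Λ) : star (A * B) = star B * star A := star_mul A B
theorem fstar_star (A : FOp Λ) : star (star A) = A := star_star A
theorem fstar_sum {ι : Type*} (s : Finset ι) (A : ι → FOp Λ) : star (∑ i ∈ s, A i) = ∑ i ∈ s, star (A i) := by
  classical
  induction s using Finset.induction_on with
  | empty => exact star_zero (FOp Λ)
  | insert a s ha ih => rw [Finset.sum_insert ha, Finset.sum_insert ha, fstar_add, ih]

def fsgn (p : Λ) (S : Finset Λ) : ℝ :=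
  (-1) ^ (S.filter (fun s => Fintype.equivFin Λ s < Fintype.equivFin Λ p)).card

/-- annihilation operator -/
def dop (p : Λ) : FOp Λ :=
  LinearMap.toContinuousLinearMap
    { toFun := fun c => WithLp.toLp 2 fun S => if p ∈ S then 0 else fsgn p S * c (insert p S)
      map_add' := by
        intro x y; ext S; simp only [PiLp.add_apply]; split_ifs <;> simp [mul_add]
      map_smul' := by
        intro a x; ext S; simp only [PiLp.smul_apply, smul_eq_mul, RingHom.id_apply]; split_ifs
        · simp
        · ring }

/-- creation operator -/
def cop (p : Λ) : FOp Λ :=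
  LinearMap.toContinuousLinearMap
    { toFun := fun c => WithLp.toLp 2 fun S => if p ∈ S then fsgn p (S.erase p) * c (S.erase p) else 0
      map_add' := by
        intro x y; ext S; simp only [PiLp.add_apply]; split_ifs <;> simp [mul_add]
      map_smul' := by
        intro a x; ext S; simp only [PiLp.smul_apply, smul_eq_mul, RingHom.id_apply]; split_ifs
        · ring
        · simp }

/-- function of the number operator -/
def gop (φ : ℤ → ℝ) : FOp Λ :=
  LinearMap.toContinuousLinearMap
    { toFun := fun c => WithLp.toLp 2 fun S => φ S.card * c S
      map_add' := by
        intro x y; ext S; simp [mul_add]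
      map_smul' := by
        intro a x; ext S; simp only [PiLp.smul_apply, smul_eq_mul, RingHom.id_apply]; ring }

theorem dop_apply (p : Λ) (c : Fock Λ) (S : Finset Λ) :
    dop p c S = if p ∈ S then 0 else fsgn p S * c (insert p S) := rfl

theorem cop_apply (p : Λ) (c : Fock Λ) (S : Finset Λ) :
    cop p c S = if p ∈ S then fsgn p (S.erase p) * c (S.erase p) else 0 := rfl

theorem gop_apply (φ : ℤ → ℝ) (c : Fock Λ) (S : Finset Λ) :
    (gop φ : FOp Λ) c S = φ S.card * c S := rfl

theorem fsgn_sq (p : Λ) (S : Finset Λ) : fsgn p S * fsgn p S = 1 := by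
  unfold fsgn
  rw [← pow_add, ← two_mul, pow_mul]; simp

theorem fsgn_insert (p q : Λ) (S : Finset Λ) (hq : q ∉ S) :
    fsgn p (insert q S) = (if Fintype.equivFin Λ q < Fintype.equivFin Λ p then -1 else 1) * fsgn p S := by
  unfold fsgn
  rw [Finset.filter_insert]
  split_ifs with h
  · rw [Finset.card_insert_of_notMem (by simp [hq]), pow_succ]; ring
  · simp

theorem fsgn_anti (p q : Λ) (hpq : p ≠ q) :
    (if Fintype.equivFin Λ q < Fintype.equivFin Λ p then (-1:ℝ) else 1)
      = - (if Fintype.equivFin Λ p < Fintype.equivFin Λ q then (-1:ℝ) else 1) := by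
  have : Fintype.equivFin Λ p ≠ Fintype.equivFin Λ q := fun h => hpq ((Fintype.equivFin Λ).injective h)
  rcases lt_or_gt_of_ne this with h | h
  · simp [h, h.not_gt]
  · simp [h, h.not_gt]

theorem dop_dop (p q : Λ) : dop p * dop q = - (dop q * dop p : FOp Λ) := by
  ext c S
  simp only [fmul_apply, fneg_apply, PiLp.neg_apply, dop_apply]
  by_cases hpq : p = q
  · subst hpq; simp
  by_cases hp : p ∈ S
  · simp [hp]
  by_cases hq : q ∈ S
  · simp [hq]
  have h1 : q ∉ insert p S := by simp [hq, Ne.symm hpq]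
  have h2 : p ∉ insert q S := by simp [hp, hpq]
  simp only [hp, hq, h1, h2, if_false]
  rw [fsgn_insert q p S hp, fsgn_insert p q S hq, fsgn_anti p q hpq, Finset.insert_comm]
  ring

theorem dop_cop (p q : Λ) : dop p * cop q + cop q * dop p = if p = q then (1 : FOp Λ) else 0 := by
  ext c S
  simp only [fmul_apply, fadd_apply, PiLp.add_apply, dop_apply, cop_apply]
  by_cases hpq : p = q
  · subst hpq
    by_cases hp : p ∈ S
    · simp only [hp, if_true, Finset.mem_erase, ne_eq, not_true, false_and, if_false, Finset.insert_erase hp, fone_apply]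
      rw [← mul_assoc, fsgn_sq]; simp
    · simp only [hp, if_false, Finset.mem_insert_self, if_true, Finset.erase_insert hp, fone_apply]
      rw [← mul_assoc, fsgn_sq]; simp
  · simp only [hpq, if_false, fzero_apply, PiLp.zero_apply]
    by_cases hp : p ∈ S
    · simp [hp, hpq]
    by_cases hq : q ∈ S
    · have h1 : q ∈ insert p S := by simp [hq]
      have h2 : p ∉ S.erase q := by simp [hp]
      simp only [hp, hq, h1, h2, if_true, if_false]
      have hS : insert q (S.erase q) = S := Finset.insert_erase hq
      have e1 : (insert p S).erase q = insert p (S.erase q) := by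
        rw [Finset.erase_insert_of_ne hpq]
      rw [e1, fsgn_insert q p _ h2]
      have e2 : fsgn p S = (if Fintype.equivFin Λ q < Fintype.equivFin Λ p then -1 else 1) * fsgn p (S.erase q) := by
        conv_lhs => rw [← hS]
        exact fsgn_insert p q _ (by simp)
      rw [e2, fsgn_anti p q hpq]
      generalize hT : (if Fintype.equivFin Λ p < Fintype.equivFin Λ q then (-1:ℝ) else 1) = z
      have hz : z * z = 1 := by rw [← hT]; split_ifs <;> norm_num
      linear_combination (fsgn p (S.erase q) * fsgn q (S.erase q) * c (insert p (S.erase q))) * (-hz)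
    · have h1 : q ∉ insert p S := by simp [hq, Ne.symm hpq]
      simp [hp, hq, h1]

theorem fock_inner (x y : Fock Λ) : inner ℝ x y = ∑ S, x S * y S := by
  rw [PiLp.inner_apply]; exact Finset.sum_congr rfl fun S _ => by simp [mul_comm]

theorem cop_adj (p : Λ) : (cop p : FOp Λ) = ContinuousLinearMap.adjoint (dop p) := by
  rw [ContinuousLinearMap.eq_adjoint_iff]
  intro x y
  rw [fock_inner, fock_inner]
  simp only [cop_apply, dop_apply, ite_mul, mul_ite, zero_mul, mul_zero]
  rw [← Finset.sum_filter]
  have : ∑ S : Finset Λ, (if p ∈ S then 0 else x S * (fsgn p S * y (insert p S)))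
      = ∑ S ∈ Finset.univ.filter (fun S : Finset Λ => p ∉ S), x S * (fsgn p S * y (insert p S)) := by
    rw [Finset.sum_filter]
    exact Finset.sum_congr rfl fun S _ => by split_ifs <;> simp_all
  rw [this]
  refine Finset.sum_bij' (fun S _ => S.erase p) (fun S _ => insert p S) ?_ ?_ ?_ ?_ ?_
  · intro S _; simp
  · intro S _; simp
  · intro S hS; simp at hS; exact Finset.insert_erase hS
  · intro S hS; simp at hS; exact Finset.erase_insert hS
  · intro S hS; simp at hS; rw [Finset.insert_erase hS]; ring

theorem adj_dop (p : Λ) : ContinuousLinearMap.adjoint (dop p : FOp Λ) = cop p := (cop_adj p).symm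
theorem adj_cop (p : Λ) : ContinuousLinearMap.adjoint (cop p : FOp Λ) = dop p := by
  rw [cop_adj, ContinuousLinearMap.adjoint_adjoint]

theorem star_dop (p : Λ) : star (dop p : FOp Λ) = cop p := adj_dop p
theorem star_cop (p : Λ) : star (cop p : FOp Λ) = dop p := adj_cop p

theorem star_gop (φ : ℤ → ℝ) : star (gop φ : FOp Λ) = gop φ := by
  symm
  rw [ContinuousLinearMap.star_eq_adjoint, ContinuousLinearMap.eq_adjoint_iff]
  intro x y
  rw [fock_inner, fock_inner]
  simp only [gop_apply]
  exact Finset.sum_congr rfl fun S _ => by ring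

theorem cop_cop (p q : Λ) : cop p * cop q = - (cop q * cop p : FOp Λ) := by
  have h := congrArg star (dop_dop (Λ := Λ) q p)
  rw [fstar_neg, fstar_mul, fstar_mul, star_dop, star_dop] at h
  exact h

theorem cop_dop (p q : Λ) : cop q * dop p = (if p = q then (1 : FOp Λ) else 0) - dop p * cop q := by
  rw [← dop_cop]; abel

theorem gop_mul (φ χ : ℤ → ℝ) : (gop φ : FOp Λ) * gop χ = gop (fun n => φ n * χ n) := by
  ext c S
  simp only [fmul_apply, gop_apply]; ring

theorem gop_one : (gop (fun _ => 1) : FOp Λ) = 1 := by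
  ext c S
  simp [gop_apply]

theorem gop_sub (φ χ : ℤ → ℝ) : (gop φ : FOp Λ) - gop χ = gop (fun n => φ n - χ n) := by
  ext c S
  simp only [fsub_apply, PiLp.sub_apply, gop_apply]; ring

/-- `A` lowers the particle number by `a`. -/
def Shf (a : ℤ) (A : FOp Λ) : Prop := ∀ φ : ℤ → ℝ, A * gop φ = gop (fun n => φ (n + a)) * A

theorem shf_dop (p : Λ) : Shf 1 (dop p : FOp Λ) := by
  intro φ
  ext c S
  simp only [fmul_apply, gop_apply, dop_apply]
  split_ifs with h
  · simp
  · rw [Finset.card_insert_of_notMem h]; push_cast; ring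

theorem shf_star {a : ℤ} {A : FOp Λ} (h : Shf a A) : Shf (-a) (star A) := by
  intro φ
  have := congrArg star (h (fun n => φ (n + -a)))
  simp only [star_mul, star_gop] at this
  rw [this]
  simp

theorem shf_cop (p : Λ) : Shf (-1) (cop p : FOp Λ) := by
  rw [← star_dop]; exact shf_star (shf_dop p)

theorem shf_mul {a b : ℤ} {A B : FOp Λ} (hA : Shf a A) (hB : Shf b B) : Shf (a + b) (A * B) := by
  intro φ
  rw [mul_assoc, hB, ← mul_assoc, hA, mul_assoc]
  congr 2; ext n; congr 1; ring

theorem shf_sum {ι : Type*} {a : ℤ} (s : Finset ι) (A : ι → FOp Λ) (h : ∀ i ∈ s, Shf a (A i)) :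
    Shf a (∑ i ∈ s, A i) := by
  intro φ
  rw [Finset.sum_mul, Finset.mul_sum]
  exact Finset.sum_congr rfl fun i hi => h i hi φ

theorem shf_smul {a : ℤ} {A : FOp Λ} (c : ℝ) (h : Shf a A) : Shf a (c • A) := by
  intro φ
  rw [fsmul_mul, h, fmul_smul]

theorem shf_congr {a b : ℤ} {A : FOp Λ} (h : Shf a A) (hab : a = b) : Shf b A := hab ▸ h

/-! norms -/

theorem fock_norm_sq (x : Fock Λ) : ‖x‖ ^ 2 = ∑ S, x S ^ 2 := by
  rw [EuclideanSpace.norm_sq_eq]; simp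

theorem gop_mono (φ χ : ℤ → ℝ) (C : ℝ) (hC : 0 ≤ C) (h : ∀ n : ℕ, |φ n| ≤ C * |χ n|) (x : Fock Λ) :
    ‖(gop φ : FOp Λ) x‖ ≤ C * ‖(gop χ : FOp Λ) x‖ := by
  apply (sq_le_sq₀ (norm_nonneg _) (by positivity)).mp
  rw [mul_pow, fock_norm_sq, fock_norm_sq, Finset.mul_sum]
  refine Finset.sum_le_sum fun S _ => ?_
  rw [gop_apply, gop_apply, mul_pow, mul_pow, ← mul_assoc]
  gcongr
  have := h S.card
  rw [← mul_pow, ← sq_abs (φ _), ← sq_abs (C * _), abs_mul, abs_of_nonneg hC]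
  gcongr

/-- the weights `(|n|+1)^{1/2}` and `|n|+1` -/
def w1f : ℤ → ℝ := fun n => √(|(n:ℝ)| + 1)
def w2f : ℤ → ℝ := fun n => |(n:ℝ)| + 1

def nrm1 (x : Fock Λ) : ℝ := ‖(gop w1f : FOp Λ) x‖
def nrm2 (x : Fock Λ) : ℝ := ‖(gop w2f : FOp Λ) x‖

theorem sum_dop_sq (x : Fock Λ) : ∑ p, ‖(dop p : FOp Λ) x‖ ^ 2 = ∑ S : Finset Λ, (S.card : ℝ) * x S ^ 2 := by
  have h1 : ∀ p : Λ, ‖(dop p : FOp Λ) x‖ ^ 2 = ∑ S : Finset Λ, if p ∈ S then x S ^ 2 else 0 := by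
    intro p
    have : ‖(dop p : FOp Λ) x‖ ^ 2 = inner ℝ x ((cop p * dop p : FOp Λ) x) := by
      rw [cop_adj, ← real_inner_self_eq_norm_sq, fmul_apply, ContinuousLinearMap.adjoint_inner_right]
    rw [this, fock_inner]
    refine Finset.sum_congr rfl fun S _ => ?_
    rw [fmul_apply, cop_apply]
    split_ifs with h
    · rw [dop_apply, if_neg (by simp), Finset.insert_erase h, ← mul_assoc (fsgn _ _), fsgn_sq]; ring
    · simp
  simp only [h1]
  rw [Finset.sum_comm]
  refine Finset.sum_congr rfl fun S _ => ?_
  rw [← Finset.sum_filter]; simp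

theorem sum_dop_le (x : Fock Λ) : ∑ p, ‖(dop p : FOp Λ) x‖ ^ 2 ≤ nrm1 x ^ 2 := by
  rw [sum_dop_sq, nrm1, fock_norm_sq]
  refine Finset.sum_le_sum fun S _ => ?_
  rw [gop_apply, mul_pow, w1f, Real.sq_sqrt (by positivity)]
  gcongr
  simp

theorem dop_norm_le (p : Λ) (x : Fock Λ) : ‖(dop p : FOp Λ) x‖ ≤ ‖x‖ := by
  apply (sq_le_sq₀ (norm_nonneg _) (norm_nonneg _)).mp
  have h1 : ‖(dop p : FOp Λ) x‖ ^ 2 + ‖(cop p : FOp Λ) x‖ ^ 2 = ‖x‖ ^ 2 := by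
    have e1 : ‖(dop p : FOp Λ) x‖ ^ 2 = inner ℝ x ((cop p * dop p : FOp Λ) x) := by
      rw [cop_adj, ← real_inner_self_eq_norm_sq, fmul_apply, ContinuousLinearMap.adjoint_inner_right]
    have e2 : ‖(cop p : FOp Λ) x‖ ^ 2 = inner ℝ x ((dop p * cop p : FOp Λ) x) := by
      rw [← adj_cop p, ← real_inner_self_eq_norm_sq, fmul_apply, ContinuousLinearMap.adjoint_inner_right]
    rw [e1, e2, ← inner_add_right, ← fadd_apply, add_comm (cop p * dop p), dop_cop, if_pos rfl]
    simp
  nlinarith [sq_nonneg ‖(cop p : FOp Λ) x‖]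

theorem cop_norm_le (p : Λ) (x : Fock Λ) : ‖(cop p : FOp Λ) x‖ ≤ ‖x‖ := by
  have h : ‖(cop p : FOp Λ)‖ ≤ 1 := by
    rw [cop_adj, LinearIsometryEquiv.norm_map]
    exact ContinuousLinearMap.opNorm_le_bound _ zero_le_one fun x => by rw [one_mul]; exact dop_norm_le p x
  calc _ ≤ ‖(cop p : FOp Λ)‖ * ‖x‖ := ContinuousLinearMap.le_opNorm _ _
    _ ≤ 1 * ‖x‖ := by gcongr
    _ = _ := one_mul _

/-- vacuum -/
def fvac : Fock Λ := EuclideanSpace.single ∅ 1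

theorem norm_fvac : ‖(fvac : Fock Λ)‖ = 1 := by simp [fvac]

theorem dop_fvac (p : Λ) : (dop p : FOp Λ) fvac = 0 := by
  ext S
  rw [dop_apply]
  split_ifs
  · simp
  · simp [fvac]

theorem gop_fvac (φ : ℤ → ℝ) : (gop φ : FOp Λ) fvac = φ 0 • (fvac : Fock Λ) := by
  ext S
  rw [gop_apply]
  by_cases h : S = ∅
  · subst h; simp
  · simp [fvac, h]

theorem op_inner_star (A : FOp Λ) (x y : Fock Λ) : inner ℝ (A x) y = inner ℝ x (star A y) := by
  rw [ContinuousLinearMap.star_eq_adjoint, ContinuousLinearMap.adjoint_inner_right]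

theorem op_inner_star' (A : FOp Λ) (x y : Fock Λ) : inner ℝ x (A y) = inner ℝ (star A x) y := by
  rw [ContinuousLinearMap.star_eq_adjoint, ContinuousLinearMap.adjoint_inner_left]

end

noncomputable section

variable {Λ : Type*} [Fintype Λ] [DecidableEq Λ]

theorem w1f_pos (n : ℤ) : 0 < w1f n := by unfold w1f; positivity
theorem w2f_pos (n : ℤ) : 0 < w2f n := by unfold w2f; positivity
theorem w1f_mul (n : ℤ) : w1f n * w1f n = w2f n := by
  unfold w1f w2f; exact Real.mul_self_sqrt (by positivity)
theorem w2f_shift (n a : ℤ) (ha : |a| ≤ 2) : w2f (n + a) ≤ 4 * w2f n := by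
  unfold w2f; push_cast
  have h1 := abs_add_le (n:ℝ) a
  have h2 : |(a:ℝ)| ≤ 2 := by exact_mod_cast ha
  have := abs_nonneg (n:ℝ)
  linarith
theorem w1f_shift (n a : ℤ) (ha : |a| ≤ 2) : w1f (n + a) ≤ 2 * w1f n := by
  apply (sq_le_sq₀ (w1f_pos _).le (by have := w1f_pos n; positivity)).mp
  rw [mul_pow, sq, sq (w1f n), w1f_mul, w1f_mul]
  have := w2f_shift n a ha
  linarith

theorem nrm1_nonneg (x : Fock Λ) : 0 ≤ nrm1 x := norm_nonneg _
theorem nrm2_nonneg (x : Fock Λ) : 0 ≤ nrm2 x := norm_nonneg _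

theorem nrm1_gop_w1f (x : Fock Λ) : nrm1 ((gop w1f : FOp Λ) x) = nrm2 x := by
  unfold nrm1 nrm2
  rw [← fmul_apply, gop_mul]
  simp only [w1f_mul]

theorem gop_shift_le (x : Fock Λ) (a : ℤ) (ha : |a| ≤ 2) :
    ‖(gop (fun n => w1f (n + a)) : FOp Λ) x‖ ≤ 2 * nrm1 x := by
  apply gop_mono _ _ _ (by norm_num)
  intro n
  rw [abs_of_pos (w1f_pos _), abs_of_pos (w1f_pos _)]
  exact w1f_shift _ _ ha

theorem nrm1_gop_shift_le (x : Fock Λ) (a : ℤ) (ha : |a| ≤ 2) :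
    nrm1 ((gop (fun n => w1f (n + a)) : FOp Λ) x) ≤ 2 * nrm2 x := by
  unfold nrm1
  rw [← fmul_apply, gop_mul]
  apply gop_mono _ _ _ (by norm_num)
  intro n
  rw [abs_of_pos (mul_pos (w1f_pos _) (w1f_pos _)), abs_of_pos (w2f_pos _), ← w1f_mul]
  have := w1f_shift n a ha
  have := w1f_pos n
  nlinarith

theorem norm_le_nrm1 (x : Fock Λ) : ‖x‖ ≤ nrm1 x := by
  have := gop_mono (Λ := Λ) (fun _ => 1) w1f 1 zero_le_one (fun n => by
    rw [abs_one, one_mul, abs_of_pos (w1f_pos _)]; unfold w1f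
    rw [Real.one_le_sqrt]; linarith [abs_nonneg (((n:ℤ)):ℝ)]) x
  rwa [gop_one, fone_apply, one_mul] at this

theorem nrm1_le_nrm2 (x : Fock Λ) : nrm1 x ≤ nrm2 x := by
  rw [← nrm1_gop_w1f]
  exact norm_le_nrm1 _

theorem gop_w1f_inv (x : Fock Λ) : (gop w1f : FOp Λ) ((gop (fun n => (w1f n)⁻¹) : FOp Λ) x) = x := by
  rw [← fmul_apply, gop_mul]
  simp only [mul_inv_cancel₀ (w1f_pos _).ne']
  rw [gop_one]; rfl

theorem gop_symm (φ : ℤ → ℝ) (x y : Fock Λ) : inner ℝ ((gop φ : FOp Λ) x) y = inner ℝ x ((gop φ : FOp Λ) y) := by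
  rw [op_inner_star, star_gop]

theorem shf_gop_left {a : ℤ} {A : FOp Λ} (h : Shf a A) (φ : ℤ → ℝ) (x : Fock Λ) :
    (gop φ : FOp Λ) (A x) = A ((gop (fun n => φ (n + -a)) : FOp Λ) x) := by
  rw [← fmul_apply A, h, fmul_apply]
  simp

theorem dual_bound {a : ℤ} {A : FOp Λ} (hA : Shf a A) (ha : |a| ≤ 2) {C : ℝ} (hC : 0 ≤ C)
    (h : ∀ χ, ‖A χ‖ ≤ C * nrm1 χ) (x : Fock Λ) : ‖(star A) x‖ ≤ 2 * C * nrm1 x := by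
  set y := (star A) x with hy
  set χ := (gop (fun n => (w1f n)⁻¹) : FOp Λ) y with hχ
  have h1 : ‖y‖ ^ 2 = inner ℝ (A χ) ((gop (fun n => w1f (n + - -a)) : FOp Λ) x) := by
    rw [op_inner_star, ← shf_gop_left (shf_star hA), ← hy, ← gop_symm, gop_w1f_inv, real_inner_self_eq_norm_sq]
  have h2 : ‖y‖ ^ 2 ≤ (C * ‖y‖) * (2 * nrm1 x) := by
    rw [h1]
    refine (real_inner_le_norm _ _).trans ?_
    have e1 : nrm1 χ = ‖y‖ := by unfold nrm1; rw [gop_w1f_inv]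
    gcongr
    · rw [← e1]; exact h χ
    · exact gop_shift_le x _ (by simpa using ha)
  by_cases hz : ‖y‖ = 0
  · rw [hz]; have := nrm1_nonneg x; positivity
  · have : 0 < ‖y‖ := lt_of_le_of_ne (norm_nonneg _) (Ne.symm hz)
    have h3 : ‖y‖ * ‖y‖ ≤ ‖y‖ * (2 * C * nrm1 x) := by nlinarith
    exact le_of_mul_le_mul_left h3 this

theorem nrm1_shf {a : ℤ} {A : FOp Λ} (hA : Shf a A) (ha : |a| ≤ 2) {C : ℝ} (hC : 0 ≤ C)
    (h : ∀ χ, ‖A χ‖ ≤ C * nrm1 χ) (x : Fock Λ) : nrm1 (A x) ≤ 2 * C * nrm2 x := by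
  unfold nrm1
  rw [shf_gop_left hA]
  refine (h _).trans ?_
  have := nrm1_gop_shift_le x (-a) (by simpa using ha)
  nlinarith

theorem sum_mult_le {R : Type*} (s : Finset R) (v : R → Λ) (m : ℕ)
    (hv : ∀ q, (s.filter (fun r => v r = q)).card ≤ m) (x : Fock Λ) :
    ∑ r ∈ s, ‖(dop (v r) : FOp Λ) x‖ ^ 2 ≤ m * nrm1 x ^ 2 := by
  calc ∑ r ∈ s, ‖(dop (v r) : FOp Λ) x‖ ^ 2 = ∑ q, ∑ r ∈ s.filter (fun r => v r = q), ‖(dop (v r) : FOp Λ) x‖ ^ 2 := by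
        rw [Finset.sum_fiberwise]
    _ = ∑ q, ((s.filter (fun r => v r = q)).card : ℝ) * ‖(dop q : FOp Λ) x‖ ^ 2 := by
        refine Finset.sum_congr rfl fun q _ => ?_
        rw [Finset.sum_congr rfl (g := fun _ => ‖(dop q : FOp Λ) x‖ ^ 2) (by intro r hr; rw [(Finset.mem_filter.mp hr).2])]
        simp
    _ ≤ ∑ q, (m : ℝ) * ‖(dop q : FOp Λ) x‖ ^ 2 := by
        gcongr with q
        exact_mod_cast hv q
    _ = m * ∑ q, ‖(dop q : FOp Λ) x‖ ^ 2 := by rw [Finset.mul_sum]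
    _ ≤ _ := by gcongr; exact sum_dop_le x

theorem cs_sum {R : Type*} (s : Finset R) (f g : R → ℝ) :
    ∑ r ∈ s, |f r| * |g r| ≤ √(∑ r ∈ s, f r ^ 2) * √(∑ r ∈ s, g r ^ 2) := by
  have := Real.sum_mul_le_sqrt_mul_sqrt s (fun r => |f r|) (fun r => |g r|)
  simpa [sq_abs] using this

theorem errAT {R : Type*} (s : Finset R) (f : R → ℝ) (u v : R → Λ) (m : ℕ)
    (hv : ∀ q, (s.filter (fun r => v r = q)).card ≤ m) (A : R → FOp Λ) (ρ : ℝ) (hρ : 0 ≤ ρ)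
    (hA : ∀ r ∈ s, ∀ χ, ‖A r χ‖ ≤ ρ * nrm1 χ) (x : Fock Λ) :
    ‖∑ r ∈ s, f r • A r (cop (u r) (dop (v r) x))‖ ≤ ρ * √m * √(∑ r ∈ s, f r ^ 2) * nrm2 x := by
  set z := (gop w1f : FOp Λ) x with hz
  have h1 : ∀ r ∈ s, ‖A r (cop (u r) (dop (v r) x))‖ ≤ ρ * ‖(dop (v r) : FOp Λ) z‖ := by
    intro r hr
    refine (hA r hr _).trans ?_
    gcongr
    unfold nrm1
    rw [← fmul_apply (cop (u r)), shf_gop_left (a := 0) (shf_congr (shf_mul (shf_cop _) (shf_dop _)) (by norm_num))]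
    simp only [neg_zero, add_zero]
    exact cop_norm_le _ _
  calc _ ≤ ∑ r ∈ s, ‖f r • A r (cop (u r) (dop (v r) x))‖ := norm_sum_le _ _
    _ ≤ ∑ r ∈ s, ρ * (|f r| * |‖(dop (v r) : FOp Λ) z‖|) := by
        refine Finset.sum_le_sum fun r hr => ?_
        rw [norm_smul, Real.norm_eq_abs, abs_norm]
        have := h1 r hr
        have := abs_nonneg (f r)
        nlinarith
    _ ≤ ρ * (√(∑ r ∈ s, f r ^ 2) * √(∑ r ∈ s, ‖(dop (v r) : FOp Λ) z‖ ^ 2)) := by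
        rw [← Finset.mul_sum]
        gcongr
        exact cs_sum s f _
    _ ≤ ρ * (√(∑ r ∈ s, f r ^ 2) * √(m * nrm1 z ^ 2)) := by
        gcongr
        exact sum_mult_le s v m hv z
    _ = _ := by
        rw [Real.sqrt_mul (by positivity), Real.sqrt_sq (nrm1_nonneg _), hz, nrm1_gop_w1f]; ring

theorem errTA {R : Type*} (s : Finset R) (f : R → ℝ) (u v : R → Λ) (m : ℕ)
    (hu : ∀ q, (s.filter (fun r => u r = q)).card ≤ m) (A : R → FOp Λ) (ρ : ℝ) (hρ : 0 ≤ ρ)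
    (a : ℤ) (ha : |a| ≤ 2) (hs : ∀ r ∈ s, Shf a (A r))
    (hA : ∀ r ∈ s, ∀ χ, ‖A r χ‖ ≤ ρ * nrm1 χ) (x : Fock Λ) :
    ‖∑ r ∈ s, f r • (cop (u r) (dop (v r) (A r x)) : Fock Λ)‖ ≤ 2 * ρ * √m * √(∑ r ∈ s, f r ^ 2) * nrm2 x := by
  set y := ∑ r ∈ s, f r • (cop (u r) (dop (v r) (A r x)) : Fock Λ) with hy
  set χ := (gop (fun n => (w1f n)⁻¹) : FOp Λ) y with hχ
  set x' := (gop (fun n => w1f (n + -a)) : FOp Λ) x with hx'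
  have e1 : nrm1 χ = ‖y‖ := by unfold nrm1; rw [gop_w1f_inv]
  have h1 : ∀ r ∈ s, inner ℝ y (cop (u r) (dop (v r) (A r x)) : Fock Λ) = inner ℝ ((dop (u r) : FOp Λ) χ) ((dop (v r) : FOp Λ) (A r x')) := by
    intro r hr
    rw [op_inner_star, star_dop, ← gop_w1f_inv y, ← hχ, gop_symm]
    congr 1
    rw [← fmul_apply (cop (u r)), shf_gop_left (a := 0) (shf_congr (shf_mul (shf_cop _) (shf_dop _)) (by norm_num))]
    simp only [neg_zero, add_zero]
    rw [shf_gop_left (hs r hr), fmul_apply]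
  have h2 : ‖y‖ ^ 2 ≤ ‖y‖ * (2 * ρ * √m * √(∑ r ∈ s, f r ^ 2) * nrm2 x) := by
    calc ‖y‖ ^ 2 = inner ℝ y y := (real_inner_self_eq_norm_sq y).symm
      _ = ∑ r ∈ s, f r * inner ℝ y (cop (u r) (dop (v r) (A r x)) : Fock Λ) := by
          conv_lhs => rw [hy, inner_sum]
          exact Finset.sum_congr rfl fun r _ => by rw [inner_smul_right]
      _ ≤ ∑ r ∈ s, (2 * ρ * nrm2 x) * (|f r| * |‖(dop (u r) : FOp Λ) χ‖|) := by
          refine Finset.sum_le_sum fun r hr => ?_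
          rw [h1 r hr, abs_norm]
          have h3 : |inner ℝ ((dop (u r) : FOp Λ) χ) ((dop (v r) : FOp Λ) (A r x'))| ≤ ‖(dop (u r) : FOp Λ) χ‖ * (2 * ρ * nrm2 x) := by
            refine (abs_real_inner_le_norm _ _).trans ?_
            gcongr
            refine (dop_norm_le _ _).trans ((hA r hr _).trans ?_)
            have := nrm1_gop_shift_le x (-a) (by simpa using ha)
            nlinarith
          calc _ ≤ |f r * _| := le_abs_self _
            _ = |f r| * _ := abs_mul _ _
            _ ≤ |f r| * (‖(dop (u r) : FOp Λ) χ‖ * (2 * ρ * nrm2 x)) := by gcongr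
            _ = _ := by ring
      _ ≤ (2 * ρ * nrm2 x) * (√(∑ r ∈ s, f r ^ 2) * √(m * nrm1 χ ^ 2)) := by
          rw [← Finset.mul_sum]
          have := nrm2_nonneg x
          gcongr
          refine (cs_sum s f _).trans ?_
          gcongr
          exact sum_mult_le s u m hu χ
      _ = _ := by
          rw [Real.sqrt_mul (by positivity), Real.sqrt_sq (nrm1_nonneg _), e1]; ring
  by_cases hz : ‖y‖ = 0
  · rw [hz]; have := nrm2_nonneg x; positivity
  · have : 0 < ‖y‖ := lt_of_le_of_ne (norm_nonneg _) (Ne.symm hz)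
    rw [sq] at h2
    exact le_of_mul_le_mul_left h2 this

set_option maxHeartbeats 1000000 in
/-- `D`-type bound for matchings. -/
theorem matching_bound {R : Type*} (s : Finset R) (f : R → ℝ) (hf : ∀ r, |f r| ≤ 1) (u v : R → Λ)
    (hu : Set.InjOn u s) (hv : Set.InjOn v s) (x : Fock Λ) :
    ‖∑ r ∈ s, f r • (cop (u r) (dop (v r) x) : Fock Λ)‖ ≤ nrm2 x := by
  set y := ∑ r ∈ s, f r • (cop (u r) (dop (v r) x) : Fock Λ) with hy
  set χ := (gop (fun n => (w1f n)⁻¹) : FOp Λ) y with hχ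
  set x' := (gop w1f : FOp Λ) x with hx'
  have e1 : nrm1 χ = ‖y‖ := by unfold nrm1; rw [gop_w1f_inv]
  have h1 : ∀ r ∈ s, inner ℝ y (cop (u r) (dop (v r) x) : Fock Λ) = inner ℝ ((dop (u r) : FOp Λ) χ) ((dop (v r) : FOp Λ) x') := by
    intro r hr
    rw [op_inner_star, star_dop, ← gop_w1f_inv y, ← hχ, gop_symm]
    congr 1
    rw [← fmul_apply (cop (u r)), shf_gop_left (a := 0) (shf_congr (shf_mul (shf_cop _) (shf_dop _)) (by norm_num))]
    simp only [neg_zero, add_zero]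
    rfl
  have hcard : ∀ (w : R → Λ), Set.InjOn w s → ∀ q, (s.filter (fun r => w r = q)).card ≤ 1 := by
    intro w hw q
    rw [Finset.card_le_one]
    intro a ha b hb
    rw [Finset.mem_filter] at ha hb
    exact hw ha.1 hb.1 (ha.2.trans hb.2.symm)
  have h2 : ‖y‖ ^ 2 ≤ ‖y‖ * nrm2 x := by
    calc ‖y‖ ^ 2 = inner ℝ y y := (real_inner_self_eq_norm_sq y).symm
      _ = ∑ r ∈ s, f r * inner ℝ y (cop (u r) (dop (v r) x) : Fock Λ) := by
          conv_lhs => rw [hy, inner_sum]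
          exact Finset.sum_congr rfl fun r _ => by rw [inner_smul_right]
      _ ≤ ∑ r ∈ s, |‖(dop (u r) : FOp Λ) χ‖| * |‖(dop (v r) : FOp Λ) x'‖| := by
          refine Finset.sum_le_sum fun r hr => ?_
          rw [h1 r hr, abs_norm, abs_norm]
          calc _ ≤ |f r * _| := le_abs_self _
            _ = |f r| * _ := abs_mul _ _
            _ ≤ 1 * (‖(dop (u r) : FOp Λ) χ‖ * ‖(dop (v r) : FOp Λ) x'‖) := by
                gcongr
                · exact hf r
                · exact abs_real_inner_le_norm _ _
            _ = _ := one_mul _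
      _ ≤ √(∑ r ∈ s, ‖(dop (u r) : FOp Λ) χ‖ ^ 2) * √(∑ r ∈ s, ‖(dop (v r) : FOp Λ) x'‖ ^ 2) := cs_sum _ _ _
      _ ≤ √((1:ℕ) * nrm1 χ ^ 2) * √((1:ℕ) * nrm1 x' ^ 2) := by
          exact mul_le_mul (Real.sqrt_le_sqrt (sum_mult_le s u 1 (hcard u hu) χ))
            (Real.sqrt_le_sqrt (sum_mult_le s v 1 (hcard v hv) x')) (Real.sqrt_nonneg _) (Real.sqrt_nonneg _)
      _ = _ := by
          simp only [Nat.cast_one, one_mul]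
          rw [Real.sqrt_sq (nrm1_nonneg _), Real.sqrt_sq (nrm1_nonneg _), e1, hx', nrm1_gop_w1f]
  by_cases hz : ‖y‖ = 0
  · rw [hz]; exact nrm2_nonneg x
  · have : 0 < ‖y‖ := lt_of_le_of_ne (norm_nonneg _) (Ne.symm hz)
    rw [sq] at h2
    exact le_of_mul_le_mul_left h2 this

end

noncomputable section

variable {Λ : Type*} [Fintype Λ] [DecidableEq Λ] {Γ : Type*} [Fintype Γ] [DecidableEq Γ]

/-- The set-up of particle-hole pairs. -/
structure PairSys (Λ Γ : Type*) [Fintype Λ] [DecidableEq Λ] [Fintype Γ] [DecidableEq Γ] where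
  P : Γ → Λ
  H : Γ → Λ
  s : ℕ
  hPH : ∀ x y, P x ≠ H y
  hinj : ∀ x y, P x = P y → H x = H y → x = y
  hsP : ∀ p, (Finset.univ.filter (fun x => P x = p)).card ≤ s
  hsH : ∀ p, (Finset.univ.filter (fun x => H x = p)).card ≤ s

/-! scalar lemmas -/
theorem fadd_smul (a c : ℝ) (A : FOp Λ) : (a + c) • A = a • A + c • A := by
  ext1 x; exact add_smul a c (A x)
theorem fsub_smul (a c : ℝ) (A : FOp Λ) : (a - c) • A = a • A - c • A := by
  ext1 x; exact sub_smul a c (A x)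
theorem fsmul_smul (a c : ℝ) (A : FOp Λ) : a • c • A = (a * c) • A := by
  ext1 x; exact smul_smul a c (A x)
theorem fzero_smul (A : FOp Λ) : (0 : ℝ) • A = 0 := by
  ext1 x; exact zero_smul ℝ (A x)
theorem fone_smul (A : FOp Λ) : (1 : ℝ) • A = A := by
  ext1 x; exact one_smul ℝ (A x)
theorem fneg_smul (c : ℝ) (A : FOp Λ) : (-c) • A = -(c • A) := by
  ext1 x; exact neg_smul c (A x)
theorem fsmul_zero (c : ℝ) : c • (0 : FOp Λ) = 0 := by
  ext1 x; exact smul_zero c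
theorem fsmul_add (c : ℝ) (A B : FOp Λ) : c • (A + B) = c • A + c • B := by
  ext1 x; exact smul_add c (A x) (B x)
theorem fsmul_sub (c : ℝ) (A B : FOp Λ) : c • (A - B) = c • A - c • B := by
  ext1 x; exact smul_sub c (A x) (B x)
theorem fsmul_neg (c : ℝ) (A : FOp Λ) : c • (-A) = -(c • A) := by
  ext1 x; exact smul_neg c (A x)
theorem fsmul_sum {ι : Type*} (c : ℝ) (t : Finset ι) (A : ι → FOp Λ) : c • (∑ i ∈ t, A i) = ∑ i ∈ t, c • A i := by
  ext1 x; rw [fsmul_apply, fsum_apply, fsum_apply, Finset.smul_sum]; rfl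
theorem fsum_smul {ι : Type*} (c : ι → ℝ) (t : Finset ι) (A : FOp Λ) : (∑ i ∈ t, c i) • A = ∑ i ∈ t, c i • A := by
  ext1 x; rw [fsmul_apply, fsum_apply, Finset.sum_smul]; rfl

theorem ring_aux1 {R : Type*} [Ring R] (h p h' p' : R) (a1 : p * h' = -(h' * p)) (a2 : p * p' = -(p' * p))
    (a3 : h * h' = -(h' * h)) (a4 : h * p' = -(p' * h)) : h * p * (h' * p') = h' * p' * (h * p) := by
  calc h * p * (h' * p') = h * (p * h') * p' := by noncomm_ring
    _ = -((h * h') * (p * p')) := by rw [a1]; noncomm_ring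
    _ = -(h' * (h * p') * p) := by rw [a2, a3]; noncomm_ring
    _ = _ := by rw [a4]; noncomm_ring

theorem ring_aux2 {R : Type*} [Ring R] (h p h' p' dP dH : R) (d1 : p * p' = dP - p' * p) (d2 : h * h' = dH - h' * h)
    (d3 : p * h' = -(h' * p)) (d4 : h * p' = -(p' * h)) (hc : h * dP = dP * h) :
    h * p * (p' * h') = p' * h' * (h * p) + dP * dH - (dP * (h' * h) + p' * dH * p) := by
  calc h * p * (p' * h') = h * (p * p') * h' := by noncomm_ring
    _ = (h * dP) * h' - (h * p') * (p * h') := by rw [d1]; noncomm_ring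
    _ = dP * (h * h') - p' * (h * h') * p := by rw [hc, d4, d3]; noncomm_ring
    _ = _ := by rw [d2]; noncomm_ring

namespace PairSys

variable (Q : PairSys Λ Γ)

def bx (x : Γ) : FOp Λ := dop (Q.H x) * dop (Q.P x)

def b (f : EuclideanSpace ℝ Γ) : FOp Λ := ∑ x, f x • Q.bx x

def bs (f : EuclideanSpace ℝ Γ) : FOp Λ := star (Q.b f)

def T (x y : Γ) : FOp Λ :=
  (if Q.P x = Q.P y then cop (Q.H y) * dop (Q.H x) else 0) +
  (if Q.H x = Q.H y then cop (Q.P y) * dop (Q.P x) else 0)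

def TT (f g : EuclideanSpace ℝ Γ) : FOp Λ := ∑ x, ∑ y, (f x * g y) • Q.T x y

theorem star_bx (x : Γ) : star (Q.bx x) = cop (Q.P x) * cop (Q.H x) := by
  unfold bx; rw [fstar_mul, star_dop, star_dop]

theorem bs_eq (f : EuclideanSpace ℝ Γ) : Q.bs f = ∑ x, f x • star (Q.bx x) := by
  unfold bs b; rw [fstar_sum]; exact Finset.sum_congr rfl fun x _ => fstar_smul _ _

theorem b_add (f g : EuclideanSpace ℝ Γ) : Q.b (f + g) = Q.b f + Q.b g := by
  unfold b; rw [← Finset.sum_add_distrib]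
  exact Finset.sum_congr rfl fun x _ => by rw [PiLp.add_apply, fadd_smul]

theorem b_smul (c : ℝ) (f : EuclideanSpace ℝ Γ) : Q.b (c • f) = c • Q.b f := by
  unfold b; rw [fsmul_sum]
  exact Finset.sum_congr rfl fun x _ => by rw [PiLp.smul_apply, smul_eq_mul, fsmul_smul]

theorem bs_add (f g : EuclideanSpace ℝ Γ) : Q.bs (f + g) = Q.bs f + Q.bs g := by
  unfold bs; rw [b_add, fstar_add]

theorem bs_smul (c : ℝ) (f : EuclideanSpace ℝ Γ) : Q.bs (c • f) = c • Q.bs f := by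
  unfold bs; rw [b_smul, fstar_smul]

theorem b_zero : Q.b 0 = 0 := by
  unfold b; exact Finset.sum_eq_zero fun x _ => by rw [PiLp.zero_apply, fzero_smul]
theorem bs_zero : Q.bs 0 = 0 := by
  unfold bs; rw [b_zero]; exact star_zero (FOp Λ)

theorem b_sum {ι : Type*} (t : Finset ι) (f : ι → EuclideanSpace ℝ Γ) : Q.b (∑ i ∈ t, f i) = ∑ i ∈ t, Q.b (f i) := by
  classical
  induction t using Finset.induction_on with
  | empty => simp [b_zero]
  | insert a s ha ih => rw [Finset.sum_insert ha, Finset.sum_insert ha, b_add, ih]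

theorem bs_sum {ι : Type*} (t : Finset ι) (f : ι → EuclideanSpace ℝ Γ) : Q.bs (∑ i ∈ t, f i) = ∑ i ∈ t, Q.bs (f i) := by
  unfold bs; rw [b_sum, fstar_sum]

theorem shf_bx (x : Γ) : Shf 2 (Q.bx x) := shf_mul (shf_dop _) (shf_dop _)
theorem shf_b (f : EuclideanSpace ℝ Γ) : Shf 2 (Q.b f) := shf_sum _ _ fun x _ => shf_smul _ (Q.shf_bx x)
theorem shf_bs (f : EuclideanSpace ℝ Γ) : Shf (-2) (Q.bs f) := shf_star (Q.shf_b f)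

theorem bx_comm (x y : Γ) : Q.bx x * Q.bx y = Q.bx y * Q.bx x := by
  unfold bx
  have a1 := dop_dop (Λ := Λ) (Q.P x) (Q.H y)
  have a2 := dop_dop (Λ := Λ) (Q.P x) (Q.P y)
  have a3 := dop_dop (Λ := Λ) (Q.H x) (Q.H y)
  have a4 := dop_dop (Λ := Λ) (Q.H x) (Q.P y)
  exact ring_aux1 _ _ _ _ a1 a2 a3 a4

theorem bx_star (x y : Γ) : Q.bx x * star (Q.bx y) = star (Q.bx y) * Q.bx x + (if x = y then (1 : FOp Λ) else 0) - Q.T x y := by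
  rw [star_bx]
  unfold bx T
  have c1 := cop_dop (Λ := Λ) (Q.P x) (Q.P y)
  have c2 := cop_dop (Λ := Λ) (Q.H x) (Q.H y)
  have c3 := cop_dop (Λ := Λ) (Q.P x) (Q.H y)
  rw [if_neg (Q.hPH x y)] at c3
  have c4 := cop_dop (Λ := Λ) (Q.H x) (Q.P y)
  rw [if_neg (fun h => Q.hPH y x h.symm)] at c4
  have d1 : dop (Q.P x) * cop (Q.P y) = (if Q.P x = Q.P y then (1 : FOp Λ) else 0) - cop (Q.P y) * dop (Q.P x) := by rw [c1]; abel
  have d2 : dop (Q.H x) * cop (Q.H y) = (if Q.H x = Q.H y then (1 : FOp Λ) else 0) - cop (Q.H y) * dop (Q.H x) := by rw [c2]; abel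
  have d3 : dop (Q.P x) * cop (Q.H y) = - (cop (Q.H y) * dop (Q.P x) : FOp Λ) := by rw [c3]; abel
  have d4 : dop (Q.H x) * cop (Q.P y) = - (cop (Q.P y) * dop (Q.H x) : FOp Λ) := by rw [c4]; abel
  have hxy : (if x = y then (1 : FOp Λ) else 0) = (if Q.P x = Q.P y then (1 : FOp Λ) else 0) * (if Q.H x = Q.H y then (1 : FOp Λ) else 0) := by
    by_cases h : x = y
    · subst h; simp
    · by_cases h1 : Q.P x = Q.P y
      · by_cases h2 : Q.H x = Q.H y
        · exact absurd (Q.hinj x y h1 h2) h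
        · simp [h, h2]
      · simp [h, h1]
  have t1 : (if Q.P x = Q.P y then cop (Q.H y) * dop (Q.H x) else (0 : FOp Λ)) = (if Q.P x = Q.P y then (1 : FOp Λ) else 0) * (cop (Q.H y) * dop (Q.H x)) := by
    split_ifs <;> simp
  have t2 : (if Q.H x = Q.H y then cop (Q.P y) * dop (Q.P x) else (0 : FOp Λ)) = cop (Q.P y) * (if Q.H x = Q.H y then (1 : FOp Λ) else 0) * dop (Q.P x) := by
    split_ifs <;> simp
  have hc : dop (Q.H x) * (if Q.P x = Q.P y then (1 : FOp Λ) else 0) = (if Q.P x = Q.P y then (1 : FOp Λ) else 0) * dop (Q.H x) := by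
    split_ifs <;> simp
  rw [hxy, t1, t2]
  generalize (if Q.P x = Q.P y then (1 : FOp Λ) else 0) = dP at *
  generalize (if Q.H x = Q.H y then (1 : FOp Λ) else 0) = dH at *
  exact ring_aux2 _ _ _ _ _ _ d1 d2 d3 d4 hc

theorem b_comm (f g : EuclideanSpace ℝ Γ) : Q.b f * Q.b g = Q.b g * Q.b f := by
  unfold b
  rw [Finset.sum_mul_sum, Finset.sum_mul_sum, Finset.sum_comm]
  refine Finset.sum_congr rfl fun y _ => Finset.sum_congr rfl fun x _ => ?_
  rw [fsmul_mul, fmul_smul, fsmul_mul, fmul_smul, bx_comm, fsmul_smul, fsmul_smul, mul_comm]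

theorem eucl_inner (f g : EuclideanSpace ℝ Γ) : inner ℝ f g = ∑ x, f x * g x := by
  rw [PiLp.inner_apply]; exact Finset.sum_congr rfl fun S _ => by simp [mul_comm]

theorem eucl_norm_sq (f : EuclideanSpace ℝ Γ) : ‖f‖ ^ 2 = ∑ x, f x ^ 2 := by
  rw [EuclideanSpace.norm_sq_eq]; simp

theorem b_bs (f g : EuclideanSpace ℝ Γ) : Q.b f * Q.bs g = Q.bs g * Q.b f + (inner ℝ f g : ℝ) • (1 : FOp Λ) - Q.TT f g := by
  rw [bs_eq]
  unfold b TT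
  rw [Finset.sum_mul_sum, Finset.sum_mul_sum, eucl_inner, Finset.sum_comm (γ := Γ)]
  rw [fsum_smul]
  have e1 : ∀ x, (f x * g x) • (1 : FOp Λ) = ∑ y, (f x * g y) • (if x = y then (1 : FOp Λ) else 0) := by
    intro x
    rw [Finset.sum_eq_single x]
    · simp
    · intro y _ hy; rw [if_neg (Ne.symm hy), fsmul_zero]
    · simp
  simp only [e1]
  rw [Finset.sum_comm (γ := Γ) (f := fun i j => g i • star (Q.bx i) * f j • Q.bx j)]
  rw [Finset.sum_comm]
  rw [← Finset.sum_add_distrib, ← Finset.sum_sub_distrib]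
  refine Finset.sum_congr rfl fun x _ => ?_
  rw [← Finset.sum_add_distrib, ← Finset.sum_sub_distrib]
  refine Finset.sum_congr rfl fun y _ => ?_
  rw [fsmul_mul, fmul_smul, fsmul_mul, fmul_smul, bx_star, fsmul_smul, fsmul_smul, fsmul_sub, fsmul_add, mul_comm (g y)]

/-! bounds -/

theorem b_bound (f : EuclideanSpace ℝ Γ) (x : Fock Λ) : ‖Q.b f x‖ ≤ √Q.s * ‖f‖ * nrm1 x := by
  unfold b
  rw [fsum_apply]
  calc _ ≤ ∑ y, ‖(f y • Q.bx y) x‖ := norm_sum_le _ _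
    _ ≤ ∑ y, |f y| * |‖(dop (Q.P y) : FOp Λ) x‖| := by
        refine Finset.sum_le_sum fun y _ => ?_
        rw [fsmul_apply, norm_smul, Real.norm_eq_abs, abs_norm]
        gcongr
        exact dop_norm_le _ _
    _ ≤ √(∑ y, f y ^ 2) * √(∑ y, ‖(dop (Q.P y) : FOp Λ) x‖ ^ 2) := cs_sum _ _ _
    _ ≤ √(∑ y, f y ^ 2) * √(Q.s * nrm1 x ^ 2) := by
        gcongr
        exact sum_mult_le _ Q.P Q.s Q.hsP x
    _ = _ := by
        rw [← eucl_norm_sq, Real.sqrt_sq (norm_nonneg _), Real.sqrt_mul (by positivity), Real.sqrt_sq (nrm1_nonneg _)]; ring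

theorem bs_bound (f : EuclideanSpace ℝ Γ) (x : Fock Λ) : ‖Q.bs f x‖ ≤ 2 * (√Q.s * ‖f‖) * nrm1 x :=
  dual_bound (Q.shf_b f) (by norm_num) (by positivity) (Q.b_bound f) x

theorem b_bound' (f : EuclideanSpace ℝ Γ) (x : Fock Λ) : ‖Q.b f x‖ ≤ 2 * (√Q.s * ‖f‖) * nrm1 x := by
  refine (Q.b_bound f x).trans ?_
  have := nrm1_nonneg x
  have : 0 ≤ √Q.s * ‖f‖ := by positivity
  nlinarith

theorem bb_bound (f g : EuclideanSpace ℝ Γ) (x : Fock Λ) : ‖Q.b f (Q.b g x)‖ ≤ 4 * Q.s * ‖f‖ * ‖g‖ * nrm2 x := by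
  refine (Q.b_bound f _).trans ?_
  have h := nrm1_shf (Q.shf_b g) (by norm_num) (by positivity) (Q.b_bound' g) x
  have h0 : 0 ≤ √Q.s * ‖f‖ := by positivity
  have h1 := mul_le_mul_of_nonneg_left h h0
  refine h1.trans (le_of_eq ?_)
  have : √(Q.s:ℝ) * √(Q.s:ℝ) = Q.s := Real.mul_self_sqrt (by positivity)
  linear_combination (4 * ‖f‖ * ‖g‖ * nrm2 x) * this

theorem b_fvac (f : EuclideanSpace ℝ Γ) : Q.b f fvac = 0 := by
  unfold b
  rw [fsum_apply]
  refine Finset.sum_eq_zero fun x _ => ?_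
  rw [fsmul_apply]
  unfold bx
  rw [fmul_apply, dop_fvac]; simp

theorem TT_fvac (f g : EuclideanSpace ℝ Γ) : Q.TT f g fvac = 0 := by
  unfold TT
  rw [fsum_apply]
  refine Finset.sum_eq_zero fun x _ => ?_
  rw [fsum_apply]
  refine Finset.sum_eq_zero fun y _ => ?_
  rw [fsmul_apply]
  unfold T
  rw [fadd_apply]
  split_ifs <;> simp [fmul_apply, dop_fvac]

theorem bs_fvac_inner (f g : EuclideanSpace ℝ Γ) : inner ℝ (Q.bs f fvac) (Q.bs g fvac) = (inner ℝ f g : ℝ) := by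
  rw [op_inner_star]
  unfold bs
  rw [fstar_star, ← fmul_apply]
  change inner ℝ fvac ((Q.b f * Q.bs g) fvac) = _
  rw [b_bs, fsub_apply, fadd_apply, TT_fvac, fmul_apply, b_fvac, fsmul_apply, fone_apply]
  simp [inner_smul_right, norm_fvac]

end PairSys
end

noncomputable section

/-- Data of the approximate Bogoliubov transformation. -/
structure Bog (Λ Γ J : Type*) [Fintype Λ] [DecidableEq Λ] [Fintype Γ] [DecidableEq Γ] [Fintype J] [DecidableEq J]
    extends PairSys Λ Γ where
  kp : J → ℝ
  F : J → EuclideanSpace ℝ Γ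
  G : J → EuclideanSpace ℝ Γ
  C0 : ℝ
  ρ : ℝ
  hkp : ∀ j, 0 ≤ kp j
  hFF : ∀ i j, inner ℝ (F i) (F j) = if i = j then (1:ℝ) else 0
  hGG : ∀ i j, inner ℝ (G i) (G j) = if i = j then (1:ℝ) else 0
  hFG : ∀ i j, inner ℝ (F i) (G j) = (0:ℝ)
  hC0 : ∑ j, kp j ≤ C0
  hρ : 0 ≤ ρ
  hρF : ∀ y, ∑ j, kp j ^ 2 * F j y ^ 2 ≤ ρ ^ 2
  hρG : ∀ y, ∑ j, kp j ^ 2 * G j y ^ 2 ≤ ρ ^ 2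

variable {Λ : Type*} [Fintype Λ] [DecidableEq Λ] {Γ : Type*} [Fintype Γ] [DecidableEq Γ]

theorem ring_aux3 {R : Type*} [Ring R] (b s1 s2 c1 c2 t1 t2 : R) (h1 : b * s1 = s1 * b + c1 - t1) (h2 : b * s2 = s2 * b + c2 - t2)
    (hc : s1 * c2 = c2 * s1):
    b * (s1 * s2) - s1 * s2 * b = (c1 * s2 + c2 * s1) - (t1 * s2 + s1 * t2) := by
  calc b * (s1 * s2) - s1 * s2 * b = (b * s1) * s2 - s1 * s2 * b := by noncomm_ring
    _ = s1 * (b * s2) + c1 * s2 - t1 * s2 - s1 * s2 * b := by rw [h1]; noncomm_ring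
    _ = s1 * c2 + c1 * s2 - t1 * s2 - s1 * t2 := by rw [h2]; noncomm_ring
    _ = _ := by rw [hc]; noncomm_ring

theorem ring_aux4 {R : Type*} [Ring R] (b K : R) : b * K - K * b = -K * b - b * -K := by noncomm_ring

namespace PairSys
variable (Q : PairSys Λ Γ)

theorem star_T (x y : Γ) : star (Q.T x y) = Q.T y x := by
  unfold T
  rw [fstar_add]
  congr 1
  · by_cases h : Q.P x = Q.P y
    · rw [if_pos h, if_pos h.symm, fstar_mul, star_dop, star_cop]
    · rw [if_neg h, if_neg (fun h' => h h'.symm)]; exact star_zero (FOp Λ)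
  · by_cases h : Q.H x = Q.H y
    · rw [if_pos h, if_pos h.symm, fstar_mul, star_dop, star_cop]
    · rw [if_neg h, if_neg (fun h' => h h'.symm)]; exact star_zero (FOp Λ)

theorem star_TT (f g : EuclideanSpace ℝ Γ) : star (Q.TT f g) = Q.TT g f := by
  unfold TT
  rw [fstar_sum]
  simp only [fstar_sum, fstar_smul, star_T]
  rw [Finset.sum_comm]
  simp only [mul_comm]

theorem mult1 (c d e : Γ → Λ) (hc : ∀ p, (Finset.univ.filter (fun x => c x = p)).card ≤ Q.s)
    (hd : ∀ p, (Finset.univ.filter (fun x => d x = p)).card ≤ Q.s) (q : Λ) :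
    (((Finset.univ : Finset (Γ × Γ)).filter (fun r => c r.1 = c r.2)).filter (fun r => d r.1 = q)).card ≤ Q.s * Q.s := by
  have h1 : (((Finset.univ : Finset (Γ × Γ)).filter (fun r => c r.1 = c r.2)).filter (fun r => d r.1 = q))
     = (Finset.univ.filter (fun x => d x = q)).biUnion (fun x => (Finset.univ.filter (fun y => c y = c x)).image (fun y => (x, y))) := by
    ext ⟨x, y⟩
    simp only [Finset.mem_filter, Finset.mem_univ, true_and, Finset.mem_biUnion, Finset.mem_image, Prod.mk.injEq]
    constructor
    · rintro ⟨h, h'⟩; exact ⟨x, h', y, h.symm, rfl, rfl⟩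
    · rintro ⟨x', h', y', h, rfl, rfl⟩; exact ⟨h.symm, h'⟩
  rw [h1]
  refine Finset.card_biUnion_le.trans ?_
  refine (Finset.sum_le_card_nsmul _ _ Q.s fun x _ => Finset.card_image_le.trans (hc _)).trans ?_
  rw [smul_eq_mul]; exact Nat.mul_le_mul_right _ (hd q)

theorem mult2 (c d e : Γ → Λ) (hc : ∀ p, (Finset.univ.filter (fun x => c x = p)).card ≤ Q.s)
    (hd : ∀ p, (Finset.univ.filter (fun x => d x = p)).card ≤ Q.s) (q : Λ) :
    (((Finset.univ : Finset (Γ × Γ)).filter (fun r => c r.1 = c r.2)).filter (fun r => d r.2 = q)).card ≤ Q.s * Q.s := by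
  refine le_trans (le_of_eq ?_) (Q.mult1 c d e hc hd q)
  refine Finset.card_bij (fun r _ => r.swap) ?_ ?_ ?_
  · rintro ⟨x, y⟩ h; simp only [Finset.mem_filter, Finset.mem_univ, true_and, Prod.fst_swap, Prod.snd_swap] at h ⊢; exact ⟨h.1.symm, h.2⟩
  · rintro ⟨x, y⟩ _ ⟨x', y'⟩ _ h; simpa [and_comm] using h
  · rintro ⟨x, y⟩ h; simp only [Finset.mem_filter, Finset.mem_univ, true_and] at h
    exact ⟨(y, x), by simp [h.1, h.2], rfl⟩

theorem sumsq1 (c : Γ → Λ) (hc : ∀ p, (Finset.univ.filter (fun x => c x = p)).card ≤ Q.s) (f : EuclideanSpace ℝ Γ) :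
    ∑ r ∈ (Finset.univ : Finset (Γ × Γ)).filter (fun r => c r.1 = c r.2), f r.1 ^ 2 ≤ Q.s * ‖f‖ ^ 2 := by
  rw [Finset.sum_filter, Fintype.sum_prod_type, eucl_norm_sq, Finset.mul_sum]
  refine Finset.sum_le_sum fun x _ => ?_
  rw [← Finset.sum_filter]
  simp only [Finset.sum_const, nsmul_eq_mul]
  gcongr
  refine le_trans (le_of_eq ?_) (hc (c x))
  simp [eq_comm]

theorem sumsq2 (c : Γ → Λ) (hc : ∀ p, (Finset.univ.filter (fun x => c x = p)).card ≤ Q.s) (f : EuclideanSpace ℝ Γ) :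
    ∑ r ∈ (Finset.univ : Finset (Γ × Γ)).filter (fun r => c r.1 = c r.2), f r.2 ^ 2 ≤ Q.s * ‖f‖ ^ 2 := by
  rw [Finset.sum_filter, Fintype.sum_prod_type_right, eucl_norm_sq, Finset.mul_sum]
  refine Finset.sum_le_sum fun x _ => ?_
  rw [← Finset.sum_filter]
  simp only [Finset.sum_const, nsmul_eq_mul]
  gcongr
  exact hc (c x)

theorem T_sum_split (w : Γ × Γ → FOp Λ → Fock Λ) (hw0 : ∀ r, w r 0 = 0) (hwa : ∀ r A B, w r (A + B) = w r A + w r B) :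
    ∑ x, ∑ y, w (x, y) (Q.T x y) =
      ∑ r ∈ (Finset.univ : Finset (Γ × Γ)).filter (fun r => Q.P r.1 = Q.P r.2), w r (cop (Q.H r.2) * dop (Q.H r.1)) +
      ∑ r ∈ (Finset.univ : Finset (Γ × Γ)).filter (fun r => Q.H r.1 = Q.H r.2), w r (cop (Q.P r.2) * dop (Q.P r.1)) := by
  rw [← Fintype.sum_prod_type' (f := fun x y => w (x, y) (Q.T x y)), Finset.sum_filter, Finset.sum_filter, ← Finset.sum_add_distrib]
  refine Finset.sum_congr rfl fun r _ => ?_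
  unfold T
  rw [hwa]
  congr 1
  · split_ifs
    · rfl
    · exact hw0 _
  · split_ifs
    · rfl
    · exact hw0 _

theorem sqrt_aux (f : EuclideanSpace ℝ Γ) (X : ℝ) (h : X ≤ Q.s * ‖f‖ ^ 2) : √((Q.s * Q.s : ℕ) : ℝ) * √X ≤ Q.s ^ 2 * ‖f‖ := by
  have h1 : √((Q.s * Q.s : ℕ) : ℝ) = Q.s := by
    push_cast; exact Real.sqrt_mul_self (by positivity)
  rw [h1]
  have h2 : √X ≤ Q.s * ‖f‖ := by
    apply Real.sqrt_le_iff.mpr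
    refine ⟨by positivity, h.trans ?_⟩
    rw [mul_pow]
    gcongr
    have : (Q.s:ℝ) ^ 2 = ((Q.s ^ 2 : ℕ) : ℝ) := by push_cast; rfl
    rw [this]
    exact_mod_cast Nat.le_self_pow (by norm_num) _
  calc _ ≤ (Q.s:ℝ) * (Q.s * ‖f‖) := by gcongr
    _ = _ := by ring

/-- bound for `Σ f_x A_y T_xy` -/
theorem bnd_AT1 (f : EuclideanSpace ℝ Γ) (A : Γ → FOp Λ) (ρ : ℝ) (hρ : 0 ≤ ρ) (hA : ∀ y χ, ‖A y χ‖ ≤ ρ * nrm1 χ) (z : Fock Λ) :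
    ‖∑ x, ∑ y, f x • A y (Q.T x y z)‖ ≤ 2 * ρ * Q.s ^ 2 * ‖f‖ * nrm2 z := by
  rw [Q.T_sum_split (fun r B => f r.1 • A r.2 (B z)) (fun r => by rw [fzero_apply, map_zero, smul_zero])
    (fun r B B' => by rw [fadd_apply, map_add, smul_add])]
  refine (norm_add_le _ _).trans ?_
  have h1 := errAT ((Finset.univ : Finset (Γ × Γ)).filter (fun r => Q.P r.1 = Q.P r.2)) (fun r => f r.1) (fun r => Q.H r.2) (fun r => Q.H r.1) (Q.s * Q.s)
    (fun q => Q.mult1 Q.P Q.H Q.H Q.hsP Q.hsH q) (fun r => A r.2) ρ hρ (fun r _ => hA r.2) z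
  have h2 := errAT ((Finset.univ : Finset (Γ × Γ)).filter (fun r => Q.H r.1 = Q.H r.2)) (fun r => f r.1) (fun r => Q.P r.2) (fun r => Q.P r.1) (Q.s * Q.s)
    (fun q => Q.mult1 Q.H Q.P Q.P Q.hsH Q.hsP q) (fun r => A r.2) ρ hρ (fun r _ => hA r.2) z
  have h3 := Q.sqrt_aux f _ (Q.sumsq1 Q.P Q.hsP f)
  have h4 := Q.sqrt_aux f _ (Q.sumsq1 Q.H Q.hsH f)
  have h5 : 0 ≤ ρ * nrm2 z := mul_nonneg hρ (nrm2_nonneg z)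
  have h6 := mul_le_mul_of_nonneg_left h3 h5
  have h7 := mul_le_mul_of_nonneg_left h4 h5
  simp only [fmul_apply]
  linarith

theorem bnd_AT2 (f : EuclideanSpace ℝ Γ) (A : Γ → FOp Λ) (ρ : ℝ) (hρ : 0 ≤ ρ) (hA : ∀ y χ, ‖A y χ‖ ≤ ρ * nrm1 χ) (z : Fock Λ) :
    ‖∑ x, ∑ y, f y • A x (Q.T x y z)‖ ≤ 2 * ρ * Q.s ^ 2 * ‖f‖ * nrm2 z := by
  rw [Q.T_sum_split (fun r B => f r.2 • A r.1 (B z)) (fun r => by rw [fzero_apply, map_zero, smul_zero])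
    (fun r B B' => by rw [fadd_apply, map_add, smul_add])]
  refine (norm_add_le _ _).trans ?_
  have h1 := errAT ((Finset.univ : Finset (Γ × Γ)).filter (fun r => Q.P r.1 = Q.P r.2)) (fun r => f r.2) (fun r => Q.H r.2) (fun r => Q.H r.1) (Q.s * Q.s)
    (fun q => Q.mult1 Q.P Q.H Q.H Q.hsP Q.hsH q) (fun r => A r.1) ρ hρ (fun r _ => hA r.1) z
  have h2 := errAT ((Finset.univ : Finset (Γ × Γ)).filter (fun r => Q.H r.1 = Q.H r.2)) (fun r => f r.2) (fun r => Q.P r.2) (fun r => Q.P r.1) (Q.s * Q.s)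
    (fun q => Q.mult1 Q.H Q.P Q.P Q.hsH Q.hsP q) (fun r => A r.1) ρ hρ (fun r _ => hA r.1) z
  have h3 := Q.sqrt_aux f _ (Q.sumsq2 Q.P Q.hsP f)
  have h4 := Q.sqrt_aux f _ (Q.sumsq2 Q.H Q.hsH f)
  have h5 : 0 ≤ ρ * nrm2 z := mul_nonneg hρ (nrm2_nonneg z)
  have h6 := mul_le_mul_of_nonneg_left h3 h5
  have h7 := mul_le_mul_of_nonneg_left h4 h5
  simp only [fmul_apply]
  linarith

theorem bnd_TA1 (f : EuclideanSpace ℝ Γ) (A : Γ → FOp Λ) (ρ : ℝ) (hρ : 0 ≤ ρ) (a : ℤ) (ha : |a| ≤ 2) (hs : ∀ y, Shf a (A y))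
    (hA : ∀ y χ, ‖A y χ‖ ≤ ρ * nrm1 χ) (z : Fock Λ) :
    ‖∑ x, ∑ y, f x • Q.T x y (A y z)‖ ≤ 4 * ρ * Q.s ^ 2 * ‖f‖ * nrm2 z := by
  rw [Q.T_sum_split (fun r B => f r.1 • B (A r.2 z)) (fun r => by rw [fzero_apply, smul_zero])
    (fun r B B' => by rw [fadd_apply, smul_add])]
  refine (norm_add_le _ _).trans ?_
  have h1 := errTA ((Finset.univ : Finset (Γ × Γ)).filter (fun r => Q.P r.1 = Q.P r.2)) (fun r => f r.1) (fun r => Q.H r.2) (fun r => Q.H r.1) (Q.s * Q.s)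
    (fun q => Q.mult2 Q.P Q.H Q.H Q.hsP Q.hsH q) (fun r => A r.2) ρ hρ a ha (fun r _ => hs r.2) (fun r _ => hA r.2) z
  have h2 := errTA ((Finset.univ : Finset (Γ × Γ)).filter (fun r => Q.H r.1 = Q.H r.2)) (fun r => f r.1) (fun r => Q.P r.2) (fun r => Q.P r.1) (Q.s * Q.s)
    (fun q => Q.mult2 Q.H Q.P Q.P Q.hsH Q.hsP q) (fun r => A r.2) ρ hρ a ha (fun r _ => hs r.2) (fun r _ => hA r.2) z
  have h3 := Q.sqrt_aux f _ (Q.sumsq1 Q.P Q.hsP f)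
  have h4 := Q.sqrt_aux f _ (Q.sumsq1 Q.H Q.hsH f)
  have h5 : 0 ≤ ρ * nrm2 z := mul_nonneg hρ (nrm2_nonneg z)
  have h6 := mul_le_mul_of_nonneg_left h3 h5
  have h7 := mul_le_mul_of_nonneg_left h4 h5
  simp only [fmul_apply]
  linarith

theorem bnd_TA2 (f : EuclideanSpace ℝ Γ) (A : Γ → FOp Λ) (ρ : ℝ) (hρ : 0 ≤ ρ) (a : ℤ) (ha : |a| ≤ 2) (hs : ∀ y, Shf a (A y))
    (hA : ∀ y χ, ‖A y χ‖ ≤ ρ * nrm1 χ) (z : Fock Λ) :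
    ‖∑ x, ∑ y, f y • Q.T x y (A x z)‖ ≤ 4 * ρ * Q.s ^ 2 * ‖f‖ * nrm2 z := by
  rw [Q.T_sum_split (fun r B => f r.2 • B (A r.1 z)) (fun r => by rw [fzero_apply, smul_zero])
    (fun r B B' => by rw [fadd_apply, smul_add])]
  refine (norm_add_le _ _).trans ?_
  have h1 := errTA ((Finset.univ : Finset (Γ × Γ)).filter (fun r => Q.P r.1 = Q.P r.2)) (fun r => f r.2) (fun r => Q.H r.2) (fun r => Q.H r.1) (Q.s * Q.s)
    (fun q => Q.mult2 Q.P Q.H Q.H Q.hsP Q.hsH q) (fun r => A r.1) ρ hρ a ha (fun r _ => hs r.1) (fun r _ => hA r.1) z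
  have h2 := errTA ((Finset.univ : Finset (Γ × Γ)).filter (fun r => Q.H r.1 = Q.H r.2)) (fun r => f r.2) (fun r => Q.P r.2) (fun r => Q.P r.1) (Q.s * Q.s)
    (fun q => Q.mult2 Q.H Q.P Q.P Q.hsH Q.hsP q) (fun r => A r.1) ρ hρ a ha (fun r _ => hs r.1) (fun r _ => hA r.1) z
  have h3 := Q.sqrt_aux f _ (Q.sumsq2 Q.P Q.hsP f)
  have h4 := Q.sqrt_aux f _ (Q.sumsq2 Q.H Q.hsH f)
  have h5 : 0 ≤ ρ * nrm2 z := mul_nonneg hρ (nrm2_nonneg z)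
  have h6 := mul_le_mul_of_nonneg_left h3 h5
  have h7 := mul_le_mul_of_nonneg_left h4 h5
  simp only [fmul_apply]
  linarith

end PairSys

namespace Bog
variable {J : Type*} [Fintype J] [DecidableEq J] (Q : Bog Λ Γ J)

def Pop : FOp Λ := ∑ j, Q.kp j • (Q.b (Q.F j) * Q.b (Q.G j))
def Kop : FOp Λ := Q.Pop - star Q.Pop
def Kf (f : EuclideanSpace ℝ Γ) : EuclideanSpace ℝ Γ :=
  ∑ j, Q.kp j • ((inner ℝ (Q.F j) f : ℝ) • Q.G j + (inner ℝ (Q.G j) f : ℝ) • Q.F j)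
def Err (f : EuclideanSpace ℝ Γ) : FOp Λ :=
  ∑ j, Q.kp j • (Q.TT f (Q.G j) * Q.bs (Q.F j) + Q.bs (Q.G j) * Q.TT f (Q.F j))

theorem star_Pop : star Q.Pop = ∑ j, Q.kp j • (Q.bs (Q.G j) * Q.bs (Q.F j)) := by
  unfold Pop
  rw [fstar_sum]
  exact Finset.sum_congr rfl fun j _ => by rw [fstar_smul, fstar_mul]; rfl

theorem star_Kop : star Q.Kop = - Q.Kop := by
  unfold Kop
  rw [fstar_sub, fstar_star]; abel

theorem b_Pop (f : EuclideanSpace ℝ Γ) : Q.b f * Q.Pop = Q.Pop * Q.b f := by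
  unfold Pop
  rw [Finset.mul_sum, Finset.sum_mul]
  refine Finset.sum_congr rfl fun j _ => ?_
  rw [fmul_smul, fsmul_mul, ← mul_assoc, Q.b_comm f, mul_assoc, Q.b_comm f, mul_assoc]

theorem comm_b (f : EuclideanSpace ℝ Γ) : Q.b f * Q.Kop - Q.Kop * Q.b f = - Q.bs (Q.Kf f) + Q.Err f := by
  have h : Q.b f * star Q.Pop - star Q.Pop * Q.b f = Q.bs (Q.Kf f) - Q.Err f := by
    rw [star_Pop]
    unfold Kf Err
    rw [Q.bs_sum, Finset.mul_sum, Finset.sum_mul, ← Finset.sum_sub_distrib, ← Finset.sum_sub_distrib]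
    refine Finset.sum_congr rfl fun j _ => ?_
    rw [fmul_smul, fsmul_mul, Q.bs_smul, ← fsmul_sub, ← fsmul_sub]
    congr 1
    have hc : Q.bs (Q.G j) * ((inner ℝ f (Q.F j) : ℝ) • (1 : FOp Λ)) = ((inner ℝ f (Q.F j) : ℝ) • (1 : FOp Λ)) * Q.bs (Q.G j) := by
      rw [fmul_smul, fsmul_mul, mul_one, one_mul]
    rw [ring_aux3 _ _ _ _ _ _ _ (Q.b_bs f (Q.G j)) (Q.b_bs f (Q.F j)) hc]
    rw [Q.bs_add, Q.bs_smul, Q.bs_smul, fsmul_mul, fsmul_mul, one_mul, one_mul, real_inner_comm f, real_inner_comm f]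
    rw [add_comm ((inner ℝ f (Q.F j) : ℝ) • _)]
  unfold Kop
  rw [mul_sub, sub_mul, Q.b_Pop]
  have : Q.Pop * Q.b f - Q.b f * star Q.Pop - (Q.Pop * Q.b f - star Q.Pop * Q.b f) = -(Q.b f * star Q.Pop - star Q.Pop * Q.b f) := by abel
  rw [this, h]; abel

theorem comm_bs (f : EuclideanSpace ℝ Γ) : Q.bs f * Q.Kop - Q.Kop * Q.bs f = - Q.b (Q.Kf f) + star (Q.Err f) := by
  have h := congrArg star (Q.comm_b f)
  rw [fstar_sub, fstar_mul, fstar_mul, star_Kop, fstar_add, fstar_neg] at h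
  have e : star (Q.bs (Q.Kf f)) = Q.b (Q.Kf f) := fstar_star _
  rw [e] at h
  rw [← h]
  change Q.bs f * Q.Kop - Q.Kop * Q.bs f = -Q.Kop * Q.bs f - Q.bs f * -Q.Kop
  exact ring_aux4 _ _

def my (y : Γ) : EuclideanSpace ℝ Γ := ∑ j, (Q.kp j * Q.G j y) • Q.F j
def ny (y : Γ) : EuclideanSpace ℝ Γ := ∑ j, (Q.kp j * Q.F j y) • Q.G j

theorem orth_norm_sq {E : Type*} [NormedAddCommGroup E] [InnerProductSpace ℝ E] (F : J → E)
    (hF : ∀ i j, inner ℝ (F i) (F j) = if i = j then (1:ℝ) else 0) (c : J → ℝ) : ‖∑ j, c j • F j‖ ^ 2 = ∑ j, c j ^ 2 := by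
  rw [← real_inner_self_eq_norm_sq, sum_inner]
  refine Finset.sum_congr rfl fun i _ => ?_
  rw [inner_sum]
  simp only [inner_smul_left, inner_smul_right, hF]
  simp [sq]

theorem norm_my (y : Γ) : ‖Q.my y‖ ≤ Q.ρ := by
  apply le_of_sq_le_sq _ Q.hρ
  unfold my
  rw [orth_norm_sq _ Q.hFF]
  simpa [mul_pow] using Q.hρG y

theorem norm_ny (y : Γ) : ‖Q.ny y‖ ≤ Q.ρ := by
  apply le_of_sq_le_sq _ Q.hρ
  unfold ny
  rw [orth_norm_sq _ Q.hGG]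
  simpa [mul_pow] using Q.hρF y

theorem bs_b_bound (f : EuclideanSpace ℝ Γ) (hf : ‖f‖ ≤ Q.ρ) (χ : Fock Λ) :
    ‖Q.bs f χ‖ ≤ (2 * (√Q.s * Q.ρ)) * nrm1 χ ∧ ‖Q.b f χ‖ ≤ (2 * (√Q.s * Q.ρ)) * nrm1 χ := by
  have := nrm1_nonneg χ
  exact ⟨(Q.bs_bound f χ).trans (by gcongr), (Q.b_bound' f χ).trans (by gcongr)⟩

/-- coefficient rearrangement -/
theorem rearr {V : Type*} [AddCommGroup V] [Module ℝ V] (k : J → ℝ) (f : Γ → ℝ) (g : J → Γ → ℝ) (W : Γ → Γ → J → V) :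
    ∑ j, k j • ∑ x, ∑ y, (f x * g j y) • W x y j = ∑ x, ∑ y, f x • ∑ j, (k j * g j y) • W x y j := by
  simp only [Finset.smul_sum, smul_smul]
  rw [Finset.sum_comm]
  refine Finset.sum_congr rfl fun x _ => ?_
  rw [Finset.sum_comm]
  refine Finset.sum_congr rfl fun y _ => Finset.sum_congr rfl fun j _ => ?_
  congr 1; ring

theorem rearr2 {V : Type*} [AddCommGroup V] [Module ℝ V] (k : J → ℝ) (f : Γ → ℝ) (g : J → Γ → ℝ) (W : Γ → Γ → J → V) :
    ∑ j, k j • ∑ x, ∑ y, (g j x * f y) • W x y j = ∑ x, ∑ y, f y • ∑ j, (k j * g j x) • W x y j := by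
  simp only [Finset.smul_sum, smul_smul]
  rw [Finset.sum_comm]
  refine Finset.sum_congr rfl fun x _ => ?_
  rw [Finset.sum_comm]
  refine Finset.sum_congr rfl fun y _ => Finset.sum_congr rfl fun j _ => ?_
  congr 1; ring

theorem TT_apply (f g : EuclideanSpace ℝ Γ) (z : Fock Λ) : Q.TT f g z = ∑ x, ∑ y, (f x * g y) • Q.T x y z := by
  unfold PairSys.TT
  rw [fsum_apply]
  refine Finset.sum_congr rfl fun x _ => ?_
  rw [fsum_apply]; rfl

theorem bs_sum_smul (c : J → ℝ) (f : J → EuclideanSpace ℝ Γ) (z : Fock Λ) : Q.bs (∑ j, c j • f j) z = ∑ j, c j • Q.bs (f j) z := by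
  rw [Q.bs_sum, fsum_apply]
  exact Finset.sum_congr rfl fun j _ => by rw [Q.bs_smul]; rfl
theorem b_sum_smul (c : J → ℝ) (f : J → EuclideanSpace ℝ Γ) (z : Fock Λ) : Q.b (∑ j, c j • f j) z = ∑ j, c j • Q.b (f j) z := by
  rw [Q.b_sum, fsum_apply]
  exact Finset.sum_congr rfl fun j _ => by rw [Q.b_smul]; rfl

theorem map_sum2 (A : FOp Λ) (c : Γ → Γ → ℝ) (W : Γ → Γ → Fock Λ) : A (∑ x, ∑ y, c x y • W x y) = ∑ x, ∑ y, c x y • A (W x y) := by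
  rw [map_sum]
  refine Finset.sum_congr rfl fun x _ => ?_
  rw [map_sum]
  exact Finset.sum_congr rfl fun y _ => A.map_smul _ _

/-- the error constant -/
def cE : ℝ := 12 * √Q.s * Q.s ^ 2

theorem cE_nonneg : 0 ≤ Q.cE := by unfold cE; positivity

theorem Err_bound (f : EuclideanSpace ℝ Γ) (z : Fock Λ) : ‖Q.Err f z‖ ≤ Q.cE * Q.ρ * ‖f‖ * nrm2 z := by
  have e : Q.Err f z = (∑ x, ∑ y, f x • Q.T x y (Q.bs (Q.my y) z)) + ∑ x, ∑ y, f x • Q.bs (Q.ny y) (Q.T x y z) := by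
    unfold Err
    rw [fsum_apply]
    simp only [fsmul_apply, fadd_apply, fmul_apply, smul_add, Finset.sum_add_distrib, TT_apply, map_sum2]
    rw [rearr Q.kp f (fun j y => Q.G j y) (fun x y j => Q.T x y (Q.bs (Q.F j) z)),
      rearr Q.kp f (fun j y => Q.F j y) (fun x y j => Q.bs (Q.G j) (Q.T x y z))]
    unfold my ny
    simp only [bs_sum_smul, map_sum, map_smul]
  rw [e]
  refine (norm_add_le _ _).trans ?_
  have h0 : 0 ≤ 2 * (√Q.s * Q.ρ) := by have := Q.hρ; positivity
  have h1 := Q.bnd_TA1 f (fun y => Q.bs (Q.my y)) _ h0 (-2) (by norm_num) (fun y => Q.shf_bs _) (fun y χ => (Q.bs_b_bound _ (Q.norm_my y) χ).1) z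
  have h2 := Q.bnd_AT1 f (fun y => Q.bs (Q.ny y)) _ h0 (fun y χ => (Q.bs_b_bound _ (Q.norm_ny y) χ).1) z
  unfold cE
  linarith

theorem star_Err_bound (f : EuclideanSpace ℝ Γ) (z : Fock Λ) : ‖(star (Q.Err f)) z‖ ≤ Q.cE * Q.ρ * ‖f‖ * nrm2 z := by
  have e : (star (Q.Err f)) z = (∑ x, ∑ y, f y • Q.b (Q.my x) (Q.T x y z)) + ∑ x, ∑ y, f y • Q.T x y (Q.b (Q.ny x) z) := by
    unfold Err
    rw [fstar_sum, fsum_apply]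
    have : ∀ j, star (Q.kp j • (Q.TT f (Q.G j) * Q.bs (Q.F j) + Q.bs (Q.G j) * Q.TT f (Q.F j)))
      = Q.kp j • (Q.b (Q.F j) * Q.TT (Q.G j) f + Q.TT (Q.F j) f * Q.b (Q.G j)) := by
      intro j
      rw [fstar_smul, fstar_add, fstar_mul, fstar_mul, Q.star_TT, Q.star_TT]
      unfold PairSys.bs
      rw [fstar_star, fstar_star]
    simp only [this]
    simp only [fsmul_apply, fadd_apply, fmul_apply, smul_add, Finset.sum_add_distrib, TT_apply, map_sum2]
    rw [rearr2 Q.kp f (fun j y => Q.G j y) (fun x y j => Q.b (Q.F j) (Q.T x y z)),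
      rearr2 Q.kp f (fun j y => Q.F j y) (fun x y j => Q.T x y (Q.b (Q.G j) z))]
    unfold my ny
    simp only [b_sum_smul, map_sum, map_smul]
  rw [e]
  refine (norm_add_le _ _).trans ?_
  have h0 : 0 ≤ 2 * (√Q.s * Q.ρ) := by have := Q.hρ; positivity
  have h1 := Q.bnd_TA2 f (fun y => Q.b (Q.ny y)) _ h0 2 (by norm_num) (fun y => Q.shf_b _) (fun y χ => (Q.bs_b_bound _ (Q.norm_ny y) χ).2) z
  have h2 := Q.bnd_AT2 f (fun y => Q.b (Q.my y)) _ h0 (fun y χ => (Q.bs_b_bound _ (Q.norm_my y) χ).2) z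
  unfold cE
  linarith

end Bog
end

noncomputable section

section AbstractExp
variable {E : Type*} [NormedAddCommGroup E] [InnerProductSpace ℝ E] [CompleteSpace E]

def Uexp (K : E →L[ℝ] E) (t : ℝ) : E →L[ℝ] E := NormedSpace.exp (t • K)

theorem Uexp_zero (K : E →L[ℝ] E) (x : E) : Uexp K 0 x = x := by
  unfold Uexp; rw [zero_smul, NormedSpace.exp_zero]; rfl

theorem Uexp_deriv (K : E →L[ℝ] E) (t : ℝ) : HasDerivAt (Uexp K) (K * Uexp K t) t := by
  have := hasDerivAt_exp_smul_const' (𝕂 := ℝ) K t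
  exact this

theorem Uexp_deriv' (K : E →L[ℝ] E) (t : ℝ) : HasDerivAt (Uexp K) (Uexp K t * K) t := by
  have := hasDerivAt_exp_smul_const (𝕂 := ℝ) K t
  exact this

theorem Uexp_commute (K A : E →L[ℝ] E) (h : A * K = K * A) (t : ℝ) (x : E) : A (Uexp K t x) = Uexp K t (A x) := by
  have h1 : Commute A (t • K) := Commute.smul_right h t
  have h2 : Commute A (NormedSpace.exp (t • K)) := h1.exp_right
  exact congrArg (fun B : E →L[ℝ] E => B x) h2

theorem Uexp_neg_mul (K : E →L[ℝ] E) (t : ℝ) (x : E) : Uexp K (-t) (Uexp K t x) = x := by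
  have h : NormedSpace.exp ((-t) • K) * NormedSpace.exp (t • K) = 1 := by
    letI : NormedAlgebra ℚ (E →L[ℝ] E) := NormedAlgebra.restrictScalars ℚ ℝ _
    have hc : Commute ((-t) • K) (t • K) := (Commute.refl K).smul_left _ |>.smul_right _
    rw [← NormedSpace.exp_add_of_commute hc, ← add_smul, neg_add_cancel, zero_smul, NormedSpace.exp_zero]
  exact congrArg (fun B : E →L[ℝ] E => B x) h

theorem Uexp_vec_deriv (K : E →L[ℝ] E) (x : E) (t : ℝ) : HasDerivAt (fun s => Uexp K s x) (K (Uexp K t x)) t := by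
  have := (Uexp_deriv K t).clm_apply (hasDerivAt_const t x)
  simpa using this

theorem Uexp_norm (K : E →L[ℝ] E) (hK : ∀ x y, inner ℝ (K x) y = - (inner ℝ x (K y) : ℝ)) (t : ℝ) (x : E) :
    ‖Uexp K t x‖ = ‖x‖ := by
  have hd : ∀ s, HasDerivAt (fun s => (inner ℝ (Uexp K s x) (Uexp K s x) : ℝ)) 0 s := by
    intro s
    have h := (Uexp_vec_deriv K x s).inner ℝ (Uexp_vec_deriv K x s)
    have e : (inner ℝ (Uexp K s x) (K (Uexp K s x)) : ℝ) + inner ℝ (K (Uexp K s x)) (Uexp K s x) = 0 := by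
      rw [hK]; ring
    rw [e] at h
    exact h
  have hc := is_const_of_deriv_eq_zero (fun s => (hd s).differentiableAt) (fun s => (hd s).deriv) t 0
  simp only [Uexp_zero, real_inner_self_eq_norm_sq] at hc
  exact (sq_eq_sq₀ (norm_nonneg _) (norm_nonneg _)).mp hc

theorem duh_deriv (K : E →L[ℝ] E) (A : ℝ → E →L[ℝ] E) (A' : E →L[ℝ] E) (s : ℝ) (hA : HasDerivAt A A' s) (x : E) :
    HasDerivAt (fun s => Uexp K (-s) (A s (Uexp K s x)))
      (Uexp K (-s) ((A' + (A s * K - K * A s)) (Uexp K s x))) s := by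
  have h1 : HasDerivAt (fun s => Uexp K (-s)) (-(Uexp K (-s) * K)) s := by
    have := (Uexp_deriv' K (-s)).scomp s (hasDerivAt_neg s)
    rw [neg_one_smul] at this
    exact this
  have h2 := hA.clm_apply (Uexp_vec_deriv K x s)
  have h3 := h1.clm_apply h2
  convert h3 using 1
  change Uexp K (-s) (A' (Uexp K s x) + (A s (K (Uexp K s x)) - K (A s (Uexp K s x)))) =
    -(Uexp K (-s) (K (A s (Uexp K s x)))) + Uexp K (-s) (A' (Uexp K s x) + A s (K (Uexp K s x)))
  rw [map_add, map_sub, map_add]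
  abel

theorem duh_bound (K : E →L[ℝ] E) (hK : ∀ x y, inner ℝ (K x) y = - (inner ℝ x (K y) : ℝ))
    (A : ℝ → E →L[ℝ] E) (A' : ℝ → E →L[ℝ] E) (x : E) (t B : ℝ) (ht : 0 ≤ t)
    (hA : ∀ s, HasDerivAt A (A' s) s)
    (hB : ∀ s, 0 ≤ s → s ≤ t → ‖(A' s + (A s * K - K * A s)) (Uexp K s x)‖ ≤ B) :
    ‖Uexp K (-t) (A t (Uexp K t x)) - A 0 x‖ ≤ B * t := by
  have h := norm_image_sub_le_of_norm_deriv_le_segment' (f := fun s => Uexp K (-s) (A s (Uexp K s x)))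
    (f' := fun s => Uexp K (-s) ((A' s + (A s * K - K * A s)) (Uexp K s x))) (C := B) (a := 0) (b := t)
    (fun s _ => (duh_deriv K A (A' s) s (hA s) x).hasDerivWithinAt)
    (fun s hs => by rw [Uexp_norm K hK]; exact hB s hs.1 hs.2.le) t ⟨ht, le_refl t⟩
  simpa [Uexp_zero] using h

theorem gron (g g' : ℝ → ℝ) (M : ℝ) (hg : ∀ s, HasDerivAt g (g' s) s) (hb : ∀ s, g' s ≤ M * g s) (t : ℝ) (ht : 0 ≤ t) :
    g t ≤ g 0 * Real.exp (M * t) := by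
  have hd : ∀ s, HasDerivAt (fun s => g s * Real.exp (-(M * s))) (g' s * Real.exp (-(M * s)) + g s * (Real.exp (-(M * s)) * (-(M * 1)))) s := by
    intro s
    exact (hg s).mul (((hasDerivAt_id s).const_mul M).neg.exp)
  have hanti : Antitone (fun s => g s * Real.exp (-(M * s))) := by
    apply antitone_of_deriv_nonpos (fun s => (hd s).differentiableAt)
    intro s
    rw [(hd s).deriv]
    have := Real.exp_pos (-(M * s))
    nlinarith [hb s]
  have h := hanti ht
  simp only [mul_zero, neg_zero, Real.exp_zero, mul_one] at h
  have h2 := mul_le_mul_of_nonneg_right h (Real.exp_pos (M * t)).le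
  rwa [mul_assoc, ← Real.exp_add, neg_add_cancel, Real.exp_zero, mul_one] at h2

end AbstractExp

variable {Λ : Type*} [Fintype Λ] [DecidableEq Λ] {Γ : Type*} [Fintype Γ] [DecidableEq Γ]

namespace Bog
variable {J : Type*} [Fintype J] [DecidableEq J] (Q : Bog Λ Γ J)

theorem Kop_anti (x y : Fock Λ) : inner ℝ (Q.Kop x) y = - (inner ℝ x (Q.Kop y) : ℝ) := by
  rw [op_inner_star, star_Kop, fneg_apply, inner_neg_right]

def psi (t : ℝ) : Fock Λ := Uexp Q.Kop t fvac

theorem norm_psi (t : ℝ) : ‖Q.psi t‖ = 1 := by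
  unfold psi; rw [Uexp_norm _ Q.Kop_anti, norm_fvac]

theorem C0_nonneg : 0 ≤ Q.C0 := (Finset.sum_nonneg fun j _ => Q.hkp j).trans Q.hC0

theorem shf_Pop : Shf 4 Q.Pop := shf_sum _ _ fun j _ => shf_smul _ (shf_congr (shf_mul (Q.shf_b _) (Q.shf_b _)) (by norm_num))

theorem norm_F (j : J) : ‖Q.F j‖ = 1 := by
  have := Q.hFF j j; rw [real_inner_self_eq_norm_sq, if_pos rfl] at this
  nlinarith [norm_nonneg (Q.F j)]
theorem norm_G (j : J) : ‖Q.G j‖ = 1 := by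
  have := Q.hGG j j; rw [real_inner_self_eq_norm_sq, if_pos rfl] at this
  nlinarith [norm_nonneg (Q.G j)]

theorem Pop_bound (x : Fock Λ) : ‖Q.Pop x‖ ≤ 4 * Q.s * Q.C0 * nrm2 x := by
  unfold Pop
  rw [fsum_apply]
  refine (norm_sum_le _ _).trans ?_
  calc _ ≤ ∑ j, Q.kp j * (4 * Q.s * nrm2 x) := by
        refine Finset.sum_le_sum fun j _ => ?_
        rw [fsmul_apply, norm_smul, Real.norm_eq_abs, abs_of_nonneg (Q.hkp j), fmul_apply]
        have := Q.bb_bound (Q.F j) (Q.G j) x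
        rw [norm_F, norm_G, mul_one, mul_one] at this
        exact mul_le_mul_of_nonneg_left this (Q.hkp j)
    _ = (∑ j, Q.kp j) * (4 * Q.s * nrm2 x) := by rw [Finset.sum_mul]
    _ ≤ Q.C0 * (4 * Q.s * nrm2 x) := mul_le_mul_of_nonneg_right Q.hC0 (by have := nrm2_nonneg x; positivity)
    _ = _ := by ring

/-- expectation of a commutator with `K` -/
theorem comm_expect (T : FOp Λ) (hT : star T = T) (x : Fock Λ) :
    (inner ℝ (Q.Kop x) (T x) : ℝ) + inner ℝ x (T (Q.Kop x)) = 2 * inner ℝ x ((T * Q.Pop - Q.Pop * T) x) := by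
  have hs : ∀ A : FOp Λ, ∀ x y : Fock Λ, (inner ℝ (star A x) y : ℝ) = inner ℝ x (A y) := fun A x y => by rw [op_inner_star' A x y]
  have e1 : (inner ℝ x (T (Q.Kop x)) : ℝ) = inner ℝ (Q.Kop x) (T x) := by
    rw [op_inner_star' T, hT, real_inner_comm]
  rw [e1]
  unfold Kop
  rw [fsub_apply, inner_sub_left, hs, fsub_apply, inner_sub_right, fmul_apply, fmul_apply, op_inner_star' T, hT, real_inner_comm x (T (Q.Pop x))]
  ring

theorem nrm2_psi_deriv (t : ℝ) :
    HasDerivAt (fun t => nrm2 (Q.psi t) ^ 2) (2 * inner ℝ (Q.psi t) (((gop (fun n => w2f n * w2f n) : FOp Λ) * Q.Pop - Q.Pop * gop (fun n => w2f n * w2f n) : FOp Λ) (Q.psi t))) t := by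
  have h := (Uexp_vec_deriv Q.Kop fvac t).inner ℝ (((gop (fun n => w2f n * w2f n) : FOp Λ).hasFDerivAt).comp_hasDerivAt t (Uexp_vec_deriv Q.Kop fvac t))
  have e : (fun t => nrm2 (Q.psi t) ^ 2) = fun t => (inner ℝ (Uexp Q.Kop t fvac) ((gop (fun n => w2f n * w2f n) : FOp Λ) (Uexp Q.Kop t fvac)) : ℝ) := by
    ext s
    unfold nrm2
    rw [← real_inner_self_eq_norm_sq, gop_symm, ← fmul_apply, gop_mul]; rfl
  rw [e, ← Q.comm_expect _ (star_gop _)]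
  rw [add_comm]
  exact h

theorem gron_psi (t : ℝ) (ht : 0 ≤ t) (ht1 : t ≤ 1) : nrm2 (Q.psi t) ≤ Real.exp (96 * Q.s * Q.C0) := by
  have h := gron _ _ (192 * Q.s * Q.C0) Q.nrm2_psi_deriv (by
    intro s
    have e : ((gop (fun n => w2f n * w2f n) : FOp Λ) * Q.Pop - Q.Pop * gop (fun n => w2f n * w2f n))
        = gop (fun n => w2f n * w2f n - w2f (n + 4) * w2f (n + 4)) * Q.Pop := by
      rw [Q.shf_Pop, ← sub_mul, gop_sub]
    rw [e, fmul_apply, ← gop_symm]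
    have h1 : ‖(gop (fun n => w2f n * w2f n - w2f (n + 4) * w2f (n + 4)) : FOp Λ) (Q.psi s)‖ ≤ 24 * nrm2 (Q.psi s) := by
      apply gop_mono _ _ _ (by norm_num)
      intro n
      unfold w2f
      have h0 : (0:ℝ) ≤ n := by positivity
      have e1 : |((n : ℤ) : ℝ)| = n := by simp
      have e2 : |(((n : ℤ) + 4 : ℤ) : ℝ)| = n + 4 := by push_cast; rw [abs_of_nonneg (by positivity)]
      rw [e1, e2, abs_of_nonneg (by positivity : (0:ℝ) ≤ (n:ℝ) + 1), abs_le]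
      constructor <;> nlinarith
    have h2 := real_inner_le_norm ((gop (fun n => w2f n * w2f n - w2f (n + 4) * w2f (n + 4)) : FOp Λ) (Q.psi s)) (Q.Pop (Q.psi s))
    have h3 := mul_le_mul h1 (Q.Pop_bound (Q.psi s)) (norm_nonneg _) (by have := nrm2_nonneg (Q.psi s); positivity)
    linarith) t ht
  have h0 : nrm2 (Q.psi 0) = 1 := by
    unfold psi nrm2
    rw [Uexp_zero, gop_fvac, norm_smul, norm_fvac]; simp [w2f]
  rw [h0] at h
  apply le_of_sq_le_sq _ (Real.exp_pos _).le
  refine h.trans ?_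
  rw [one_pow, one_mul, ← Real.exp_nat_mul]
  apply Real.exp_le_exp.mpr
  have := mul_nonneg (mul_nonneg (by norm_num : (0:ℝ) ≤ 192) (Nat.cast_nonneg (α := ℝ) Q.s)) Q.C0_nonneg
  push_cast
  nlinarith

end Bog
end

noncomputable section
variable {Λ : Type*} [Fintype Λ] [DecidableEq Λ] {Γ : Type*} [Fintype Γ] [DecidableEq Γ]

theorem cosh_sub_one_bd (τ k C : ℝ) (hτ : |τ| ≤ 1) (hk : 0 ≤ k) (hkC : k ≤ C) :
    |Real.cosh (τ * k) - 1| ≤ k * Real.exp C ∧ |Real.sinh (τ * k)| ≤ k * Real.exp C := by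
  have h0 : Real.exp k - 1 ≤ k * Real.exp k := by
    have := Real.add_one_le_exp (-k)
    have h2 := mul_le_mul_of_nonneg_right this (Real.exp_pos k).le
    rw [← Real.exp_add, neg_add_cancel, Real.exp_zero] at h2
    linarith
  have h1 : k * Real.exp k ≤ k * Real.exp C := by gcongr
  have hx : |τ * k| ≤ k := by
    rw [abs_mul, abs_of_nonneg hk]; nlinarith
  have h2 : Real.cosh (τ * k) ≤ Real.cosh k := by
    rw [Real.cosh_le_cosh]; rwa [abs_of_nonneg hk]
  have h3 : |Real.sinh (τ * k)| ≤ Real.sinh k := by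
    rw [Real.abs_sinh]; exact Real.sinh_le_sinh.mpr hx
  have h4 := Real.one_le_cosh (τ * k)
  have h5 : Real.cosh k + Real.sinh k = Real.exp k := Real.cosh_add_sinh k
  have h6 : 0 ≤ Real.sinh k := Real.sinh_nonneg_iff.mpr hk
  have h7 := Real.one_le_cosh k
  constructor
  · rw [abs_of_nonneg (by linarith)]; linarith
  · linarith

namespace Bog
variable {J : Type*} [Fintype J] [DecidableEq J] (Q : Bog Λ Γ J)

def fl (τ : ℝ) (α β : EuclideanSpace ℝ Γ) : EuclideanSpace ℝ Γ :=
  α + ∑ j, (((Real.cosh (τ * Q.kp j) - 1) * inner ℝ (Q.F j) α + Real.sinh (τ * Q.kp j) * inner ℝ (Q.G j) β) • Q.F j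
    + ((Real.cosh (τ * Q.kp j) - 1) * inner ℝ (Q.G j) α + Real.sinh (τ * Q.kp j) * inner ℝ (Q.F j) β) • Q.G j)

theorem fl_zero (α β : EuclideanSpace ℝ Γ) : Q.fl 0 α β = α := by simp [fl]

theorem inner_F_fl (τ : ℝ) (α β : EuclideanSpace ℝ Γ) (i : J) :
    (inner ℝ (Q.F i) (Q.fl τ α β) : ℝ) = Real.cosh (τ * Q.kp i) * inner ℝ (Q.F i) α + Real.sinh (τ * Q.kp i) * inner ℝ (Q.G i) β := by
  unfold fl
  rw [inner_add_right, inner_sum]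
  simp only [inner_add_right, inner_smul_right, Q.hFF, Q.hFG]
  simp
  ring

theorem inner_G_fl (τ : ℝ) (α β : EuclideanSpace ℝ Γ) (i : J) :
    (inner ℝ (Q.G i) (Q.fl τ α β) : ℝ) = Real.cosh (τ * Q.kp i) * inner ℝ (Q.G i) α + Real.sinh (τ * Q.kp i) * inner ℝ (Q.F i) β := by
  unfold fl
  have hGF : ∀ j, (inner ℝ (Q.G i) (Q.F j) : ℝ) = 0 := fun j => by rw [real_inner_comm]; exact Q.hFG j i
  rw [inner_add_right, inner_sum]
  simp only [inner_add_right, inner_smul_right, Q.hGG, hGF]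
  simp
  ring

theorem fl_deriv (α β : EuclideanSpace ℝ Γ) (τ : ℝ) : HasDerivAt (fun τ => Q.fl τ α β) (Q.Kf (Q.fl τ β α)) τ := by
  have h : HasDerivAt (fun τ => Q.fl τ α β) (0 + ∑ j, (((Q.kp j * Real.sinh (τ * Q.kp j)) * inner ℝ (Q.F j) α + (Q.kp j * Real.cosh (τ * Q.kp j)) * inner ℝ (Q.G j) β) • Q.F j
    + ((Q.kp j * Real.sinh (τ * Q.kp j)) * inner ℝ (Q.G j) α + (Q.kp j * Real.cosh (τ * Q.kp j)) * inner ℝ (Q.F j) β) • Q.G j)) τ := by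
    unfold fl
    refine (hasDerivAt_const _ _).add ?_
    refine HasDerivAt.fun_sum fun j _ => ?_
    have hm : HasDerivAt (fun τ : ℝ => τ * Q.kp j) (Q.kp j) τ := by simpa using (hasDerivAt_id τ).mul_const (Q.kp j)
    have hc : HasDerivAt (fun τ => Real.cosh (τ * Q.kp j) - 1) (Q.kp j * Real.sinh (τ * Q.kp j)) τ := by
      have := (hm.cosh).sub_const 1
      rwa [mul_comm] at this
    have hs : HasDerivAt (fun τ => Real.sinh (τ * Q.kp j)) (Q.kp j * Real.cosh (τ * Q.kp j)) τ := by
      have := hm.sinh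
      rwa [mul_comm] at this
    exact (((hc.mul_const _).add (hs.mul_const _)).smul_const _).add (((hc.mul_const _).add (hs.mul_const _)).smul_const _)
  convert h using 1
  unfold Kf
  rw [zero_add]
  refine Finset.sum_congr rfl fun j _ => ?_
  rw [inner_F_fl, inner_G_fl, smul_add, smul_smul, smul_smul, add_comm]
  congr 2 <;> ring

def cF : ℝ := 1 + 2 * Q.C0 * Real.exp Q.C0
theorem cF_nonneg : 0 ≤ Q.cF := by unfold cF; have := Q.C0_nonneg; positivity

theorem kp_le (j : J) : Q.kp j ≤ Q.C0 :=
  (Finset.single_le_sum (f := Q.kp) (fun i _ => Q.hkp i) (Finset.mem_univ j)).trans Q.hC0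

theorem fl_norm (τ : ℝ) (hτ : |τ| ≤ 1) (α β : EuclideanSpace ℝ Γ) : ‖Q.fl τ α β‖ ≤ Q.cF * (‖α‖ + ‖β‖) := by
  unfold fl
  refine (norm_add_le _ _).trans ?_
  have h : ‖∑ j, (((Real.cosh (τ * Q.kp j) - 1) * inner ℝ (Q.F j) α + Real.sinh (τ * Q.kp j) * inner ℝ (Q.G j) β) • Q.F j
    + ((Real.cosh (τ * Q.kp j) - 1) * inner ℝ (Q.G j) α + Real.sinh (τ * Q.kp j) * inner ℝ (Q.F j) β) • Q.G j)‖
    ≤ ∑ j, Q.kp j * (2 * Real.exp Q.C0 * (‖α‖ + ‖β‖)) := by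
    refine (norm_sum_le _ _).trans (Finset.sum_le_sum fun j _ => ?_)
    obtain ⟨hc, hs⟩ := cosh_sub_one_bd τ (Q.kp j) Q.C0 hτ (Q.hkp j) (Q.kp_le j)
    have i1 : ∀ v : EuclideanSpace ℝ Γ, |(inner ℝ (Q.F j) v : ℝ)| ≤ ‖v‖ := fun v => by
      have := abs_real_inner_le_norm (Q.F j) v; rwa [norm_F, one_mul] at this
    have i2 : ∀ v : EuclideanSpace ℝ Γ, |(inner ℝ (Q.G j) v : ℝ)| ≤ ‖v‖ := fun v => by
      have := abs_real_inner_le_norm (Q.G j) v; rwa [norm_G, one_mul] at this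
    have h0 : 0 ≤ Q.kp j * Real.exp Q.C0 := mul_nonneg (Q.hkp j) (Real.exp_pos _).le
    have key : ∀ x y : ℝ, |x| ≤ ‖α‖ → |y| ≤ ‖β‖ → |(Real.cosh (τ * Q.kp j) - 1) * x + Real.sinh (τ * Q.kp j) * y| ≤ Q.kp j * Real.exp Q.C0 * (‖α‖ + ‖β‖) := by
      intro x y hx hy
      refine (abs_add_le _ _).trans ?_
      rw [abs_mul, abs_mul]
      have a1 := mul_le_mul hc hx (abs_nonneg _) h0
      have a2 := mul_le_mul hs hy (abs_nonneg _) h0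
      linarith
    refine (norm_add_le _ _).trans ?_
    rw [norm_smul, norm_smul, norm_F, norm_G, mul_one, mul_one, Real.norm_eq_abs, Real.norm_eq_abs]
    have a1 := key _ _ (i1 α) (i2 β)
    have a2 := key _ _ (i2 α) (i1 β)
    linarith
  rw [← Finset.sum_mul] at h
  have h2 : (∑ j, Q.kp j) * (2 * Real.exp Q.C0 * (‖α‖ + ‖β‖)) ≤ Q.C0 * (2 * Real.exp Q.C0 * (‖α‖ + ‖β‖)) :=
    mul_le_mul_of_nonneg_right Q.hC0 (by positivity)
  unfold cF
  have := norm_nonneg β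
  nlinarith

def bL : EuclideanSpace ℝ Γ →L[ℝ] FOp Λ :=
  LinearMap.toContinuousLinearMap { toFun := Q.b, map_add' := Q.b_add, map_smul' := Q.b_smul }
def bsL : EuclideanSpace ℝ Γ →L[ℝ] FOp Λ :=
  LinearMap.toContinuousLinearMap { toFun := Q.bs, map_add' := Q.bs_add, map_smul' := Q.bs_smul }

def cG : ℝ := Real.exp (96 * Q.s * Q.C0)
theorem cG_nonneg : 0 ≤ Q.cG := (Real.exp_pos _).le

def cD : ℝ := Q.cE * (2 * Q.cF) * Q.cG
theorem cD_nonneg : 0 ≤ Q.cD := mul_nonneg (mul_nonneg Q.cE_nonneg (by have := Q.cF_nonneg; positivity)) Q.cG_nonneg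

def ob (α β : EuclideanSpace ℝ Γ) : FOp Λ := Q.b α + Q.bs β

theorem duhamel (t : ℝ) (ht : 0 ≤ t) (ht1 : t ≤ 1) (α β : EuclideanSpace ℝ Γ) :
    ‖Uexp Q.Kop (-t) (Q.ob α β (Q.psi t)) - Q.bs (Q.fl (-t) β α) fvac‖ ≤ Q.cD * Q.ρ * (‖α‖ + ‖β‖) := by
  have hd : ∀ a b : EuclideanSpace ℝ Γ, ∀ s, HasDerivAt (fun s => Q.fl (s - t) a b) (Q.Kf (Q.fl (s - t) b a)) s := by
    intro a b s
    have := (Q.fl_deriv a b (s - t)).scomp s ((hasDerivAt_id s).sub_const t)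
    rw [one_smul] at this
    exact this
  have h := duh_bound Q.Kop Q.Kop_anti (fun s => Q.ob (Q.fl (s - t) α β) (Q.fl (s - t) β α))
    (fun s => Q.ob (Q.Kf (Q.fl (s - t) β α)) (Q.Kf (Q.fl (s - t) α β))) fvac t (Q.cD * Q.ρ * (‖α‖ + ‖β‖)) ht ?_ ?_
  · simp only [sub_self, fl_zero, zero_sub] at h
    have e : Q.ob (Q.fl (-t) α β) (Q.fl (-t) β α) fvac = Q.bs (Q.fl (-t) β α) fvac := by
      unfold ob; rw [fadd_apply, Q.b_fvac, zero_add]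
    rw [e] at h
    refine h.trans ?_
    have : 0 ≤ Q.cD * Q.ρ * (‖α‖ + ‖β‖) := mul_nonneg (mul_nonneg Q.cD_nonneg Q.hρ) (by positivity)
    nlinarith
  · intro s
    exact ((Q.bL.hasFDerivAt).comp_hasDerivAt s (hd α β s)).add ((Q.bsL.hasFDerivAt).comp_hasDerivAt s (hd β α s))
  · intro s hs hst
    set a := Q.fl (s - t) α β with ha
    set c := Q.fl (s - t) β α with hc
    have e : Q.ob (Q.Kf c) (Q.Kf a) + (Q.ob a c * Q.Kop - Q.Kop * Q.ob a c) = Q.Err a + star (Q.Err c) := by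
      have e1 : Q.ob a c * Q.Kop - Q.Kop * Q.ob a c = (Q.b a * Q.Kop - Q.Kop * Q.b a) + (Q.bs c * Q.Kop - Q.Kop * Q.bs c) := by
        unfold ob; rw [add_mul, mul_add]; abel
      rw [e1, comm_b, comm_bs]
      unfold ob; abel
    rw [e, fadd_apply]
    refine (norm_add_le _ _).trans ?_
    have hab : |s - t| ≤ 1 := by rw [abs_le]; constructor <;> linarith
    have n1 := Q.fl_norm (s - t) hab α β
    have n2 := Q.fl_norm (s - t) hab β α
    have b1 := Q.Err_bound a (Uexp Q.Kop s fvac)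
    have b2 := Q.star_Err_bound c (Uexp Q.Kop s fvac)
    have g := Q.gron_psi s hs (hst.trans ht1)
    have hcr : 0 ≤ Q.cE * Q.ρ := mul_nonneg Q.cE_nonneg Q.hρ
    have key : ∀ x : ℝ, 0 ≤ x → x ≤ Q.cF * (‖α‖ + ‖β‖) → Q.cE * Q.ρ * x * nrm2 (Uexp Q.Kop s fvac) ≤ Q.cE * Q.ρ * (Q.cF * (‖α‖ + ‖β‖)) * Q.cG := by
      intro x hx hx2
      apply mul_le_mul (mul_le_mul_of_nonneg_left hx2 hcr) g (nrm2_nonneg _)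
      exact mul_nonneg hcr (hx.trans hx2)
    have k1 := key _ (norm_nonneg a) n1
    have k2 := key _ (norm_nonneg c) (by rw [add_comm (‖α‖)]; exact n2)
    unfold cD
    linarith

def cI : ℝ := Q.cD * (2 * √Q.s * Q.cG + Q.cF)
theorem cI_nonneg : 0 ≤ Q.cI := mul_nonneg Q.cD_nonneg (by have := Q.cF_nonneg; have := Q.cG_nonneg; positivity)

theorem nrm1_psi (t : ℝ) (ht : 0 ≤ t) (ht1 : t ≤ 1) : nrm1 (Q.psi t) ≤ Q.cG := (nrm1_le_nrm2 _).trans (Q.gron_psi t ht ht1)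

theorem ob_norm (t : ℝ) (ht : 0 ≤ t) (ht1 : t ≤ 1) (α β : EuclideanSpace ℝ Γ) : ‖Q.ob α β (Q.psi t)‖ ≤ 2 * √Q.s * Q.cG * (‖α‖ + ‖β‖) := by
  unfold ob
  rw [fadd_apply]
  refine (norm_add_le _ _).trans ?_
  have h1 := Q.b_bound' α (Q.psi t)
  have h2 := Q.bs_bound β (Q.psi t)
  have h3 := Q.nrm1_psi t ht ht1
  have h4 := mul_le_mul_of_nonneg_left h3 (by positivity : 0 ≤ 2 * (√(Q.s:ℝ) * ‖α‖))
  have h5 := mul_le_mul_of_nonneg_left h3 (by positivity : 0 ≤ 2 * (√(Q.s:ℝ) * ‖β‖))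
  linarith

theorem bs_fvac_norm (f : EuclideanSpace ℝ Γ) : ‖Q.bs f fvac‖ = ‖f‖ := by
  have := Q.bs_fvac_inner f f
  rw [real_inner_self_eq_norm_sq, real_inner_self_eq_norm_sq] at this
  exact (sq_eq_sq₀ (norm_nonneg _) (norm_nonneg _)).mp this

theorem inner_Uexp (t : ℝ) (x y : Fock Λ) : (inner ℝ (Uexp Q.Kop t x) (Uexp Q.Kop t y) : ℝ) = inner ℝ x y := by
  rw [real_inner_eq_norm_add_mul_self_sub_norm_mul_self_sub_norm_mul_self_div_two, real_inner_eq_norm_add_mul_self_sub_norm_mul_self_sub_norm_mul_self_div_two, ← map_add,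
    Uexp_norm _ Q.Kop_anti, Uexp_norm _ Q.Kop_anti, Uexp_norm _ Q.Kop_anti]

theorem pairing (t : ℝ) (ht : 0 ≤ t) (ht1 : t ≤ 1) (α β α' β' : EuclideanSpace ℝ Γ) :
    |(inner ℝ (Q.ob α β (Q.psi t)) (Q.ob α' β' (Q.psi t)) : ℝ) - inner ℝ (Q.fl (-t) β α) (Q.fl (-t) β' α')|
      ≤ Q.cI * Q.ρ * (‖α‖ + ‖β‖) * (‖α'‖ + ‖β'‖) := by
  rw [← Q.inner_Uexp (-t), ← Q.bs_fvac_inner]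
  have d1 := Q.duhamel t ht ht1 α β
  have d2 := Q.duhamel t ht ht1 α' β'
  have n1 : ‖Uexp Q.Kop (-t) (Q.ob α' β' (Q.psi t))‖ ≤ _ := (Uexp_norm Q.Kop Q.Kop_anti (-t) _).le.trans (Q.ob_norm t ht ht1 α' β')
  have n2 : ‖Q.bs (Q.fl (-t) β α) fvac‖ ≤ Q.cF * (‖α‖ + ‖β‖) := by
    rw [bs_fvac_norm, add_comm]; exact Q.fl_norm _ (by rw [abs_neg, abs_of_nonneg ht]; exact ht1) _ _
  set x := Uexp Q.Kop (-t) (Q.ob α β (Q.psi t))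
  set y := Uexp Q.Kop (-t) (Q.ob α' β' (Q.psi t))
  set x0 := Q.bs (Q.fl (-t) β α) fvac
  set y0 := Q.bs (Q.fl (-t) β' α') fvac
  have e : (inner ℝ x y : ℝ) - inner ℝ x0 y0 = inner ℝ (x - x0) y + inner ℝ x0 (y - y0) := by
    rw [inner_sub_left, inner_sub_right]; ring
  rw [e]
  refine (abs_add_le _ _).trans ?_
  have a1 := (abs_real_inner_le_norm (x - x0) y).trans (mul_le_mul d1 n1 (norm_nonneg _) (mul_nonneg (mul_nonneg Q.cD_nonneg Q.hρ) (by positivity)))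
  have a2 := (abs_real_inner_le_norm x0 (y - y0)).trans (mul_le_mul n2 d2 (norm_nonneg _) (mul_nonneg Q.cF_nonneg (by positivity)))
  refine (add_le_add a1 a2).trans (le_of_eq ?_)
  unfold cI; ring

/-- result (a) -/
theorem resA (α β : EuclideanSpace ℝ Γ) (a : J → ℝ) (h1 : ∀ j, inner ℝ (Q.F j) β = (0:ℝ)) (h2 : ∀ j, inner ℝ (Q.G j) α = (0:ℝ))
    (h3 : ∀ j, inner ℝ (Q.F j) α = a j) (h4 : ∀ j, inner ℝ (Q.G j) β = a j) :
    ‖Q.ob α β (Q.psi 1)‖ ^ 2 ≤ ‖β‖ ^ 2 + ∑ j, (Real.exp (-2 * Q.kp j) - 1) * a j ^ 2 + Q.cI * Q.ρ * (‖α‖ + ‖β‖) ^ 2 := by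
  have h := Q.pairing 1 (by norm_num) le_rfl α β α β
  have e : Q.fl (-1) β α = β + ∑ j, ((Real.exp (-Q.kp j) - 1) * a j) • Q.G j := by
    unfold fl
    congr 1
    refine Finset.sum_congr rfl fun j _ => ?_
    rw [h1, h2, h3, h4, mul_zero, mul_zero, add_zero, zero_smul, zero_add, neg_one_mul, Real.cosh_neg, Real.sinh_neg, ← Real.cosh_sub_sinh]
    congr 1; ring
  have e2 : (inner ℝ (Q.fl (-1) β α) (Q.fl (-1) β α) : ℝ) = ‖β‖ ^ 2 + ∑ j, (Real.exp (-2 * Q.kp j) - 1) * a j ^ 2 := by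
    rw [real_inner_self_eq_norm_sq, e, norm_add_sq_real, orth_norm_sq _ Q.hGG, inner_sum, Finset.mul_sum, add_assoc, ← Finset.sum_add_distrib]
    congr 1
    refine Finset.sum_congr rfl fun j _ => ?_
    rw [inner_smul_right, real_inner_comm, h4]
    have : Real.exp (-2 * Q.kp j) = Real.exp (-Q.kp j) ^ 2 := by rw [← Real.exp_nat_mul]; congr 1; push_cast; ring
    rw [this]; ring
  rw [e2, real_inner_self_eq_norm_sq] at h
  have := (abs_le.mp h).2
  nlinarith

/-- result (c) -/
theorem resC (A : FOp Λ) (hA : ∀ x, A * Q.bx x = Q.bx x * A) (hA' : ∀ x, A * star (Q.bx x) = star (Q.bx x) * A) (t : ℝ) :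
    A (Q.psi t) = Uexp Q.Kop t (A fvac) := by
  have hb : ∀ f, A * Q.b f = Q.b f * A := by
    intro f; unfold PairSys.b
    rw [Finset.mul_sum, Finset.sum_mul]
    exact Finset.sum_congr rfl fun x _ => by rw [fmul_smul, fsmul_mul, hA]
  have hbs : ∀ f, A * Q.bs f = Q.bs f * A := by
    intro f; rw [Q.bs_eq]
    rw [Finset.mul_sum, Finset.sum_mul]
    exact Finset.sum_congr rfl fun x _ => by rw [fmul_smul, fsmul_mul, hA']
  apply Uexp_commute
  unfold Kop
  rw [mul_sub, sub_mul, star_Pop]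
  unfold Pop
  rw [Finset.mul_sum, Finset.sum_mul, Finset.mul_sum, Finset.sum_mul]
  congr 1
  · exact Finset.sum_congr rfl fun j _ => by rw [fmul_smul, fsmul_mul, ← mul_assoc, hb, mul_assoc, hb, mul_assoc]
  · exact Finset.sum_congr rfl fun j _ => by rw [fmul_smul, fsmul_mul, ← mul_assoc, hbs, mul_assoc, hbs, mul_assoc]

def emul (e : Γ → ℝ) (f : EuclideanSpace ℝ Γ) : EuclideanSpace ℝ Γ := WithLp.toLp 2 fun x => e x * f x

theorem emul_norm (e : Γ → ℝ) (M : ℝ) (hM : ∀ x, |e x| ≤ M) (hM0 : 0 ≤ M) (f : EuclideanSpace ℝ Γ) : ‖emul e f‖ ≤ M * ‖f‖ := by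
  apply le_of_sq_le_sq _ (by positivity)
  rw [mul_pow, PairSys.eucl_norm_sq, PairSys.eucl_norm_sq, Finset.mul_sum]
  refine Finset.sum_le_sum fun x _ => ?_
  change (e x * f x) ^ 2 ≤ _
  rw [mul_pow]
  exact mul_le_mul_of_nonneg_right (sq_le_sq' (abs_le.mp (hM x)).1 (abs_le.mp (hM x)).2) (sq_nonneg _)

theorem ring_aux5 {R : Type*} [Ring R] (T b c b' c' : R) (hb : T * b - b * T = -b') (hc : T * c - c * T = -c') :
    T * (b * c) - b * c * T = -(b' * c + b * c') := by
  calc T * (b * c) - b * c * T = (T * b - b * T) * c + b * (T * c - c * T) := by noncomm_ring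
    _ = _ := by rw [hb, hc]; noncomm_ring

theorem bb_expect (t : ℝ) (ht : 0 ≤ t) (ht1 : t ≤ 1) (f v : EuclideanSpace ℝ Γ) :
    |(inner ℝ (Q.psi t) (Q.b f (Q.b v (Q.psi t))) : ℝ) - inner ℝ (Q.fl (-t) f 0) (Q.fl (-t) 0 v)| ≤ Q.cI * Q.ρ * ‖f‖ * ‖v‖ := by
  have h := Q.pairing t ht ht1 0 f v 0
  have e1 : Q.ob 0 f = Q.bs f := by unfold ob; rw [Q.b_zero, zero_add]
  have e2 : Q.ob v 0 = Q.b v := by unfold ob; rw [Q.bs_zero, add_zero]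
  rw [e1, e2, norm_zero, zero_add, add_zero] at h
  rw [op_inner_star']
  exact h

theorem F_fl (t : ℝ) (j : J) (v : EuclideanSpace ℝ Γ) :
    (inner ℝ (Q.fl (-t) (Q.F j) 0) (Q.fl (-t) 0 v) : ℝ) = - (Real.cosh (t * Q.kp j) * Real.sinh (t * Q.kp j) * inner ℝ (Q.G j) v) := by
  have hGF : ∀ i j, (inner ℝ (Q.G i) (Q.F j) : ℝ) = 0 := fun i j => by rw [real_inner_comm]; exact Q.hFG j i
  have e : Q.fl (-t) (Q.F j) 0 = Real.cosh (t * Q.kp j) • Q.F j := by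
    unfold fl
    simp only [hGF, Q.hFF, inner_zero_right, mul_zero, add_zero, zero_smul]
    rw [Finset.sum_eq_single j]
    · rw [if_pos rfl, mul_one, neg_mul, Real.cosh_neg, sub_smul, one_smul]; abel
    · intro i _ hi; rw [if_neg hi]; simp
    · simp
  rw [e, inner_smul_left, inner_F_fl]
  simp
  ring

theorem G_fl (t : ℝ) (j : J) (v : EuclideanSpace ℝ Γ) :
    (inner ℝ (Q.fl (-t) (Q.G j) 0) (Q.fl (-t) 0 v) : ℝ) = - (Real.cosh (t * Q.kp j) * Real.sinh (t * Q.kp j) * inner ℝ (Q.F j) v) := by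
  have e : Q.fl (-t) (Q.G j) 0 = Real.cosh (t * Q.kp j) • Q.G j := by
    unfold fl
    simp only [Q.hFG, Q.hGG, inner_zero_right, mul_zero, add_zero, zero_smul]
    rw [Finset.sum_eq_single j]
    · rw [if_pos rfl, mul_one, neg_mul, Real.cosh_neg, sub_smul, one_smul, zero_add]; abel
    · intro i _ hi; rw [if_neg hi]; simp
    · simp
  rw [e, inner_smul_left, inner_G_fl]
  simp
  ring

/-- result (b) -/
theorem resB (T : FOp Λ) (hT : star T = T) (e : Γ → ℝ) (hTb : ∀ x, T * Q.bx x - Q.bx x * T = -(e x • Q.bx x))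
    (τ : ℝ) (hΩ : T fvac = τ • (fvac : Fock Λ)) (M : ℝ) (hM0 : 0 ≤ M) (hM : ∀ x, |e x| ≤ M) :
    (inner ℝ (Q.psi 1) (T (Q.psi 1)) : ℝ) ≤ τ + ∑ j, 1 / 2 * (Real.cosh (2 * Q.kp j) - 1) * (inner ℝ (Q.F j) (emul e (Q.F j)) + inner ℝ (Q.G j) (emul e (Q.G j)))
      + 4 * Q.C0 * Q.cI * Q.ρ * M := by
  have hTf : ∀ f, T * Q.b f - Q.b f * T = - Q.b (emul e f) := by
    intro f; unfold PairSys.b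
    rw [Finset.mul_sum, Finset.sum_mul, ← Finset.sum_sub_distrib, ← Finset.sum_neg_distrib]
    refine Finset.sum_congr rfl fun x _ => ?_
    rw [fmul_smul, fsmul_mul, ← fsmul_sub, hTb, fsmul_neg, fsmul_smul]
    change -((f x * e x) • Q.bx x) = -((e x * f x) • Q.bx x)
    rw [mul_comm]
  have hTP : T * Q.Pop - Q.Pop * T = -∑ j, Q.kp j • (Q.b (Q.G j) * Q.b (emul e (Q.F j)) + Q.b (Q.F j) * Q.b (emul e (Q.G j))) := by
    unfold Pop
    rw [Finset.mul_sum, Finset.sum_mul, ← Finset.sum_sub_distrib, ← Finset.sum_neg_distrib]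
    refine Finset.sum_congr rfl fun j _ => ?_
    rw [fmul_smul, fsmul_mul, ← fsmul_sub, ring_aux5 _ _ _ _ _ (hTf (Q.F j)) (hTf (Q.G j)), fsmul_neg, Q.b_comm (emul e (Q.F j))]
  set w : J → ℝ := fun j => inner ℝ (Q.F j) (emul e (Q.F j)) + inner ℝ (Q.G j) (emul e (Q.G j)) with hw
  set g : ℝ → ℝ := fun t => inner ℝ (Q.psi t) (T (Q.psi t)) - ∑ j, 1 / 2 * (Real.cosh (2 * (t * Q.kp j)) - 1) * w j with hg
  set g' : ℝ → ℝ := fun t => 2 * inner ℝ (Q.psi t) ((T * Q.Pop - Q.Pop * T : FOp Λ) (Q.psi t)) - ∑ j, Q.kp j * Real.sinh (2 * (t * Q.kp j)) * w j with hg'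
  have hd : ∀ t, HasDerivAt g (g' t) t := by
    intro t
    have h := (Uexp_vec_deriv Q.Kop fvac t).inner ℝ ((T.hasFDerivAt).comp_hasDerivAt t (Uexp_vec_deriv Q.Kop fvac t))
    have h1 : HasDerivAt (fun t => (inner ℝ (Q.psi t) (T (Q.psi t)) : ℝ)) (2 * inner ℝ (Q.psi t) ((T * Q.Pop - Q.Pop * T : FOp Λ) (Q.psi t))) t := by
      rw [← Q.comm_expect _ hT, add_comm]
      exact h
    refine h1.sub (HasDerivAt.fun_sum fun j _ => ?_)
    have hm : HasDerivAt (fun τ : ℝ => 2 * (τ * Q.kp j)) (2 * Q.kp j) t := by simpa using ((hasDerivAt_id t).mul_const (Q.kp j)).const_mul 2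
    have := ((hm.cosh.sub_const 1).const_mul (1/2)).mul_const (w j)
    refine this.congr_deriv ?_
    ring
  have hbd : ∀ t ∈ Set.Ico (0:ℝ) 1, ‖g' t‖ ≤ 4 * Q.C0 * Q.cI * Q.ρ * M := by
    rintro t ⟨ht, ht1⟩
    have e1 : g' t = ∑ j, Q.kp j * (-2 * ((inner ℝ (Q.psi t) (Q.b (Q.G j) (Q.b (emul e (Q.F j)) (Q.psi t))) : ℝ) - inner ℝ (Q.fl (-t) (Q.G j) 0) (Q.fl (-t) 0 (emul e (Q.F j))))
        + -2 * ((inner ℝ (Q.psi t) (Q.b (Q.F j) (Q.b (emul e (Q.G j)) (Q.psi t))) : ℝ) - inner ℝ (Q.fl (-t) (Q.F j) 0) (Q.fl (-t) 0 (emul e (Q.G j))))) := by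
      rw [hg']
      simp only [hTP]
      rw [fneg_apply, fsum_apply, inner_neg_right, inner_sum, ← Finset.sum_neg_distrib, Finset.mul_sum, ← Finset.sum_sub_distrib]
      refine Finset.sum_congr rfl fun j _ => ?_
      rw [fsmul_apply, fadd_apply, inner_smul_right, inner_add_right, fmul_apply, fmul_apply, F_fl, G_fl, Real.sinh_two_mul]
      ring
    rw [e1]
    refine (norm_sum_le _ _).trans ?_
    calc _ ≤ ∑ j, Q.kp j * (4 * Q.cI * Q.ρ * M) := by
          refine Finset.sum_le_sum fun j _ => ?_
          rw [norm_mul, Real.norm_eq_abs, Real.norm_eq_abs, abs_of_nonneg (Q.hkp j)]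
          refine mul_le_mul_of_nonneg_left ?_ (Q.hkp j)
          refine (abs_add_le _ _).trans ?_
          rw [abs_mul, abs_mul]
          have b1 := Q.bb_expect t ht ht1.le (Q.G j) (emul e (Q.F j))
          have b2 := Q.bb_expect t ht ht1.le (Q.F j) (emul e (Q.G j))
          have m1 := emul_norm e M hM hM0 (Q.F j)
          have m2 := emul_norm e M hM hM0 (Q.G j)
          rw [norm_F, mul_one] at m1
          rw [norm_G, mul_one] at m2
          rw [norm_G, mul_one] at b1
          rw [norm_F, mul_one] at b2
          have c0 : 0 ≤ Q.cI * Q.ρ := mul_nonneg Q.cI_nonneg Q.hρ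
          have m3 := mul_le_mul_of_nonneg_left m1 c0
          have m4 := mul_le_mul_of_nonneg_left m2 c0
          have : |(-2:ℝ)| = 2 := by norm_num
          rw [this]
          linarith
      _ = (∑ j, Q.kp j) * (4 * Q.cI * Q.ρ * M) := by rw [Finset.sum_mul]
      _ ≤ Q.C0 * (4 * Q.cI * Q.ρ * M) := mul_le_mul_of_nonneg_right Q.hC0 (by have := Q.cI_nonneg; have := Q.hρ; positivity)
      _ = _ := by ring
  have h := norm_image_sub_le_of_norm_deriv_le_segment' (fun t _ => (hd t).hasDerivWithinAt) hbd 1 ⟨by norm_num, le_rfl⟩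
  have h0 : g 0 = τ := by
    rw [hg]
    have : Q.psi 0 = fvac := Uexp_zero _ _
    simp only [this, hΩ, inner_smul_right, real_inner_self_eq_norm_sq, norm_fvac]
    simp
  rw [h0, Real.norm_eq_abs] at h
  have h1 := (abs_le.mp h).2
  simp only [hg, one_mul] at h1
  linarith

end Bog
end

noncomputable section

abbrev E3 := EuclideanSpace ℝ (Fin 3)

def zE (p : Fin 3 → ℤ) : E3 := WithLp.toLp 2 (fun i => (p i : ℝ))

lemma znorm_eq (p : Fin 3 → ℤ) : znorm p = ‖zE p‖ := by
  rw [EuclideanSpace.norm_eq]; simp [znorm, zE]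

lemma zE_add (p q : Fin 3 → ℤ) : zE (p + q) = zE p + zE q := by
  ext i; simp [zE]
lemma zE_sub (p q : Fin 3 → ℤ) : zE (p - q) = zE p - zE q := by
  ext i; simp [zE]
lemma zE_neg (p : Fin 3 → ℤ) : zE (-p) = - zE p := by
  ext i; simp [zE]

lemma znorm_neg (p : Fin 3 → ℤ) : znorm (-p) = znorm p := by
  rw [znorm_eq, znorm_eq, zE_neg, norm_neg]

lemma abs_coord_le (p : Fin 3 → ℤ) (i : Fin 3) : |(p i : ℝ)| ≤ znorm p := by
  rw [znorm_eq]
  have := PiLp.norm_apply_le (zE p) i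
  simpa [zE] using this

lemma ball_finite (R : ℝ) : {p : Fin 3 → ℤ | znorm p ≤ R}.Finite := by
  apply (Set.finite_Icc (fun _ : Fin 3 => -⌈R⌉) (fun _ => ⌈R⌉)).subset
  intro p hp
  have hp' : znorm p ≤ R := hp
  constructor <;> intro i
  · have := (abs_le.1 ((abs_coord_le p i).trans hp')).1
    have h2 := Int.le_ceil R
    have : (-(⌈R⌉:ℝ)) ≤ p i := by linarith
    exact_mod_cast this
  · have := (abs_le.1 ((abs_coord_le p i).trans hp')).2
    have h2 := Int.le_ceil R
    have : (p i : ℝ) ≤ (⌈R⌉:ℝ) := by linarith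
    exact_mod_cast this

def ballF (R : ℝ) : Finset (Fin 3 → ℤ) := (ball_finite R).toFinset

lemma mem_ballF {R : ℝ} {p : Fin 3 → ℤ} : p ∈ ballF R ↔ znorm p ≤ R := by simp [ballF]

lemma card_ballF (R : ℝ) : (ballF R).card = numParticles R := by
  rw [numParticles, ballF, Set.ncard_eq_toFinset_card _ (ball_finite R)]

lemma neg_mem_ballF {R : ℝ} {p : Fin 3 → ℤ} : -p ∈ ballF R ↔ p ∈ ballF R := by
  rw [mem_ballF, mem_ballF, znorm_neg]

def fl3 (x : E3) : Fin 3 → ℤ := fun i => ⌊x i⌋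

def cube3 (p : Fin 3 → ℤ) : Set E3 := {x | fl3 x = p}

lemma cube3_eq (p : Fin 3 → ℤ) :
    cube3 p = WithLp.ofLp ⁻¹' (Set.univ.pi fun i => Set.Ico (p i : ℝ) (p i + 1)) := by
  ext x
  simp only [cube3, fl3, Set.mem_setOf_eq, Set.mem_preimage, Set.mem_univ_pi, Set.mem_Ico]
  rw [funext_iff]
  exact forall_congr' fun i => Int.floor_eq_iff

lemma cube3_meas (p : Fin 3 → ℤ) : MeasurableSet (cube3 p) := by
  rw [cube3_eq]
  exact (PiLp.volume_preserving_ofLp (Fin 3)).measurable (MeasurableSet.univ_pi fun i => measurableSet_Ico)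

lemma cube3_vol (p : Fin 3 → ℤ) : volume (cube3 p) = 1 := by
  rw [cube3_eq, (PiLp.volume_preserving_ofLp (Fin 3)).measure_preimage
    (MeasurableSet.univ_pi fun i => measurableSet_Ico).nullMeasurableSet, Real.volume_pi_Ico]
  simp

lemma fl3_dist (x : E3) : ‖zE (fl3 x) - x‖ ≤ 2 := by
  rw [EuclideanSpace.norm_eq, Fin.sum_univ_three]
  apply Real.sqrt_le_iff.2
  refine ⟨by norm_num, ?_⟩
  have h : ∀ i, ‖(zE (fl3 x) - x) i‖^2 ≤ 1 := by
    intro i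
    have h1 := Int.floor_le (x i)
    have h2 := Int.lt_floor_add_one (x i)
    simp only [zE, fl3, PiLp.sub_apply, Real.norm_eq_abs, sq_abs]
    nlinarith
  linarith [h 0, h 1, h 2]

lemma ball3_vol (r : ℝ) (hr : 0 ≤ r) : (volume (Metric.closedBall (0:E3) r)).toReal = 4/3*π*r^3 := by
  rw [EuclideanSpace.volume_closedBall_fin_three]
  rw [ENNReal.toReal_mul, ENNReal.toReal_pow, ENNReal.toReal_ofReal hr, ENNReal.toReal_ofReal (by positivity)]
  ring

lemma ball3_ne_top (r : ℝ) : volume (Metric.closedBall (0:E3) r) ≠ ⊤ :=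
  measure_closedBall_lt_top.ne

/-- Riemann sum comparison. -/
lemma riemann3 (R : ℝ) (hR : 2 ≤ R) (k : Fin 3 → ℤ) (G : ℝ → ℝ) (M L : ℝ) (hM : 0 ≤ M) (hL : 0 ≤ L)
    (hGc : Continuous G)
    (hGM : ∀ z, |G z| ≤ M) (hGL : ∀ z w, |G z - G w| ≤ L * |z - w|) :
    |∑ p ∈ ballF R, G (inner ℝ (zE k) (zE p)) - ∫ x in Metric.closedBall (0:E3) R, G (inner ℝ (zE k) x)|
      ≤ 70 * (M * R^2 + znorm k * L * R^3) := by
  classical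
  set f : E3 → ℝ := fun x => ∑ p ∈ ballF R, (cube3 p).indicator (fun _ => G (inner ℝ (zE k) (zE p))) x with hf
  set g : E3 → ℝ := (Metric.closedBall (0:E3) R).indicator (fun x => G (inner ℝ (zE k) x)) with hg
  have hfv : ∀ x, f x = if fl3 x ∈ ballF R then G (inner ℝ (zE k) (zE (fl3 x))) else 0 := by
    intro x
    simp only [hf, Set.indicator_apply, cube3, Set.mem_setOf_eq]
    rw [Finset.sum_ite_eq]
  have hfi : Integrable f := by
    apply integrable_finset_sum
    intro p _
    exact (integrable_indicator_iff (cube3_meas p)).2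
      (integrableOn_const (by rw [cube3_vol]; simp))
  have hfint : ∫ x, f x = ∑ p ∈ ballF R, G (inner ℝ (zE k) (zE p)) := by
    simp only [hf]
    rw [integral_finset_sum]
    · apply Finset.sum_congr rfl
      intro p _
      rw [integral_indicator_const _ (cube3_meas p), Measure.real, cube3_vol]; simp
    · intro p _
      exact (integrable_indicator_iff (cube3_meas p)).2
        (integrableOn_const (by rw [cube3_vol]; simp))
  have hgi : Integrable g := by
    rw [hg, integrable_indicator_iff measurableSet_closedBall]
    exact ContinuousOn.integrableOn_compact (isCompact_closedBall _ _)
      (hGc.comp (by fun_prop)).continuousOn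
  have hgint : ∫ x, g x = ∫ x in Metric.closedBall (0:E3) R, G (inner ℝ (zE k) x) :=
    integral_indicator measurableSet_closedBall
  set b : E3 → ℝ := fun x => (Metric.closedBall (0:E3) (R+2)).indicator (fun _ => 2 * znorm k * L + M) x
     - (Metric.closedBall (0:E3) (R-2)).indicator (fun _ => M) x with hb
  have i1 : Integrable ((Metric.closedBall (0:E3) (R+2)).indicator (fun _ => 2 * znorm k * L + M)) :=
    (integrable_indicator_iff measurableSet_closedBall).2 (integrableOn_const (ball3_ne_top _))
  have i2 : Integrable ((Metric.closedBall (0:E3) (R-2)).indicator (fun _ => M)) :=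
    (integrable_indicator_iff measurableSet_closedBall).2 (integrableOn_const (ball3_ne_top _))
  have hbi : Integrable b := i1.sub i2
  have hbint : ∫ x, b x = 4/3*π*(R+2)^3 * (2 * znorm k * L + M) - 4/3*π*(R-2)^3 * M := by
    simp only [hb]
    rw [integral_sub i1 i2, integral_indicator_const _ measurableSet_closedBall,
      integral_indicator_const _ measurableSet_closedBall, Measure.real, Measure.real,
      ball3_vol _ (by linarith), ball3_vol _ (by linarith)]
    simp
  have hk0 : 0 ≤ znorm k := Real.sqrt_nonneg _
  have hpt : ∀ x, |f x - g x| ≤ b x := by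
    intro x
    rw [hfv]
    have hd := fl3_dist x
    have hn1 : ‖x‖ ≤ ‖zE (fl3 x)‖ + 2 := by
      have := norm_sub_norm_le x (zE (fl3 x)); rw [norm_sub_rev] at this; linarith
    have hn2 : ‖zE (fl3 x)‖ ≤ ‖x‖ + 2 := by
      have := norm_sub_norm_le (zE (fl3 x)) x; linarith
    have hl : |G (inner ℝ (zE k) (zE (fl3 x))) - G (inner ℝ (zE k) x)| ≤ 2 * znorm k * L := by
      refine (hGL _ _).trans ?_
      rw [← inner_sub_right]
      have := abs_real_inner_le_norm (zE k) (zE (fl3 x) - x)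
      rw [← znorm_eq] at this
      nlinarith [mul_le_mul_of_nonneg_left hd hk0]
    have g1 := hGM (inner ℝ (zE k) (zE (fl3 x)))
    have g2 := hGM (inner ℝ (zE k) x)
    simp only [hb, hg, Set.indicator_apply, Metric.mem_closedBall, dist_zero_right, mem_ballF, znorm_eq (fl3 x)]
    have hkL : 0 ≤ 2 * znorm k * L := by positivity
    split_ifs <;> (try simp only [sub_zero, zero_sub, abs_neg, abs_zero]) <;> linarith
  have hmain : |∫ x, (f x - g x)| ≤ ∫ x, b x := by
    rw [← Real.norm_eq_abs]
    exact norm_integral_le_of_norm_le hbi (Filter.Eventually.of_forall hpt)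
  rw [integral_sub hfi hgi, hfint, hgint, hbint] at hmain
  refine hmain.trans ?_
  have hpi := Real.pi_lt_d2
  have hpi0 := Real.pi_pos
  have e1 : (R+2)^3 ≤ 8 * R^3 := by
    have : (R+2)^3 ≤ (2*R)^3 := by gcongr; linarith
    nlinarith
  have e2 : (R+2)^3 - (R-2)^3 ≤ 16 * R^2 := by nlinarith
  have z1 : 4/3*π*(R+2)^3 * (2 * znorm k * L) ≤ 4/3*3.15*(8*R^3) * (2 * znorm k * L) := by gcongr
  have z2 : 4/3*π*((R+2)^3 - (R-2)^3) * M ≤ 4/3*3.15*(16*R^2) * M := by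
    gcongr
    nlinarith [sq_nonneg R]
  have z3 : 0 ≤ znorm k * L * R^3 := by positivity
  have z4 : 0 ≤ M * R^2 := by positivity
  nlinarith
end

noncomputable section

lemma disk_vol (a : ℝ) : (volume {w : Fin 2 → ℝ | w 0 ^2 + w 1 ^2 ≤ a}).toReal = π * max a 0 := by
  rcases lt_or_ge a 0 with ha | ha
  · have : {w : Fin 2 → ℝ | w 0 ^2 + w 1 ^2 ≤ a} = ∅ := by
      ext w; simp only [Set.mem_setOf_eq, Set.mem_empty_iff_false, iff_false, not_le]
      nlinarith [sq_nonneg (w 0), sq_nonneg (w 1)]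
    rw [this, max_eq_right ha.le]; simp
  · have hE := EuclideanSpace.volume_closedBall_fin_two (0 : EuclideanSpace ℝ (Fin 2)) (Real.sqrt a)
    have : {w : Fin 2 → ℝ | w 0 ^2 + w 1 ^2 ≤ a} =
        WithLp.toLp 2 ⁻¹' (Metric.closedBall (0 : EuclideanSpace ℝ (Fin 2)) (Real.sqrt a)) := by
      ext w
      simp only [Set.mem_setOf_eq, Set.mem_preimage, Metric.mem_closedBall, dist_zero_right,
        EuclideanSpace.norm_eq, Fin.sum_univ_two, Real.norm_eq_abs, sq_abs]
      rw [Real.sqrt_le_sqrt_iff ha]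
    rw [this, (PiLp.volume_preserving_toLp (Fin 2)).measure_preimage
      measurableSet_closedBall.nullMeasurableSet, hE, max_eq_left ha]
    rw [ENNReal.toReal_mul, ENNReal.toReal_pow, ENNReal.toReal_ofReal (Real.sqrt_nonneg _), Real.sq_sqrt ha]
    rw [ENNReal.toReal_ofReal Real.pi_pos.le, mul_comm]

lemma slice0 (R : ℝ) (hR : 0 ≤ R) (G : ℝ → ℝ) (hG : Continuous G) :
    ∫ x in Metric.closedBall (0:E3) R, G (x 0) = π * ∫ z in (-R)..R, (R^2 - z^2) * G z := by
  have hgi : Integrable ((Metric.closedBall (0:E3) R).indicator (fun x => G (x 0))) := by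
    rw [integrable_indicator_iff measurableSet_closedBall]
    exact ContinuousOn.integrableOn_compact (isCompact_closedBall _ _)
      (hG.comp (by fun_prop)).continuousOn
  rw [← integral_indicator measurableSet_closedBall]
  set e := (MeasurableEquiv.piFinSuccAbove (fun _ : Fin 3 => ℝ) 0).symm
  have mp : MeasurePreserving (fun q : ℝ × (Fin 2 → ℝ) => (WithLp.toLp 2 (e q) : E3)) :=
    (PiLp.volume_preserving_toLp (Fin 3)).comp (volume_preserving_piFinSuccAbove (fun _ : Fin 3 => ℝ) 0).symm
  have me : MeasurableEmbedding (fun q : ℝ × (Fin 2 → ℝ) => (WithLp.toLp 2 (e q) : E3)) :=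
    (MeasurableEquiv.toLp 2 (Fin 3 → ℝ)).measurableEmbedding.comp e.measurableEmbedding
  rw [← mp.integral_comp me]
  have hIg := (mp.integrable_comp_emb me).2 hgi
  have hval : ∀ q : ℝ × (Fin 2 → ℝ), (Metric.closedBall (0:E3) R).indicator (fun x => G (x 0)) (WithLp.toLp 2 (e q))
      = ({w : Fin 2 → ℝ | w 0 ^2 + w 1 ^2 ≤ R^2 - q.1^2}).indicator (fun _ => G q.1) q.2 := by
    rintro ⟨z, w⟩
    have e0 : e (z, w) 0 = z := rfl
    have e1 : e (z, w) 1 = w 0 := rfl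
    have e2 : e (z, w) 2 = w 1 := rfl
    have hiff : (WithLp.toLp 2 (e (z, w)) : E3) ∈ Metric.closedBall (0:E3) R ↔
        w ∈ {w : Fin 2 → ℝ | w 0 ^2 + w 1 ^2 ≤ R^2 - z^2} := by
      rw [Metric.mem_closedBall, dist_zero_right, EuclideanSpace.norm_eq, Fin.sum_univ_three,
        Real.sqrt_le_left hR]
      simp only [Real.norm_eq_abs, sq_abs, Set.mem_setOf_eq, e0, e1, e2]
      constructor <;> intro h <;> linarith
    by_cases h : w ∈ {w : Fin 2 → ℝ | w 0 ^2 + w 1 ^2 ≤ R^2 - z^2}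
    · rw [Set.indicator_of_mem h, Set.indicator_of_mem (hiff.2 h)]
      exact congrArg G e0
    · rw [Set.indicator_of_notMem h, Set.indicator_of_notMem (fun h' => h (hiff.1 h'))]
  have hIg' : Integrable (fun q : ℝ × (Fin 2 → ℝ) =>
      ({w : Fin 2 → ℝ | w 0 ^2 + w 1 ^2 ≤ R^2 - q.1^2}).indicator (fun _ => G q.1) q.2) (volume.prod volume) :=
    hIg.congr (Filter.Eventually.of_forall hval)
  calc _ = ∫ q : ℝ × (Fin 2 → ℝ), ({w : Fin 2 → ℝ | w 0 ^2 + w 1 ^2 ≤ R^2 - q.1^2}).indicator (fun _ => G q.1) q.2 ∂(volume.prod volume) :=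
        integral_congr_ae (Filter.Eventually.of_forall hval)
    _ = ∫ z : ℝ, ∫ w : Fin 2 → ℝ, ({w : Fin 2 → ℝ | w 0 ^2 + w 1 ^2 ≤ R^2 - z^2}).indicator (fun _ => G z) w :=
        integral_prod _ hIg'
    _ = ∫ z : ℝ, (Set.Ioc (-R) R).indicator (fun z => π * ((R^2 - z^2) * G z)) z := by
        apply integral_congr_ae
        have hne : ∀ᵐ z : ℝ, z ≠ -R := by
          rw [ae_iff]; simp
        filter_upwards [hne] with z hz
        have hms : MeasurableSet {w : Fin 2 → ℝ | w 0 ^2 + w 1 ^2 ≤ R^2 - z^2} :=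
          measurableSet_le (by fun_prop) (by fun_prop)
        rw [integral_indicator_const _ hms, Measure.real, disk_vol]
        by_cases h : z ∈ Set.Ioc (-R) R
        · rw [Set.indicator_of_mem h, max_eq_left]
          · simp only [smul_eq_mul]; ring
          · nlinarith [h.1, h.2]
        · rw [Set.indicator_of_notMem h, max_eq_right]
          · simp
          · have : |R| ≤ |z| := by
              rw [abs_of_nonneg hR]
              by_contra hc; push Not at hc
              have := abs_lt.1 hc
              exact h ⟨this.1, this.2.le⟩
            nlinarith [sq_le_sq.2 this]
    _ = _ := by
        rw [integral_indicator measurableSet_Ioc, intervalIntegral.integral_of_le (by linarith), integral_const_mul]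

lemma slice (R : ℝ) (hR : 0 ≤ R) (G : ℝ → ℝ) (hG : Continuous G) (v : E3) (hv : v ≠ 0) :
    ∫ x in Metric.closedBall (0:E3) R, G (inner ℝ v x) = π * ∫ z in (-R)..R, (R^2 - z^2) * G (‖v‖ * z) := by
  have hv' : ‖v‖ ≠ 0 := norm_ne_zero_iff.2 hv
  set w : Fin 3 → E3 := fun _ => ‖v‖⁻¹ • v
  have ho : Orthonormal ℝ (({0} : Set (Fin 3)).restrict w) := by
    constructor
    · rintro ⟨i, hi⟩
      change ‖‖v‖⁻¹ • v‖ = 1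
      rw [norm_smul, norm_inv, norm_norm]
      exact inv_mul_cancel₀ hv'
    · rintro ⟨i, hi⟩ ⟨j, hj⟩ hij
      exfalso; apply hij; simp only [Set.mem_singleton_iff] at hi hj; simp [hi, hj]
  obtain ⟨b, hb⟩ := ho.exists_orthonormalBasis_extension_of_card_eq (by simp)
  have hb0 : b 0 = ‖v‖⁻¹ • v := hb 0 (by simp)
  have hin : ∀ x, inner ℝ v x = ‖v‖ * (b.repr x) 0 := by
    intro x
    rw [b.repr_apply_apply, hb0, inner_smul_left]
    simp only [map_inv₀, conj_trivial]
    field_simp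
  have mp : MeasurePreserving b.repr := b.repr.measurePreserving
  have me : MeasurableEmbedding b.repr := b.repr.toMeasurableEquiv.measurableEmbedding
  have := mp.setIntegral_preimage_emb me (fun y => G (‖v‖ * y 0)) (Metric.closedBall (0:E3) R)
  rw [LinearIsometryEquiv.preimage_closedBall, map_zero] at this
  simp_rw [hin]
  rw [this]
  exact slice0 R hR (fun z => G (‖v‖ * z)) (by fun_prop)

end

noncomputable section

open Classical in
def Lset (R : ℝ) (k : Fin 3 → ℤ) : Finset (Fin 3 → ℤ) :=
  (ballF (R + znorm k)).filter (fun p => p - k ∈ ballF R ∧ p ∉ ballF R)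

lemma mem_Lset {R : ℝ} {k p : Fin 3 → ℤ} : p ∈ Lset R k ↔ p - k ∈ ballF R ∧ p ∉ ballF R := by
  classical
  simp only [Lset, Finset.mem_filter, and_iff_right_iff_imp]
  rintro ⟨h, _⟩
  rw [mem_ballF] at *
  have : zE p = zE (p - k) + zE k := by rw [← zE_add]; congr 1; abel
  rw [znorm_eq, this]
  refine (norm_add_le _ _).trans ?_
  rw [← znorm_eq, ← znorm_eq]; linarith

def lamk (k p : Fin 3 → ℤ) : ℝ := inner ℝ (zE k) (zE p) - znorm k ^ 2 / 2

lemma lamk_eq (k p : Fin 3 → ℤ) : 2 * lamk k p = znorm p ^ 2 - znorm (p - k) ^ 2 := by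
  rw [lamk, znorm_eq, znorm_eq, znorm_eq, zE_sub, norm_sub_sq_real, real_inner_comm]; ring

lemma lamk_neg (k p : Fin 3 → ℤ) : lamk (-k) (-p) = lamk k p := by
  rw [lamk, lamk, zE_neg, zE_neg, znorm_neg, inner_neg_neg]

lemma lamk_refl (k p : Fin 3 → ℤ) : lamk k (k - p) = - lamk k p := by
  rw [lamk, lamk, zE_sub, inner_sub_right, real_inner_self_eq_norm_sq, znorm_eq]; ring

lemma lamk_shift (k p : Fin 3 → ℤ) : lamk k (p + k) = lamk k p + znorm k ^ 2 := by
  rw [lamk, lamk, zE_add, inner_add_right, real_inner_self_eq_norm_sq, znorm_eq]; ring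

lemma neg_mem_Lset {R : ℝ} {k p : Fin 3 → ℤ} : -p ∈ Lset R (-k) ↔ p ∈ Lset R k := by
  rw [mem_Lset, mem_Lset, neg_mem_ballF, show -p - -k = -(p - k) by abel, neg_mem_ballF]

lemma lamk_pos {R : ℝ} {k p : Fin 3 → ℤ} (h : p ∈ Lset R k) : 0 < lamk k p := by
  obtain ⟨h1, h2⟩ := mem_Lset.1 h
  rw [mem_ballF] at h1 h2
  push Not at h2
  have h0 : 0 ≤ znorm (p - k) := Real.sqrt_nonneg _
  nlinarith [lamk_eq k p]

lemma lamk_le {R : ℝ} {k p : Fin 3 → ℤ} (h : p ∈ Lset R k) : lamk k p ≤ znorm k * R + znorm k ^ 2 / 2 := by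
  obtain ⟨h1, h2⟩ := mem_Lset.1 h
  rw [mem_ballF, znorm_eq] at h1
  have : zE p = zE (p - k) + zE k := by rw [← zE_add]; congr 1; abel
  rw [lamk, this, inner_add_right, real_inner_self_eq_norm_sq, znorm_eq]
  have := real_inner_le_norm (zE k) (zE (p - k))
  nlinarith [mul_le_mul_of_nonneg_left h1 (norm_nonneg (zE k))]

lemma Lset_tele (R : ℝ) (k : Fin 3 → ℤ) (g : ℝ → ℝ) :
    ∑ p ∈ Lset R k, (g (lamk k p) - g (- lamk k p)) =
      ∑ p ∈ ballF R, (g (lamk k p + znorm k ^ 2) - g (lamk k p)) := by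
  classical
  rw [Finset.sum_sub_distrib, Finset.sum_sub_distrib]
  set Bk := (ballF R).image (fun p => p + k) with hBk
  have hmB : ∀ p, p ∈ Bk ↔ p - k ∈ ballF R := by
    intro p
    simp only [hBk, Finset.mem_image]
    constructor
    · rintro ⟨q, hq, rfl⟩; simpa using hq
    · intro h; exact ⟨p - k, h, by abel⟩
  have e1 : ∑ p ∈ ballF R, g (lamk k p + znorm k ^ 2) = ∑ p ∈ Bk, g (lamk k p) := by
    rw [hBk, Finset.sum_image (fun a _ b _ h => by simpa using h)]
    exact Finset.sum_congr rfl fun p _ => by rw [lamk_shift]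
  have e2 : Lset R k = Bk \ ballF R := by
    ext p; rw [mem_Lset, Finset.mem_sdiff, hmB]
  have e3 : ∑ p ∈ Lset R k, g (- lamk k p) = ∑ p ∈ ballF R \ Bk, g (lamk k p) := by
    apply Finset.sum_bij' (fun p _ => k - p) (fun p _ => k - p)
    · intro p hp
      rw [mem_Lset] at hp
      rw [Finset.mem_sdiff, hmB, show k - p - k = - p by abel, neg_mem_ballF,
        show k - p = -(p - k) by abel, neg_mem_ballF]
      exact hp
    · intro p hp
      rw [Finset.mem_sdiff, hmB] at hp
      rw [mem_Lset, show k - p - k = - p by abel, neg_mem_ballF,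
        show k - p = -(p - k) by abel, neg_mem_ballF]
      exact hp
    · intros; abel
    · intros; abel
    · intro p hp; rw [lamk_refl]
  rw [e1, e3, e2, Finset.sum_sdiff_sub_sum_sdiff]

lemma abs_sub_le_of_deriv {f f' : ℝ → ℝ} {M : ℝ} (h : ∀ x, HasDerivAt f (f' x) x) (hM : ∀ x, |f' x| ≤ M)
    (x y : ℝ) : |f x - f y| ≤ M * |x - y| := by
  have := Convex.norm_image_sub_le_of_norm_hasDerivWithin_le (s := Set.univ) (f := f) (f' := f') (C := M)
    (fun x _ => (h x).hasDerivWithinAt) (fun x _ => hM x) convex_univ (Set.mem_univ y) (Set.mem_univ x)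
  simpa using this

lemma Lset_sum (R : ℝ) (hR : 2 ≤ R) (k : Fin 3 → ℤ) (hk : k ≠ 0) (f f' f'' : ℝ → ℝ) (M1 M2 : ℝ)
    (h1 : ∀ x, HasDerivAt f (f' x) x) (h2 : ∀ x, HasDerivAt f' (f'' x) x)
    (hM1 : ∀ x, |f' x| ≤ M1) (hM2 : ∀ x, |f'' x| ≤ M2) :
    |∑ p ∈ Lset R k, (f (lamk k p / (znorm k * R)) - f (-(lamk k p / (znorm k * R))))
      - 2 * π * znorm k * R^2 * ∫ y in (-1:ℝ)..1, y * f y| ≤ (70 * znorm k + 4 * znorm k ^ 2) * (M1 + M2) * R := by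
  have hv : zE k ≠ 0 := by
    intro h; apply hk; ext i
    have : zE k i = 0 := by rw [h]; rfl
    simpa [zE] using this
  have hM10 : 0 ≤ M1 := (abs_nonneg _).trans (hM1 0)
  have hM20 : 0 ≤ M2 := (abs_nonneg _).trans (hM2 0)
  set a := znorm k with ha
  have ha0 : 0 < a := by rw [ha, znorm_eq]; exact norm_pos_iff.2 hv
  have hR0 : 0 < R := by linarith
  have hcf : Continuous f := continuous_iff_continuousAt.2 fun x => (h1 x).continuousAt
  have hcf' : Continuous f' := continuous_iff_continuousAt.2 fun x => (h2 x).continuousAt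
  set G : ℝ → ℝ := fun z => f ((z + a^2/2)/(a*R)) - f ((z - a^2/2)/(a*R)) with hG
  have hGc : Continuous G := by
    simp only [hG]; fun_prop
  have lip1 := abs_sub_le_of_deriv h1 hM1
  have lip2 := abs_sub_le_of_deriv h2 hM2
  have hGM : ∀ z, |G z| ≤ M1 * (a / R) := by
    intro z
    refine (lip1 _ _).trans (le_of_eq ?_)
    congr 1
    rw [← sub_div, show z + a^2/2 - (z - a^2/2) = a^2 by ring, abs_of_nonneg (by positivity)]
    field_simp
  have hGd : ∀ z, HasDerivAt G ((f' ((z + a^2/2)/(a*R)) - f' ((z - a^2/2)/(a*R))) * (1/(a*R))) z := by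
    intro z
    have d1 : HasDerivAt (fun z : ℝ => (z + a^2/2)/(a*R)) (1/(a*R)) z :=
      ((hasDerivAt_id z).add_const _).div_const _
    have d2 : HasDerivAt (fun z : ℝ => (z - a^2/2)/(a*R)) (1/(a*R)) z :=
      ((hasDerivAt_id z).sub_const _).div_const _
    have := ((h1 _).comp z d1).sub ((h1 _).comp z d2)
    rw [← sub_mul] at this
    exact this
  have hGL : ∀ z w, |G z - G w| ≤ (M2 / R^2) * |z - w| := by
    refine abs_sub_le_of_deriv hGd ?_
    intro z
    rw [abs_mul, abs_of_nonneg (show 0 ≤ 1/(a*R) by positivity)]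
    have := lip2 ((z + a^2/2)/(a*R)) ((z - a^2/2)/(a*R))
    rw [← sub_div, show z + a^2/2 - (z - a^2/2) = a^2 by ring, abs_of_nonneg (show 0 ≤ a^2/(a*R) by positivity)] at this
    refine (mul_le_mul_of_nonneg_right this (show 0 ≤ 1/(a*R) by positivity)).trans (le_of_eq ?_)
    field_simp
  have hrie := riemann3 R hR k G (M1 * (a/R)) (M2/R^2) (by positivity) (by positivity) hGc hGM hGL
  have hsum : ∑ p ∈ Lset R k, (f (lamk k p / (a * R)) - f (-(lamk k p / (a * R)))) =
      ∑ p ∈ ballF R, G (inner ℝ (zE k) (zE p)) := by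
    have := Lset_tele R k (fun z => f (z / (a * R)))
    simp only [neg_div] at this
    rw [this]
    apply Finset.sum_congr rfl
    intro p _
    simp only [hG, lamk, ← ha]
    congr 3
    ring
  rw [slice R hR0.le G hGc (zE k) hv, ← znorm_eq, ← ha] at hrie
  have hIc : ∀ u : ℝ → ℝ, Continuous u → IntervalIntegrable u volume (-R) R := fun u hu => hu.intervalIntegrable _ _
  -- main term
  have hmain : ∫ z in (-R)..R, (R^2 - z^2) * ((a/R) * f' (z/R)) = 2 * a * R^2 * ∫ y in (-1:ℝ)..1, y * f y := by
    have ibp := intervalIntegral.integral_mul_deriv_eq_deriv_mul (a := -R) (b := R)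
      (u := fun z => R^2 - z^2) (u' := fun z => -(2*z)) (v := fun z => a * f (z/R)) (v' := fun z => (a/R) * f' (z/R))
      (fun z _ => by
        have := (hasDerivAt_pow 2 z).const_sub (R^2)
        simpa using this)
      (fun z _ => by
        have d1 : HasDerivAt (fun z : ℝ => z/R) (1/R) z := (hasDerivAt_id z).div_const _
        have := (((h1 _).comp z d1).const_mul a)
        have e : a * (f' (z/R) * (1/R)) = (a/R) * f' (z/R) := by ring
        rw [e] at this
        exact this)
      (hIc _ (by fun_prop)) (hIc _ (by fun_prop))
    rw [ibp]
    have := intervalIntegral.integral_comp_div (a := -R) (b := R) (fun y => y * f y) hR0.ne'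
    rw [show -R/R = -1 by field_simp, div_self hR0.ne'] at this
    have e : (fun z => -(2*z) * (a * f (z/R))) = fun z => (-(2 * a * R)) * (z/R * f (z/R)) := by
      ext z; field_simp
    rw [e, intervalIntegral.integral_const_mul, this]
    simp only [smul_eq_mul]
    ring
  have hdiff : |∫ z in (-R)..R, (R^2 - z^2) * G (a*z) - (R^2 - z^2) * ((a/R) * f' (z/R))| ≤ a^2 * R * M2 := by
    have hb : ∀ z ∈ Set.uIoc (-R) R, ‖(R^2 - z^2) * G (a*z) - (R^2 - z^2) * ((a/R) * f' (z/R))‖ ≤ a^2/2 * M2 := by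
      intro z hz
      rw [Set.uIoc_of_le (by linarith)] at hz
      set δ := a/(2*R) with hδ
      have hδ0 : 0 ≤ δ := by positivity
      have hd : |f (z/R+δ) - f (z/R-δ) - 2*δ*f' (z/R)| ≤ 2 * M2 * δ^2 := by
        have hder : ∀ t : ℝ, HasDerivAt (fun t => f (z/R+t) - f (z/R-t) - 2*t*f' (z/R))
            (f' (z/R+t) + f' (z/R-t) - 2 * f' (z/R)) t := by
          intro t
          have d1 : HasDerivAt (fun t : ℝ => z/R+t) 1 t := (hasDerivAt_id t).const_add _
          have d2 : HasDerivAt (fun t : ℝ => z/R-t) (-1) t := (hasDerivAt_id t).const_sub _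
          have d3 : HasDerivAt (fun t : ℝ => 2*t*f' (z/R)) (2 * 1 * f' (z/R)) t :=
            ((hasDerivAt_id t).const_mul 2).mul_const _
          have := (((h1 _).comp t d1).sub ((h1 _).comp t d2)).sub d3
          have e : f' (z/R+t) * 1 - f' (z/R-t) * (-1) - 2 * 1 * f' (z/R) = f' (z/R+t) + f' (z/R-t) - 2 * f' (z/R) := by ring
          rw [e] at this
          exact this
        have := Convex.norm_image_sub_le_of_norm_hasDerivWithin_le (s := Set.Icc 0 δ)
          (f := fun t => f (z/R+t) - f (z/R-t) - 2*t*f' (z/R)) (C := 2 * M2 * δ)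
          (fun t _ => (hder t).hasDerivWithinAt) (fun t ht => by
            have q1 := lip2 (z/R+t) (z/R)
            have q2 := lip2 (z/R-t) (z/R)
            rw [show z/R+t-z/R = t by ring, abs_of_nonneg ht.1] at q1
            rw [show z/R-t-z/R = -t by ring, abs_neg, abs_of_nonneg ht.1] at q2
            have q3 : M2 * t ≤ M2 * δ := mul_le_mul_of_nonneg_left ht.2 hM20
            rw [Real.norm_eq_abs]
            have : f' (z/R+t) + f' (z/R-t) - 2 * f' (z/R) = (f' (z/R+t) - f' (z/R)) + (f' (z/R-t) - f' (z/R)) := by ring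
            rw [this]
            refine (abs_add_le _ _).trans ?_
            linarith) (convex_Icc 0 δ) (Set.left_mem_Icc.2 hδ0) (Set.right_mem_Icc.2 hδ0)
        simp only [add_zero, sub_zero, mul_zero, zero_mul, sub_self, Real.norm_eq_abs, abs_of_nonneg hδ0] at this
        refine this.trans (le_of_eq (by ring))
      have hGz : G (a*z) = f (z/R+δ) - f (z/R-δ) := by
        simp only [hG, hδ]
        congr 2 <;> field_simp
      have hdd : a/R = 2*δ := by rw [hδ]; field_simp
      rw [hGz, hdd, ← mul_sub, norm_mul, Real.norm_eq_abs, Real.norm_eq_abs]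
      have hz2 : |R^2 - z^2| ≤ R^2 := by
        rw [abs_le]; constructor <;> nlinarith [hz.1, hz.2]
      calc _ ≤ R^2 * (2 * M2 * δ^2) := mul_le_mul hz2 hd (abs_nonneg _) (by positivity)
        _ = _ := by rw [hδ]; field_simp
    have := intervalIntegral.norm_integral_le_of_norm_le_const hb
    rw [Real.norm_eq_abs, show R - -R = 2*R by ring, abs_of_nonneg (by positivity : 0 ≤ 2*R)] at this
    refine this.trans (le_of_eq (by ring))
  rw [intervalIntegral.integral_sub (hIc _ (by fun_prop)) (hIc _ (by fun_prop)), hmain] at hdiff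
  rw [hsum]
  set S1 := ∑ p ∈ ballF R, G (inner ℝ (zE k) (zE p))
  set I1 := ∫ z in (-R)..R, (R^2 - z^2) * G (a*z)
  set I0 := ∫ y in (-1:ℝ)..1, y * f y
  have e1 : 70 * (M1 * (a/R) * R^2 + a * (M2/R^2) * R^3) = 70 * a * (M1 + M2) * R := by
    field_simp
  rw [e1] at hrie
  have hpi : π ≤ 4 := Real.pi_le_four
  have h3 : |π * I1 - 2*π*a*R^2*I0| ≤ 4 * (a^2*R*M2) := by
    have : π * I1 - 2*π*a*R^2*I0 = π * (I1 - 2*a*R^2*I0) := by ring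
    rw [this, abs_mul, abs_of_pos Real.pi_pos]
    exact mul_le_mul hpi hdiff (abs_nonneg _) (by norm_num)
  have h4 := abs_add_le (S1 - π * I1) (π * I1 - 2*π*a*R^2*I0)
  rw [show S1 - π * I1 + (π * I1 - 2*π*a*R^2*I0) = S1 - 2*π*a*R^2*I0 by ring] at h4
  have h5 : 0 ≤ a^2 * R * M1 := by positivity
  nlinarith
end

noncomputable section

lemma N_asym (R : ℝ) (hR : 2 ≤ R) : |(numParticles R : ℝ) - 4/3*π*R^3| ≤ 70 * R^2 := by
  have := riemann3 R hR 0 (fun _ => 1) 1 0 (by norm_num) (by norm_num) continuous_const (by simp) (by simp)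
  simp only [Finset.sum_const, nsmul_eq_mul, mul_one, integral_const, mul_zero, zero_mul, add_zero, one_mul,
    smul_eq_mul, card_ballF] at this
  rw [Measure.real, Measure.restrict_apply_univ, ball3_vol R (by linarith)] at this
  exact this

lemma Lset_card (R : ℝ) (k : Fin 3 → ℤ) (hR : 2 ≤ R) (hRk : znorm k ≤ R) :
    ((Lset R k).card : ℝ) ≤ (30 * znorm k + 350) * R^2 := by
  classical
  have h0 : 0 ≤ znorm k := Real.sqrt_nonneg _
  have hsub : Lset R k ⊆ ballF (R + znorm k) \ ballF R := by
    intro p hp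
    rw [Finset.mem_sdiff]
    exact ⟨(Finset.mem_filter.1 hp).1, (mem_Lset.1 hp).2⟩
  have hss : ballF R ⊆ ballF (R + znorm k) := by
    intro p hp; rw [mem_ballF] at *; linarith
  have h1 := Finset.card_le_card hsub
  have h2 := Finset.card_sdiff_add_card_eq_card hss
  rw [card_ballF, card_ballF] at h2
  have h3 : ((Lset R k).card : ℝ) + numParticles R ≤ numParticles (R + znorm k) := by
    exact_mod_cast (by omega)
  have a1 := (abs_le.1 (N_asym R hR)).1
  have a2 := (abs_le.1 (N_asym (R + znorm k) (by linarith))).2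
  have hpi := Real.pi_lt_d2
  have e1 : 4/3*π*(R+znorm k)^3 - 4/3*π*R^3 ≤ 30 * znorm k * R^2 := by
    have : (R+znorm k)^3 - R^3 ≤ 7 * znorm k * R^2 := by
      nlinarith [mul_nonneg h0 (mul_nonneg (sub_nonneg.2 hRk) (by linarith : 0 ≤ R)),
        mul_nonneg (mul_nonneg h0 h0) (sub_nonneg.2 hRk), mul_nonneg h0 (mul_nonneg (sub_nonneg.2 hRk) h0)]
    have h7 : 0 ≤ 7 * znorm k * R^2 := by positivity
    nlinarith [Real.pi_pos]
  have e2 : (R+znorm k)^2 ≤ 4 * R^2 := by nlinarith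
  nlinarith

/-- The function `y/(y²+σ²)`. -/
def Fs (σ y : ℝ) : ℝ := y / (y^2 + σ^2)

lemma Fs_odd (σ y : ℝ) : Fs σ (-y) = - Fs σ y := by simp [Fs, neg_div]

lemma Fs_d1 {σ : ℝ} (hσ : 0 < σ) (y : ℝ) : HasDerivAt (Fs σ) ((σ^2 - y^2)/(y^2+σ^2)^2) y := by
  have hne : y^2 + σ^2 ≠ 0 := by positivity
  have h := (hasDerivAt_id y).div (((hasDerivAt_pow 2 y).add_const (σ^2))) hne
  have e : (1 * (y^2+σ^2) - id y * (((2:ℕ):ℝ) * y^(2-1)))/(y^2+σ^2)^2 = (σ^2 - y^2)/(y^2+σ^2)^2 := by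
    congr 1; simp; ring
  rw [e] at h
  exact h

lemma Fs_d2 {σ : ℝ} (hσ : 0 < σ) (y : ℝ) :
    HasDerivAt (fun y => (σ^2 - y^2)/(y^2+σ^2)^2) (2*y*(y^2-3*σ^2)/(y^2+σ^2)^3) y := by
  have hne : (y^2 + σ^2)^2 ≠ 0 := by positivity
  have hne' : (y^2 + σ^2) ≠ 0 := by positivity
  have h := ((hasDerivAt_pow 2 y).const_sub (σ^2)).div (((hasDerivAt_pow 2 y).add_const (σ^2)).pow 2) hne
  refine h.congr_deriv ?_
  simp
  field_simp
  ring

lemma Fs_b1 {σ : ℝ} (hσ : 0 < σ) (y : ℝ) : |(σ^2 - y^2)/(y^2+σ^2)^2| ≤ 1/σ^2 := by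
  rw [abs_div, abs_of_pos (show 0 < (y^2+σ^2)^2 by positivity), div_le_div_iff₀ (by positivity) (by positivity)]
  have : |σ^2 - y^2| ≤ y^2 + σ^2 := by rw [abs_le]; constructor <;> nlinarith [sq_nonneg y, sq_nonneg σ]
  have h2 : |σ^2 - y^2| * σ^2 ≤ (y^2 + σ^2) * (y^2+σ^2) := by
    apply mul_le_mul this _ (by positivity) (by positivity); nlinarith [sq_nonneg y]
  linarith

lemma Fs_b2 {σ : ℝ} (hσ : 0 < σ) (y : ℝ) : |2*y*(y^2-3*σ^2)/(y^2+σ^2)^3| ≤ 6/σ^3 := by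
  rw [abs_div, abs_of_pos (show 0 < (y^2+σ^2)^3 by positivity), div_le_div_iff₀ (by positivity) (by positivity)]
  have h1 : |y^2 - 3*σ^2| ≤ 3 * (y^2 + σ^2) := by rw [abs_le]; constructor <;> nlinarith [sq_nonneg y, sq_nonneg σ]
  have h2 : |2 * y| * σ ≤ y^2 + σ^2 := by
    rw [abs_mul, abs_two, ← sq_abs y]; nlinarith [sq_nonneg (|y| - σ)]
  have h3 : σ^2 ≤ y^2+σ^2 := by nlinarith [sq_nonneg y]
  rw [abs_mul]
  calc |2*y| * |y^2-3*σ^2| * σ^3 = (|2*y| * σ) * |y^2-3*σ^2| * σ^2 := by ring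
    _ ≤ (y^2+σ^2) * (3 * (y^2 + σ^2)) * (y^2+σ^2) := by gcongr
    _ ≤ _ := by nlinarith [show 0 ≤ (y^2+σ^2)^3 by positivity]

/-- `1 - σ arctan (1/σ)`. -/
def wf (σ : ℝ) : ℝ := 1 - σ * Real.arctan (1/σ)

lemma Fs_int {σ : ℝ} (hσ : 0 < σ) : ∫ y in (-1:ℝ)..1, y * Fs σ y = 2 * wf σ := by
  have hder : ∀ y : ℝ, HasDerivAt (fun y => y - σ * Real.arctan (y/σ)) (y * Fs σ y) y := by
    intro y
    have d1 : HasDerivAt (fun y : ℝ => y/σ) (1/σ) y := (hasDerivAt_id y).div_const _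
    have h := (hasDerivAt_id y).sub (((Real.hasDerivAt_arctan (y/σ)).comp y d1).const_mul σ)
    refine h.congr_deriv ?_
    unfold Fs
    have : y^2+σ^2 ≠ 0 := by positivity
    have : 1 + (y/σ)^2 ≠ 0 := by positivity
    field_simp
    ring
  rw [intervalIntegral.integral_eq_sub_of_hasDerivAt (fun y _ => hder y)]
  · rw [neg_div, Real.arctan_neg, wf]; ring
  · apply Continuous.intervalIntegrable
    unfold Fs
    have : ∀ y : ℝ, y^2+σ^2 ≠ 0 := fun y => by positivity
    fun_prop (disch := assumption)

def xk (R : ℝ) (k p : Fin 3 → ℤ) : ℝ := lamk k p / (znorm k * R)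

lemma znorm_pos {k : Fin 3 → ℤ} (hk : k ≠ 0) : 0 < znorm k := by
  rw [znorm_eq]; apply norm_pos_iff.2
  intro h; apply hk; ext i
  have : zE k i = 0 := by rw [h]; rfl
  simpa [zE] using this

lemma xk_pos {R : ℝ} (hR : 2 ≤ R) {k p : Fin 3 → ℤ} (hk : k ≠ 0) (hp : p ∈ Lset R k) : 0 < xk R k p :=
  div_pos (lamk_pos hp) (mul_pos (znorm_pos hk) (by linarith))

lemma sum_Fs (R : ℝ) (hR : 2 ≤ R) (k : Fin 3 → ℤ) (hk : k ≠ 0) {σ : ℝ} (hσ : 0 < σ) :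
    ∑ p ∈ Lset R k, Fs σ (xk R k p) ≤ 2 * π * znorm k * R^2 * wf σ
      + (35 * znorm k + 2 * znorm k ^ 2) * (1/σ^2 + 6/σ^3) * R := by
  have h := Lset_sum R hR k hk (Fs σ) _ _ _ _ (Fs_d1 hσ) (Fs_d2 hσ) (Fs_b1 hσ) (Fs_b2 hσ)
  rw [Fs_int hσ] at h
  have e : ∑ p ∈ Lset R k, (Fs σ (lamk k p / (znorm k * R)) - Fs σ (-(lamk k p / (znorm k * R)))) =
      2 * ∑ p ∈ Lset R k, Fs σ (xk R k p) := by
    rw [Finset.mul_sum]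
    apply Finset.sum_congr rfl
    intro p _
    rw [Fs_odd, xk]; ring
  rw [e] at h
  have := (abs_le.1 h).2
  linarith

/-- odd minorant -/
def mf (θ y : ℝ) : ℝ := 2/π * Real.arctan (y/θ) - 2*θ*Fs θ y

lemma mf_odd (θ y : ℝ) : mf θ (-y) = - mf θ y := by
  rw [mf, mf, Fs_odd, neg_div, Real.arctan_neg]; ring

lemma mf_d1 {θ : ℝ} (hθ : 0 < θ) (y : ℝ) : HasDerivAt (mf θ)
    (2/π * (θ/(y^2+θ^2)) - 2*θ*((θ^2 - y^2)/(y^2+θ^2)^2)) y := by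
  have d1 : HasDerivAt (fun y : ℝ => y/θ) (1/θ) y := (hasDerivAt_id y).div_const _
  have h := (((Real.hasDerivAt_arctan (y/θ)).comp y d1).const_mul (2/π)).sub ((Fs_d1 hθ y).const_mul (2*θ))
  refine h.congr_deriv ?_
  congr 2
  have : y^2+θ^2 ≠ 0 := by positivity
  have : 1 + (y/θ)^2 ≠ 0 := by positivity
  field_simp
  ring

lemma mf_d2 {θ : ℝ} (hθ : 0 < θ) (y : ℝ) : HasDerivAt
    (fun y => 2/π * (θ/(y^2+θ^2)) - 2*θ*((θ^2 - y^2)/(y^2+θ^2)^2))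
    (2/π * (-(2*θ*y)/(y^2+θ^2)^2) - 2*θ*(2*y*(y^2-3*θ^2)/(y^2+θ^2)^3)) y := by
  have hne : y^2 + θ^2 ≠ 0 := by positivity
  have h1 : HasDerivAt (fun y => θ/(y^2+θ^2)) (-(2*θ*y)/(y^2+θ^2)^2) y := by
    have h := (hasDerivAt_const y θ).div (((hasDerivAt_pow 2 y).add_const (θ^2))) hne
    refine h.congr_deriv ?_
    congr 1; simp; ring
  exact (h1.const_mul (2/π)).sub ((Fs_d2 hθ y).const_mul (2*θ))

lemma two_div_pi_le : 2/π ≤ 1 := by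
  rw [div_le_one Real.pi_pos]; linarith [Real.pi_gt_three]

lemma mf_b1 {θ : ℝ} (hθ : 0 < θ) (y : ℝ) : |2/π * (θ/(y^2+θ^2)) - 2*θ*((θ^2 - y^2)/(y^2+θ^2)^2)| ≤ 3/θ := by
  refine (abs_sub _ _).trans ?_
  rw [abs_mul, abs_mul, abs_of_pos (show 0 < 2/π by positivity), abs_of_pos (show 0 < θ/(y^2+θ^2) by positivity),
    abs_of_pos (show 0 < 2*θ by positivity)]
  have h1 : θ/(y^2+θ^2) ≤ 1/θ := by
    rw [div_le_div_iff₀ (by positivity) hθ]; nlinarith [sq_nonneg y]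
  have h2 := mul_le_mul_of_nonneg_left (Fs_b1 hθ y) (show 0 ≤ 2*θ by positivity)
  have h3 : 2/π * (θ/(y^2+θ^2)) ≤ 1 * (1/θ) := mul_le_mul two_div_pi_le h1 (by positivity) (by norm_num)
  have e : 2*θ*(1/θ^2) = 2/θ := by field_simp
  rw [e] at h2
  have : 3/θ = 1*(1/θ) + 2/θ := by ring
  linarith

lemma mf_b2 {θ : ℝ} (hθ : 0 < θ) (y : ℝ) :
    |2/π * (-(2*θ*y)/(y^2+θ^2)^2) - 2*θ*(2*y*(y^2-3*θ^2)/(y^2+θ^2)^3)| ≤ 13/θ^2 := by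
  refine (abs_sub _ _).trans ?_
  rw [abs_mul, abs_mul (2*θ), abs_of_pos (show 0 < 2/π by positivity), 
    abs_of_pos (show 0 < 2*θ by positivity)]
  have h1 : |-(2*θ*y)/(y^2+θ^2)^2| ≤ 1/θ^2 := by
    rw [abs_div, abs_of_pos (show 0 < (y^2+θ^2)^2 by positivity), div_le_div_iff₀ (by positivity) (by positivity),
      abs_neg]
    have q1 : |2*θ*y| ≤ y^2+θ^2 := by rw [abs_le]; constructor <;> nlinarith [sq_nonneg (θ-y), sq_nonneg (θ+y)]
    have : |2*θ*y| * θ^2 ≤ (y^2+θ^2)*(y^2+θ^2) := mul_le_mul q1 (by nlinarith [sq_nonneg y]) (by positivity) (by positivity)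
    linarith
  have h2 := mul_le_mul_of_nonneg_left (Fs_b2 hθ y) (show 0 ≤ 2*θ by positivity)
  have h3 := mul_le_mul two_div_pi_le h1 (by positivity) (by norm_num)
  have e : 2*θ*(6/θ^3) = 12/θ^2 := by field_simp; norm_num
  rw [e] at h2
  have : 13/θ^2 = 1*(1/θ^2) + 12/θ^2 := by ring
  linarith

lemma arctan_le_self' {u : ℝ} (hu : 0 ≤ u) : Real.arctan u ≤ u := by
  have h := Real.le_tan (Real.arctan_nonneg.2 hu) (Real.arctan_lt_pi_div_two u)
  rwa [Real.tan_arctan] at h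

lemma mf_le_one {θ y : ℝ} (hθ : 0 < θ) (hy : 0 < y) : mf θ y ≤ 1 := by
  have h1 := (Real.arctan_lt_pi_div_two (y/θ)).le
  have h2 : 0 ≤ 2*θ*Fs θ y := by unfold Fs; positivity
  have h3 : 2/π * Real.arctan (y/θ) ≤ 2/π * (π/2) := mul_le_mul_of_nonneg_left h1 (by positivity)
  have e : 2/π*(π/2) = 1 := by have := Real.pi_pos; field_simp
  unfold mf; linarith

lemma mf_le_zero {θ y : ℝ} (hθ : 0 < θ) (hy : 0 < y) (hyθ : y < θ) : mf θ y ≤ 0 := by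
  have h1 := arctan_le_self' (show 0 ≤ y/θ by positivity)
  have h3 : 2/π * Real.arctan (y/θ) ≤ 1 * (y/θ) :=
    mul_le_mul two_div_pi_le h1 (Real.arctan_nonneg.2 (by positivity)) (by norm_num)
  have h2 : y/θ ≤ 2*θ*Fs θ y := by
    unfold Fs
    rw [← mul_div_assoc, div_le_div_iff₀ hθ (by positivity)]
    nlinarith [mul_pos hy (mul_pos (sub_pos.2 hyθ) (add_pos hy hθ))]
  unfold mf; linarith

lemma mf_int {θ : ℝ} (hθ : 0 < θ) : 1 - 6*θ ≤ ∫ y in (-1:ℝ)..1, y * mf θ y := by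
  have hF : Continuous (Fs θ) := continuous_iff_continuousAt.2 fun y => (Fs_d1 hθ y).continuousAt
  have hm : Continuous (mf θ) := continuous_iff_continuousAt.2 fun y => (mf_d1 hθ y).continuousAt
  have hlow : ∀ y : ℝ, |y| - 3*θ ≤ y * mf θ y := by
    have hpos : ∀ y : ℝ, 0 < y → y - 3*θ ≤ y * mf θ y := by
      intro y hy
      have h1 : π/2 - θ/y ≤ Real.arctan (y/θ) := by
        have := Real.arctan_inv_of_pos (show 0 < y/θ by positivity)
        have h2 := arctan_le_self' (show 0 ≤ (y/θ)⁻¹ by positivity)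
        rw [inv_div] at this h2
        linarith
      have h2 : 2/π * (π/2 - θ/y) ≤ 2/π * Real.arctan (y/θ) := mul_le_mul_of_nonneg_left h1 (by positivity)
      have h3 : y * Fs θ y ≤ 1 := by
        unfold Fs; rw [← mul_div_assoc, div_le_one (by positivity)]; nlinarith [sq_nonneg θ]
      have h4 : y * (2/π * (π/2 - θ/y)) = y - 2/π*θ := by
        have := Real.pi_pos; field_simp
      have h5 := mul_le_mul_of_nonneg_left h2 hy.le
      have h6 : 2/π*θ ≤ 1 * θ := mul_le_mul_of_nonneg_right two_div_pi_le hθ.le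
      have h7 := mul_le_mul_of_nonneg_left h3 (show 0 ≤ 2*θ by positivity)
      unfold mf
      nlinarith
    intro y
    rcases lt_trichotomy y 0 with h | h | h
    · have := hpos (-y) (by linarith)
      rw [mf_odd] at this
      rw [abs_of_neg h]; linarith
    · subst h; simp; exact hθ.le
    · rw [abs_of_pos h]; exact hpos y h
  have hmono := intervalIntegral.integral_mono_on (a := -1) (b := 1) (μ := volume) (by norm_num)
    (Continuous.intervalIntegrable (by fun_prop) _ _) (Continuous.intervalIntegrable (by fun_prop) _ _)
    (f := fun y => |y| - 3*θ) (g := fun y => y * mf θ y) (fun y _ => hlow y)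
  have hval : ∫ y in (-1:ℝ)..1, (|y| - 3*θ) = 1 - 6*θ := by
    rw [intervalIntegral.integral_sub (Continuous.intervalIntegrable (by fun_prop) _ _) (by simp)]
    have : ∫ y in (-1:ℝ)..1, |y| = 1 := by
      rw [← intervalIntegral.integral_add_adjacent_intervals (b := 0) (Continuous.intervalIntegrable (by fun_prop) _ _) (Continuous.intervalIntegrable (by fun_prop) _ _)]
      have e1 : ∫ y in (-1:ℝ)..0, |y| = ∫ y in (-1:ℝ)..0, -y := by
        apply intervalIntegral.integral_congr
        intro y hy
        rw [Set.uIcc_of_le (by norm_num)] at hy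
        exact abs_of_nonpos hy.2
      have e2 : ∫ y in (0:ℝ)..1, |y| = ∫ y in (0:ℝ)..1, y := by
        apply intervalIntegral.integral_congr
        intro y hy
        rw [Set.uIcc_of_le (by norm_num)] at hy
        exact abs_of_nonneg hy.1
      rw [e1, e2, intervalIntegral.integral_neg, integral_id, integral_id]; norm_num
    rw [this]; simp; ring
  rw [hval] at hmono
  exact hmono

open Classical in
def cutk (R : ℝ) (k : Fin 3 → ℤ) (θ : ℝ) : Finset (Fin 3 → ℤ) := (Lset R k).filter (fun p => θ ≤ xk R k p)

lemma cutk_card (R : ℝ) (hR : 2 ≤ R) (k : Fin 3 → ℤ) (hk : k ≠ 0) {θ : ℝ} (hθ : 0 < θ) (hθ1 : θ ≤ 1) :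
    π * znorm k * R^2 * (1 - 6*θ) - (35 * znorm k + 2 * znorm k ^ 2) * (16/θ^2) * R ≤ ((cutk R k θ).card : ℝ) := by
  classical
  have ha := znorm_pos hk
  have hpi := Real.pi_pos
  have h := Lset_sum R hR k hk (mf θ) _ _ _ _ (mf_d1 hθ) (mf_d2 hθ) (mf_b1 hθ) (mf_b2 hθ)
  have e : ∑ p ∈ Lset R k, (mf θ (lamk k p / (znorm k * R)) - mf θ (-(lamk k p / (znorm k * R)))) =
      2 * ∑ p ∈ Lset R k, mf θ (xk R k p) := by
    rw [Finset.mul_sum]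
    apply Finset.sum_congr rfl
    intro p _
    rw [mf_odd, xk]; ring
  rw [e] at h
  have h1 := (abs_le.1 h).1
  have h2 := mul_le_mul_of_nonneg_left (mf_int hθ) (show 0 ≤ 2*π*znorm k*R^2 by positivity)
  have h3 : 3/θ + 13/θ^2 ≤ 16/θ^2 := by
    have : 3/θ ≤ 3/θ^2 := by
      apply div_le_div_of_nonneg_left (by norm_num) (by positivity)
      nlinarith
    have e : 16/θ^2 = 3/θ^2 + 13/θ^2 := by ring
    linarith
  have h4 : (70 * znorm k + 4 * znorm k^2) * (3/θ + 13/θ^2) * R ≤ (70 * znorm k + 4 * znorm k^2) * (16/θ^2) * R := by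
    gcongr
  have h5 : ∑ p ∈ Lset R k, mf θ (xk R k p) ≤ ((cutk R k θ).card : ℝ) := by
    rw [cutk, Finset.card_filter]
    push_cast
    apply Finset.sum_le_sum
    intro p hp
    have hx := xk_pos hR hk hp
    split_ifs with hc
    · exact mf_le_one hθ hx
    · exact mf_le_zero hθ hx (not_le.1 hc)
  linarith

lemma wf_le {σ : ℝ} (hσ : 0 < σ) : wf σ ≤ 1/(1+σ^2) := by
  have key : ∀ u : ℝ, 0 ≤ u → u/(1+u^2) ≤ Real.arctan u := by
    intro u hu
    have hmono : MonotoneOn (fun u => Real.arctan u - u/(1+u^2)) (Set.Ici 0) := by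
      have hd : ∀ u : ℝ, HasDerivAt (fun u => Real.arctan u - u/(1+u^2)) (2*u^2/(1+u^2)^2) u := by
        intro u
        have hne : 1 + u^2 ≠ 0 := by positivity
        have := (Real.hasDerivAt_arctan u).sub ((hasDerivAt_id u).div ((hasDerivAt_pow 2 u).const_add 1) hne)
        refine this.congr_deriv ?_
        simp
        field_simp
        ring
      refine monotoneOn_of_hasDerivWithinAt_nonneg (convex_Ici 0) (fun x _ => (hd x).continuousAt.continuousWithinAt)
        (fun x _ => (hd x).hasDerivWithinAt) (fun x _ => by positivity)
    have := hmono (Set.self_mem_Ici) hu hu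
    simp at this
    linarith
  have := mul_le_mul_of_nonneg_left (key (1/σ) (by positivity)) hσ.le
  have e : σ * (1/σ/(1+(1/σ)^2)) = 1 - 1/(1+σ^2) := by
    field_simp; ring
  rw [e] at this
  unfold wf; linarith

lemma wf_nonneg {σ : ℝ} (hσ : 0 < σ) : 0 ≤ wf σ := by
  have := mul_le_mul_of_nonneg_left (arctan_le_self' (show 0 ≤ 1/σ by positivity)) hσ.le
  have e : σ * (1/σ) = 1 := by field_simp
  rw [e] at this; unfold wf; linarith

lemma cut_inv (R : ℝ) (hR : 2 ≤ R) (k : Fin 3 → ℤ) (hk : k ≠ 0) {θ : ℝ} (hθ : 0 < θ) (hθ1 : θ ≤ 1) (hθR : 1 ≤ R * θ^3) :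
    ∑ p ∈ cutk R k θ, 1 / xk R k p ≤ (510 * znorm k + 28 * znorm k ^ 2) * R^2 := by
  classical
  have ha := znorm_pos hk
  have h1 : ∑ p ∈ cutk R k θ, 1 / xk R k p ≤ ∑ p ∈ Lset R k, 2 * Fs θ (xk R k p) := by
    refine (Finset.sum_le_sum (fun p hp => ?_)).trans
      (Finset.sum_le_sum_of_subset_of_nonneg (Finset.filter_subset _ _) (fun p hp _ => ?_))
    · have hp := Finset.mem_filter.1 hp
      have hx := xk_pos hR hk hp.1
      unfold Fs
      rw [← mul_div_assoc, div_le_div_iff₀ hx (by positivity)]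
      nlinarith [hp.2]
    · have hx := xk_pos hR hk hp
      unfold Fs; positivity
  rw [← Finset.mul_sum] at h1
  have h2 := sum_Fs R hR k hk hθ
  have h3 : wf θ ≤ 1 := (wf_le hθ).trans (by rw [div_le_one (by positivity)]; nlinarith)
  have h4 : 1/θ^2 + 6/θ^3 ≤ 7 * R := by
    have q : 1/θ^3 ≤ R := by rw [div_le_iff₀ (by positivity)]; exact hθR
    have q2 : 1/θ^2 ≤ 1/θ^3 := by
      apply div_le_div_of_nonneg_left (by norm_num) (by positivity)
      nlinarith [sq_nonneg θ]
    have : 6/θ^3 = 6 * (1/θ^3) := by ring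
    linarith
  have hpi := Real.pi_le_four
  have h5 : 2 * π * znorm k * R^2 * wf θ ≤ 2 * 4 * znorm k * R^2 * 1 := by
    apply mul_le_mul _ h3 (wf_nonneg hθ) (by positivity)
    gcongr
  have h6 : (35 * znorm k + 2 * znorm k^2) * (1/θ^2 + 6/θ^3) * R ≤ (35 * znorm k + 2 * znorm k^2) * (7*R) * R := by
    gcongr
  have : 0 ≤ znorm k * R^2 := by positivity
  nlinarith
end

noncomputable section

def nR (R : ℝ) : ℝ := (numParticles R : ℝ)
def hb (R : ℝ) : ℝ := (nR R ^ ((1:ℝ)/3))⁻¹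
def th (R : ℝ) : ℝ := nR R ^ (-(1:ℝ)/27)

lemma nR_lo {R : ℝ} (hR : 100 ≤ R) : 3 * R^3 ≤ nR R := by
  have := (abs_le.1 (N_asym R (by linarith))).1
  have hpi := Real.pi_gt_three
  have : 70 * R^2 ≤ R^3 := by nlinarith [sq_nonneg R]
  have h3 : 0 ≤ R^3 := by positivity
  unfold nR; nlinarith

lemma nR_hi {R : ℝ} (hR : 100 ≤ R) : nR R ≤ 6 * R^3 := by
  have := (abs_le.1 (N_asym R (by linarith))).2
  have hpi := Real.pi_lt_d2
  have : 70 * R^2 ≤ R^3 := by nlinarith [sq_nonneg R]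
  have h3 : 0 ≤ R^3 := by positivity
  unfold nR; nlinarith

lemma nR_pos {R : ℝ} (hR : 100 ≤ R) : 0 < nR R :=
  lt_of_lt_of_le (by positivity) (nR_lo hR)

lemma hb_pos {R : ℝ} (hR : 100 ≤ R) : 0 < hb R := by
  have := nR_pos hR
  unfold hb; positivity

lemma hb_cube {R : ℝ} (hR : 100 ≤ R) : hb R ^ 3 * nR R = 1 := by
  have := nR_pos hR
  unfold hb
  rw [inv_pow, ← Real.rpow_natCast, ← Real.rpow_mul this.le]
  norm_num
  exact inv_mul_cancel₀ this.ne'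

lemma th_pos {R : ℝ} (hR : 100 ≤ R) : 0 < th R := by
  have := nR_pos hR
  unfold th; positivity

lemma th_pow {R : ℝ} (hR : 100 ≤ R) : th R ^ 9 = hb R := by
  have := nR_pos hR
  unfold hb th
  rw [← Real.rpow_natCast, ← Real.rpow_mul this.le, ← Real.rpow_neg this.le]
  norm_num

lemma hbR_hi {R : ℝ} (hR : 100 ≤ R) : hb R * R ≤ 1 := by
  have h1 := hb_cube hR
  have h2 := nR_lo hR
  have h3 := hb_pos hR
  have h4 : (hb R * R)^3 ≤ 1^3 := by
    have : hb R ^3 * (3 * R^3) ≤ hb R ^3 * nR R := mul_le_mul_of_nonneg_left h2 (by positivity)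
    have h5 : 0 ≤ hb R ^3 * R^3 := by positivity
    nlinarith
  exact le_of_pow_le_pow_left₀ (by norm_num) (by norm_num) h4

lemma hbR_lo {R : ℝ} (hR : 100 ≤ R) : 1/2 ≤ hb R * R := by
  have h1 := hb_cube hR
  have h2 := nR_hi hR
  have h3 := hb_pos hR
  have h4 : (1/2)^3 ≤ (hb R * R)^3 := by
    have : hb R ^3 * nR R ≤ hb R ^3 * (6 * R^3) := mul_le_mul_of_nonneg_left h2 (by positivity)
    nlinarith
  exact le_of_pow_le_pow_left₀ (by norm_num) (by positivity) h4

lemma inv_R_le {R : ℝ} (hR : 100 ≤ R) : 1/R ≤ 2 * hb R := by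
  have := hbR_lo hR
  rw [div_le_iff₀ (by linarith)]; linarith

lemma hb_le {R : ℝ} (hR : 100 ≤ R) : hb R ≤ 1/100 := by
  have := hbR_hi hR
  have := hb_pos hR
  nlinarith

lemma th_le_one {R : ℝ} (hR : 100 ≤ R) : th R ≤ 1 := by
  have h := th_pow hR
  have h2 := hb_le hR
  by_contra hc; push Not at hc
  have := one_le_pow₀ (n := 9) hc.le
  linarith

lemma th_six {R : ℝ} (hR : 100 ≤ R) : th R ^ 6 ≤ 1/2 := by
  have h0 := th_pos hR
  have : (th R ^ 6)^3 ≤ (1/2)^3 := by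
    have e : (th R ^ 6)^3 = (th R ^9)^2 := by ring
    rw [e, th_pow hR]
    nlinarith [hb_le hR, hb_pos hR]
  exact le_of_pow_le_pow_left₀ (by norm_num) (by norm_num) this

lemma th_R {R : ℝ} (hR : 100 ≤ R) : 1 ≤ R * th R ^ 3 := by
  have h0 := th_pos hR
  have h1 := hbR_lo hR
  rw [← th_pow hR] at h1
  have h2 := th_six hR
  have e : th R ^ 9 * R = th R ^6 * (R * th R ^3) := by ring
  rw [e] at h1
  have : 0 ≤ R * th R ^3 := by positivity
  nlinarith

lemma hb_le_th {R : ℝ} (hR : 100 ≤ R) : hb R ≤ th R := by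
  rw [← th_pow hR]
  exact pow_le_of_le_one (th_pos hR).le (th_le_one hR) (by norm_num)

lemma hb_div_th3 {R : ℝ} (hR : 100 ≤ R) : hb R / th R ^3 ≤ th R := by
  have h0 := th_pos hR
  rw [div_le_iff₀ (by positivity), ← th_pow hR]
  have := pow_le_one₀ (n := 5) h0.le (th_le_one hR)
  have e : th R ^ 9 = th R * th R ^3 * th R ^ 5 := by ring
  rw [e]
  have : 0 ≤ th R * th R ^3 := by positivity
  nlinarith

lemma hb_div_th2 {R : ℝ} (hR : 100 ≤ R) : hb R / th R ^2 ≤ th R := by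
  have h0 := th_pos hR
  refine le_trans ?_ (hb_div_th3 hR)
  apply div_le_div_of_nonneg_left (hb_pos hR).le (by positivity)
  exact pow_le_pow_of_le_one h0.le (th_le_one hR) (by norm_num)

lemma kappa_pos : 0 < κ := by unfold κ; positivity
lemma kappa_cube : κ ^ 3 = 3/(4*π) := by
  unfold κ
  rw [← Real.rpow_natCast, ← Real.rpow_mul (by positivity)]; norm_num
lemma kappa_le_one : κ ≤ 1 := by
  have h : κ^3 ≤ 1^3 := by
    rw [kappa_cube, one_pow, div_le_one (by positivity)]; linarith [Real.pi_gt_three]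
  exact le_of_pow_le_pow_left₀ (by norm_num) (by norm_num) h

lemma r_kappa {R : ℝ} (hR : 100 ≤ R) : |hb R * R - κ| ≤ 140 * th R := by
  have h1 := hb_cube hR
  have h2 := nR_lo hR
  have hN := N_asym R (by linarith)
  have h3 := hb_pos hR
  have hk := kappa_pos
  set r := hb R * R with hr
  have hr0 : 0 < r := by positivity
  have e1 : r^3 - κ^3 = hb R ^3 * (κ^3 * (4/3*π*R^3 - nR R)) := by
    have : κ^3 * (4/3*π) = 1 := by rw [kappa_cube]; have := Real.pi_pos; field_simp
    calc r^3 - κ^3 = hb R ^3 * (1 * R^3) - κ^3 * 1 := by rw [hr]; ring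
      _ = hb R ^3 * ((κ^3 * (4/3*π)) * R^3) - κ^3 * (hb R ^3 * nR R) := by rw [this, h1]
      _ = _ := by ring
  have e2 : |r^3 - κ^3| ≤ κ^3 * (hb R ^3 * (70*R^2)) := by
    rw [e1, abs_mul, abs_mul, abs_of_pos (by positivity : 0 < hb R ^3), abs_of_pos (by positivity : 0 < κ^3)]
    have : |4/3*π*R^3 - nR R| ≤ 70 * R^2 := by rw [abs_sub_comm]; exact hN
    calc hb R ^3 * (κ^3 * |4/3*π*R^3 - nR R|) ≤ hb R ^3 * (κ^3 * (70*R^2)) := by gcongr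
      _ = _ := by ring
  have e3 : |r^3 - κ^3| = |r - κ| * (r^2 + r*κ + κ^2) := by
    rw [← abs_of_pos (by positivity : 0 < r^2 + r*κ + κ^2), ← abs_mul]
    congr 1
    ring
  have e4 : |r - κ| * κ^2 ≤ κ^2 * (κ * (hb R ^3 * (70*R^2))) := by
    have : |r-κ| * κ^2 ≤ |r - κ| * (r^2 + r*κ + κ^2) :=
      mul_le_mul_of_nonneg_left (by nlinarith [mul_pos hr0 hk, sq_nonneg r]) (abs_nonneg _)
    calc _ ≤ _ := this
      _ = |r^3-κ^3| := e3.symm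
      _ ≤ _ := e2
      _ = _ := by ring
  have e5 : |r - κ| ≤ κ * (hb R ^3 * (70*R^2)) := by
    rw [mul_comm] at e4
    exact le_of_mul_le_mul_left e4 (by positivity)
  have e6 : hb R ^3 * (70*R^2) = 70 * (r^2 * hb R) := by rw [hr]; ring
  have e7 : r^2 ≤ 1 := by
    have := hbR_hi hR
    nlinarith
  rw [e6] at e5
  have e8 : r^2 * hb R ≤ 1 * th R := mul_le_mul e7 (hb_le_th hR) h3.le (by norm_num)
  have e9 : κ * (70 * (r^2 * hb R)) ≤ 1 * (70 * (1 * th R)) :=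
    mul_le_mul kappa_le_one (by linarith) (by positivity) (by norm_num)
  have := th_pos hR
  linarith

lemma log_add_le {a b : ℝ} (ha : 0 ≤ a) (hb : 0 ≤ b) : Real.log (1 + a + b) ≤ Real.log (1 + a) + b := by
  have : 1 + a + b ≤ (1 + a) * (1 + b) := by nlinarith
  calc _ ≤ Real.log ((1+a)*(1+b)) := Real.log_le_log (by positivity) this
    _ = Real.log (1+a) + Real.log (1+b) := Real.log_mul (by positivity) (by positivity)
    _ ≤ _ := by
      have := Real.log_le_sub_one_of_pos (show 0 < 1+b by positivity)
      linarith

lemma int_cauchy : ∫ s in Set.Ioi (0:ℝ), (1:ℝ)/(1+s^2) = π/2 := by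
  have := integral_Ioi_inv_one_add_sq (i := 0)
  simpa using this

lemma intble_cauchy (c : ℝ) : IntegrableOn (fun s : ℝ => c/(1+s^2)) (Set.Ioi 0) := by
  have := (integrable_inv_one_add_sq.const_mul c).integrableOn (s := Set.Ioi (0:ℝ))
  simpa [div_eq_mul_inv] using this

lemma wf_meas : Measurable wf := by unfold wf; fun_prop

lemma rpa_intble {b : ℝ} (hb : 0 ≤ b) : IntegrableOn (fun s => Real.log (1 + b * wf s)) (Set.Ioi 0) := by
  refine Integrable.mono' (intble_cauchy b) ?_ ?_
  · exact (Real.measurable_log.comp ((wf_meas.const_mul b).const_add 1)).aestronglyMeasurable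
  · filter_upwards [ae_restrict_mem measurableSet_Ioi] with s hs
    have h1 := wf_le hs
    have h2 := wf_nonneg hs
    have h3 := mul_nonneg hb h2
    rw [Real.norm_eq_abs, abs_of_nonneg (Real.log_nonneg (by linarith))]
    have := Real.log_le_sub_one_of_pos (show 0 < 1 + b * wf s by linarith)
    have h4 := mul_le_mul_of_nonneg_left h1 hb
    rw [mul_one_div] at h4
    linarith

lemma rpa_int_le {b : ℝ} (hb : 0 ≤ b) : ∫ s in Set.Ioi (0:ℝ), Real.log (1 + b * wf s) ≤ b * (π/2) := by
  rw [← int_cauchy, ← integral_const_mul]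
  refine setIntegral_mono_on (rpa_intble hb) ?_ measurableSet_Ioi ?_
  · simpa only [mul_one_div] using intble_cauchy b
  · intro s hs
    have h2 := wf_nonneg hs
    have h3 := mul_nonneg hb h2
    have := Real.log_le_sub_one_of_pos (show 0 < 1 + b * wf s by linarith)
    have h4 := mul_le_mul_of_nonneg_left (wf_le hs) hb
    linarith

lemma rpa_int_nonneg {b : ℝ} (hb : 0 ≤ b) : 0 ≤ ∫ s in Set.Ioi (0:ℝ), Real.log (1 + b * wf s) := by
  apply setIntegral_nonneg measurableSet_Ioi
  intro s hs
  exact Real.log_nonneg (by linarith [mul_nonneg hb (wf_nonneg hs)])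

set_option maxHeartbeats 1000000 in
lemma LI_bound (k : Fin 3 → ℤ) (hk : k ≠ 0) (V : ℝ) (hV : 0 ≤ V) (R : ℝ) (hR : 100 ≤ R) :
    ∫ s in Set.Ioi (0:ℝ), Real.log (1 + V * hb R / (znorm k * R) * ∑ p ∈ cutk R k (th R), Fs s (xk R k p))
      ≤ (∫ s in Set.Ioi (0:ℝ), Real.log (1 + V * κ * (2*π) * wf s)) + V * (3300 + 100 * znorm k) * th R := by
  classical
  have hR2 : 2 ≤ R := by linarith
  have hR0 : 0 < R := by linarith
  have ha := znorm_pos hk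
  have hθ := th_pos hR
  have hθ1 := th_le_one hR
  have hpi := Real.pi_pos
  have hkp := kappa_pos
  have hhb := hb_pos hR
  set a := znorm k with hadef
  set θ := th R with hθdef
  set q := V * hb R / (a * R) with hq
  have hq0 : 0 ≤ q := by positivity
  set c1 := V * (510 + 28 * a) with hc1
  set c2 := V * (1372 + 28 * a) * θ with hc2
  have hxpos : ∀ p ∈ cutk R k θ, 0 < xk R k p := fun p hp => xk_pos hR2 hk (Finset.mem_filter.1 hp).1
  have hFnn : ∀ s p, p ∈ cutk R k θ → 0 ≤ Fs s (xk R k p) := by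
    intro s p hp
    have := hxpos p hp
    unfold Fs; positivity
  have hsumnn : ∀ s, 0 ≤ q * ∑ p ∈ cutk R k θ, Fs s (xk R k p) :=
    fun s => mul_nonneg hq0 (Finset.sum_nonneg (hFnn s))
  have hbV : 0 ≤ V * κ * (2*π) := by positivity
  set D : ℝ → ℝ := fun s => Real.log (1 + V * κ * (2*π) * wf s) + (Set.Ioc 0 θ).indicator (fun _ => c1) s + c2/(1+s^2) with hD
  have i1 := rpa_intble hbV
  have i2 : IntegrableOn ((Set.Ioc 0 θ).indicator (fun _ => c1)) (Set.Ioi (0:ℝ)) := by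
    apply Integrable.integrableOn
    rw [integrable_indicator_iff measurableSet_Ioc]
    exact integrableOn_const (by simp)
  have i3 := intble_cauchy c2
  have hDi : IntegrableOn D (Set.Ioi 0) := (i1.add i2).add i3
  have hDint : ∫ s in Set.Ioi (0:ℝ), D s = (∫ s in Set.Ioi (0:ℝ), Real.log (1 + V * κ * (2*π) * wf s)) + c1 * θ + c2 * (π/2) := by
    simp only [hD]
    rw [integral_add (f := fun s => Real.log (1 + V * κ * (2*π) * wf s) + (Set.Ioc 0 θ).indicator (fun _ => c1) s) (i1.add i2) i3, integral_add i1 i2]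
    congr 1
    · congr 1
      rw [setIntegral_indicator measurableSet_Ioc, Set.inter_eq_right.2 (fun x hx => hx.1)]
      simp [mul_comm, hθ.le]
    · rw [← int_cauchy, ← integral_const_mul]; simp only [mul_one_div]
  have hle : ∫ s in Set.Ioi (0:ℝ), Real.log (1 + q * ∑ p ∈ cutk R k θ, Fs s (xk R k p)) ≤ ∫ s in Set.Ioi (0:ℝ), D s := by
    refine integral_mono_of_nonneg ?_ hDi ?_
    · exact Filter.Eventually.of_forall fun s => Real.log_nonneg (by linarith [hsumnn s])
    · filter_upwards [ae_restrict_mem measurableSet_Ioi] with s hs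
      have hs0 : 0 < s := hs
      have hw := wf_nonneg hs0
      have hwle := wf_le hs0
      have hlog0 : 0 ≤ Real.log (1 + V * κ * (2*π) * wf s) := Real.log_nonneg (by linarith [mul_nonneg hbV hw])
      have hc2nn : 0 ≤ c2/(1+s^2) := by positivity
      simp only [hD]
      by_cases hsθ : s ≤ θ
      · rw [Set.indicator_of_mem (show s ∈ Set.Ioc 0 θ from ⟨hs0, hsθ⟩)]
        have h1 := Real.log_le_sub_one_of_pos (show 0 < 1 + q * ∑ p ∈ cutk R k θ, Fs s (xk R k p) by linarith [hsumnn s])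
        have h2 : ∑ p ∈ cutk R k θ, Fs s (xk R k p) ≤ ∑ p ∈ cutk R k θ, 1 / xk R k p := by
          apply Finset.sum_le_sum
          intro p hp
          have := hxpos p hp
          unfold Fs
          rw [div_le_div_iff₀ (by positivity) this]
          nlinarith [sq_nonneg s]
        have h3 := cut_inv R hR2 k hk hθ hθ1 (th_R hR)
        have h4 : q * ∑ p ∈ cutk R k θ, Fs s (xk R k p) ≤ q * ((510 * a + 28 * a^2) * R^2) :=
          mul_le_mul_of_nonneg_left (h2.trans h3) hq0
        have h5 : q * ((510 * a + 28 * a^2) * R^2) = c1 * (hb R * R) := by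
          rw [hq, hc1]; field_simp
        have h6 : c1 * (hb R * R) ≤ c1 * 1 := mul_le_mul_of_nonneg_left (hbR_hi hR) (by positivity)
        linarith
      · rw [Set.indicator_of_notMem (fun h => hsθ h.2)]
        push Not at hsθ
        have h1 : ∑ p ∈ cutk R k θ, Fs s (xk R k p) ≤ ∑ p ∈ Lset R k, Fs s (xk R k p) := by
          apply Finset.sum_le_sum_of_subset_of_nonneg (Finset.filter_subset _ _)
          intro p hp _
          have := xk_pos hR2 hk hp
          unfold Fs; positivity
        have h2 := sum_Fs R hR2 k hk hs0
        have h3 : 1/s^2 + 6/s^3 ≤ 14/θ^3 * (1/(1+s^2)) := by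
          have q1 : 1/s^2 ≤ 2/θ^2*(1/(1+s^2)) := by
            rw [div_mul_div_comm, div_le_div_iff₀ (by positivity) (by positivity)]
            have : θ^2 ≤ s^2 := by gcongr
            have : θ^2 ≤ 1 := by nlinarith
            nlinarith [sq_nonneg s]
          have q2 : 1/s ≤ 1/θ := one_div_le_one_div_of_le hθ hsθ.le
          have q3 : 1/s^2 + 6/s^3 = (1 + 6 * (1/s)) * (1/s^2) := by field_simp
          have q4 : 1 ≤ 1/θ := by rw [le_div_iff₀ hθ]; linarith
          have q5 : 1 + 6*(1/s) ≤ 7 * (1/θ) := by linarith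
          rw [q3]
          calc (1 + 6*(1/s)) * (1/s^2) ≤ (7 * (1/θ)) * (2/θ^2*(1/(1+s^2))) :=
                mul_le_mul q5 q1 (by positivity) (by positivity)
            _ = _ := by field_simp; norm_num
        set r := hb R * R with hr
        have hrk := r_kappa hR
        rw [← hθdef, ← hr] at hrk
        have h4 : q * ∑ p ∈ cutk R k θ, Fs s (xk R k p) ≤
            V * r * (2*π) * wf s + V * (hb R / θ^3) * ((35 + 2*a)*14) * (1/(1+s^2)) := by
          calc _ ≤ q * (2 * π * a * R^2 * wf s + (35 * a + 2 * a ^ 2) * (14/θ^3 * (1/(1+s^2))) * R) := by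
                apply mul_le_mul_of_nonneg_left _ hq0
                refine (h1.trans h2).trans ?_
                gcongr
            _ = _ := by rw [hq, hr]; field_simp
        have h5 : V * r * (2*π) * wf s ≤ V * κ * (2*π) * wf s + V * (882 * θ) * (1/(1+s^2)) := by
          have z1 : r ≤ κ + 140*θ := by linarith [(abs_le.1 hrk).2]
          have z2 : V * r * (2*π) * wf s ≤ V * (κ + 140*θ) * (2*π) * wf s := by gcongr
          have z3 : V * (140*θ) * (2*π) * wf s ≤ V * (140*θ) * (2*3.15) * (1/(1+s^2)) := by
            gcongr
            linarith [Real.pi_lt_d2]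
          nlinarith
        have h6 : V * (hb R / θ^3) * ((35 + 2*a)*14) * (1/(1+s^2)) ≤ V * θ * ((35 + 2*a)*14) * (1/(1+s^2)) := by
          have := hb_div_th3 hR
          gcongr
        have h7 : c2/(1+s^2) = V * (882 * θ) * (1/(1+s^2)) + V * θ * ((35 + 2*a)*14) * (1/(1+s^2)) := by
          rw [hc2]; ring
        have h8 : 1 + q * ∑ p ∈ cutk R k θ, Fs s (xk R k p) ≤ 1 + V * κ * (2*π) * wf s + c2/(1+s^2) := by
          rw [h7]; linarith
        calc _ ≤ Real.log (1 + V * κ * (2*π) * wf s + c2/(1+s^2)) :=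
              Real.log_le_log (by linarith [hsumnn s]) h8
          _ ≤ _ := by
            have := log_add_le (mul_nonneg hbV hw) hc2nn
            linarith
  rw [hDint] at hle
  have : c1 * θ + c2 * (π/2) ≤ V * (3300 + 100 * a) * θ := by
    have : c2 * (π/2) ≤ c2 * (3.15/2) := by
      have := Real.pi_lt_d2
      have : 0 ≤ c2 := by positivity
      gcongr
    have z : 0 ≤ V * θ := by positivity
    have z2 : 0 ≤ V * a * θ := by positivity
    rw [hc1]; rw [hc2] at this ⊢
    nlinarith
  linarith

def hk2 (R : ℝ) (k p : Fin 3 → ℤ) : ℝ := 2 * hb R ^ 2 * lamk k p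

def rpaK (V a : ℝ) : ℝ := a * ((1/π) * (∫ s in Set.Ioi (0:ℝ), Real.log (1 + V * κ * (2*π) * wf s)) - V * (κ * π/2))

set_option maxHeartbeats 1000000 in
lemma lattice_k (k : Fin 3 → ℤ) (hk : k ≠ 0) (V : ℝ) (hV : 0 ≤ V) (R : ℝ) (hR : 100 ≤ R) :
    (1/π) * (∫ t in Set.Ioi (0:ℝ), Real.log (1 + (2*V/nR R) * ∑ p ∈ cutk R k (th R), hk2 R k p/(hk2 R k p^2 + t^2)))
      - (2*V/nR R)/2 * ((cutk R k (th R)).card : ℝ)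
    ≤ hb R * (2 * (κ * rpaK V (znorm k))) + V * (20000 * (znorm k + znorm k ^ 2)) * (hb R * th R) := by
  have hR2 : 2 ≤ R := by linarith
  have hR0 : 0 < R := by linarith
  have ha := znorm_pos hk
  have hθ := th_pos hR
  have hθ1 := th_le_one hR
  have hpi := Real.pi_pos
  have hkp := kappa_pos
  have hhb := hb_pos hR
  have hN := nR_pos hR
  have hcube := hb_cube hR
  have hLI := LI_bound k hk V hV R hR
  have hcard := cutk_card R hR2 k hk hθ hθ1
  have hrk := abs_le.1 (r_kappa hR)
  have hr1 := hbR_hi hR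
  have hr0 := hbR_lo hR
  have hd2 := hb_div_th2 hR
  set a := znorm k with hadef
  set θ := th R with hθdef
  set h := hb R with hhdef
  set A := 2 * h^2 * (a * R) with hA
  have hA0 : 0 < A := by positivity
  have hxa : ∀ p, hk2 R k p = A * xk R k p := by
    intro p; rw [hk2, xk, hA, ← hadef, ← hhdef]; field_simp
  have hinvN : 1/nR R = h^3 := by rw [div_eq_iff hN.ne']; linarith
  have hsub := integral_comp_mul_left_Ioi (fun t => Real.log (1 + (2*V/nR R) * ∑ p ∈ cutk R k θ, hk2 R k p/(hk2 R k p^2 + t^2))) 0 hA0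
  rw [mul_zero] at hsub
  have hsub2 : ∫ t in Set.Ioi (0:ℝ), Real.log (1 + (2*V/nR R) * ∑ p ∈ cutk R k θ, hk2 R k p/(hk2 R k p^2 + t^2)) =
      A * ∫ s in Set.Ioi (0:ℝ), Real.log (1 + V * h / (a * R) * ∑ p ∈ cutk R k θ, Fs s (xk R k p)) := by
    have e : ∀ s : ℝ, (2*V/nR R) * ∑ p ∈ cutk R k θ, hk2 R k p/(hk2 R k p^2 + (A*s)^2) =
        V * h / (a * R) * ∑ p ∈ cutk R k θ, Fs s (xk R k p) := by
      intro s
      rw [Finset.mul_sum, Finset.mul_sum]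
      apply Finset.sum_congr rfl
      intro p hp
      have hx := xk_pos hR2 hk (Finset.mem_filter.1 hp).1
      rw [hxa, Fs, show 2*V/nR R = 2*V*(1/nR R) by ring, hinvN,
        show (A * xk R k p)^2 + (A*s)^2 = A^2 * (xk R k p^2 + s^2) by ring]
      have : xk R k p^2 + s^2 ≠ 0 := by positivity
      rw [hA]
      field_simp
    simp only [e] at hsub
    rw [hsub, smul_eq_mul, mul_inv_cancel_left₀ hA0.ne']
  rw [hsub2]
  set I0 := ∫ s in Set.Ioi (0:ℝ), Real.log (1 + V * κ * (2*π) * wf s) with hI0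
  have hbV : 0 ≤ V * κ * (2*π) := by positivity
  have hI0nn : 0 ≤ I0 := rpa_int_nonneg hbV
  have hI0le : I0 ≤ 10 * V := by
    have h1 := rpa_int_le hbV
    have h2 : V * κ * (2*π) * (π/2) ≤ V * 1 * (2*3.15) * (3.15/2) := by
      have := kappa_le_one
      have := Real.pi_lt_d2
      gcongr
    rw [← hI0] at h1
    nlinarith
  set r := h * R with hr
  have hAr : A = h * (2 * a * r) := by rw [hA, hr]; ring
  -- first term
  have t1 : (1/π) * (A * ∫ s in Set.Ioi (0:ℝ), Real.log (1 + V * h / (a * R) * ∑ p ∈ cutk R k θ, Fs s (xk R k p)))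
      ≤ h * (2 * a * κ * ((1/π) * I0)) + h * (2 * a * θ * (1400 * V + V * (3300 + 100*a))) := by
    have s1 := mul_le_mul_of_nonneg_left hLI hA0.le
    have s2 : A * (I0 + V * (3300 + 100*a) * θ) ≤ h * (2*a) * (κ * I0 + θ * (1400 * V + V * (3300 + 100*a))) := by
      rw [hAr, show h * (2*a*r) * (I0 + V * (3300 + 100*a) * θ) = h * (2*a) * (r * I0 + r * (V * (3300 + 100*a) * θ)) by ring]
      apply mul_le_mul_of_nonneg_left _ (by positivity)
      have u1 : r * I0 ≤ (κ + 140 * θ) * I0 := mul_le_mul_of_nonneg_right (by linarith [hrk.2]) hI0nn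
      have u2 : r * (V * (3300 + 100*a) * θ) ≤ 1 * (V * (3300 + 100*a) * θ) := mul_le_mul_of_nonneg_right hr1 (by positivity)
      have u3 : 140 * θ * I0 ≤ 140 * θ * (10*V) := mul_le_mul_of_nonneg_left hI0le (by positivity)
      linarith
    have s3 := mul_le_mul_of_nonneg_left (s1.trans s2) (show 0 ≤ 1/π by positivity)
    refine s3.trans ?_
    have hp1 : 1/π ≤ 1 := by rw [div_le_one hpi]; linarith [Real.pi_gt_three]
    have u4 : (1/π) * (h * (2*a) * (θ * (1400 * V + V * (3300 + 100*a)))) ≤ 1 * (h * (2*a) * (θ * (1400 * V + V * (3300 + 100*a)))) :=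
      mul_le_mul_of_nonneg_right hp1 (by positivity)
    linarith
  have t2 : h * (V * π * a * κ^2) - h * θ * V * (286 * 4 * a + 16 * (35*a + 2*a^2)) ≤ (2*V/nR R)/2 * ((cutk R k θ).card : ℝ) := by
    have s0 : (2*V/nR R)/2 = V * h^3 := by rw [← hinvN]; ring
    rw [s0]
    have s1 := mul_le_mul_of_nonneg_left hcard (show 0 ≤ V * h^3 by positivity)
    refine le_trans ?_ s1
    have s2 : V * h^3 * (π * a * R^2 * (1 - 6*θ) - (35*a + 2*a^2) * (16/θ^2) * R) =
        h * (V * (π * a) * (r^2 - 6*θ*r^2)) - h * V * (16 * (35*a+2*a^2)) * (r * (h/θ^2)) := by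
      rw [hr]; ring
    rw [s2]
    have u1 : κ^2 - 286*θ ≤ r^2 - 6*θ*r^2 := by
      have hk1 := kappa_le_one
      have v1 : r^2 ≤ 1 := by nlinarith
      have v2 : κ^2 - r^2 ≤ 280*θ := by
        have : κ^2 - r^2 = (κ - r) * (κ + r) := by ring
        rw [this]
        have w1 : (κ - r) * (κ + r) ≤ (140*θ) * (κ + r) := mul_le_mul_of_nonneg_right (by linarith [hrk.1]) (by positivity)
        have w2 : (140*θ) * (κ + r) ≤ (140*θ) * 2 := mul_le_mul_of_nonneg_left (by linarith) (by positivity)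
        linarith
      have v3 : 6*θ*r^2 ≤ 6*θ*1 := mul_le_mul_of_nonneg_left v1 (by positivity)
      linarith
    have u2 : r * (h/θ^2) ≤ 1 * θ := mul_le_mul hr1 hd2 (by positivity) (by norm_num)
    have u3 : h * (V * (π*a) * (κ^2 - 286*θ)) ≤ h * (V * (π * a) * (r^2 - 6*θ*r^2)) := by gcongr
    have u4 : h * V * (16 * (35*a+2*a^2)) * (r * (h/θ^2)) ≤ h * V * (16 * (35*a+2*a^2)) * (1*θ) := by gcongr
    have u5 : h * (V * (π*a) * (286*θ)) ≤ h * (V * (4*a) * (286*θ)) := by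
      have := Real.pi_le_four
      gcongr
    linarith
  have e1 : h * (2 * (κ * rpaK V a)) = h * (2 * a * κ * ((1/π) * I0)) - h * (V * π * a * κ^2) := by
    rw [rpaK, ← hI0]; ring
  rw [e1]
  have z1 : 0 ≤ V * a * (h * θ) := by positivity
  have z2 : 0 ≤ V * a^2 * (h * θ) := by positivity
  nlinarith
end

/-! ### Module J: from Fock vectors to antisymmetric coefficient functions -/

noncomputable section

variable {Λ : Type*} [Fintype Λ] [DecidableEq Λ]

/-- abstract CAR family on the Fock space with a one dimensional vacuum sector -/
structure CarFam (Λ : Type*) [Fintype Λ] [DecidableEq Λ] where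
  a : Λ → FOp Λ
  B : Finset Λ
  haa : ∀ p q, a p * a q = -(a q * a p)
  hac : ∀ p q, a p * star (a q) + star (a q) * a p = if p = q then 1 else 0
  hvac : ∀ φ φ' : Fock Λ, (∀ p, a p φ = 0) → inner ℝ φ φ' = φ B * φ' B

theorem ring_aux20 {R : Type*} [Ring R] (r s q d : R) (h1 : r * s + s * r = d) (h2 : r * q = -(q * r)) :
    r * (s * q) = s * q * r + d * q := by
  have : r * s = d - s * r := eq_sub_of_add_eq h1
  calc r * (s * q) = (r * s) * q := by noncomm_ring
    _ = d * q - s * (r * q) := by rw [this]; noncomm_ring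
    _ = _ := by rw [h2]; noncomm_ring

namespace CarFam

variable (A : CarFam Λ)

def str : (n : ℕ) → (Fin n → Λ) → FOp Λ
  | 0, _ => 1
  | n + 1, P => str n (Fin.tail P) * A.a (P 0)

/-- one-body operator -/
def ob1 (m : Λ → Λ → ℝ) : FOp Λ := ∑ p, ∑ q, m p q • (star (A.a p) * A.a q)

theorem a_ob1 (m : Λ → Λ → ℝ) (r : Λ) :
    A.a r * A.ob1 m = A.ob1 m * A.a r + ∑ q, m r q • A.a q := by
  have h : ∀ p q, A.a r * (star (A.a p) * A.a q) = star (A.a p) * A.a q * A.a r + (if r = p then (1 : FOp Λ) else 0) * A.a q :=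
    fun p q => ring_aux20 _ _ _ _ (A.hac r p) (A.haa r q)
  unfold ob1
  rw [Finset.mul_sum, Finset.sum_mul]
  have e : ∑ q, m r q • A.a q = ∑ p, ∑ q, m p q • ((if r = p then (1 : FOp Λ) else 0) * A.a q) := by
    rw [Finset.sum_eq_single (a := r) (f := fun p => ∑ q, m p q • ((if r = p then (1 : FOp Λ) else 0) * A.a q))]
    · refine Finset.sum_congr rfl fun q _ => ?_
      rw [if_pos rfl, one_mul]
    · intro p _ hp
      refine Finset.sum_eq_zero fun q _ => ?_
      rw [if_neg (Ne.symm hp), zero_mul]; exact fsmul_zero _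
    · simp
  rw [e, ← Finset.sum_add_distrib]
  refine Finset.sum_congr rfl fun p _ => ?_
  rw [Finset.mul_sum, Finset.sum_mul, ← Finset.sum_add_distrib]
  refine Finset.sum_congr rfl fun q _ => ?_
  rw [fmul_smul, h, fsmul_add, fsmul_mul]

def numop : FOp Λ := A.ob1 (fun p q => if p = q then 1 else 0)

theorem a_numop (r : Λ) : A.a r * A.numop = A.numop * A.a r + A.a r := by
  unfold numop
  rw [a_ob1]
  congr 1
  rw [Finset.sum_eq_single r]
  · rw [if_pos rfl]; exact fone_smul _
  · intro q _ hq; rw [if_neg (Ne.symm hq)]; exact fzero_smul _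
  · simp

theorem numop_eq : A.numop = ∑ p, star (A.a p) * A.a p := by
  unfold numop ob1
  refine Finset.sum_congr rfl fun p _ => ?_
  rw [Finset.sum_eq_single p]
  · simp only [if_true]; exact fone_smul _
  · intro q _ hq; simp only [if_neg (Ne.symm hq)]; exact fzero_smul _
  · simp

theorem star_numop : star A.numop = A.numop := by
  rw [numop_eq, fstar_sum]
  exact Finset.sum_congr rfl fun p _ => by rw [fstar_mul, fstar_star]

theorem numop_as (r : Λ) : A.numop * star (A.a r) = star (A.a r) * A.numop + star (A.a r) := by
  have h := congrArg star (A.a_numop r)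
  rw [fstar_mul, fstar_add, fstar_mul, star_numop] at h
  exact h

theorem ring_aux21 {R : Type*} [Ring R] (n s q : R) (h1 : n * s = s * n + s) (h2 : q * n = n * q + q) :
    n * (s * q) = s * q * n := by
  calc n * (s * q) = (n * s) * q := by noncomm_ring
    _ = s * (n * q + q) := by rw [h1]; noncomm_ring
    _ = _ := by rw [← h2]; noncomm_ring

theorem numop_ob1 (m : Λ → Λ → ℝ) : A.numop * A.ob1 m = A.ob1 m * A.numop := by
  conv_lhs => rw [ob1]
  conv_rhs => rw [ob1]
  rw [Finset.mul_sum, Finset.sum_mul]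
  refine Finset.sum_congr rfl fun p _ => ?_
  rw [Finset.mul_sum, Finset.sum_mul]
  refine Finset.sum_congr rfl fun q _ => ?_
  rw [fmul_smul, fsmul_mul, ring_aux21 _ _ _ (A.numop_as p) (A.a_numop q)]

def Sec (n : ℕ) (ψ : Fock Λ) : Prop := A.numop ψ = (n : ℝ) • ψ

theorem sec_a {n : ℕ} {ψ : Fock Λ} (h : A.Sec (n + 1) ψ) (r : Λ) : A.Sec n (A.a r ψ) := by
  unfold Sec at *
  have e : (A.a r * A.numop) ψ = (A.numop * A.a r + A.a r) ψ := by rw [a_numop]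
  rw [fmul_apply, fadd_apply, fmul_apply, h, map_smul] at e
  rw [eq_sub_of_add_eq e.symm]
  push_cast; rw [add_smul, one_smul]; abel

theorem sec_ob1 {n : ℕ} {ψ : Fock Λ} (h : A.Sec n ψ) (m : Λ → Λ → ℝ) : A.Sec n (A.ob1 m ψ) := by
  unfold Sec at *
  rw [← fmul_apply, numop_ob1, fmul_apply, h, map_smul]

theorem sum_inner_a (ψ φ : Fock Λ) : ∑ r, inner ℝ (A.a r ψ) (A.a r φ) = inner ℝ ψ (A.numop φ) := by
  rw [numop_eq, fsum_apply, inner_sum]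
  refine Finset.sum_congr rfl fun r _ => ?_
  rw [fmul_apply, op_inner_star]

theorem sec_zero {ψ : Fock Λ} (h : A.Sec 0 ψ) (p : Λ) : A.a p ψ = 0 := by
  have h1 := A.sum_inner_a ψ ψ
  unfold Sec at h
  rw [h] at h1
  simp only [Nat.cast_zero, zero_smul, inner_zero_right] at h1
  have h2 := (Finset.sum_eq_zero_iff_of_nonneg (fun r _ => real_inner_self_nonneg (x := A.a r ψ))).1 h1 p (Finset.mem_univ _)
  exact inner_self_eq_zero.1 h2

theorem str_iso (n : ℕ) : ∀ {ψ φ : Fock Λ}, A.Sec n ψ → A.Sec n φ →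
    ∑ P : Fin n → Λ, (A.str n P ψ) A.B * (A.str n P φ) A.B = (n.factorial : ℝ) * inner ℝ ψ φ := by
  induction n with
  | zero =>
    intro ψ φ hψ hφ
    rw [A.hvac ψ φ (A.sec_zero hψ)]
    simp [str, fone_apply]
  | succ n ih =>
    intro ψ φ hψ hφ
    rw [← (Fin.consEquiv (fun _ : Fin (n+1) => Λ)).sum_comp, Fintype.sum_prod_type]
    have : ∀ r : Λ, ∑ P : Fin n → Λ, (A.str (n+1) ((Fin.consEquiv (fun _ : Fin (n+1) => Λ)) (r, P)) ψ) A.B *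
        (A.str (n+1) ((Fin.consEquiv (fun _ : Fin (n+1) => Λ)) (r, P)) φ) A.B
        = (n.factorial : ℝ) * inner ℝ (A.a r ψ) (A.a r φ) := by
      intro r
      rw [← ih (A.sec_a hψ r) (A.sec_a hφ r)]
      refine Finset.sum_congr rfl fun P _ => ?_
      simp [str, Fin.consEquiv, fmul_apply]
    rw [Finset.sum_congr rfl fun r _ => this r, ← Finset.mul_sum, sum_inner_a]
    unfold Sec at hφ
    rw [hφ, inner_smul_right, Nat.factorial_succ]
    push_cast; ring

theorem str_swap (n : ℕ) : ∀ (P : Fin (n+1) → Λ) (i : Fin n),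
    A.str (n+1) (P ∘ Equiv.swap i.castSucc i.succ) = - A.str (n+1) P := by
  induction n with
  | zero => intro P i; exact i.elim0
  | succ n ih =>
    intro P i
    induction i using Fin.cases with
    | zero =>
      have h1 : (P ∘ Equiv.swap (0 : Fin (n+2)) 1) 0 = P 1 := by simp
      have h2 : (P ∘ Equiv.swap (0 : Fin (n+2)) 1) 1 = P 0 := by simp
      have h3 : Fin.tail (Fin.tail (P ∘ Equiv.swap (0 : Fin (n+2)) 1)) = Fin.tail (Fin.tail P) := by
        funext j
        simp only [Fin.tail, Function.comp]
        rw [Equiv.swap_apply_of_ne_of_ne]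
        · exact Fin.succ_ne_zero _
        · intro h
          have := congrArg Fin.val h; simp at this
      show A.str n (Fin.tail (Fin.tail (P ∘ Equiv.swap (0 : Fin (n+2)) 1))) * A.a ((P ∘ Equiv.swap (0 : Fin (n+2)) 1) 1) * A.a ((P ∘ Equiv.swap (0 : Fin (n+2)) 1) 0)
        = - (A.str n (Fin.tail (Fin.tail P)) * A.a (P 1) * A.a (P 0))
      rw [h1, h2, h3, mul_assoc, mul_assoc, A.haa (P 0) (P 1)]
      ext1 x; simp only [fmul_apply, fneg_apply, map_neg]
    | succ i =>
      have h1 : (P ∘ Equiv.swap i.succ.castSucc i.succ.succ) 0 = P 0 := by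
        simp only [Function.comp]
        rw [Equiv.swap_apply_of_ne_of_ne]
        · intro h; have := congrArg Fin.val h; simp at this
        · exact (Fin.succ_ne_zero _).symm
      have h2 : Fin.tail (P ∘ Equiv.swap i.succ.castSucc i.succ.succ) = Fin.tail P ∘ Equiv.swap i.castSucc i.succ := by
        funext j
        simp only [Fin.tail, Function.comp]
        congr 1
        rw [← Fin.succ_castSucc]
        by_cases hj1 : j = i.castSucc
        · subst hj1; simp
        by_cases hj2 : j = i.succ
        · subst hj2; simp
        rw [Equiv.swap_apply_of_ne_of_ne hj1 hj2, Equiv.swap_apply_of_ne_of_ne]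
        · exact fun h => hj1 (Fin.succ_injective _ h)
        · exact fun h => hj2 (Fin.succ_injective _ h)
      show A.str (n+1) (Fin.tail (P ∘ Equiv.swap i.succ.castSucc i.succ.succ)) * A.a ((P ∘ Equiv.swap i.succ.castSucc i.succ.succ) 0)
        = - (A.str (n+1) (Fin.tail P) * A.a (P 0))
      rw [h1, h2, ih]
      rfl

theorem str_perm (n : ℕ) (σ : Equiv.Perm (Fin n)) : ∀ (P : Fin n → Λ),
    A.str n (P ∘ σ) = (((Equiv.Perm.sign σ : ℤ) : ℝ)) • A.str n P := by
  rcases n with _ | n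
  · intro P
    have : σ = 1 := Subsingleton.elim _ _
    subst this
    simp only [Equiv.Perm.sign_one]
    push_cast
    exact (fone_smul _).symm
  have hm : σ ∈ Submonoid.closure (Set.range fun i : Fin n => Equiv.swap i.castSucc i.succ) := by
    rw [Equiv.Perm.mclosure_swap_castSucc_succ]; trivial
  induction hm using Submonoid.closure_induction with
  | mem τ hτ =>
    obtain ⟨i, rfl⟩ := hτ
    intro P
    rw [str_swap, Equiv.Perm.sign_swap (Fin.castSucc_lt_succ).ne]
    push_cast
    rw [fneg_smul, fone_smul]
  | one =>
    intro P
    simp only [Equiv.Perm.sign_one]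
    push_cast
    exact (fone_smul _).symm
  | mul x y _ _ hx hy =>
    intro P
    have : (P ∘ ((x * y : Equiv.Perm (Fin (n+1))) : Fin (n+1) → Fin (n+1))) = (P ∘ x) ∘ y := rfl
    rw [this, hy, hx, fsmul_smul, Equiv.Perm.sign_mul]
    push_cast; rw [mul_comm]

theorem str_ob1 (m : Λ → Λ → ℝ) (n : ℕ) : ∀ (P : Fin n → Λ),
    A.str n P * A.ob1 m = A.ob1 m * A.str n P + ∑ i, ∑ q, m (P i) q • A.str n (Function.update P i q) := by
  induction n with
  | zero => intro P; simp [str]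
  | succ n ih =>
    intro P
    have e0 : ∀ q, A.str (n+1) (Function.update P 0 q) = A.str n (Fin.tail P) * A.a q := by
      intro q; simp [str]
    have e1 : ∀ (i : Fin n) q, A.str (n+1) (Function.update P i.succ q) = A.str n (Function.update (Fin.tail P) i q) * A.a (P 0) := by
      intro i q
      simp only [str, Fin.tail_update_succ]
      rw [Function.update_of_ne (Fin.succ_ne_zero i).symm]
    rw [Fin.sum_univ_succ]
    have s0 : ∑ q, m (P 0) q • A.str (n+1) (Function.update P 0 q) = A.str n (Fin.tail P) * ∑ q, m (P 0) q • A.a q := by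
      rw [Finset.mul_sum]
      exact Finset.sum_congr rfl fun q _ => by rw [e0, fmul_smul]
    have s1 : ∑ i : Fin n, ∑ q, m (P i.succ) q • A.str (n+1) (Function.update P i.succ q)
        = (∑ i, ∑ q, m (Fin.tail P i) q • A.str n (Function.update (Fin.tail P) i q)) * A.a (P 0) := by
      rw [Finset.sum_mul]
      refine Finset.sum_congr rfl fun i _ => ?_
      rw [Finset.sum_mul]
      exact Finset.sum_congr rfl fun q _ => by rw [e1, fsmul_mul]; rfl
    rw [s0, s1]
    have key : A.str n (Fin.tail P) * A.a (P 0) * A.ob1 m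
       = (A.str n (Fin.tail P) * A.ob1 m) * A.a (P 0) + A.str n (Fin.tail P) * ∑ q, m (P 0) q • A.a q := by
      rw [mul_assoc, A.a_ob1, mul_add, mul_assoc]
    show A.str n (Fin.tail P) * A.a (P 0) * A.ob1 m = A.ob1 m * (A.str n (Fin.tail P) * A.a (P 0)) + _
    rw [key, ih, add_mul, mul_assoc, add_assoc]
    congr 1
    exact add_comm _ _

theorem sec_str (n : ℕ) : ∀ {ψ : Fock Λ}, A.Sec n ψ → ∀ P, A.Sec 0 (A.str n P ψ) := by
  induction n with
  | zero => intro ψ h P; exact h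
  | succ n ih => intro ψ h P; exact ih (A.sec_a h (P 0)) _

theorem str_ob1_apply (m : Λ → Λ → ℝ) {n : ℕ} {ψ : Fock Λ} (h : A.Sec n ψ) (P : Fin n → Λ) :
    A.str n P (A.ob1 m ψ) = ∑ i, ∑ q, m (P i) q • A.str n (Function.update P i q) ψ := by
  have h0 : A.ob1 m (A.str n P ψ) = 0 := by
    unfold ob1
    rw [fsum_apply]
    refine Finset.sum_eq_zero fun p _ => ?_
    rw [fsum_apply]
    refine Finset.sum_eq_zero fun q _ => ?_
    rw [fsmul_apply, fmul_apply, A.sec_zero (A.sec_str n h P) q]; simp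
  rw [← fmul_apply, str_ob1, fadd_apply, fmul_apply, h0, zero_add, fsum_apply]
  refine Finset.sum_congr rfl fun i _ => ?_
  rw [fsum_apply]; rfl

theorem str_zero (p : Λ) (n : ℕ) : ∀ {ψ : Fock Λ}, A.a p ψ = 0 → ∀ (P : Fin n → Λ) (i : Fin n), P i = p → A.str n P ψ = 0 := by
  induction n with
  | zero => intro ψ _ P i; exact i.elim0
  | succ n ih =>
    intro ψ h P i hi
    show A.str n (Fin.tail P) (A.a (P 0) ψ) = 0
    induction i using Fin.cases with
    | zero => rw [hi, h, map_zero]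
    | succ i =>
      refine ih ?_ _ i hi
      rw [← fmul_apply, A.haa, fneg_apply, fmul_apply, h, map_zero, neg_zero]

end CarFam
end

/-! ### Module J: plane waves, product integrals, energy identity -/

noncomputable section

/-- plane wave -/
def ek (k : Fin 3 → ℤ) (x : Fin 3 → ℝ) : ℂ := Complex.exp (Complex.I * ((∑ i, (k i : ℝ) * x i : ℝ) : ℂ))

theorem ek_norm (k x) : ‖ek k x‖ = 1 := by
  unfold ek; rw [mul_comm]; exact Complex.norm_exp_ofReal_mul_I _

theorem ek_add (k l x) : ek (k + l) x = ek k x * ek l x := by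
  unfold ek; rw [← Complex.exp_add, ← mul_add, ← Complex.ofReal_add, ← Finset.sum_add_distrib]
  simp only [Pi.add_apply, Int.cast_add, add_mul]

theorem ek_zero (x) : ek 0 x = 1 := by simp [ek]

theorem ek_conj (k x) : (starRingEnd ℂ) (ek k x) = ek (-k) x := by
  unfold ek; rw [← Complex.exp_conj]
  simp

theorem ek_sub_arg (k) (x y : Fin 3 → ℝ) : ek k (x - y) = ek k x * (starRingEnd ℂ) (ek k y) := by
  rw [ek_conj]; unfold ek
  rw [← Complex.exp_add, ← mul_add, ← Complex.ofReal_add, ← Finset.sum_add_distrib]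
  congr 3
  refine Finset.sum_congr rfl fun i _ => ?_
  simp; ring

theorem ek_contDiff (k) : ContDiff ℝ (⊤ : ℕ∞) (ek k) := by
  have h : ContDiff ℝ (⊤ : ℕ∞) (fun x : Fin 3 → ℝ => ∑ i, (k i : ℝ) * x i) :=
    ContDiff.sum fun i _ => contDiff_const.mul (contDiff_apply ℝ ℝ i)
  exact Complex.contDiff_exp.comp (contDiff_const.mul (Complex.ofRealCLM.contDiff.comp h))

theorem ek_cont (k) : Continuous (ek k) := (ek_contDiff k).continuous

theorem ek_prod (k x) : ek k x = ∏ i, Complex.exp (Complex.I * ((k i : ℝ) * x i : ℝ)) := by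
  unfold ek; rw [← Complex.exp_sum, ← Finset.mul_sum]; push_cast; rfl

theorem box1_subset : box1 ⊆ Set.univ.pi fun _ => Set.Icc 0 (2 * π) :=
  Set.pi_mono fun _ _ => Set.Ico_subset_Icc_self

theorem box1_cint {E : Type*} [NormedAddCommGroup E] (f : (Fin 3 → ℝ) → E) (hf : Continuous f) :
    IntegrableOn f box1 :=
  (hf.continuousOn.integrableOn_compact (isCompact_univ_pi fun _ => isCompact_Icc)).mono_set box1_subset

theorem boxN_cint {E : Type*} [NormedAddCommGroup E] {N : ℕ} (f : (Fin N → Fin 3 → ℝ) → E) (hf : Continuous f) :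
    IntegrableOn f (boxN N) :=
  (hf.continuousOn.integrableOn_compact (isCompact_univ_pi fun _ => isCompact_univ_pi fun _ => isCompact_Icc)).mono_set
    (Set.pi_mono fun _ _ => box1_subset)

theorem prodint {N : ℕ} (g : Fin N → (Fin 3 → ℝ) → ℂ) :
    ∫ x in boxN N, ∏ j, g j (x j) = ∏ j, ∫ y in box1, g j y := by
  unfold boxN
  rw [volume_pi, Measure.restrict_pi_pi]
  exact integral_fintype_prod_eq_prod (𝕜 := ℂ) (μ := fun _ : Fin N => volume.restrict box1) g

theorem int_exp1 (n : ℤ) : ∫ t in Set.Ico (0:ℝ) (2*π), Complex.exp (Complex.I * ((n : ℝ) * t : ℝ)) = if n = 0 then (2*π : ℂ) else 0 := by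
  have e1 : ∫ t in Set.Ico (0:ℝ) (2*π), Complex.exp (Complex.I * ((n : ℝ) * t : ℝ)) = ∫ t in (0:ℝ)..(2*π), Complex.exp ((Complex.I * n) * t) := by
    rw [intervalIntegral.integral_of_le (by positivity), integral_Ico_eq_integral_Ioc]
    congr 1; funext t; push_cast; ring_nf
  rw [e1]
  split_ifs with h
  · subst h; simp
  · rw [integral_exp_mul_complex (by simp [h])]
    have : Complex.exp (Complex.I * n * ((2*π : ℝ):ℂ)) = 1 := by
      rw [Complex.exp_eq_one_iff]; exact ⟨n, by push_cast; ring⟩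
    rw [this]; simp

theorem int_ek (k : Fin 3 → ℤ) : ∫ y in box1, ek k y = if k = 0 then ((2*π : ℂ))^3 else 0 := by
  simp_rw [ek_prod]
  unfold box1
  rw [volume_pi, Measure.restrict_pi_pi,
    integral_fintype_prod_eq_prod (𝕜 := ℂ) (μ := fun _ : Fin 3 => volume.restrict (Set.Ico (0:ℝ) (2*π)))
      (fun i t => Complex.exp (Complex.I * ((k i : ℝ) * t : ℝ)))]
  simp_rw [int_exp1]
  split_ifs with h
  · subst h; simp
  · have : ∃ i, k i ≠ 0 := by by_contra hh; push Not at hh; exact h (funext hh)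
    obtain ⟨i, hi⟩ := this
    exact Finset.prod_eq_zero (Finset.mem_univ i) (if_neg hi)

theorem potential_eq (V : (Fin 3 → ℤ) → ℝ) (hfin : (Function.support V).Finite) (x) :
    potential V x = ∑ k ∈ hfin.toFinset, V k * (ek k x).re := by
  unfold potential
  rw [finsum_eq_sum_of_support_subset (s := hfin.toFinset), Complex.re_sum]
  · refine Finset.sum_congr rfl fun k _ => ?_
    rw [Complex.re_ofReal_mul]; unfold ek; norm_num
  · intro k hk
    simp only [Set.Finite.coe_toFinset, Function.mem_support] at *
    intro h; apply hk; rw [h]; simp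

theorem sum_lt_pairs {N : ℕ} (g : Fin N → Fin N → ℝ) (hs : ∀ i j, g i j = g j i) :
    ∑ i, ∑ j, g i j = ∑ i, g i i + 2 * ∑ p ∈ Finset.univ.filter (fun p : Fin N × Fin N => p.1 < p.2), g p.1 p.2 := by
  have e1 : ∑ p ∈ Finset.univ.filter (fun p : Fin N × Fin N => p.1 < p.2), g p.1 p.2 = ∑ i, ∑ j, if i < j then g i j else 0 := by
    rw [Finset.sum_filter, ← Finset.univ_product_univ, Finset.sum_product]
  have e2 : ∑ p ∈ Finset.univ.filter (fun p : Fin N × Fin N => p.1 < p.2), g p.1 p.2 = ∑ i, ∑ j, if j < i then g i j else 0 := by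
    rw [e1, Finset.sum_comm]
    refine Finset.sum_congr rfl fun i _ => Finset.sum_congr rfl fun j _ => ?_
    rw [hs]
  have e3 : ∑ i, g i i = ∑ i, ∑ j, if i = j then g i j else 0 := by simp
  rw [two_mul]
  nth_rw 1 [e1]
  rw [e2, e3, ← Finset.sum_add_distrib, ← Finset.sum_add_distrib]
  refine Finset.sum_congr rfl fun i _ => ?_
  rw [← Finset.sum_add_distrib, ← Finset.sum_add_distrib]
  refine Finset.sum_congr rfl fun j _ => ?_
  rcases lt_trichotomy i j with h | h | h
  · simp [h, h.ne, h.not_gt]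
  · simp [h]
  · simp [h, h.ne', h.not_gt]

theorem norm_sum_sq {N : ℕ} (z : Fin N → ℂ) : ‖∑ j, z j‖^2 = ∑ i, ∑ j, (z i * (starRingEnd ℂ) (z j)).re := by
  rw [← Complex.normSq_eq_norm_sq]
  have : (Complex.normSq (∑ j, z j) : ℂ) = (∑ i, ∑ j, z i * (starRingEnd ℂ) (z j)) := by
    rw [Complex.normSq_eq_conj_mul_self, mul_comm, map_sum, Finset.sum_mul_sum]
  have h2 := congrArg Complex.re this
  rw [Complex.ofReal_re] at h2
  rw [h2, Complex.re_sum]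
  exact Finset.sum_congr rfl fun i _ => Complex.re_sum _ _

theorem pot_pairs (V : (Fin 3 → ℤ) → ℝ) (hfin : (Function.support V).Finite) {N : ℕ} (x : Fin N → Fin 3 → ℝ) :
    ∑ p ∈ Finset.univ.filter (fun p : Fin N × Fin N => p.1 < p.2), potential V (x p.1 - x p.2)
      = 1/2 * ∑ k ∈ hfin.toFinset, V k * (‖∑ j, ek k (x j)‖^2 - N) := by
  simp_rw [potential_eq V hfin]
  rw [Finset.sum_comm, Finset.mul_sum]
  refine Finset.sum_congr rfl fun k _ => ?_
  rw [← Finset.mul_sum, norm_sum_sq, sum_lt_pairs]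
  · have : ∑ i : Fin N, (ek k (x i) * (starRingEnd ℂ) (ek k (x i))).re = N := by
      have : ∀ i, (ek k (x i) * (starRingEnd ℂ) (ek k (x i))).re = 1 := by
        intro i; rw [Complex.mul_conj, Complex.ofReal_re, Complex.normSq_eq_norm_sq, ek_norm]; norm_num
      simp [this]
    rw [this]
    simp_rw [ek_sub_arg]; ring
  · intro i j
    rw [← Complex.conj_re, map_mul, Complex.conj_conj, mul_comm]

theorem energy_eq (V : (Fin 3 → ℤ) → ℝ) (hfin : (Function.support V).Finite) {N : ℕ}
    (ψ : (Fin N → Fin 3 → ℝ) → ℂ) (hψ : IsAdmissible N ψ) :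
    energy V N ψ = (((N : ℝ) ^ ((1 : ℝ) / 3))⁻¹) ^ 2 * (∑ j : Fin N, ∫ x in boxN N, ∑ i : Fin 3,
        ‖fderiv ℝ ψ x (Pi.single j (Pi.single i (1 : ℝ)))‖ ^ 2)
     + 1/(2*N) * ∑ k ∈ hfin.toFinset, V k * ((∫ x in boxN N, ‖(∑ j, ek k (x j)) * ψ x‖^2) - N) := by
  unfold energy
  have hc : Continuous ψ := hψ.smooth.continuous
  have hpot : ∀ a b : Fin N, Continuous fun x : Fin N → Fin 3 → ℝ => potential V (x a - x b) := by
    intro a b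
    simp_rw [potential_eq V hfin]
    refine continuous_finset_sum _ fun k _ => continuous_const.mul (Complex.continuous_re.comp ((ek_cont k).comp ?_))
    fun_prop
  rw [← Finset.mul_sum]
  congr 1
  rw [← integral_finset_sum]
  · simp_rw [← Finset.sum_mul, pot_pairs V hfin]
    have e1 : ∀ x : Fin N → Fin 3 → ℝ, 1/2 * (∑ k ∈ hfin.toFinset, V k * (‖∑ j, ek k (x j)‖^2 - N)) * ‖ψ x‖^2
       = 1/2 * ∑ k ∈ hfin.toFinset, V k * (‖(∑ j, ek k (x j)) * ψ x‖^2 - N * ‖ψ x‖^2) := by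
      intro x
      rw [mul_assoc, Finset.sum_mul]
      congr 1
      refine Finset.sum_congr rfl fun k _ => ?_
      rw [norm_mul]; ring
    have hcc : ∀ k, Continuous fun x : Fin N → Fin 3 → ℝ => ‖(∑ j, ek k (x j)) * ψ x‖^2 := by
      intro k
      refine (Continuous.norm ((continuous_finset_sum _ fun j _ => (ek_cont k).comp (by fun_prop)).mul hc)).pow 2
    simp_rw [e1]
    rw [integral_const_mul, integral_finset_sum]
    · have : ∀ k, ∫ x in boxN N, V k * (‖(∑ j, ek k (x j)) * ψ x‖^2 - N * ‖ψ x‖^2) =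
         V k * ((∫ x in boxN N, ‖(∑ j, ek k (x j)) * ψ x‖^2) - N) := by
        intro k
        rw [integral_const_mul, integral_sub, integral_const_mul, hψ.normalized, mul_one]
        · exact boxN_cint _ (hcc k)
        · exact boxN_cint _ (by fun_prop)
      simp_rw [this]
      ring
    · intro k _
      exact boxN_cint _ (continuous_const.mul ((hcc k).sub (by fun_prop)))
  · intro p _
    exact boxN_cint _ ((hpot p.1 p.2).mul (by fun_prop))

theorem ground_le (V : (Fin 3 → ℤ) → ℝ) (hnn : ∀ k, 0 ≤ V k) (hfin : (Function.support V).Finite) {N : ℕ}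
    (ψ : (Fin N → Fin 3 → ℝ) → ℂ) (hψ : IsAdmissible N ψ) : groundEnergy V N ≤ energy V N ψ := by
  refine csInf_le ⟨1/(2*N) * ∑ k ∈ hfin.toFinset, V k * (0 - N), ?_⟩ ⟨ψ, hψ, rfl⟩
  rintro _ ⟨φ, hφ, rfl⟩
  rw [energy_eq V hfin φ hφ]
  have h1 : 0 ≤ (((N : ℝ) ^ ((1 : ℝ) / 3))⁻¹) ^ 2 * (∑ j : Fin N, ∫ x in boxN N, ∑ i : Fin 3,
        ‖fderiv ℝ φ x (Pi.single j (Pi.single i (1 : ℝ)))‖ ^ 2) :=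
    mul_nonneg (by positivity) (Finset.sum_nonneg fun j _ => integral_nonneg fun x => by positivity)
  have h2 : 1/(2*(N:ℝ)) * ∑ k ∈ hfin.toFinset, V k * (0 - N) ≤ 1/(2*N) * ∑ k ∈ hfin.toFinset, V k * ((∫ x in boxN N, ‖(∑ j, ek k (x j)) * φ x‖^2) - N) := by
    refine mul_le_mul_of_nonneg_left (Finset.sum_le_sum fun k _ => mul_le_mul_of_nonneg_left ?_ (hnn k)) (by positivity)
    have : 0 ≤ ∫ x in boxN N, ‖(∑ j, ek k (x j)) * φ x‖^2 := integral_nonneg fun x => by positivity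
    linarith
  linarith

end

noncomputable section

variable {N : ℕ}

def eP (P : Fin N → Fin 3 → ℤ) (x : Fin N → Fin 3 → ℝ) : ℂ := ∏ j, ek (P j) (x j)

def nrmc (N : ℕ) : ℝ := (Real.sqrt ((2*π)^(3*N)))⁻¹

theorem nrmc_pos : 0 < nrmc N := by unfold nrmc; positivity
theorem nrmc_sq : nrmc N ^ 2 * (2*π)^(3*N) = 1 := by
  unfold nrmc; rw [inv_pow, Real.sq_sqrt (by positivity)]; exact inv_mul_cancel₀ (by positivity)

def tp (D : Finset (Fin N → Fin 3 → ℤ)) (c : (Fin N → Fin 3 → ℤ) → ℂ) (x : Fin N → Fin 3 → ℝ) : ℂ :=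
  (nrmc N : ℂ) * ∑ P ∈ D, c P * eP P x

theorem eP_contDiff (P : Fin N → Fin 3 → ℤ) : ContDiff ℝ (⊤ : ℕ∞) (eP P) := by
  have : eP P = fun x => ∏ j, ek (P j) (x j) := rfl
  rw [this]
  exact contDiff_prod fun j _ => (ek_contDiff (P j)).comp (contDiff_apply ℝ (Fin 3 → ℝ) j)

theorem tp_contDiff (D) (c : (Fin N → Fin 3 → ℤ) → ℂ) : ContDiff ℝ (⊤ : ℕ∞) (tp D c) := by
  have : tp D c = fun x => (nrmc N : ℂ) * ∑ P ∈ D, c P * eP P x := rfl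
  rw [this]
  exact contDiff_const.mul (ContDiff.sum fun P _ => contDiff_const.mul (eP_contDiff P))

theorem eP_inner (P Q : Fin N → Fin 3 → ℤ) :
    ∫ x in boxN N, (starRingEnd ℂ) (eP P x) * eP Q x = if P = Q then ((2*π : ℂ))^(3*N) else 0 := by
  have e : ∀ x, (starRingEnd ℂ) (eP P x) * eP Q x = ∏ j, ek (-P j + Q j) (x j) := by
    intro x; unfold eP
    rw [map_prod, ← Finset.prod_mul_distrib]
    exact Finset.prod_congr rfl fun j _ => by rw [ek_conj, ← ek_add]
  simp_rw [e]
  rw [prodint]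
  simp_rw [int_ek]
  split_ifs with h
  · subst h; simp [pow_mul]
  · have : ∃ i, P i ≠ Q i := by by_contra hh; push Not at hh; exact h (funext hh)
    obtain ⟨i, hi⟩ := this
    refine Finset.prod_eq_zero (Finset.mem_univ i) (if_neg ?_)
    intro h0; exact hi (neg_add_eq_zero.1 h0)

theorem tp_norm (D) (c : (Fin N → Fin 3 → ℤ) → ℂ) : ∫ x in boxN N, ‖tp D c x‖^2 = ∑ P ∈ D, ‖c P‖^2 := by
  have h : ((∫ x in boxN N, ‖tp D c x‖^2 : ℝ) : ℂ) = ((∑ P ∈ D, ‖c P‖^2 : ℝ) : ℂ) := by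
    rw [← integral_complex_ofReal]
    have e : ∀ x, ((‖tp D c x‖^2 : ℝ) : ℂ) = ∑ P ∈ D, ∑ Q ∈ D, ((nrmc N : ℂ)^2 * ((starRingEnd ℂ) (c P) * c Q)) * ((starRingEnd ℂ) (eP P x) * eP Q x) := by
      intro x
      rw [← Complex.normSq_eq_norm_sq, Complex.normSq_eq_conj_mul_self]
      unfold tp
      rw [map_mul, Complex.conj_ofReal, map_sum, mul_mul_mul_comm, Finset.sum_mul_sum, Finset.mul_sum]
      refine Finset.sum_congr rfl fun P _ => ?_
      rw [Finset.mul_sum]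
      refine Finset.sum_congr rfl fun Q _ => ?_
      rw [map_mul]; ring
    have hc : ∀ P : Fin N → Fin 3 → ℤ, Continuous (eP P) := fun P => (eP_contDiff P).continuous
    have hi : ∀ P Q : Fin N → Fin 3 → ℤ, IntegrableOn (fun x => ((nrmc N : ℂ)^2 * ((starRingEnd ℂ) (c P) * c Q)) * ((starRingEnd ℂ) (eP P x) * eP Q x)) (boxN N) := by
      intro P Q
      exact boxN_cint _ (continuous_const.mul ((Complex.continuous_conj.comp (hc P)).mul (hc Q)))
    have e2 : ∫ x in boxN N, ((‖tp D c x‖^2 : ℝ) : ℂ) = ∑ P ∈ D, ∑ Q ∈ D, ((nrmc N : ℂ)^2 * ((starRingEnd ℂ) (c P) * c Q)) * (if P = Q then ((2*π : ℂ))^(3*N) else 0) := by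
      simp_rw [e]
      rw [integral_finset_sum _ fun P _ => integrable_finset_sum _ fun Q _ => hi P Q]
      refine Finset.sum_congr rfl fun P _ => ?_
      rw [integral_finset_sum _ fun Q _ => hi P Q]
      refine Finset.sum_congr rfl fun Q _ => ?_
      rw [integral_const_mul, eP_inner]
    refine e2.trans ?_
    push_cast
    refine Finset.sum_congr rfl fun P hP => ?_
    rw [Finset.sum_eq_single P]
    · rw [if_pos rfl, ← Complex.normSq_eq_conj_mul_self, Complex.normSq_eq_norm_sq]
      have := nrmc_sq (N := N)
      have h2 : ((nrmc N : ℂ))^2 * ((2*π : ℂ))^(3*N) = 1 := by exact_mod_cast this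
      push_cast
      linear_combination (‖c P‖^2 : ℂ) * h2
    · intro Q _ hQ; rw [if_neg (Ne.symm hQ), mul_zero]
    · intro h; exact absurd hP h
  exact_mod_cast h

theorem single_smul_apply (j l : Fin N) (i m : Fin 3) (t : ℝ) :
    (t • (Pi.single j (Pi.single i (1:ℝ)) : Fin N → Fin 3 → ℝ)) l m = if l = j ∧ m = i then t else 0 := by
  by_cases h : l = j
  · subst h
    by_cases h' : m = i
    · subst h'; simp
    · simp [h']
  · simp [h]

theorem eP_eq (P : Fin N → Fin 3 → ℤ) (x) : eP P x = Complex.exp (Complex.I * ((∑ j, ∑ i, (P j i : ℝ) * x j i : ℝ) : ℂ)) := by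
  unfold eP ek; rw [← Complex.exp_sum, ← Finset.mul_sum]; push_cast; rfl

theorem eP_line (P : Fin N → Fin 3 → ℤ) (x) (j : Fin N) (i : Fin 3) (t : ℝ) :
    eP P (x + t • (Pi.single j (Pi.single i (1:ℝ)) : Fin N → Fin 3 → ℝ)) = eP P x * Complex.exp (Complex.I * (P j i : ℂ) * t) := by
  rw [eP_eq, eP_eq, ← Complex.exp_add]
  congr 1
  have : ∑ l, ∑ m, (P l m : ℝ) * (x + t • (Pi.single j (Pi.single i (1:ℝ)) : Fin N → Fin 3 → ℝ)) l m = ∑ l, ∑ m, (P l m : ℝ) * x l m + (P j i : ℝ) * t := by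
    have e : (P j i : ℝ) * t = ∑ l, ∑ m, (P l m : ℝ) * (t • (Pi.single j (Pi.single i (1:ℝ)) : Fin N → Fin 3 → ℝ)) l m := by
      simp_rw [single_smul_apply]
      rw [Finset.sum_eq_single j]
      · rw [Finset.sum_eq_single i]
        · simp
        · intro m _ hm; simp [hm]
        · simp
      · intro l _ hl; simp [hl]
      · simp
    rw [e, ← Finset.sum_add_distrib]
    refine Finset.sum_congr rfl fun l _ => ?_
    rw [← Finset.sum_add_distrib]
    refine Finset.sum_congr rfl fun m _ => ?_
    rw [Pi.add_apply, Pi.add_apply, mul_add]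
  rw [this]; push_cast; ring

theorem tp_fderiv (D) (c : (Fin N → Fin 3 → ℤ) → ℂ) (x) (j : Fin N) (i : Fin 3) :
    fderiv ℝ (tp D c) x (Pi.single j (Pi.single i (1 : ℝ))) = tp D (fun P => Complex.I * (P j i : ℂ) * c P) x := by
  have hd : DifferentiableAt ℝ (tp D c) x := ((tp_contDiff D c).differentiable (by simp)) x
  rw [← hd.lineDeriv_eq_fderiv]
  apply HasLineDerivAt.lineDeriv
  unfold HasLineDerivAt
  have h1 : ∀ P : Fin N → Fin 3 → ℤ, HasDerivAt (fun t : ℝ => Complex.exp (Complex.I * (P j i : ℂ) * t)) (Complex.I * (P j i : ℂ)) 0 := by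
    intro P
    have h0 : HasDerivAt (fun t : ℝ => Complex.I * (P j i : ℂ) * (t:ℂ)) (Complex.I * (P j i : ℂ) * 1) 0 :=
      (HasDerivAt.ofReal_comp (hasDerivAt_id (0:ℝ))).const_mul _ |>.congr_deriv (by simp)
    have := h0.cexp
    refine this.congr_deriv ?_
    simp
  have h2 : HasDerivAt (fun t : ℝ => (nrmc N : ℂ) * ∑ P ∈ D, c P * (eP P x * Complex.exp (Complex.I * (P j i : ℂ) * t)))
      ((nrmc N : ℂ) * ∑ P ∈ D, c P * (eP P x * (Complex.I * (P j i : ℂ)))) 0 :=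
    (HasDerivAt.fun_sum fun P _ => ((h1 P).const_mul _).const_mul _).const_mul _
  have e1 : (fun t : ℝ => tp D c (x + t • (Pi.single j (Pi.single i (1:ℝ)) : Fin N → Fin 3 → ℝ))) = fun t : ℝ => (nrmc N : ℂ) * ∑ P ∈ D, c P * (eP P x * Complex.exp (Complex.I * (P j i : ℂ) * t)) := by
    funext t; unfold tp; simp_rw [eP_line]
  rw [e1]
  refine h2.congr_deriv ?_
  unfold tp
  congr 1
  exact Finset.sum_congr rfl fun P _ => by ring

theorem tp_kin (D) (c : (Fin N → Fin 3 → ℤ) → ℂ) (j : Fin N) :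
    ∫ x in boxN N, ∑ i : Fin 3, ‖fderiv ℝ (tp D c) x (Pi.single j (Pi.single i (1 : ℝ)))‖ ^ 2
      = ∑ P ∈ D, znorm (P j)^2 * ‖c P‖^2 := by
  simp_rw [tp_fderiv]
  rw [integral_finset_sum]
  · simp_rw [tp_norm]
    rw [Finset.sum_comm]
    refine Finset.sum_congr rfl fun P _ => ?_
    unfold znorm
    rw [Real.sq_sqrt (Finset.sum_nonneg fun _ _ => sq_nonneg _), Finset.sum_mul]
    refine Finset.sum_congr rfl fun i _ => ?_
    rw [norm_mul, norm_mul, Complex.norm_I, one_mul, mul_pow, Complex.norm_intCast, sq_abs]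
  · intro i _
    exact boxN_cint _ ((tp_contDiff D _).continuous.norm.pow 2)

theorem ek_periodic (k) (y : Fin 3 → ℝ) (m : Fin 3 → ℤ) : ek k (y + fun i => 2 * π * (m i : ℝ)) = ek k y := by
  unfold ek
  rw [Complex.exp_eq_exp_iff_exists_int]
  refine ⟨∑ i, k i * m i, ?_⟩
  push_cast
  simp only [Pi.add_apply]
  push_cast
  simp only [mul_add, Finset.sum_add_distrib, Finset.sum_mul]
  congr 1
  rw [Finset.mul_sum]
  exact Finset.sum_congr rfl fun i _ => by ring

theorem eP_periodic (P : Fin N → Fin 3 → ℤ) (x) (j : Fin N) (m : Fin 3 → ℤ) :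
    eP P (Function.update x j (x j + fun i => 2 * π * (m i : ℝ))) = eP P x := by
  unfold eP
  refine Finset.prod_congr rfl fun l _ => ?_
  by_cases h : l = j
  · subst h; rw [Function.update_self, ek_periodic]
  · rw [Function.update_of_ne h]

theorem eP_perm (P : Fin N → Fin 3 → ℤ) (x) (σ : Equiv.Perm (Fin N)) : eP (P ∘ σ) (x ∘ σ) = eP P x := by
  unfold eP
  exact Equiv.prod_comp σ (fun j => ek (P j) (x j))

theorem tp_admissible (D : Finset (Fin N → Fin 3 → ℤ)) (c : (Fin N → Fin 3 → ℤ) → ℂ)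
    (hD : ∀ P (σ : Equiv.Perm (Fin N)), P ∈ D → P ∘ σ ∈ D)
    (hc : ∀ P (σ : Equiv.Perm (Fin N)), c (P ∘ σ) = ((Equiv.Perm.sign σ : ℤ) : ℂ) * c P)
    (h1 : ∑ P ∈ D, ‖c P‖^2 = 1) : IsAdmissible N (tp D c) where
  smooth := tp_contDiff D c
  periodic := by
    intro x j m; unfold tp; simp_rw [eP_periodic]
  antisymm := by
    intro x σ; unfold tp
    rw [mul_left_comm]
    congr 1
    rw [Finset.mul_sum]
    symm
    refine Finset.sum_bij (s := D) (t := D) (fun P _ => P ∘ σ) (fun P hP => hD P σ hP) ?_ ?_ ?_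
    · intro P _ Q _ h
      exact σ.surjective.injective_comp_right h
    · intro Q hQ
      refine ⟨Q ∘ σ.symm, hD Q σ.symm hQ, ?_⟩
      funext j; simp
    · intro P _
      rw [hc, eP_perm]; ring
  normalized := by rw [tp_norm, h1]

theorem eP_shift (P : Fin N → Fin 3 → ℤ) (x) (j : Fin N) (k : Fin 3 → ℤ) :
    ek k (x j) * eP P x = eP (P + Pi.single j k) x := by
  unfold eP
  rw [← Finset.mul_prod_erase _ _ (Finset.mem_univ j), ← Finset.mul_prod_erase (a := j) _ _ (Finset.mem_univ j), ← mul_assoc, ← ek_add]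
  congr 1
  · simp [add_comm]
  · refine Finset.prod_congr rfl fun l hl => ?_
    rw [Pi.add_apply, Pi.single_eq_of_ne (Finset.ne_of_mem_erase hl), add_zero]

theorem tp_shift1 (D : Finset (Fin N → Fin 3 → ℤ)) (c : (Fin N → Fin 3 → ℤ) → ℂ) (x) (j : Fin N) (k : Fin 3 → ℤ)
    (hcD : ∀ P, c P ≠ 0 → P ∈ D ∧ P + Pi.single j k ∈ D) :
    ek k (x j) * tp D c x = tp D (fun Q => c (Q - Pi.single j k)) x := by
  unfold tp
  rw [mul_left_comm, Finset.mul_sum]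
  congr 1
  refine Finset.sum_bij_ne_zero (fun P _ _ => P + Pi.single j k) ?_ ?_ ?_ ?_
  · intro P _ h
    exact (hcD P (by intro h0; apply h; rw [h0]; simp)).2
  · intro P _ _ Q _ _ h
    exact add_right_cancel h
  · intro Q _ h
    have h0 : c (Q - Pi.single j k) ≠ 0 := by intro h0; apply h; show c (Q - Pi.single j k) * _ = 0; rw [h0]; simp
    refine ⟨Q - Pi.single j k, (hcD _ h0).1, ?_, by simp⟩
    rw [mul_left_comm, eP_shift, sub_add_cancel]; exact h
  · intro P _ _
    show _ = c (P + Pi.single j k - Pi.single j k) * _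
    rw [mul_left_comm, eP_shift, add_sub_cancel_right]

theorem tp_shift (D : Finset (Fin N → Fin 3 → ℤ)) (c : (Fin N → Fin 3 → ℤ) → ℂ) (x) (k : Fin 3 → ℤ)
    (hcD : ∀ P j, c P ≠ 0 → P ∈ D ∧ P + Pi.single j k ∈ D) :
    (∑ j, ek k (x j)) * tp D c x = tp D (fun Q => ∑ j, c (Q - Pi.single j k)) x := by
  rw [Finset.sum_mul, Finset.sum_congr rfl fun j _ => tp_shift1 D c x j k fun P => hcD P j]
  unfold tp
  rw [← Finset.mul_sum, Finset.sum_comm]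
  congr 1
  exact Finset.sum_congr rfl fun P _ => by rw [Finset.sum_mul]

end

noncomputable section

variable {N : ℕ} {L : Finset (Fin 3 → ℤ)}

open Classical in
def cf (A : CarFam L) (ψ : Fock L) (P : Fin N → Fin 3 → ℤ) : ℝ :=
  if h : ∀ j, P j ∈ L then (Real.sqrt (N.factorial : ℝ))⁻¹ * (A.str N (fun j => ⟨P j, h j⟩) ψ) A.B else 0

theorem cf_coe (A : CarFam L) (ψ : Fock L) (Q : Fin N → L) :
    cf A ψ (fun j => (Q j : Fin 3 → ℤ)) = (Real.sqrt (N.factorial : ℝ))⁻¹ * (A.str N Q ψ) A.B := by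
  unfold cf; rw [dif_pos fun j => (Q j).2]

theorem sum_piL {M : Type*} [AddCommMonoid M] (g : (Fin N → Fin 3 → ℤ) → M) :
    ∑ P ∈ Fintype.piFinset (fun _ : Fin N => L), g P = ∑ Q : Fin N → L, g (fun j => (Q j : Fin 3 → ℤ)) := by
  symm
  refine Finset.sum_bij (fun Q _ => fun j => (Q j : Fin 3 → ℤ)) ?_ ?_ ?_ ?_
  · intro Q _; simp
  · intro Q _ Q' _ h; funext j; exact Subtype.ext (congrFun h j)
  · intro P hP
    rw [Fintype.mem_piFinset] at hP
    exact ⟨fun j => ⟨P j, hP j⟩, Finset.mem_univ _, rfl⟩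
  · intro Q _; rfl

theorem cf_inner (A : CarFam L) {ψ φ : Fock L} (h : A.Sec N ψ) (h' : A.Sec N φ) :
    ∑ Q : Fin N → L, cf A ψ (fun j => (Q j : Fin 3 → ℤ)) * cf A φ (fun j => (Q j : Fin 3 → ℤ)) = inner ℝ ψ φ := by
  simp_rw [cf_coe]
  have hN : (0:ℝ) < N.factorial := by exact_mod_cast N.factorial_pos
  have e : ∀ Q : Fin N → L, (Real.sqrt (N.factorial : ℝ))⁻¹ * (A.str N Q ψ) A.B * ((Real.sqrt (N.factorial : ℝ))⁻¹ * (A.str N Q φ) A.B)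
     = ((N.factorial : ℝ))⁻¹ * ((A.str N Q ψ) A.B * (A.str N Q φ) A.B) := by
    intro Q
    have : (Real.sqrt (N.factorial : ℝ))⁻¹ * (Real.sqrt (N.factorial : ℝ))⁻¹ = ((N.factorial : ℝ))⁻¹ := by
      rw [← mul_inv, Real.mul_self_sqrt hN.le]
    rw [← this]; ring
  simp_rw [e]
  rw [← Finset.mul_sum, A.str_iso N h h', ← mul_assoc, inv_mul_cancel₀ hN.ne', one_mul]

theorem cf_perm (A : CarFam L) (ψ : Fock L) (P : Fin N → Fin 3 → ℤ) (σ : Equiv.Perm (Fin N)) :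
    cf A ψ (P ∘ σ) = ((Equiv.Perm.sign σ : ℤ) : ℝ) * cf A ψ P := by
  by_cases h : ∀ j, P j ∈ L
  · have h' : ∀ j, (P ∘ σ) j ∈ L := fun j => h (σ j)
    unfold cf
    rw [dif_pos h, dif_pos h']
    have : (fun j => (⟨(P ∘ σ) j, h' j⟩ : L)) = (fun j => (⟨P j, h j⟩ : L)) ∘ σ := rfl
    rw [this, A.str_perm, fsmul_apply, PiLp.smul_apply, smul_eq_mul]; ring
  · have h' : ¬ ∀ j, (P ∘ σ) j ∈ L := by
      intro h'; apply h; intro j; have := h' (σ.symm j); simpa using this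
    unfold cf
    rw [dif_neg h, dif_neg h', mul_zero]

open Classical in
/-- matrix of the momentum shift -/
def shm (L : Finset (Fin 3 → ℤ)) (k : Fin 3 → ℤ) (p q : L) : ℝ := if (q : Fin 3 → ℤ) = (p : Fin 3 → ℤ) - k then 1 else 0

def dgm (L : Finset (Fin 3 → ℤ)) (p q : L) : ℝ := if p = q then znorm p ^ 2 else 0

theorem cf_shift (A : CarFam L) {ψ : Fock L} (h : A.Sec N ψ) (k : Fin 3 → ℤ) (Q : Fin N → L) :
    ∑ j, cf A ψ ((fun j => (Q j : Fin 3 → ℤ)) - Pi.single j k) = cf A (A.ob1 (shm L k) ψ) (fun j => (Q j : Fin 3 → ℤ)) := by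
  rw [cf_coe, A.str_ob1_apply _ h, WithLp.ofLp_sum, Finset.sum_apply, Finset.mul_sum]
  refine Finset.sum_congr rfl fun j _ => ?_
  by_cases hj : (Q j : Fin 3 → ℤ) - k ∈ L
  · rw [Finset.sum_eq_single ⟨(Q j : Fin 3 → ℤ) - k, hj⟩]
    · have e : ((fun j => (Q j : Fin 3 → ℤ)) - Pi.single j k) = fun l => ((Function.update Q j ⟨(Q j : Fin 3 → ℤ) - k, hj⟩ l : L) : Fin 3 → ℤ) := by
        funext l
        by_cases hl : l = j
        · subst hl; simp
        · simp [hl]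
      rw [e, cf_coe]
      unfold shm
      rw [if_pos rfl, one_smul]
    · intro q _ hq
      unfold shm
      rw [if_neg (fun h => hq (Subtype.ext h)), zero_smul]
    · simp
  · have h1 : ¬ ∀ l, ((fun j => (Q j : Fin 3 → ℤ)) - Pi.single j k : Fin N → Fin 3 → ℤ) l ∈ L := by
      intro hh; have := hh j; simp at this; exact hj this
    unfold cf
    rw [dif_neg h1, Finset.sum_eq_zero]
    · simp
    · intro q _
      unfold shm
      rw [if_neg, zero_smul]
      intro hq; exact hj (hq ▸ q.2)

theorem cf_diag (A : CarFam L) {ψ : Fock L} (h : A.Sec N ψ) (Q : Fin N → L) :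
    (∑ j, znorm (Q j) ^ 2) * cf A ψ (fun j => (Q j : Fin 3 → ℤ)) = cf A (A.ob1 (dgm L) ψ) (fun j => (Q j : Fin 3 → ℤ)) := by
  rw [cf_coe, cf_coe, A.str_ob1_apply _ h, WithLp.ofLp_sum, Finset.sum_apply, Finset.mul_sum, Finset.sum_mul]
  refine Finset.sum_congr rfl fun j _ => ?_
  rw [Finset.sum_eq_single (Q j)]
  · unfold dgm
    rw [if_pos rfl, Function.update_eq_self, PiLp.smul_apply, smul_eq_mul]; ring
  · intro q _ hq
    unfold dgm
    rw [if_neg (Ne.symm hq), zero_smul]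
  · simp

set_option maxHeartbeats 1000000 in
theorem fock_energy (V : (Fin 3 → ℤ) → ℝ) (hnn : ∀ k, 0 ≤ V k) (hfin : (Function.support V).Finite)
    (A : CarFam L) (ψ : Fock L) (hS : A.Sec N ψ) (hψ : ‖ψ‖ = 1) (L' : Finset (Fin 3 → ℤ))
    (hL' : ∀ p : L, (p : Fin 3 → ℤ) ∉ L' → A.a p ψ = 0)
    (g : (Fin 3 → ℤ) → (Fin 3 → ℤ)) (hg : ∀ k, g k = k ∨ g k = -k)
    (hk : ∀ k ∈ hfin.toFinset, ∀ p ∈ L', p + g k ∈ L) :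
    groundEnergy V N ≤ (((N : ℝ) ^ ((1 : ℝ) / 3))⁻¹) ^ 2 * inner ℝ ψ (A.ob1 (dgm L) ψ)
      + 1/(2*N) * ∑ k ∈ hfin.toFinset, V k * (‖A.ob1 (shm L (g k)) ψ‖^2 - N) := by
  classical
  set D := Fintype.piFinset (fun _ : Fin N => L) with hD
  set c : (Fin N → Fin 3 → ℤ) → ℂ := fun P => (cf A ψ P : ℂ) with hc
  have hcz : ∀ P, c P ≠ 0 → ∀ j, P j ∈ L ∧ P j ∈ L' := by
    intro P hP
    have h : ∀ j, P j ∈ L := by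
      by_contra h; apply hP; simp only [hc]; unfold cf; rw [dif_neg h]; simp
    intro j
    refine ⟨h j, ?_⟩
    by_contra hj
    apply hP
    simp only [hc]; unfold cf
    rw [dif_pos h, A.str_zero ⟨P j, h j⟩ N (hL' _ hj) _ j rfl]
    simp
  have hadm : IsAdmissible N (tp D c) := by
    refine tp_admissible D c ?_ ?_ ?_
    · intro P σ hP
      rw [hD, Fintype.mem_piFinset] at *
      exact fun j => hP (σ j)
    · intro P σ
      simp only [hc]; rw [cf_perm]; push_cast; rfl
    · rw [hD, sum_piL]
      have := cf_inner A hS hS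
      rw [real_inner_self_eq_norm_sq, hψ, one_pow] at this
      rw [← this]
      refine Finset.sum_congr rfl fun Q _ => ?_
      simp only [hc]; rw [Complex.norm_real, Real.norm_eq_abs, sq_abs]; ring
  refine (ground_le V hnn hfin _ hadm).trans (le_of_eq ?_)
  rw [energy_eq V hfin _ hadm]
  congr 1
  · congr 1
    simp_rw [tp_kin]
    rw [Finset.sum_comm, hD, sum_piL, ← cf_inner A hS (A.sec_ob1 hS _)]
    refine Finset.sum_congr rfl fun Q _ => ?_
    rw [← cf_diag A hS, ← Finset.sum_mul]
    simp only [hc]; rw [Complex.norm_real, Real.norm_eq_abs, sq_abs]; ring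
  · congr 1
    refine Finset.sum_congr rfl fun k hkk => ?_
    congr 2
    have e0 : ∀ x : Fin N → Fin 3 → ℝ, ‖(∑ j, ek k (x j)) * tp D c x‖ = ‖(∑ j, ek (g k) (x j)) * tp D c x‖ := by
      intro x
      rcases hg k with h | h
      · rw [h]
      · rw [h, norm_mul, norm_mul, ← Complex.norm_conj (∑ j, ek k (x j)), map_sum]
        simp_rw [ek_conj]
    have e : ∀ x, (∑ j, ek (g k) (x j)) * tp D c x = tp D (fun Q => ∑ j, c (Q - Pi.single j (g k))) x := by
      intro x
      refine tp_shift D c x (g k) ?_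
      intro P j hP
      have h1 := hcz P hP
      rw [hD, Fintype.mem_piFinset, Fintype.mem_piFinset]
      refine ⟨fun l => (h1 l).1, fun l => ?_⟩
      by_cases hl : l = j
      · subst hl
        simp only [Pi.add_apply, Pi.single_eq_same]
        exact hk k hkk _ (h1 l).2
      · simp only [Pi.add_apply, Pi.single_eq_of_ne hl, add_zero]; exact (h1 l).1
    simp_rw [e0, e]
    rw [tp_norm, hD, sum_piL, ← real_inner_self_eq_norm_sq, ← cf_inner A (A.sec_ob1 hS _) (A.sec_ob1 hS _)]
    refine Finset.sum_congr rfl fun Q _ => ?_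
    rw [← cf_shift A hS]
    have : ∑ j, c ((fun j => (Q j : Fin 3 → ℤ)) - Pi.single j (g k)) = ((∑ j, cf A ψ ((fun j => (Q j : Fin 3 → ℤ)) - Pi.single j (g k)) : ℝ) : ℂ) := by
      push_cast; rfl
    rw [this, Complex.norm_real, Real.norm_eq_abs, sq_abs]; ring

end

/-! ### Particle-hole transformation -/

noncomputable section

variable {Λ : Type*} [Fintype Λ] [DecidableEq Λ]

def pha (B : Finset Λ) (p : Λ) : FOp Λ := if p ∈ B then cop p else dop p

theorem star_pha (B : Finset Λ) (p : Λ) : star (pha B p) = if p ∈ B then dop p else cop p := by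
  unfold pha
  by_cases h : p ∈ B
  · rw [if_pos h, if_pos h, star_cop]
  · rw [if_neg h, if_neg h, star_dop]

theorem cop_dop_ne {p q : Λ} (h : p ≠ q) : (cop q : FOp Λ) * dop p = -(dop p * cop q) := by
  rw [cop_dop, if_neg h]; exact zero_sub _

theorem dop_cop_ne {p q : Λ} (h : p ≠ q) : (dop p : FOp Λ) * cop q = -(cop q * dop p) := by
  rw [cop_dop_ne h]; exact (neg_neg _).symm

theorem add_of_anti {R : Type*} [Ring R] {a b : R} (h : a = -b) : a + b = 0 := by rw [h]; simp

def phFam (B : Finset Λ) : CarFam Λ where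
  a := pha B
  B := B
  haa := by
    intro p q
    unfold pha
    by_cases hp : p ∈ B <;> by_cases hq : q ∈ B
    · rw [if_pos hp, if_pos hq]; exact cop_cop p q
    · rw [if_pos hp, if_neg hq]
      exact cop_dop_ne (fun h => hq (h ▸ hp))
    · rw [if_neg hp, if_pos hq]
      exact dop_cop_ne (fun h => hp (h ▸ hq))
    · rw [if_neg hp, if_neg hq]; exact dop_dop p q
  hac := by
    intro p q
    rw [star_pha]
    unfold pha
    by_cases hp : p ∈ B <;> by_cases hq : q ∈ B
    · rw [if_pos hp, if_pos hq]
      have := dop_cop q p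
      rw [add_comm, this]
      by_cases h : p = q
      · rw [if_pos h, if_pos h.symm]
      · rw [if_neg h, if_neg (Ne.symm h)]
    · rw [if_pos hp, if_neg hq, if_neg (show p ≠ q from fun h => hq (h ▸ hp))]
      exact add_of_anti (cop_cop p q)
    · rw [if_neg hp, if_pos hq, if_neg (show p ≠ q from fun h => hp (h ▸ hq))]
      exact add_of_anti (dop_dop p q)
    · rw [if_neg hp, if_neg hq]; exact dop_cop p q
  hvac := by
    intro φ φ' h
    rw [fock_inner]
    rw [Finset.sum_eq_single B]
    · intro S _ hS
      suffices φ S = 0 by rw [this, zero_mul]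
      obtain ⟨r, hr⟩ : ∃ r, ¬ (r ∈ S ↔ r ∈ B) := by
        by_contra hc; push Not at hc; exact hS (Finset.ext fun r => by simpa using hc r)
      have hz : ∀ (q : Λ) (T : Finset Λ), (pha B q φ) T = 0 := by
        intro q T; rw [h q]; rfl
      by_cases hrS : r ∈ S
      · have hrB : r ∉ B := fun hB => hr (by simp [hrS, hB])
        have := hz r (S.erase r)
        unfold pha at this
        rw [if_neg hrB, dop_apply, if_neg (Finset.notMem_erase r S), Finset.insert_erase hrS] at this
        have hs := fsgn_sq r (S.erase r)
        rcases mul_eq_zero.1 this with h1 | h1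
        · rw [h1] at hs; norm_num at hs
        · exact h1
      · have hrB : r ∈ B := by by_contra hB; exact hr (by simp [hrS, hB])
        have := hz r (insert r S)
        unfold pha at this
        rw [if_pos hrB, cop_apply, if_pos (Finset.mem_insert_self r S), Finset.erase_insert hrS] at this
        have hs := fsgn_sq r S
        rcases mul_eq_zero.1 this with h1 | h1
        · rw [h1] at hs; norm_num at hs
        · exact h1
    · simp

theorem phFam_a (B : Finset Λ) (p : Λ) : (phFam B).a p = pha B p := rfl

theorem pha_in {B : Finset Λ} {p : Λ} (h : p ∈ B) : pha B p = cop p := if_pos h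
theorem pha_out {B : Finset Λ} {p : Λ} (h : p ∉ B) : pha B p = dop p := if_neg h

/-- cop then dop on the vacuum -/
theorem dop_cop_fvac (p : Λ) : (dop p : FOp Λ) (cop p fvac) = fvac := by
  have h := congrArg (fun A : FOp Λ => A fvac) (dop_cop p p)
  simp only [if_true, fadd_apply, fmul_apply, fone_apply, dop_fvac, map_zero, add_zero] at h
  exact h

theorem ob1_diag_fvac (B : Finset Λ) (ε : Λ → ℝ) :
    (phFam B).ob1 (fun p q => if p = q then ε p else 0) fvac = (∑ p ∈ B, ε p) • (fvac : Fock Λ) := by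
  unfold CarFam.ob1
  rw [fsum_apply, Finset.sum_smul, ← Finset.sum_filter_add_sum_filter_not Finset.univ (fun p => p ∈ B)]
  have e1 : ∀ p, (∑ q, (if p = q then ε p else 0) • (star ((phFam B).a p) * (phFam B).a q) : FOp Λ) fvac
      = ε p • star (pha B p) (pha B p fvac) := by
    intro p
    rw [fsum_apply, Finset.sum_eq_single p]
    · simp only [if_true]; rfl
    · intro q _ hq; rw [if_neg (Ne.symm hq), fzero_smul]; rfl
    · simp
  rw [Finset.sum_congr rfl fun p _ => e1 p, Finset.sum_congr (s₁ := Finset.univ.filter (fun p => ¬ p ∈ B)) rfl fun p _ => e1 p]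
  rw [Finset.sum_eq_zero (s := Finset.univ.filter (fun p => ¬ p ∈ B)), add_zero]
  · rw [Finset.filter_mem_eq_inter, Finset.univ_inter]
    refine Finset.sum_congr rfl fun p hp => ?_
    rw [star_pha, if_pos hp, pha_in hp, dop_cop_fvac]
  · intro p hp
    have hp' : p ∉ B := (Finset.mem_filter.1 hp).2
    rw [pha_out hp', dop_fvac, map_zero, smul_zero]

theorem comm_aux1 {R : Type*} [Ring R] {p h q : R} (h1 : p * h = -(h * p)) (h2 : p * q = -(q * p)) :
    p * (h * q) = h * q * p := by
  calc p * (h * q) = (p * h) * q := by noncomm_ring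
    _ = -(h * (p * q)) := by rw [h1]; noncomm_ring
    _ = _ := by rw [h2]; noncomm_ring

theorem comm_aux2 {R : Type*} [Ring R] {t s q s' q' : R} (h1 : t * s = s * t + s') (h2 : q * t = t * q + q') :
    t * (s * q) - s * q * t = s' * q - s * q' := by
  calc t * (s * q) - s * q * t = (t * s) * q - s * (q * t) := by noncomm_ring
    _ = _ := by rw [h1, h2]; noncomm_ring

variable {Γ J : Type*} [Fintype Γ] [DecidableEq Γ] [Fintype J] [DecidableEq J]

namespace Bog

variable (Q : Bog Λ Γ J) (B : Finset Λ)

theorem bx_ph (hP : ∀ x, Q.P x ∉ B) (hH : ∀ x, Q.H x ∈ B) (x : Γ) : Q.bx x = star ((phFam B).a (Q.H x)) * (phFam B).a (Q.P x) := by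
  rw [phFam_a, phFam_a, star_pha, if_pos (hH x), pha_out (hP x)]; rfl

theorem sbx_ph (hP : ∀ x, Q.P x ∉ B) (hH : ∀ x, Q.H x ∈ B) (x : Γ) : star (Q.bx x) = star ((phFam B).a (Q.P x)) * (phFam B).a (Q.H x) := by
  rw [Q.star_bx, phFam_a, phFam_a, star_pha, if_neg (hP x), pha_in (hH x)]

theorem sec_psi (hP : ∀ x, Q.P x ∉ B) (hH : ∀ x, Q.H x ∈ B) : (phFam B).Sec B.card (Q.psi 1) := by
  unfold CarFam.Sec
  rw [Q.resC (phFam B).numop]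
  · unfold CarFam.numop
    rw [ob1_diag_fvac B (fun _ => 1)]
    rw [map_smul]
    simp [psi]
  · intro x
    rw [Q.bx_ph B hP hH]
    exact CarFam.ring_aux21 _ _ _ ((phFam B).numop_as _) ((phFam B).a_numop _)
  · intro x
    rw [Q.sbx_ph B hP hH]
    exact CarFam.ring_aux21 _ _ _ ((phFam B).numop_as _) ((phFam B).a_numop _)


theorem unused_psi {p : Λ} (hpB : p ∉ B) (hH : ∀ x, Q.H x ∈ B) (hp : ∀ x, Q.P x ≠ p) :
    (phFam B).a p (Q.psi 1) = 0 := by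
  rw [phFam_a, pha_out hpB]
  have hpH : ∀ x, Q.H x ≠ p := fun x h => hpB (h ▸ hH x)
  rw [Q.resC (dop p)]
  · rw [dop_fvac, map_zero]
  · intro x
    exact comm_aux1 (dop_dop p (Q.H x)) (dop_dop p (Q.P x))
  · intro x
    rw [Q.star_bx]
    exact comm_aux1 (dop_cop_ne (hp x).symm) (dop_cop_ne (hpH x).symm)

theorem kin_psi (hP : ∀ x, Q.P x ∉ B) (hH : ∀ x, Q.H x ∈ B) (ε : Λ → ℝ) (M : ℝ) (hM : 0 ≤ M)
    (hε : ∀ x, |ε (Q.P x) - ε (Q.H x)| ≤ M) :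
    inner ℝ (Q.psi 1) ((phFam B).ob1 (fun p q => if p = q then ε p else 0) (Q.psi 1)) ≤
      ∑ p ∈ B, ε p + ∑ j, 1/2*(Real.cosh (2*Q.kp j)-1)*
        ((inner ℝ (Q.F j) (emul (fun x => ε (Q.P x) - ε (Q.H x)) (Q.F j)))
          + (inner ℝ (Q.G j) (emul (fun x => ε (Q.P x) - ε (Q.H x)) (Q.G j)))) + 4*Q.C0*Q.cI*Q.ρ*M := by
  set T := (phFam B).ob1 (fun p q => if p = q then ε p else 0) with hT
  have h1 : ∀ r, (phFam B).a r * T = T * (phFam B).a r + ε r • (phFam B).a r := by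
    intro r
    rw [hT, CarFam.a_ob1]
    congr 1
    rw [Finset.sum_eq_single r]
    · simp only [if_true]
    · intro q _ hq; rw [if_neg (Ne.symm hq)]; exact fzero_smul _
    · simp
  have hs : star T = T := by
    rw [hT]; unfold CarFam.ob1
    rw [fstar_sum]
    refine Finset.sum_congr rfl fun p _ => ?_
    rw [fstar_sum]
    refine Finset.sum_congr rfl fun q _ => ?_
    by_cases h : p = q
    · subst h; rw [fstar_smul, fstar_mul, fstar_star]
    · simp only [if_neg h]; rw [fzero_smul]; have h0 := fstar_smul 0 (1 : FOp Λ); rwa [fzero_smul, fzero_smul] at h0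
  have h2 : ∀ r, T * star ((phFam B).a r) = star ((phFam B).a r) * T + ε r • star ((phFam B).a r) := by
    intro r
    have h := congrArg star (h1 r)
    rw [fstar_mul, fstar_add, fstar_mul, hs, fstar_smul] at h
    exact h
  refine Q.resB T hs (fun x => ε (Q.P x) - ε (Q.H x)) ?_ _ (ob1_diag_fvac B ε) M hM hε
  intro x
  rw [Q.bx_ph B hP hH]
  rw [comm_aux2 (h2 (Q.H x)) (h1 (Q.P x)), fsmul_mul, fmul_smul, fsub_smul]
  exact (neg_sub _ _).symm

theorem shift_psi (hP : ∀ x, Q.P x ∉ B) (hH : ∀ x, Q.H x ∈ B) (m : Λ → Λ → ℝ) (hm0 : ∀ p q, |m p q| ≤ 1) (hmd : ∀ p, m p p = 0)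
    (hr : ∀ p q q', m p q ≠ 0 → m p q' ≠ 0 → q = q') (hc : ∀ p p' q, m p q ≠ 0 → m p' q ≠ 0 → p = p')
    (α β : EuclideanSpace ℝ Γ)
    (hα : ∀ p q, p ∈ B → q ∉ B → m p q = ∑ x, if Q.H x = p ∧ Q.P x = q then α x else 0)
    (hβ : ∀ p q, p ∉ B → q ∈ B → m p q = ∑ x, if Q.P x = p ∧ Q.H x = q then β x else 0) (ψ : Fock Λ) :
    ‖(phFam B).ob1 m ψ - Q.ob α β ψ‖ ≤ 2 * nrm2 ψ := by
  classical
  let s1 : Finset (Λ × Λ) := Finset.univ.filter fun r => m r.1 r.2 ≠ 0 ∧ r.1 ∉ B ∧ r.2 ∉ B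
  let s2 : Finset (Λ × Λ) := Finset.univ.filter fun r => m r.1 r.2 ≠ 0 ∧ r.1 ∈ B ∧ r.2 ∈ B
  have key : (phFam B).ob1 m ψ - Q.ob α β ψ = ∑ r ∈ s1, m r.1 r.2 • (cop r.1 : FOp Λ) ((dop r.2 : FOp Λ) ψ)
      - ∑ r ∈ s2, m r.1 r.2 • (cop r.2 : FOp Λ) ((dop r.1 : FOp Λ) ψ) := by
    have e1 : Q.b α ψ = ∑ r : Λ × Λ, (∑ x, if Q.H x = r.1 ∧ Q.P x = r.2 then α x else 0) • (dop r.1 : FOp Λ) ((dop r.2 : FOp Λ) ψ) := by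
      simp_rw [Finset.sum_smul]
      rw [Finset.sum_comm]
      unfold PairSys.b
      rw [fsum_apply]
      refine Finset.sum_congr rfl fun x _ => ?_
      rw [Finset.sum_eq_single (Q.H x, Q.P x)]
      · simp only [and_self, if_true]; rfl
      · rintro ⟨p, q⟩ _ hne
        rw [if_neg, zero_smul]
        rintro ⟨h1, h2⟩; exact hne (by simp at h1 h2; rw [h1, h2])
      · simp
    have e2 : Q.bs β ψ = ∑ r : Λ × Λ, (∑ x, if Q.P x = r.1 ∧ Q.H x = r.2 then β x else 0) • (cop r.1 : FOp Λ) ((cop r.2 : FOp Λ) ψ) := by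
      simp_rw [Finset.sum_smul]
      rw [Finset.sum_comm, Q.bs_eq, fsum_apply]
      refine Finset.sum_congr rfl fun x _ => ?_
      rw [Finset.sum_eq_single (Q.P x, Q.H x)]
      · simp only [and_self, if_true]; rw [Q.star_bx]; rfl
      · rintro ⟨p, q⟩ _ hne
        rw [if_neg, zero_smul]
        rintro ⟨h1, h2⟩; exact hne (by simp at h1 h2; rw [h1, h2])
      · simp
    have e3 : (phFam B).ob1 m ψ = ∑ r : Λ × Λ, m r.1 r.2 • star (pha B r.1) (pha B r.2 ψ) := by
      unfold CarFam.ob1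
      rw [fsum_apply, Fintype.sum_prod_type]
      refine Finset.sum_congr rfl fun p _ => ?_
      rw [fsum_apply]; rfl
    have e4 : Q.ob α β ψ = Q.b α ψ + Q.bs β ψ := rfl
    rw [e4, e1, e2, e3]
    simp only [s1, s2]
    rw [Finset.sum_filter, Finset.sum_filter, ← Finset.sum_add_distrib, ← Finset.sum_sub_distrib, ← Finset.sum_sub_distrib]
    refine Finset.sum_congr rfl ?_
    rintro ⟨p, q⟩ _
    simp only
    have z1 : ¬ (p ∈ B ∧ q ∉ B) → (∑ x, if Q.H x = p ∧ Q.P x = q then α x else 0) = 0 := fun h =>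
      Finset.sum_eq_zero fun x _ => if_neg (by rintro ⟨rfl, rfl⟩; exact h ⟨hH x, hP x⟩)
    have z2 : ¬ (p ∉ B ∧ q ∈ B) → (∑ x, if Q.P x = p ∧ Q.H x = q then β x else 0) = 0 := fun h =>
      Finset.sum_eq_zero fun x _ => if_neg (by rintro ⟨rfl, rfl⟩; exact h ⟨hP x, hH x⟩)
    rw [star_pha]
    by_cases hp : p ∈ B <;> by_cases hq : q ∈ B
    · rw [z1 (by tauto), z2 (by tauto), if_pos hp, pha_in hq, if_neg (by tauto)]
      by_cases hm : m p q = 0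
      · rw [hm]; simp
      · rw [if_pos ⟨hm, hp, hq⟩]
        have hne : p ≠ q := by rintro rfl; exact hm (hmd p)
        rw [← fmul_apply, dop_cop_ne hne, fneg_apply, fmul_apply]
        simp
    · rw [← hα p q hp hq, z2 (by tauto), if_pos hp, pha_out hq, if_neg (by tauto), if_neg (by tauto)]
      simp
    · rw [← hβ p q hp hq, z1 (by tauto), if_neg hp, pha_in hq, if_neg (by tauto), if_neg (by tauto)]
      simp
    · rw [z1 (by tauto), z2 (by tauto), if_neg hp, pha_out hq, if_neg (by tauto : ¬ (m p q ≠ 0 ∧ p ∈ B ∧ q ∈ B))]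
      by_cases hm : m p q = 0
      · rw [hm]; simp
      · rw [if_pos ⟨hm, hp, hq⟩]; simp
  rw [key, two_mul]
  refine (norm_sub_le _ _).trans (add_le_add ?_ ?_)
  · refine matching_bound s1 (fun r => m r.1 r.2) (fun r => hm0 _ _) Prod.fst Prod.snd ?_ ?_ ψ
    · rintro ⟨p, q⟩ h ⟨p', q'⟩ h' (rfl : p = p')
      rw [hr p q q' (Finset.mem_filter.1 h).2.1 (Finset.mem_filter.1 h').2.1]
    · rintro ⟨p, q⟩ h ⟨p', q'⟩ h' (rfl : q = q')
      rw [hc p p' q (Finset.mem_filter.1 h).2.1 (Finset.mem_filter.1 h').2.1]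
  · refine matching_bound s2 (fun r => m r.1 r.2) (fun r => hm0 _ _) Prod.snd Prod.fst ?_ ?_ ψ
    · rintro ⟨p, q⟩ h ⟨p', q'⟩ h' (rfl : q = q')
      rw [hc p p' q (Finset.mem_filter.1 h).2.1 (Finset.mem_filter.1 h').2.1]
    · rintro ⟨p, q⟩ h ⟨p', q'⟩ h' (rfl : p = p')
      rw [hr p q q' (Finset.mem_filter.1 h).2.1 (Finset.mem_filter.1 h').2.1]

theorem shift_sq (hP : ∀ x, Q.P x ∉ B) (hH : ∀ x, Q.H x ∈ B) (m : Λ → Λ → ℝ) (hm0 : ∀ p q, |m p q| ≤ 1) (hmd : ∀ p, m p p = 0)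
    (hr : ∀ p q q', m p q ≠ 0 → m p q' ≠ 0 → q = q') (hc : ∀ p p' q, m p q ≠ 0 → m p' q ≠ 0 → p = p')
    (α β : EuclideanSpace ℝ Γ)
    (hα : ∀ p q, p ∈ B → q ∉ B → m p q = ∑ x, if Q.H x = p ∧ Q.P x = q then α x else 0)
    (hβ : ∀ p q, p ∉ B → q ∈ B → m p q = ∑ x, if Q.P x = p ∧ Q.H x = q then β x else 0)
    (a : J → ℝ) (h1 : ∀ j, inner ℝ (Q.F j) β = (0:ℝ)) (h2 : ∀ j, inner ℝ (Q.G j) α = (0:ℝ))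
    (h3 : ∀ j, inner ℝ (Q.F j) α = a j) (h4 : ∀ j, inner ℝ (Q.G j) β = a j) :
    ‖(phFam B).ob1 m (Q.psi 1)‖ ^ 2 ≤ ‖β‖^2 + ∑ j, (Real.exp (-2*Q.kp j)-1)*a j^2 + Q.cI*Q.ρ*(‖α‖+‖β‖)^2
      + 8 * √Q.s * Q.cG ^ 2 * (‖α‖ + ‖β‖) + 4 * Q.cG ^ 2 := by
  have hA := Q.resA α β a h1 h2 h3 h4
  have hB := Q.shift_psi B hP hH m hm0 hmd hr hc α β hα hβ (Q.psi 1)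
  have hC := Q.ob_norm 1 zero_le_one le_rfl α β
  have hg : nrm2 (Q.psi 1) ≤ Q.cG := Q.gron_psi 1 zero_le_one le_rfl
  set X := (phFam B).ob1 m (Q.psi 1)
  set Y := Q.ob α β (Q.psi 1)
  have hX : ‖X‖ ≤ ‖Y‖ + 2 * Q.cG := by
    have : X = Y + (X - Y) := by abel
    rw [this]
    refine (norm_add_le _ _).trans ?_
    linarith
  have hcG := Q.cG_nonneg
  have hsq : ‖X‖^2 ≤ (‖Y‖ + 2 * Q.cG)^2 := pow_le_pow_left₀ (norm_nonneg _) hX 2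
  have : ‖Y‖ * Q.cG ≤ (2*√Q.s*Q.cG*(‖α‖+‖β‖)) * Q.cG := mul_le_mul_of_nonneg_right hC hcG
  nlinarith

end Bog
end

/-! ### Concrete Bogoliubov data -/

noncomputable section

abbrev Z3 := Fin 3 → ℤ

structure Dat where
  S : Finset Z3
  Sp : Finset Z3
  R : ℝ
  m : ℝ
  cut : Z3 → Finset Z3
  kp : Z3 → Z3 → ℝ
  φ : Z3 → Z3 → Z3 → ℝ
  C0 : ℝ
  ρ : ℝ
  hS0 : (0 : Z3) ∉ S
  hSn : ∀ k ∈ S, -k ∈ S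
  hSp : ∀ k ∈ Sp, k ∈ S
  hSpn : ∀ k ∈ Sp, -k ∉ Sp
  hSc : ∀ k ∈ S, k ∉ Sp → -k ∈ Sp
  hm0 : 0 ≤ m
  hm : ∀ k ∈ S, znorm k ≤ m
  hcut : ∀ k, cut k ⊆ Lset R k
  hkp : ∀ k i, 0 ≤ kp k i
  hφ : ∀ k i p, p ∉ cut k → φ k i p = 0
  horth : ∀ k ∈ Sp, ∀ i ∈ cut k, ∀ j ∈ cut k, ∑ p ∈ cut k, φ k i p * φ k j p = if i = j then 1 else 0
  hC0 : ∑ k ∈ Sp, ∑ i ∈ cut k, kp k i ≤ C0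
  hρ0 : 0 ≤ ρ
  hρ : ∀ k ∈ Sp, ∀ p ∈ cut k, ∑ i ∈ cut k, kp k i ^ 2 * φ k i p ^ 2 ≤ ρ ^ 2

def prs (S : Finset Z3) (t : Z3 → Finset Z3) : Finset (Z3 × Z3) := S.biUnion fun k => (t k).image (Prod.mk k)

theorem mem_prs {S : Finset Z3} {t : Z3 → Finset Z3} {x : Z3 × Z3} : x ∈ prs S t ↔ x.1 ∈ S ∧ x.2 ∈ t x.1 := by
  rcases x with ⟨a, b⟩
  simp [prs]

theorem sum_prs (S : Finset Z3) (t : Z3 → Finset Z3) (f : Z3 × Z3 → ℝ) :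
    ∑ y : ↥(prs S t), f y = ∑ k ∈ S, ∑ p ∈ t k, f (k, p) := by
  rw [Finset.sum_coe_sort (prs S t) f]
  exact Finset.sum_finset_product _ _ _ fun p => mem_prs

theorem sum_prs_if (S : Finset Z3) (t : Z3 → Finset Z3) (f : Z3 → ℝ) {k : Z3} (hk : k ∈ S) :
    ∑ y : ↥(prs S t), (if y.1.1 = k then f y.1.2 else 0) = ∑ p ∈ t k, f p := by
  rw [sum_prs S t (fun x => if x.1 = k then f x.2 else 0), Finset.sum_eq_single k]
  · simp
  · intro b _ hb; simp [hb]
  · exact fun h => absurd hk h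

theorem sum_Lset_neg (R : ℝ) (k : Z3) (f : Z3 → ℝ) : ∑ p ∈ Lset R (-k), f (-p) = ∑ p ∈ Lset R k, f p := by
  refine Finset.sum_nbij' (fun p => -p) (fun p => -p) ?_ ?_ ?_ ?_ ?_
  · intro p hp
    have := (neg_mem_Lset (R := R) (k := k) (p := -p)).1 (by simpa using hp)
    exact this
  · intro p hp; exact neg_mem_Lset.2 hp
  · simp
  · simp
  · simp

theorem Lset_znorm {R : ℝ} {k p : Z3} (hp : p ∈ Lset R k) : znorm p ≤ R + znorm k := by
  have h := (mem_Lset.1 hp).1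
  rw [mem_ballF] at h
  rw [znorm_eq] at *
  rw [znorm_eq] at *
  have e : zE p = zE (p - k) + zE k := by rw [zE_sub]; abel
  rw [e]
  exact (norm_add_le _ _).trans (by linarith)

namespace Dat

variable (D : Dat)

theorem sum_cut (k i : Z3) (f : Z3 → ℝ) (hf : ∀ p, p ∉ D.cut k → f p = 0) :
    ∑ p ∈ Lset D.R k, f p = ∑ p ∈ D.cut k, f p :=
  (Finset.sum_subset (D.hcut k) fun p _ hp => hf p hp).symm

abbrev Lb : Finset Z3 := ballF (D.R + 2 * D.m)
abbrev Γ : Type := ↥(prs D.S (Lset D.R))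
abbrev J : Type := ↥(prs D.Sp D.cut)

theorem memP (y : D.Γ) : y.1.2 ∈ D.Lb := by
  have h := mem_prs.1 y.2
  rw [mem_ballF]
  have := Lset_znorm h.2
  have := D.hm _ h.1
  have := D.hm0
  linarith

theorem memH (y : D.Γ) : y.1.2 - y.1.1 ∈ D.Lb := by
  have h := mem_prs.1 y.2
  have h2 := (mem_Lset.1 h.2).1
  rw [mem_ballF] at *
  have := D.hm0
  linarith

def PH : PairSys ↥D.Lb D.Γ where
  P y := ⟨y.1.2, D.memP y⟩
  H y := ⟨y.1.2 - y.1.1, D.memH y⟩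
  s := D.S.card
  hPH := by
    intro x y h
    have h1 := Subtype.ext_iff.1 h
    simp only at h1
    have hx := (mem_Lset.1 (mem_prs.1 x.2).2).2
    have hy := (mem_Lset.1 (mem_prs.1 y.2).2).1
    rw [h1] at hx; exact hx hy
  hinj := by
    intro x y h h'
    have h1 : x.1.2 = y.1.2 := Subtype.ext_iff.1 h
    have h2 : x.1.2 - x.1.1 = y.1.2 - y.1.1 := Subtype.ext_iff.1 h'
    rw [h1] at h2
    exact Subtype.ext (Prod.ext (sub_right_injective h2) h1)
  hsP := by
    intro p
    refine Finset.card_le_card_of_injOn (fun x => x.1.1) ?_ ?_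
    · intro x _; exact (mem_prs.1 x.2).1
    · intro x hx y hy h
      have h1 := Subtype.ext_iff.1 ((Finset.mem_filter.1 hx).2.trans (Finset.mem_filter.1 hy).2.symm)
      exact Subtype.ext (Prod.ext h h1)
  hsH := by
    intro p
    refine Finset.card_le_card_of_injOn (fun x => x.1.1) ?_ ?_
    · intro x _; exact (mem_prs.1 x.2).1
    · intro x hx y hy h
      have h1 : x.1.2 - x.1.1 = y.1.2 - y.1.1 := Subtype.ext_iff.1 ((Finset.mem_filter.1 hx).2.trans (Finset.mem_filter.1 hy).2.symm)
      have h' : x.1.1 = y.1.1 := h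
      rw [h'] at h1
      exact Subtype.ext (Prod.ext h (sub_left_injective h1))

def Fv (j : Z3 × Z3) : EuclideanSpace ℝ D.Γ := WithLp.toLp 2 fun y => if y.1.1 = j.1 then D.φ j.1 j.2 y.1.2 else 0
def Gv (j : Z3 × Z3) : EuclideanSpace ℝ D.Γ := WithLp.toLp 2 fun y => if y.1.1 = -j.1 then D.φ j.1 j.2 (-y.1.2) else 0

theorem Fv_apply (j) (y : D.Γ) : D.Fv j y = if y.1.1 = j.1 then D.φ j.1 j.2 y.1.2 else 0 := rfl
theorem Gv_apply (j) (y : D.Γ) : D.Gv j y = if y.1.1 = -j.1 then D.φ j.1 j.2 (-y.1.2) else 0 := rfl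

/-- sums against F -/
theorem sumF (j : Z3 × Z3) (hj : j ∈ prs D.Sp D.cut) (f : Z3 → Z3 → ℝ) :
    ∑ y : D.Γ, D.Fv j y * f y.1.1 y.1.2 = ∑ p ∈ D.cut j.1, D.φ j.1 j.2 p * f j.1 p := by
  have h := mem_prs.1 hj
  rw [← D.sum_cut j.1 j.2 _ (fun p hp => by rw [D.hφ _ _ _ hp, zero_mul]), ← sum_prs_if D.S (Lset D.R) _ (D.hSp _ h.1)]
  refine Finset.sum_congr rfl fun y _ => ?_
  rw [Fv_apply]
  by_cases hy : y.1.1 = j.1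
  · rw [if_pos hy, if_pos hy, hy]
  · rw [if_neg hy, if_neg hy, zero_mul]

theorem sumG (j : Z3 × Z3) (hj : j ∈ prs D.Sp D.cut) (f : Z3 → Z3 → ℝ) :
    ∑ y : D.Γ, D.Gv j y * f y.1.1 y.1.2 = ∑ p ∈ D.cut j.1, D.φ j.1 j.2 p * f (-j.1) (-p) := by
  have h := mem_prs.1 hj
  rw [← D.sum_cut j.1 j.2 _ (fun p hp => by rw [D.hφ _ _ _ hp, zero_mul]), ← sum_Lset_neg,
    ← sum_prs_if D.S (Lset D.R) _ (D.hSn _ (D.hSp _ h.1))]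
  refine Finset.sum_congr rfl fun y _ => ?_
  rw [Gv_apply]
  by_cases hy : y.1.1 = -j.1
  · rw [if_pos hy, if_pos hy, hy, neg_neg]
  · rw [if_neg hy, if_neg hy, zero_mul]

theorem pm_ne {k l : Z3} (hk : k ∈ D.Sp) (hl : l ∈ D.Sp) : k ≠ -l := by
  rintro rfl; exact D.hSpn _ hl hk

theorem rho_aux (k0 p : Z3) : ∑ j : D.J, (D.kp j.1.1 j.1.2) ^ 2 * (if k0 = j.1.1 then D.φ j.1.1 j.1.2 p else 0) ^ 2 ≤ D.ρ ^ 2 := by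
  rw [sum_prs D.Sp D.cut (fun j => D.kp j.1 j.2 ^ 2 * (if k0 = j.1 then D.φ j.1 j.2 p else 0) ^ 2)]
  by_cases hk : k0 ∈ D.Sp
  · rw [Finset.sum_eq_single k0]
    · simp only [if_true]
      by_cases hp : p ∈ D.cut k0
      · exact D.hρ k0 hk p hp
      · rw [Finset.sum_eq_zero]
        · exact sq_nonneg _
        · intro i _; rw [D.hφ _ _ _ hp]; simp
    · intro b _ hb; simp [Ne.symm hb]
    · exact fun h => absurd hk h
  · rw [Finset.sum_eq_zero]
    · exact sq_nonneg _
    · intro k hk'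
      refine Finset.sum_eq_zero fun i _ => ?_
      rw [if_neg (by rintro rfl; exact hk hk')]; simp

def bog : Bog ↥D.Lb D.Γ D.J where
  toPairSys := D.PH
  kp j := D.kp j.1.1 j.1.2
  F j := D.Fv j
  G j := D.Gv j
  C0 := D.C0
  ρ := D.ρ
  hkp j := D.hkp _ _
  hFF := by
    intro i j
    have hi := mem_prs.1 i.2
    have hj := mem_prs.1 j.2
    rw [PairSys.eucl_inner]
    have e := D.sumF i.1 i.2 (fun k p => if k = j.1.1 then D.φ j.1.1 j.1.2 p else 0)
    simp only [Fv_apply D j.1]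
    rw [e]
    by_cases h1 : i.1.1 = j.1.1
    · simp only [if_pos h1]
      have := D.horth i.1.1 hi.1 i.1.2 hi.2 j.1.2 (h1 ▸ hj.2)
      rw [← h1, this]
      by_cases h2 : i.1.2 = j.1.2
      · rw [if_pos h2, if_pos (Subtype.ext (Prod.ext h1 h2))]
      · rw [if_neg h2, if_neg (by rintro rfl; exact h2 rfl)]
    · rw [if_neg (by rintro rfl; exact h1 rfl)]
      simp [h1]
  hGG := by
    intro i j
    have hi := mem_prs.1 i.2
    have hj := mem_prs.1 j.2
    rw [PairSys.eucl_inner]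
    have e := D.sumG i.1 i.2 (fun k p => if k = -j.1.1 then D.φ j.1.1 j.1.2 (-p) else 0)
    simp only [Gv_apply D j.1]
    rw [e]
    by_cases h1 : i.1.1 = j.1.1
    · simp only [h1, if_true, neg_neg]
      have := D.horth i.1.1 hi.1 i.1.2 hi.2 j.1.2 (h1 ▸ hj.2)
      rw [← h1, this]
      by_cases h2 : i.1.2 = j.1.2
      · rw [if_pos h2, if_pos (Subtype.ext (Prod.ext h1 h2))]
      · rw [if_neg h2, if_neg (by rintro rfl; exact h2 rfl)]
    · rw [if_neg (by rintro rfl; exact h1 rfl)]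
      simp [h1]
  hFG := by
    intro i j
    have hi := mem_prs.1 i.2
    have hj := mem_prs.1 j.2
    rw [PairSys.eucl_inner]
    have e := D.sumF i.1 i.2 (fun k p => if k = -j.1.1 then D.φ j.1.1 j.1.2 (-p) else 0)
    simp only [Gv_apply D j.1]
    rw [e]
    simp [D.pm_ne hi.1 hj.1]
  hC0 := by
    rw [sum_prs D.Sp D.cut (fun j => D.kp j.1 j.2)]
    exact D.hC0
  hρ := D.hρ0
  hρF y := D.rho_aux y.1.1 y.1.2
  hρG y := by
    refine le_trans (le_of_eq ?_) (D.rho_aux (-y.1.1) (-y.1.2))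
    refine Finset.sum_congr rfl fun j _ => ?_
    rw [Gv_apply]
    by_cases h : y.1.1 = -j.1.1
    · rw [if_pos h, if_pos (by rw [h, neg_neg])]
    · rw [if_neg h, if_neg (fun h' => h (by rw [← h', neg_neg]))]

end Dat
end

/-! ### Energy of the concrete trial state -/

noncomputable section

def cGf (s : ℕ) (C0 : ℝ) : ℝ := Real.exp (96 * s * C0)
def cIf (s : ℕ) (C0 : ℝ) : ℝ :=
  12 * √s * s ^ 2 * (2 * (1 + 2 * C0 * Real.exp C0)) * cGf s C0 * (2 * √s * cGf s C0 + (1 + 2 * C0 * Real.exp C0))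

namespace Dat

variable (D : Dat)

theorem bog_cI : D.bog.cI = cIf D.S.card D.C0 := rfl
theorem bog_cG : D.bog.cG = cGf D.S.card D.C0 := rfl

def Bs : Finset ↥D.Lb := Finset.univ.filter fun p => p.1 ∈ ballF D.R

theorem ball_sub : ballF D.R ⊆ D.Lb := by
  intro p hp
  rw [mem_ballF] at *
  have := D.hm0
  linarith

theorem sum_Bs (f : Z3 → ℝ) : ∑ p ∈ D.Bs, f p = ∑ p ∈ ballF D.R, f p := by
  unfold Bs
  rw [Finset.sum_filter, Finset.sum_coe_sort D.Lb (fun p => if p ∈ ballF D.R then f p else 0), ← Finset.sum_filter,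
    Finset.filter_mem_eq_inter, Finset.inter_eq_right.2 D.ball_sub]

theorem card_Bs : D.Bs.card = numParticles D.R := by
  have h := D.sum_Bs (fun _ => 1)
  simp only [Finset.sum_const, nsmul_eq_mul, mul_one] at h
  rw [← card_ballF]; exact_mod_cast h

theorem hP (y : D.Γ) : D.bog.P y ∉ D.Bs := by
  intro h
  exact (mem_Lset.1 (mem_prs.1 y.2).2).2 (Finset.mem_filter.1 h).2

theorem hH (y : D.Γ) : D.bog.H y ∈ D.Bs :=
  Finset.mem_filter.2 ⟨Finset.mem_univ _, (mem_Lset.1 (mem_prs.1 y.2).2).1⟩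

def psi : Fock ↥D.Lb := D.bog.psi 1

/-- correlation kinetic term (unscaled) -/
def Kk (k : Z3) : ℝ := ∑ i ∈ D.cut k, (Real.cosh (2 * D.kp k i) - 1) * ∑ p ∈ D.cut k, 2 * lamk k p * D.φ k i p ^ 2
def Wk (k : Z3) : ℝ := ∑ i ∈ D.cut k, (Real.exp (-2 * D.kp k i) - 1) * (∑ p ∈ D.cut k, D.φ k i p) ^ 2

theorem inner_F (j : D.J) (e : Z3 → Z3 → ℝ) :
    inner ℝ (D.Fv j) (Bog.emul (fun y : D.Γ => e y.1.1 y.1.2) (D.Fv j)) = ∑ p ∈ D.cut j.1.1, e j.1.1 p * D.φ j.1.1 j.1.2 p ^ 2 := by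
  rw [PairSys.eucl_inner]
  have h := D.sumF j.1 j.2 (fun k p => e k p * (if k = j.1.1 then D.φ j.1.1 j.1.2 p else 0))
  simp only [if_true] at h
  refine (Eq.trans ?_ h).trans ?_
  · rfl
  · exact Finset.sum_congr rfl fun p _ => by ring

theorem inner_G (j : D.J) (e : Z3 → Z3 → ℝ) :
    inner ℝ (D.Gv j) (Bog.emul (fun y : D.Γ => e y.1.1 y.1.2) (D.Gv j)) = ∑ p ∈ D.cut j.1.1, e (-j.1.1) (-p) * D.φ j.1.1 j.1.2 p ^ 2 := by
  rw [PairSys.eucl_inner]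
  have h := D.sumG j.1 j.2 (fun k p => e k p * (if k = -j.1.1 then D.φ j.1.1 j.1.2 (-p) else 0))
  simp only [if_true, neg_neg] at h
  refine (Eq.trans ?_ h).trans ?_
  · rfl
  · exact Finset.sum_congr rfl fun p _ => by ring

theorem kin (M : ℝ) (hM : 0 ≤ M) (hMb : ∀ k ∈ D.S, ∀ p ∈ Lset D.R k, 2 * lamk k p ≤ M) :
    inner ℝ D.psi ((phFam D.Bs).ob1 (dgm D.Lb) D.psi) ≤ ∑ p ∈ ballF D.R, znorm p ^ 2 + ∑ k ∈ D.Sp, D.Kk k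
      + 4 * D.C0 * cIf D.S.card D.C0 * D.ρ * M := by
  have he : ∀ y : D.Γ, znorm (D.bog.P y).1 ^ 2 - znorm (D.bog.H y).1 ^ 2 = 2 * lamk y.1.1 y.1.2 := fun y => (lamk_eq _ _).symm
  have h := D.bog.kin_psi D.Bs D.hP D.hH (fun p => znorm p.1 ^ 2) M hM (by
    intro y
    have hy := mem_prs.1 y.2
    simp only [he y]
    have h0 := lamk_pos hy.2
    rw [abs_of_nonneg (by linarith)]
    exact hMb _ hy.1 _ hy.2)
  have e1 : (phFam D.Bs).ob1 (dgm D.Lb) = (phFam D.Bs).ob1 (fun p q => if p = q then znorm p.1 ^ 2 else 0) := rfl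
  rw [e1]
  refine h.trans (le_of_eq ?_)
  rw [D.sum_Bs (fun p => znorm p ^ 2)]
  congr 1
  congr 1
  have e2 : ∑ k ∈ D.Sp, D.Kk k = ∑ j : D.J, (Real.cosh (2 * D.kp j.1.1 j.1.2) - 1) * ∑ p ∈ D.cut j.1.1, 2 * lamk j.1.1 p * D.φ j.1.1 j.1.2 p ^ 2 := by
    unfold Kk
    exact (sum_prs D.Sp D.cut (fun j => (Real.cosh (2 * D.kp j.1 j.2) - 1) * ∑ p ∈ D.cut j.1, 2 * lamk j.1 p * D.φ j.1 j.2 p ^ 2)).symm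
  rw [e2]
  refine Finset.sum_congr rfl fun j _ => ?_
  simp only [he]
  have f1 := D.inner_F j (fun k p => 2 * lamk k p)
  have f2 := D.inner_G j (fun k p => 2 * lamk k p)
  simp only [lamk_neg] at f2
  have g1 : D.bog.F j = D.Fv j := rfl
  have g2 : D.bog.G j = D.Gv j := rfl
  have g3 : D.bog.kp j = D.kp j.1.1 j.1.2 := rfl
  rw [g1, g2, g3, f1, f2]
  ring

def ind (k : Z3) : EuclideanSpace ℝ D.Γ := WithLp.toLp 2 fun y => if y.1.1 = k then 1 else 0

theorem ind_apply (k : Z3) (y : D.Γ) : D.ind k y = if y.1.1 = k then 1 else 0 := rfl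

theorem ind_norm {k : Z3} (hk : k ∈ D.S) : ‖D.ind k‖ ^ 2 = ((Lset D.R k).card : ℝ) := by
  rw [PairSys.eucl_norm_sq]
  have := sum_prs_if D.S (Lset D.R) (fun _ => 1) hk
  rw [Finset.sum_const, nsmul_eq_mul, mul_one] at this
  rw [← this]
  refine Finset.sum_congr rfl fun y _ => ?_
  rw [ind_apply]; split_ifs <;> norm_num

theorem card_neg (R : ℝ) (k : Z3) : (Lset R (-k)).card = (Lset R k).card := by
  have := sum_Lset_neg R k (fun _ => 1)
  simp only [Finset.sum_const, nsmul_eq_mul, mul_one] at this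
  exact_mod_cast this

theorem pot {k : Z3} (hk : k ∈ D.Sp) :
    ‖(phFam D.Bs).ob1 (shm D.Lb (-k)) D.psi‖ ^ 2 ≤ (Lset D.R k).card + D.Wk k
      + 4 * cIf D.S.card D.C0 * D.ρ * (Lset D.R k).card + 16 * √D.S.card * cGf D.S.card D.C0 ^ 2 * √(Lset D.R k).card
      + 4 * cGf D.S.card D.C0 ^ 2 := by
  classical
  have hkS := D.hSp k hk
  have hk0 : k ≠ 0 := by rintro rfl; exact D.hS0 hkS
  have hsv : ∀ p q : ↥D.Lb, shm D.Lb (-k) p q ≠ 0 → q.1 = p.1 + k := by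
    intro p q h
    unfold shm at h
    by_contra hc
    exact h (if_neg (by rwa [sub_neg_eq_add]))
  have hsh : ∀ p q : ↥D.Lb, shm D.Lb (-k) p q = if q.1 = p.1 + k then 1 else 0 := by
    intro p q; unfold shm
    simp only [sub_neg_eq_add]
  have h := D.bog.shift_sq D.Bs D.hP D.hH (shm D.Lb (-k)) ?_ ?_ ?_ ?_ (D.ind k) (D.ind (-k)) ?_ ?_
    (fun j => if j.1.1 = k then ∑ p ∈ D.cut j.1.1, D.φ j.1.1 j.1.2 p else 0) ?_ ?_ ?_ ?_
  · rw [D.ind_norm (D.hSn k hkS)] at h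
    have hn1 : ‖D.ind k‖ = √(Lset D.R k).card := by
      rw [← D.ind_norm hkS, Real.sqrt_sq (norm_nonneg _)]
    have hn2 : ‖D.ind (-k)‖ = √(Lset D.R k).card := by
      rw [← card_neg, ← D.ind_norm (D.hSn k hkS), Real.sqrt_sq (norm_nonneg _)]
    rw [hn1, hn2, card_neg, bog_cI, bog_cG] at h
    have hw : ∑ j : D.J, (Real.exp (-2 * D.bog.kp j) - 1) * (if j.1.1 = k then ∑ p ∈ D.cut j.1.1, D.φ j.1.1 j.1.2 p else 0) ^ 2 = D.Wk k := by
      unfold Wk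
      rw [← sum_prs_if D.Sp D.cut (fun i => (Real.exp (-2 * D.kp k i) - 1) * (∑ p ∈ D.cut k, D.φ k i p) ^ 2) hk]
      refine Finset.sum_congr rfl fun j _ => ?_
      by_cases hj : j.1.1 = k
      · rw [if_pos hj, if_pos hj, hj]
        have : D.bog.kp j = D.kp k j.1.2 := by rw [← hj]; rfl
        rw [this]
      · rw [if_neg hj, if_neg hj]; ring
    rw [hw] at h
    have hs : (√((Lset D.R k).card : ℝ) + √((Lset D.R k).card : ℝ)) ^ 2 = 4 * (Lset D.R k).card := by
      have := Real.sq_sqrt (Nat.cast_nonneg (α := ℝ) (Lset D.R k).card)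
      nlinarith
    rw [hs] at h
    have hs2 : (D.bog.s : ℝ) = D.S.card := rfl
    have hr : D.bog.ρ = D.ρ := rfl
    rw [hs2, hr] at h
    refine h.trans (le_of_eq ?_)
    ring
  · intro p q; rw [hsh]; split_ifs <;> norm_num
  · intro p; rw [hsh, if_neg]
    intro hc; exact hk0 (by simpa using hc)
  · intro p q q' h1 h2
    exact Subtype.ext ((hsv _ _ h1).trans (hsv _ _ h2).symm)
  · intro p p' q h1 h2
    exact Subtype.ext (add_right_cancel ((hsv _ _ h1).symm.trans (hsv _ _ h2)))
  · intro p q hp hq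
    rw [hsh]
    have hp' : p.1 ∈ ballF D.R := (Finset.mem_filter.1 hp).2
    have hq' : q.1 ∉ ballF D.R := fun hc => hq (Finset.mem_filter.2 ⟨Finset.mem_univ _, hc⟩)
    by_cases hpq : q.1 = p.1 + k
    · have hx : ((k, q.1) : Z3 × Z3) ∈ prs D.S (Lset D.R) := mem_prs.2 ⟨hkS, mem_Lset.2 ⟨by rw [hpq]; simpa using hp', hq'⟩⟩
      rw [if_pos hpq, Finset.sum_eq_single (⟨(k, q.1), hx⟩ : D.Γ)]
      · rw [if_pos, ind_apply, if_pos rfl]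
        refine ⟨Subtype.ext ?_, Subtype.ext rfl⟩
        change q.1 - k = p.1
        rw [hpq]; simp
      · intro y _ hy
        by_cases hc : D.bog.H y = p ∧ D.bog.P y = q
        · rw [if_pos hc, ind_apply, if_neg]
          intro hyk
          exact hy (Subtype.ext (Prod.ext hyk (Subtype.ext_iff.1 hc.2)))
        · rw [if_neg hc]
      · simp
    · rw [if_neg hpq]
      symm
      refine Finset.sum_eq_zero fun y _ => ?_
      by_cases hc : D.bog.H y = p ∧ D.bog.P y = q
      · rw [if_pos hc, ind_apply, if_neg]
        intro hyk
        apply hpq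
        have h1 : y.1.2 - y.1.1 = p.1 := Subtype.ext_iff.1 hc.1
        have h2 : y.1.2 = q.1 := Subtype.ext_iff.1 hc.2
        rw [← h1, ← h2, hyk]; simp
      · rw [if_neg hc]
  · intro p q hp hq
    rw [hsh]
    have hq' : q.1 ∈ ballF D.R := (Finset.mem_filter.1 hq).2
    have hp' : p.1 ∉ ballF D.R := fun hc => hp (Finset.mem_filter.2 ⟨Finset.mem_univ _, hc⟩)
    by_cases hpq : q.1 = p.1 + k
    · have hx : ((-k, p.1) : Z3 × Z3) ∈ prs D.S (Lset D.R) :=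
        mem_prs.2 ⟨D.hSn k hkS, mem_Lset.2 ⟨by simp only [sub_neg_eq_add]; rw [← hpq]; exact hq', hp'⟩⟩
      rw [if_pos hpq, Finset.sum_eq_single (⟨(-k, p.1), hx⟩ : D.Γ)]
      · rw [if_pos, ind_apply, if_pos rfl]
        refine ⟨Subtype.ext rfl, Subtype.ext ?_⟩
        change p.1 - -k = q.1
        rw [hpq]; simp
      · intro y _ hy
        by_cases hc : D.bog.P y = p ∧ D.bog.H y = q
        · rw [if_pos hc, ind_apply, if_neg]
          intro hyk
          exact hy (Subtype.ext (Prod.ext hyk (Subtype.ext_iff.1 hc.1)))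
        · rw [if_neg hc]
      · simp
    · rw [if_neg hpq]
      symm
      refine Finset.sum_eq_zero fun y _ => ?_
      by_cases hc : D.bog.P y = p ∧ D.bog.H y = q
      · rw [if_pos hc, ind_apply, if_neg]
        intro hyk
        apply hpq
        have h1 : y.1.2 - y.1.1 = q.1 := Subtype.ext_iff.1 hc.2
        have h2 : y.1.2 = p.1 := Subtype.ext_iff.1 hc.1
        rw [← h1, ← h2, hyk]; simp
      · rw [if_neg hc]
  · intro j
    have hj := mem_prs.1 j.2
    rw [PairSys.eucl_inner]
    refine (D.sumF j.1 j.2 (fun l p => if l = -k then 1 else 0)).trans ?_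
    simp [D.pm_ne hj.1 hk]
  · intro j
    have hj := mem_prs.1 j.2
    rw [PairSys.eucl_inner]
    refine (D.sumG j.1 j.2 (fun l p => if l = k then 1 else 0)).trans ?_
    simp [(D.pm_ne hk hj.1).symm]
  · intro j
    rw [PairSys.eucl_inner]
    refine (D.sumF j.1 j.2 (fun l p => if l = k then 1 else 0)).trans ?_
    by_cases h : j.1.1 = k <;> simp [h]
  · intro j
    rw [PairSys.eucl_inner]
    refine (D.sumG j.1 j.2 (fun l p => if l = -k then 1 else 0)).trans ?_
    by_cases h : j.1.1 = k <;> simp [h]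

end Dat
end

noncomputable section

namespace Dat

variable (D : Dat)

theorem sum_S_half (f : Z3 → ℝ) (hf : ∀ k, f (-k) = f k) : ∑ k ∈ D.S, f k = 2 * ∑ k ∈ D.Sp, f k := by
  classical
  have e : D.S = D.Sp ∪ D.Sp.image (fun k => -k) := by
    ext k
    simp only [Finset.mem_union, Finset.mem_image]
    constructor
    · intro h
      by_cases hk : k ∈ D.Sp
      · exact Or.inl hk
      · exact Or.inr ⟨-k, D.hSc k h hk, neg_neg k⟩
    · rintro (h | ⟨l, hl, rfl⟩)
      · exact D.hSp k h
      · exact D.hSn _ (D.hSp _ hl)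
  rw [e, Finset.sum_union, Finset.sum_image (fun a _ b _ h => neg_injective h)]
  · simp only [hf]; ring
  · rw [Finset.disjoint_left]
    intro k hk hk'
    obtain ⟨l, hl, rfl⟩ := Finset.mem_image.1 hk'
    exact D.hSpn l hl hk

theorem norm_psi1 : ‖D.psi‖ = 1 := D.bog.norm_psi 1

def Err (k : Z3) : ℝ := 4 * cIf D.S.card D.C0 * D.ρ * (Lset D.R k).card + 16 * √D.S.card * cGf D.S.card D.C0 ^ 2 * √(Lset D.R k).card
      + 4 * cGf D.S.card D.C0 ^ 2

def Epot (V : Z3 → ℝ) (hfin : (Function.support V).Finite) (R : ℝ) : ℝ :=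
  1 / (2 * nR R) * ∑ k ∈ hfin.toFinset, V k * ((if k = 0 then nR R ^ 2 else ((Lset R k).card : ℝ)) - nR R)

theorem ground (V : Z3 → ℝ) (hnn : ∀ k, 0 ≤ V k) (hfin : (Function.support V).Finite) (hev : ∀ k, V (-k) = V k)
    (hSV : ∀ k, k ∈ D.S ↔ V k ≠ 0 ∧ k ≠ 0) (M : ℝ) (hM : 0 ≤ M) (hMb : ∀ k ∈ D.S, ∀ p ∈ Lset D.R k, 2 * lamk k p ≤ M) :
    groundEnergy V (numParticles D.R) ≤ hb D.R ^ 2 * (∑ p ∈ ballF D.R, znorm p ^ 2 + ∑ k ∈ D.Sp, D.Kk k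
      + 4 * D.C0 * cIf D.S.card D.C0 * D.ρ * M) + Epot V hfin D.R + 1 / nR D.R * ∑ k ∈ D.Sp, V k * (D.Wk k + D.Err k) := by
  classical
  set N := numParticles D.R with hN
  have hsec : (phFam D.Bs).Sec N D.psi := by rw [hN, ← D.card_Bs]; exact D.bog.sec_psi D.Bs D.hP D.hH
  let g : Z3 → Z3 := fun k => if k ∈ D.Sp then -k else k
  have hg : ∀ k, g k = k ∨ g k = -k := by
    intro k; by_cases h : k ∈ D.Sp
    · right; exact if_pos h
    · left; exact if_neg h
  have h := fock_energy (N := N) V hnn hfin (phFam D.Bs) D.psi hsec D.norm_psi1 (ballF (D.R + D.m)) ?_ g hg ?_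
  · refine h.trans ?_
    have hhb : ((N : ℝ) ^ ((1:ℝ)/3))⁻¹ = hb D.R := rfl
    have hnr : (N : ℝ) = nR D.R := rfl
    rw [hhb, add_assoc]
    refine add_le_add (mul_le_mul_of_nonneg_left (D.kin M hM hMb) (sq_nonneg _)) ?_
    unfold Epot
    rw [hnr]
    have hle : ∀ k ∈ hfin.toFinset, V k * (‖(phFam D.Bs).ob1 (shm D.Lb (g k)) D.psi‖ ^ 2 - nR D.R) ≤
        V k * ((if k = 0 then nR D.R ^ 2 else ((Lset D.R k).card : ℝ)) - nR D.R)
         + (if k ∈ D.S then V k * (if k ∈ D.Sp then D.Wk k + D.Err k else D.Wk (-k) + D.Err (-k)) else 0) := by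
      intro k hk
      have hk1 : V k ≠ 0 := by simpa using hk
      by_cases hk0 : k = 0
      · subst hk0
        have h0 : (0 : Z3) ∉ D.Sp := fun h => D.hS0 (D.hSp _ h)
        have hg0 : g 0 = 0 := if_neg h0
        rw [if_pos rfl, if_neg D.hS0, hg0, add_zero]
        have e : (phFam D.Bs).ob1 (shm D.Lb 0) = (phFam D.Bs).numop := by
          unfold CarFam.numop
          congr 1
          funext p q
          unfold shm
          simp only [sub_zero]
          by_cases hpq : p = q
          · rw [if_pos hpq, if_pos (by rw [hpq])]
          · rw [if_neg hpq, if_neg (fun h => hpq (Subtype.ext h.symm))]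
        rw [e, show (phFam D.Bs).numop D.psi = (N : ℝ) • D.psi from hsec, norm_smul, D.norm_psi1, hnr]
        simp
      · have hkS : k ∈ D.S := (hSV k).2 ⟨hk1, hk0⟩
        rw [if_neg hk0, if_pos hkS, ← mul_add]
        refine mul_le_mul_of_nonneg_left ?_ (hnn k)
        by_cases hkp : k ∈ D.Sp
        · have := D.pot hkp
          rw [show g k = -k from if_pos hkp, if_pos hkp]
          unfold Err; linarith
        · have := D.pot (D.hSc k hkS hkp)
          rw [neg_neg] at this
          rw [show g k = k from if_neg hkp, if_neg hkp]
          rw [card_neg] at this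
          unfold Err
          rw [card_neg]; linarith
    have hs := Finset.sum_le_sum hle
    rw [Finset.sum_add_distrib, ← Finset.sum_filter] at hs
    have hf : hfin.toFinset.filter (fun k => k ∈ D.S) = D.S := by
      ext k
      simp only [Finset.mem_filter, Set.Finite.mem_toFinset, Function.mem_support]
      exact ⟨fun h => h.2, fun h => ⟨((hSV k).1 h).1, h⟩⟩
    rw [hf] at hs
    have hs2 : ∑ k ∈ D.S, V k * (if k ∈ D.Sp then D.Wk k + D.Err k else D.Wk (-k) + D.Err (-k)) = 2 * ∑ k ∈ D.Sp, V k * (D.Wk k + D.Err k) := by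
      have := D.sum_S_half (fun k => if k ∈ D.Sp then V k * (D.Wk k + D.Err k) else if -k ∈ D.Sp then V k * (D.Wk (-k) + D.Err (-k)) else 0) ?_
      · rw [Finset.sum_congr rfl (g := fun k => V k * (if k ∈ D.Sp then D.Wk k + D.Err k else D.Wk (-k) + D.Err (-k)))] at this
        · rw [this]
          congr 1
          refine Finset.sum_congr rfl fun k hk => ?_
          rw [if_pos hk]
        · intro k hk
          by_cases hkp : k ∈ D.Sp
          · simp only [if_pos hkp]
          · simp only [if_neg hkp, if_pos (D.hSc k hk hkp)]
      · intro k
        by_cases hkp : k ∈ D.Sp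
        · have := D.hSpn k hkp
          simp only [if_pos hkp, if_neg this, neg_neg, hev]
        · by_cases hkn : -k ∈ D.Sp
          · simp only [if_neg hkp, if_pos hkn, hev]
          · simp only [if_neg hkp, if_neg hkn, neg_neg]
    rw [hs2] at hs
    have hnn0 : 0 ≤ nR D.R := Nat.cast_nonneg _
    have := mul_le_mul_of_nonneg_left hs (show 0 ≤ 1 / (2 * nR D.R) by positivity)
    refine this.trans (le_of_eq ?_)
    rw [mul_add]
    congr 1
    ring
  · intro p hp
    have hpz : ¬ znorm p.1 ≤ D.R + D.m := by rwa [mem_ballF] at hp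
    refine D.bog.unused_psi D.Bs ?_ D.hH ?_
    · intro hc
      have := mem_ballF.1 (Finset.mem_filter.1 hc).2
      have := D.hm0
      apply hpz; linarith
    · intro y hy
      have hy1 := mem_prs.1 y.2
      have h1 : y.1.2 = p.1 := Subtype.ext_iff.1 hy
      have h2 := Lset_znorm hy1.2
      have h3 := D.hm _ hy1.1
      rw [h1] at h2
      apply hpz; linarith
  · intro k hk p hp
    have hk1 : V k ≠ 0 := by simpa using hk
    rw [mem_ballF] at *
    have hz : znorm (g k) ≤ D.m := by
      have e : znorm (g k) = znorm k := by
        rcases hg k with h | h <;> rw [h]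
        exact znorm_neg k
      rw [e]
      by_cases hk0 : k = 0
      · subst hk0
        have : znorm (0 : Z3) = 0 := by simp [znorm]
        rw [this]; exact D.hm0
      · exact D.hm k ((hSV k).2 ⟨hk1, hk0⟩)
    have : znorm (p + g k) ≤ znorm p + znorm (g k) := by
      rw [znorm_eq, znorm_eq, znorm_eq, zE_add]; exact norm_add_le _ _
    linarith

end Dat
end

noncomputable section

theorem orth_sum {I : Type*} [Fintype I] [DecidableEq I] (φ : I → I → ℝ)
    (h : ∀ i j, ∑ p, φ i p * φ j p = if i = j then 1 else 0) : ∑ i, (∑ p, φ i p) ^ 2 = Fintype.card I := by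
  have h1 : (Matrix.of φ) * (Matrix.of φ).transpose = 1 := by
    ext i j
    rw [Matrix.mul_apply, Matrix.one_apply, ← h i j]; rfl
  have h2 := mul_eq_one_comm.1 h1
  have h3 : ∀ p q, ∑ i, φ i p * φ i q = if p = q then 1 else 0 := by
    intro p q
    have := congrFun (congrFun h2 p) q
    rw [Matrix.mul_apply, Matrix.one_apply] at this
    exact this
  calc ∑ i, (∑ p, φ i p) ^ 2 = ∑ i, ∑ p, ∑ q, φ i p * φ i q := by
        refine Finset.sum_congr rfl fun i _ => ?_
        rw [sq, Finset.sum_mul_sum]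
    _ = ∑ p, ∑ q, ∑ i, φ i p * φ i q := by
        rw [Finset.sum_comm]
        exact Finset.sum_congr rfl fun p _ => Finset.sum_comm
    _ = _ := by simp [h3]

theorem mmf (I : Finset Z3) (h : Z3 → ℝ) (hpos : ∀ p ∈ I, 0 < h p) (c : ℝ) (hc : 0 ≤ c) :
    ∃ (kp : Z3 → ℝ) (φ : Z3 → Z3 → ℝ), (∀ i, 0 ≤ kp i) ∧ (∀ i p, p ∉ I → φ i p = 0) ∧
      (∀ i ∈ I, ∀ j ∈ I, ∑ p ∈ I, φ i p * φ j p = if i = j then 1 else 0) ∧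
      (∑ i ∈ I, kp i ≤ c / 4 * ∑ p ∈ I, 1 / h p) ∧
      (∀ hm > 0, (∀ p ∈ I, hm ≤ h p) → ∀ p ∈ I, ∑ i ∈ I, kp i ^ 2 * φ i p ^ 2 ≤ c / (4 * hm)) ∧
      ∑ i ∈ I, (Real.cosh (2 * kp i) - 1) * ∑ p ∈ I, h p * φ i p ^ 2
        + c / 2 * (∑ i ∈ I, (Real.exp (-2 * kp i) - 1) * (∑ p ∈ I, φ i p) ^ 2)
      = (1 / π) * (∫ t in Set.Ioi (0:ℝ), Real.log (1 + c * ∑ p ∈ I, h p / (h p ^ 2 + t ^ 2)))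
        - c / 2 * I.card := by
  classical
  obtain ⟨kp, φ, h1, h2, h3, h4, h5⟩ := mm_main (I := ↥I) (fun p => h p) (fun p => hpos p p.2) c hc
  let kp' : Z3 → ℝ := fun i => if hi : i ∈ I then kp ⟨i, hi⟩ else 0
  let φ' : Z3 → Z3 → ℝ := fun i p => if hi : i ∈ I then (if hp : p ∈ I then φ ⟨i, hi⟩ ⟨p, hp⟩ else 0) else 0
  have e1 : ∀ i : ↥I, kp' i = kp i := fun i => dif_pos i.2
  have e2 : ∀ i p : ↥I, φ' i p = φ i p := fun i p => by
    simp only [φ']; rw [dif_pos i.2, dif_pos p.2]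
  have hs : ∀ f : Z3 → ℝ, ∑ p ∈ I, f p = ∑ p : ↥I, f p := fun f => (Finset.sum_coe_sort I f).symm
  have horth := orth_sum φ h2
  refine ⟨kp', φ', ?_, ?_, ?_, ?_, ?_, ?_⟩
  · intro i
    by_cases hi : i ∈ I
    · exact (e1 ⟨i, hi⟩).symm ▸ h1 _
    · simp only [kp']; rw [dif_neg hi]
  · intro i p hp
    simp only [φ', dif_neg hp]; simp
  · intro i hi j hj
    rw [hs]
    have := h2 ⟨i, hi⟩ ⟨j, hj⟩
    simp only [Subtype.mk.injEq] at this
    rw [← this]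
    exact Finset.sum_congr rfl fun p _ => by rw [← e2, ← e2]
  · rw [hs, hs]; simp only [e1]; exact h3
  · intro hm hm0 hmb p hp
    rw [hs]
    have := h4 hm hm0 (fun p => hmb p p.2) ⟨p, hp⟩
    refine le_trans (le_of_eq ?_) this
    exact Finset.sum_congr rfl fun i _ => by rw [← e2, ← e1]
  · simp only [hs, e1, e2]
    simp only [Fintype.card_coe] at h5 horth
    rw [← h5]
    congr 2
    rw [← horth, ← Finset.sum_sub_distrib]
    exact Finset.sum_congr rfl fun i _ => by ring

def posZ (k : Z3) : Prop := 0 < k 0 ∨ (k 0 = 0 ∧ (0 < k 1 ∨ (k 1 = 0 ∧ 0 < k 2)))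

theorem posZ_neg {k : Z3} (h : posZ k) : ¬ posZ (-k) := by
  unfold posZ at *; simp only [Pi.neg_apply]; omega

theorem posZ_or {k : Z3} (h0 : k ≠ 0) (h : ¬ posZ k) : posZ (-k) := by
  unfold posZ at *; simp only [Pi.neg_apply]
  by_contra hc
  apply h0
  ext i
  fin_cases i <;> simp <;> omega

open Classical in
def SV (V : Z3 → ℝ) (hfin : (Function.support V).Finite) : Finset Z3 := hfin.toFinset.filter (fun k => k ≠ 0)
open Classical in
def SVp (V : Z3 → ℝ) (hfin : (Function.support V).Finite) : Finset Z3 := (SV V hfin).filter posZ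

theorem mem_SV {V : Z3 → ℝ} {hfin : (Function.support V).Finite} {k : Z3} : k ∈ SV V hfin ↔ V k ≠ 0 ∧ k ≠ 0 := by
  simp [SV]
theorem mem_SVp {V : Z3 → ℝ} {hfin : (Function.support V).Finite} {k : Z3} : k ∈ SVp V hfin ↔ (V k ≠ 0 ∧ k ≠ 0) ∧ posZ k := by
  classical
  simp only [SVp, Finset.mem_filter, mem_SV]

theorem one_le_znorm {k : Z3} (hk : k ≠ 0) : 1 ≤ znorm k := by
  obtain ⟨i, hi⟩ : ∃ i, k i ≠ 0 := by
    by_contra hc; push Not at hc; exact hk (funext hc)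
  have h1 := abs_coord_le k i
  have h2 : (1:ℝ) ≤ |(k i : ℝ)| := by exact_mod_cast Int.one_le_abs hi
  linarith

def mV (V : Z3 → ℝ) (hfin : (Function.support V).Finite) : ℝ := ∑ k ∈ SV V hfin, znorm k
def vV (V : Z3 → ℝ) (hfin : (Function.support V).Finite) : ℝ := 1 + ∑ k ∈ SV V hfin, V k
def cV (V : Z3 → ℝ) (hfin : (Function.support V).Finite) : ℝ := ∑ k ∈ SVp V hfin, V k * (510 + 28 * znorm k)

theorem kp_const {R V z S : ℝ} (hR : 100 ≤ R) (hV : 0 ≤ V) (hz : 0 < z) (hS : S ≤ (510 * z + 28 * z ^ 2) * R^2) :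
    (2 * V / nR R) / 4 * (1 / (2 * hb R ^ 2 * (z * R)) * S) ≤ V * (510 + 28 * z) := by
  have h0 := hb_pos hR
  have hN : 1 / nR R = hb R ^ 3 := by
    rw [div_eq_iff (nR_pos hR).ne', hb_cube hR]
  have hRp : 0 < R := by linarith
  calc (2 * V / nR R) / 4 * (1 / (2 * hb R ^ 2 * (z * R)) * S) ≤ (2 * V / nR R) / 4 * (1 / (2 * hb R ^ 2 * (z * R)) * ((510 * z + 28 * z ^ 2) * R^2)) := by
        have := (nR_pos hR)
        gcongr
    _ = V * (510 + 28 * z) * (hb R * R) / 4 := by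
        rw [show 2 * V / nR R = 2 * V * (1 / nR R) by ring, hN]
        field_simp
    _ ≤ V * (510 + 28 * z) := by
        have h1 := hbR_hi hR
        have h2 : 0 ≤ V * (510 + 28 * z) := by positivity
        nlinarith [mul_le_mul_of_nonneg_left h1 h2]

theorem rho_const {R V z v : ℝ} (hR : 100 ≤ R) (hV : 0 ≤ V) (hz : 1 ≤ z) (hv : V ≤ v) (hv1 : 1 ≤ v) :
    (2 * V / nR R) / (4 * (2 * hb R ^ 2 * (th R * (z * R)))) ≤ (v * th R) ^ 2 := by
  have h0 := hb_pos hR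
  have hN : 1 / nR R = hb R ^ 3 := by
    rw [div_eq_iff (nR_pos hR).ne', hb_cube hR]
  have hRp : 0 < R := by linarith
  have ht := th_pos hR
  have e : (2 * V / nR R) / (4 * (2 * hb R ^ 2 * (th R * (z * R)))) = V * (hb R / th R) * (1 / R) * (1 / z) / 4 := by
    rw [show 2 * V / nR R = 2 * V * (1 / nR R) by ring, hN]
    field_simp
  rw [e]
  have h1 : 1 / z ≤ 1 := by rw [div_le_one (by linarith)]; exact hz
  have h2 := inv_R_le hR
  have h3 : hb R / th R ≤ 1 := by rw [div_le_one ht]; exact hb_le_th hR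
  have h4 : hb R ≤ th R ^ 2 := by
    have := hb_div_th3 hR
    rw [div_le_iff₀ (by positivity)] at this
    have ht1 := th_le_one hR
    have : th R * th R ^ 3 ≤ th R ^ 2 * 1 := by
      rw [show th R * th R ^ 3 = th R ^ 2 * th R ^ 2 by ring]
      gcongr
      exact pow_le_one₀ ht.le ht1
    linarith
  calc V * (hb R / th R) * (1 / R) * (1 / z) / 4 ≤ V * 1 * (2 * hb R) * 1 / 4 := by gcongr
    _ ≤ V * th R ^ 2 := by nlinarith [mul_le_mul_of_nonneg_left h4 hV, mul_nonneg hV h0.le]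
    _ ≤ v ^ 2 * th R ^ 2 := by
        gcongr; nlinarith
    _ = _ := by ring

def mkDat (V : Z3 → ℝ) (hnn : ∀ k, 0 ≤ V k) (hfin : (Function.support V).Finite) (hev : ∀ k, V (-k) = V k) (R : ℝ) (hR : 100 ≤ R)
    (kp : Z3 → Z3 → ℝ) (φ : Z3 → Z3 → Z3 → ℝ) (h1 : ∀ k i, 0 ≤ kp k i) (h2 : ∀ k i p, p ∉ cutk R k (th R) → φ k i p = 0)
    (h3 : ∀ k, ∀ i ∈ cutk R k (th R), ∀ j ∈ cutk R k (th R), ∑ p ∈ cutk R k (th R), φ k i p * φ k j p = if i = j then 1 else 0)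
    (h4 : ∀ k, ∑ i ∈ cutk R k (th R), kp k i ≤ (2 * V k / nR R) / 4 * ∑ p ∈ cutk R k (th R), 1 / hk2 R k p)
    (h5 : ∀ k, ∀ hm > 0, (∀ p ∈ cutk R k (th R), hm ≤ hk2 R k p) → ∀ p ∈ cutk R k (th R),
      ∑ i ∈ cutk R k (th R), kp k i ^ 2 * φ k i p ^ 2 ≤ (2 * V k / nR R) / (4 * hm)) : Dat where
  S := SV V hfin
  Sp := SVp V hfin
  R := R
  m := mV V hfin
  cut k := cutk R k (th R)
  kp := kp
  φ := φ
  C0 := cV V hfin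
  ρ := vV V hfin * th R
  hS0 := by rw [mem_SV]; simp
  hSn := by intro k; rw [mem_SV, mem_SV, hev]; simp
  hSp := by intro k; rw [mem_SV, mem_SVp]; exact fun h => h.1
  hSpn := by intro k; rw [mem_SVp, mem_SVp]; exact fun h h' => posZ_neg h.2 h'.2
  hSc := by
    intro k; rw [mem_SV, mem_SVp, mem_SVp]
    intro h h'
    refine ⟨⟨by rw [hev]; exact h.1, by simpa using h.2⟩, posZ_or h.2 fun hc => h' ⟨h, hc⟩⟩
  hm0 := Finset.sum_nonneg fun k _ => Real.sqrt_nonneg _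
  hm k hk := Finset.single_le_sum (f := fun k => znorm k) (fun k _ => Real.sqrt_nonneg _) hk
  hcut k := Finset.filter_subset _ _
  hkp := h1
  hφ := h2
  horth k _ := h3 k
  hC0 := by
    refine Finset.sum_le_sum fun k hk => (h4 k).trans ?_
    have hk0 := (mem_SVp.1 hk).1.2
    have hz := znorm_pos hk0
    have e : ∑ p ∈ cutk R k (th R), 1 / hk2 R k p = 1 / (2 * hb R ^ 2 * (znorm k * R)) * ∑ p ∈ cutk R k (th R), 1 / xk R k p := by
      rw [Finset.mul_sum]
      refine Finset.sum_congr rfl fun p _ => ?_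
      unfold hk2 xk
      have hRp : R ≠ 0 := by linarith
      field_simp
    rw [e]
    exact kp_const hR (hnn k) hz (cut_inv R (by linarith) k hk0 (th_pos hR) (th_le_one hR) (th_R hR))
  hρ0 := mul_nonneg (add_nonneg zero_le_one (Finset.sum_nonneg fun k _ => hnn k)) (th_pos hR).le
  hρ := by
    intro k hk p hp
    have hk0 := (mem_SVp.1 hk).1.2
    have hz := znorm_pos hk0
    have hb0 := hb_pos hR
    have ht := th_pos hR
    have hsum : 0 ≤ ∑ k ∈ SV V hfin, V k := Finset.sum_nonneg fun k _ => hnn k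
    refine (h5 k (2 * hb R ^ 2 * (th R * (znorm k * R))) (by positivity) ?_ p hp).trans
      (rho_const hR (hnn k) (one_le_znorm hk0) ?_ ?_)
    · intro q hq
      have hq2 := (Finset.mem_filter.1 hq).2
      unfold xk at hq2
      rw [le_div_iff₀ (by positivity)] at hq2
      unfold hk2
      gcongr
    · have := Finset.single_le_sum (f := V) (fun k _ => hnn k) (mem_SV.2 (mem_SVp.1 hk).1 : k ∈ SV V hfin)
      unfold vV; linarith
    · unfold vV; linarith


theorem err_const {R L a cI cG s v : ℝ} (hR : 100 ≤ R) (hL : L ≤ a * R ^ 2) (ha : 0 ≤ a) (hcI : 0 ≤ cI) (hs : 0 ≤ s) (hv : 0 ≤ v) :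
    1 / nR R * (4 * cI * (v * th R) * L + 16 * s * cG ^ 2 * √L + 4 * cG ^ 2) ≤
      (4 * cI * v * a + 16 * s * cG ^ 2 * √a + 4 * cG ^ 2) * (hb R * th R) := by
  have h0 := hb_pos hR
  have hN : 1 / nR R = hb R ^ 3 := by
    rw [div_eq_iff (nR_pos hR).ne', hb_cube hR]
  have hRp : 0 < R := by linarith
  have ht := th_pos hR
  have h1 := hbR_hi hR
  have h2 := hb_le_th hR
  have h3 : √L ≤ √a * R := by
    refine (Real.sqrt_le_sqrt hL).trans (le_of_eq ?_)
    rw [Real.sqrt_mul ha, Real.sqrt_sq hRp.le]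
  have hb1 : hb R ≤ 1 := (hb_le hR).trans (by norm_num)
  have hsq : (hb R * R) ^ 2 ≤ 1 := pow_le_one₀ (by positivity) h1
  rw [hN]
  have a1 : hb R ^ 3 * (4 * cI * (v * th R) * L) ≤ 4 * cI * v * a * (hb R * th R) := by
    calc hb R ^ 3 * (4 * cI * (v * th R) * L) ≤ hb R ^ 3 * (4 * cI * (v * th R) * (a * R ^ 2)) := by gcongr
      _ = 4 * cI * v * a * (hb R * th R) * (hb R * R) ^ 2 := by ring
      _ ≤ 4 * cI * v * a * (hb R * th R) * 1 := by gcongr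
      _ = _ := mul_one _
  have a2 : hb R ^ 3 * (16 * s * cG ^ 2 * √L) ≤ 16 * s * cG ^ 2 * √a * (hb R * th R) := by
    calc hb R ^ 3 * (16 * s * cG ^ 2 * √L) ≤ hb R ^ 3 * (16 * s * cG ^ 2 * (√a * R)) := by gcongr
      _ = 16 * s * cG ^ 2 * √a * (hb R * hb R) * (hb R * R) := by ring
      _ ≤ 16 * s * cG ^ 2 * √a * (hb R * th R) * 1 := by gcongr
      _ = _ := mul_one _
  have a3 : hb R ^ 3 * (4 * cG ^ 2) ≤ 4 * cG ^ 2 * (hb R * th R) := by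
    calc hb R ^ 3 * (4 * cG ^ 2) = 4 * cG ^ 2 * (hb R * hb R) * hb R := by ring
      _ ≤ 4 * cG ^ 2 * (hb R * th R) * 1 := by gcongr
      _ = _ := mul_one _
  nlinarith

theorem kin_err {R C m : ℝ} (hR : 100 ≤ R) (hm : 0 ≤ m) (hC : 0 ≤ C) :
    hb R ^ 2 * (C * th R * (2 * (m * R + m ^ 2 / 2))) ≤ C * (2 * m + m ^ 2) * (hb R * th R) := by
  have h0 := hb_pos hR
  have ht := th_pos hR
  have h1 := hbR_hi hR
  have hb1 : hb R ≤ 1 := (hb_le hR).trans (by norm_num)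
  have hRp : 0 < R := by linarith
  have e : hb R ^ 2 * (C * th R * (2 * (m * R + m ^ 2 / 2))) = C * (2 * m * (hb R * R) + m ^ 2 * hb R) * (hb R * th R) := by ring
  rw [e]
  have q1 : 2*m*(hb R*R) ≤ 2*m := by nlinarith [mul_le_mul_of_nonneg_left h1 (by positivity : 0 ≤ 2*m)]
  have q2 : m^2*hb R ≤ m^2 := by nlinarith [mul_le_mul_of_nonneg_left hb1 (sq_nonneg m)]
  exact mul_le_mul_of_nonneg_right (mul_le_mul_of_nonneg_left (by linarith) hC) (by positivity)

/-- upper bound on the ground state energy -/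
theorem ground_upper (V : Z3 → ℝ) (hnn : ∀ k, 0 ≤ V k) (hfin : (Function.support V).Finite) (hev : ∀ k, V (-k) = V k) :
    ∃ C : ℝ, ∃ R0 : ℝ, ∀ R, R0 ≤ R → groundEnergy V (numParticles R) ≤ hb R ^ 2 * ∑ p ∈ ballF R, znorm p ^ 2
      + Dat.Epot V hfin R + hb R * ∑ k ∈ SVp V hfin, 2 * (κ * rpaK (V k) (znorm k)) + C * (hb R * th R) := by
  set m := mV V hfin with hmdef
  have hm0 : 0 ≤ m := Finset.sum_nonneg fun k _ => Real.sqrt_nonneg _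
  have hmk : ∀ k ∈ SV V hfin, znorm k ≤ m := fun k hk =>
    Finset.single_le_sum (f := fun k => znorm k) (fun k _ => Real.sqrt_nonneg _) hk
  have hv0 : 0 ≤ vV V hfin := add_nonneg zero_le_one (Finset.sum_nonneg fun k _ => hnn k)
  have hc0 : 0 ≤ cV V hfin := Finset.sum_nonneg fun k _ => mul_nonneg (hnn k) (by have : 0 ≤ znorm k := Real.sqrt_nonneg _; positivity)
  set cI := cIf (SV V hfin).card (cV V hfin) with hcI
  set cG := cGf (SV V hfin).card (cV V hfin) with hcG
  have hcI0 : 0 ≤ cI := by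
    rw [hcI]; unfold cIf cGf; positivity
  set E1 := 4 * cI * vV V hfin * (30 * m + 350) + 16 * √(SV V hfin).card * cG ^ 2 * √(30 * m + 350) + 4 * cG ^ 2 with hE1
  refine ⟨4 * cV V hfin * cI * vV V hfin * (2 * m + m ^ 2) + ∑ k ∈ SVp V hfin, (V k * (20000*(znorm k+znorm k^2)) + V k * E1), max 100 m, ?_⟩
  intro R hRm
  have hR : 100 ≤ R := (le_max_left _ _).trans hRm
  have hRm' : m ≤ R := (le_max_right _ _).trans hRm
  have hN := nR_pos hR
  have hb0 := hb_pos hR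
  have hpos : ∀ k, ∀ p ∈ cutk R k (th R), 0 < hk2 R k p := by
    intro k p hp
    have := lamk_pos (Finset.mem_filter.1 hp).1
    unfold hk2; positivity
  choose kp φ h1 h2 h3 h4 h5 h6 using fun k => mmf (cutk R k (th R)) (hk2 R k) (hpos k) (2 * V k / nR R) (by have := hnn k; positivity)
  let D := mkDat V hnn hfin hev R hR kp φ h1 h2 h3 h4 h5
  have hg := D.ground V hnn hfin hev (fun k => mem_SV) (2 * (m * R + m ^ 2 / 2)) (by positivity) (by
    intro k hk p hp
    have a1 := lamk_le hp
    have a2 : znorm k ≤ m := hmk k hk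
    have a3 : 0 ≤ znorm k := Real.sqrt_nonneg _
    have hRp : 0 ≤ R := by linarith
    change lamk k p ≤ znorm k * R + znorm k ^ 2 / 2 at a1
    have : znorm k * R ≤ m * R := by gcongr
    have : znorm k ^ 2 ≤ m ^ 2 := by gcongr
    linarith)
  change groundEnergy V (numParticles R) ≤ hb R ^ 2 * (∑ p ∈ ballF R, znorm p ^ 2 + ∑ k ∈ SVp V hfin, D.Kk k
      + 4 * cV V hfin * cI * (vV V hfin * th R) * (2 * (m * R + m ^ 2 / 2))) + Dat.Epot V hfin R
      + 1 / nR R * ∑ k ∈ SVp V hfin, V k * (D.Wk k + D.Err k) at hg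
  refine hg.trans ?_
  have hk := kin_err (C := 4 * cV V hfin * cI * vV V hfin) hR hm0 (by positivity)
  have hmain : ∀ k ∈ SVp V hfin, hb R ^ 2 * D.Kk k + 1 / nR R * (V k * (D.Wk k + D.Err k)) ≤
      hb R * (2 * (κ * rpaK (V k) (znorm k))) + (V k * (20000*(znorm k+znorm k^2)) + V k * E1) * (hb R * th R) := by
    intro k hk
    have hkm := (mem_SVp.1 hk).1
    have hl := lattice_k k hkm.2 (V k) (hnn k) R hR
    rw [← h6 k] at hl
    have e1 : hb R ^ 2 * D.Kk k = ∑ i ∈ cutk R k (th R), (Real.cosh (2 * kp k i) - 1) * ∑ p ∈ cutk R k (th R), hk2 R k p * φ k i p ^ 2 := by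
      change hb R ^ 2 * (∑ i ∈ cutk R k (th R), (Real.cosh (2 * kp k i) - 1) * ∑ p ∈ cutk R k (th R), 2 * lamk k p * φ k i p ^ 2) = _
      rw [Finset.mul_sum]
      refine Finset.sum_congr rfl fun i _ => ?_
      rw [mul_left_comm, Finset.mul_sum]
      congr 1
      refine Finset.sum_congr rfl fun p _ => ?_
      unfold hk2; ring
    have e2 : D.Wk k = ∑ i ∈ cutk R k (th R), (Real.exp (-2 * kp k i) - 1) * (∑ p ∈ cutk R k (th R), φ k i p) ^ 2 := rfl
    have e3 : 1 / nR R * D.Err k ≤ E1 * (hb R * th R) := by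
      have a1 := Lset_card R k (by linarith) ((hmk k (mem_SV.2 hkm)).trans hRm')
      have a2 : ((Lset R k).card : ℝ) ≤ (30 * m + 350) * R ^ 2 := by
        refine a1.trans ?_
        have := hmk k (mem_SV.2 hkm)
        gcongr
      exact err_const hR a2 (by positivity) hcI0 (Real.sqrt_nonneg _) hv0
    have e4 := mul_le_mul_of_nonneg_left e3 (hnn k)
    rw [e1, e2]
    set W := ∑ i ∈ cutk R k (th R), (Real.exp (-2 * kp k i) - 1) * (∑ p ∈ cutk R k (th R), φ k i p) ^ 2 with hW
    have e5 : 1 / nR R * (V k * (W + D.Err k)) = 2 * V k / nR R / 2 * W + V k * (1 / nR R * D.Err k) := by ring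
    rw [e5]
    linarith [hl, e4]
  have hsum := Finset.sum_le_sum hmain
  rw [Finset.sum_add_distrib, Finset.sum_add_distrib, ← Finset.mul_sum, ← Finset.mul_sum, ← Finset.mul_sum, ← Finset.sum_mul] at hsum
  nlinarith [hsum, hk]

end

/-! ### Module H: one-particle L² space and Parseval -/

noncomputable section

abbrev mu1 : Measure (Fin 3 → ℝ) := volume.restrict box1

theorem box1_lt : volume box1 < ⊤ := (measure_mono box1_subset).trans_lt
  (isCompact_univ_pi fun _ => isCompact_Icc).measure_lt_top

instance : IsFiniteMeasure mu1 := ⟨by rw [Measure.restrict_apply_univ]; exact box1_lt⟩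

theorem cm_memLp (f : C(Fin 3 → ℝ, ℂ)) : MemLp f 2 mu1 :=
  (memLp_two_iff_integrable_sq_norm f.continuous.aestronglyMeasurable).2
    (box1_cint _ (f.continuous.norm.pow 2))

/-- continuous functions as elements of L² of the box -/
def eL : C(Fin 3 → ℝ, ℂ) →ₗ[ℂ] Lp ℂ 2 mu1 where
  toFun f := (cm_memLp f).toLp f
  map_add' f g := MemLp.toLp_add (cm_memLp f) (cm_memLp g)
  map_smul' c f := MemLp.toLp_const_smul c (cm_memLp f)

theorem eL_inner (f g : C(Fin 3 → ℝ, ℂ)) :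
    inner ℂ (eL f) (eL g) = ∫ y in box1, (starRingEnd ℂ) (f y) * g y := by
  rw [L2.inner_def]
  refine integral_congr_ae ?_
  filter_upwards [(cm_memLp f).coeFn_toLp, (cm_memLp g).coeFn_toLp] with y h1 h2
  change inner ℂ ((cm_memLp f).toLp f y) ((cm_memLp g).toLp g y) = _
  rw [h1, h2, RCLike.inner_apply', ]

theorem eL_norm (f : C(Fin 3 → ℝ, ℂ)) : ‖eL f‖ ^ 2 = ∫ y in box1, ‖f y‖ ^ 2 := by
  have h := inner_self_eq_norm_sq_to_K (𝕜 := ℂ) (eL f)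
  rw [eL_inner] at h
  have : ((‖eL f‖ ^ 2 : ℝ) : ℂ) = ((∫ y in box1, ‖f y‖ ^ 2 : ℝ) : ℂ) := by
    rw [← integral_complex_ofReal, Complex.ofReal_pow]
    refine h.symm.trans ?_
    congr 1; funext y
    rw [← Complex.normSq_eq_conj_mul_self, Complex.normSq_eq_norm_sq]
  exact_mod_cast this

/-- normalised plane waves -/
def wk (p : Fin 3 → ℤ) : C(Fin 3 → ℝ, ℂ) := ((nrmc 1 : ℝ) : ℂ) • ⟨ek p, ek_cont p⟩

theorem wk_apply (p y) : wk p y = (nrmc 1 : ℂ) * ek p y := rfl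

theorem wk_orth : Orthonormal ℂ (fun p => eL (wk p)) := by
  rw [orthonormal_iff_ite]
  intro p q
  rw [eL_inner]
  have e : ∀ y, (starRingEnd ℂ) (wk p y) * wk q y = (nrmc 1 : ℂ) ^ 2 * ek (-p + q) y := by
    intro y; rw [wk_apply, wk_apply, map_mul, ek_conj, ek_add, Complex.conj_ofReal]; ring
  simp_rw [e]
  rw [integral_const_mul, int_ek]
  have := nrmc_sq (N := 1)
  by_cases h : p = q
  · subst h; simp
    exact_mod_cast this
  · have : -p + q ≠ 0 := fun h' => h (by rw [neg_add_eq_zero] at h'; exact h')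
    simp [h, this]

def boxc : Set (Fin 3 → ℝ) := {x | ∀ i, x i ∈ Set.Ioc (0:ℝ) (0 + 1)}

open scoped Pointwise in
theorem boxc_int {E : Type*} [NormedAddCommGroup E] [NormedSpace ℝ E] (G : (Fin 3 → ℝ) → E) :
    ∫ x in boxc, G ((2*π) • x) = ((2*π)^3)⁻¹ • ∫ y in box1, G y := by
  rw [Measure.setIntegral_comp_smul volume G boxc (R := 2*π) (by positivity)]
  have h1 : (2*π) • boxc = Set.univ.pi fun _ : Fin 3 => Set.Ioc (0:ℝ) (2*π) := by
    ext x
    rw [Set.mem_smul_set_iff_inv_smul_mem₀ (by positivity)]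
    simp only [boxc, Set.mem_setOf_eq, Set.mem_pi, Set.mem_univ, true_imp_iff, Pi.smul_apply, smul_eq_mul, Set.mem_Ioc]
    refine forall_congr' fun i => ?_
    have h2 : (0:ℝ) < 2*π := by positivity
    rw [zero_add, inv_mul_eq_div, div_le_one h2]
    constructor
    · rintro ⟨a, b⟩; exact ⟨(div_pos_iff_of_pos_right h2).1 a, b⟩
    · rintro ⟨a, b⟩; exact ⟨div_pos a h2, b⟩
  rw [h1]
  congr 1
  · rw [Module.finrank_fin_fun, abs_of_pos (by positivity)]
  · apply setIntegral_congr_set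
    exact Measure.univ_pi_Ioc_ae_eq_Icc.trans Measure.univ_pi_Ico_ae_eq_Icc.symm

abbrev Tor := UnitAddTorus (Fin 3)
def torm : Measure Tor := Measure.pi fun _ => AddCircle.haarAddCircle

/-- transplant to torus -/
def lft (t : Tor) : Fin 3 → ℝ := (2*π) • fun i => (AddCircle.equivIoc 1 0 (t i)).1

theorem lft_coe (x : Fin 3 → ℝ) (hx : x ∈ boxc) : lft (fun i => (x i : UnitAddCircle)) = (2*π) • x := by
  unfold lft
  congr 1; funext i
  exact AddCircle.equivIoc_coe_of_mem (hx i)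

theorem torm_int {E : Type*} [NormedAddCommGroup E] [NormedSpace ℝ E] (G : (Fin 3 → ℝ) → E) :
    ∫ t, G (lft t) ∂torm = ((2*π)^3)⁻¹ • ∫ y in box1, G y := by
  rw [← boxc_int]
  have := UnitAddTorus.integral_preimage (fun t : Tor => G (lft t)) (fun _ => 0)
  refine Eq.trans this ?_
  change ∫ x in boxc, _ = _
  refine setIntegral_congr_fun ?_ fun x hx => ?_
  · have : boxc = Set.univ.pi fun _ : Fin 3 => Set.Ioc (0:ℝ) (0 + 1) := by ext x; simp [boxc]
    rw [this]
    exact MeasurableSet.univ_pi fun _ => measurableSet_Ioc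
  · exact congrArg G (lft_coe x hx)

theorem lft_meas : Measurable lft := by
  refine measurable_pi_iff.2 fun i => ?_
  refine Measurable.const_mul ?_ (2*π)
  exact measurable_subtype_coe.comp ((AddCircle.measurableEquivIoc 1 0).measurable.comp (measurable_pi_apply i))

theorem lft_mem (t) : lft t ∈ Set.univ.pi fun _ : Fin 3 => Set.Icc (0:ℝ) (2*π) := by
  intro i _
  have := (AddCircle.equivIoc 1 0 (t i)).2
  rw [Set.mem_Ioc] at this
  have h2 : (0:ℝ) < 2*π := by positivity
  constructor
  · exact mul_nonneg h2.le this.1.le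
  · change 2*π * _ ≤ _
    nlinarith [this.2]

theorem fourier_lft (p : Fin 3 → ℤ) (t : Tor) : UnitAddTorus.mFourier (-p) t = (starRingEnd ℂ) (ek p (lft t)) := by
  rw [ek_conj, ek_prod]
  change ∏ i, fourier ((-p) i) (t i) = _
  refine Finset.prod_congr rfl fun i _ => ?_
  have h : t i = ((AddCircle.equivIoc 1 0 (t i)).1 : UnitAddCircle) := AddCircle.coe_equivIoc.symm
  conv_lhs => rw [h]
  rw [fourier_coe_apply]
  congr 1
  simp only [lft, Pi.smul_apply, smul_eq_mul]
  push_cast; ring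

theorem parseval (f : C(Fin 3 → ℝ, ℂ)) : HasSum (fun p => ‖inner ℂ (eL (wk p)) (eL f)‖ ^ 2) (‖eL f‖ ^ 2) := by
  obtain ⟨B, hB⟩ := (isCompact_univ_pi fun _ : Fin 3 => isCompact_Icc (a := (0:ℝ)) (b := 2*π)).exists_bound_of_continuousOn f.continuous.continuousOn
  have hm : MemLp (fun t => f (lft t)) 2 torm := by
    haveI : IsFiniteMeasure torm := by unfold torm; infer_instance
    exact MemLp.of_bound (f.continuous.measurable.comp lft_meas).aestronglyMeasurable B (Filter.Eventually.of_forall fun t => hB _ (lft_mem t))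
  have h := UnitAddTorus.hasSum_sq_mFourierCoeff (d := Fin 3) (hm.toLp _)
  have hae := hm.coeFn_toLp
  have e1 : ∫ t, ‖hm.toLp _ t‖ ^ 2 ∂torm = ((2*π)^3)⁻¹ * ‖eL f‖ ^ 2 := by
    rw [eL_norm, ← smul_eq_mul, ← torm_int (fun y => ‖f y‖^2)]
    refine integral_congr_ae ?_
    filter_upwards [hae] with t ht
    rw [ht]
  have e2 : ∀ p, ‖UnitAddTorus.mFourierCoeff (hm.toLp _) p‖ ^ 2 = ((2*π)^3)⁻¹ * ‖inner ℂ (eL (wk p)) (eL f)‖ ^ 2 := by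
    intro p
    have e3 : UnitAddTorus.mFourierCoeff (hm.toLp _) p = ∫ t, (starRingEnd ℂ) (ek p (lft t)) * f (lft t) ∂torm := by
      refine integral_congr_ae ?_
      filter_upwards [hae] with t ht
      rw [ht, fourier_lft]; rfl
    rw [e3, torm_int (fun y => (starRingEnd ℂ) (ek p y) * f y), eL_inner]
    have e4 : ∀ y, (starRingEnd ℂ) (wk p y) * f y = (nrmc 1 : ℂ) * ((starRingEnd ℂ) (ek p y) * f y) := by
      intro y; rw [wk_apply, map_mul, Complex.conj_ofReal]; ring
    simp_rw [e4]
    rw [integral_const_mul, norm_smul, norm_mul]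
    have h5 := nrmc_sq (N := 1)
    simp only [mul_one] at h5
    have h6 : ‖((nrmc 1 : ℝ) : ℂ)‖ ^ 2 = ((2*π)^3)⁻¹ := by
      rw [Complex.norm_real, Real.norm_eq_abs, sq_abs]
      exact eq_inv_of_mul_eq_one_left h5
    rw [mul_pow ‖((nrmc 1 : ℝ) : ℂ)‖, h6, Real.norm_of_nonneg (by positivity)]; ring
  have h' : HasSum (fun p => ((2*π)^3)⁻¹ * ‖inner ℂ (eL (wk p)) (eL f)‖ ^ 2) (((2*π)^3)⁻¹ * ‖eL f‖ ^ 2) := by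
    rw [← e1, ← funext e2]; exact h
  rwa [hasSum_mul_left_iff (by positivity)] at h'

end

/-! ### Fourier coefficients of derivatives -/

noncomputable section

def Per (f : (Fin 3 → ℝ) → ℂ) : Prop := ∀ (y : Fin 3 → ℝ) (m : Fin 3 → ℤ), f (y + fun i => 2 * π * (m i : ℝ)) = f y

theorem int_pderiv (g : (Fin 3 → ℝ) → ℂ) (hg : ContDiff ℝ (⊤ : ℕ∞) g) (hp : Per g) (i : Fin 3) :
    ∫ y in box1, fderiv ℝ g y (Pi.single i (1:ℝ)) = 0 := by
  have hpi : (0:ℝ) ≤ 2 * π := by positivity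
  have hc : Continuous fun y => fderiv ℝ g y (Pi.single i (1:ℝ)) :=
    (hg.continuous_fderiv (by simp)).clm_apply continuous_const
  have h := integral_divergence_of_hasFDerivAt_off_countable' (n := 2) (fun _ => (0:ℝ)) (fun _ => 2*π) (fun _ => hpi)
    (fun l y => if l = i then g y else 0) (fun l y => if l = i then fderiv ℝ g y else 0) ∅ Set.countable_empty
    (fun l => by
      by_cases h : l = i
      · simp only [h, if_true]; exact hg.continuous.continuousOn
      · simp only [h, if_false]; exact continuousOn_const)
    (fun x _ l => by
      by_cases h : l = i
      · simp only [h, if_true]; exact ((hg.differentiable (by simp)) x).hasFDerivAt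
      · simp only [h, if_false]; exact hasFDerivAt_const _ _)
    (by
      have e : (fun x => ∑ l, (if l = i then fderiv ℝ g x else 0) (Pi.single l (1:ℝ))) = fun y => fderiv ℝ g y (Pi.single i (1:ℝ)) := by
        funext x
        rw [Finset.sum_eq_single i (fun l _ hl => by simp [hl]) (by simp)]
        simp
      rw [e]
      exact hc.continuousOn.integrableOn_compact isCompact_Icc)
  have e : ∀ x, ∑ l, (if l = i then fderiv ℝ g x else 0) (Pi.single l (1:ℝ)) = fderiv ℝ g x (Pi.single i (1:ℝ)) := by
    intro x
    rw [Finset.sum_eq_single i (fun l _ hl => by simp [hl]) (by simp)]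
    simp
  simp_rw [e] at h
  have e2 : ∫ y in box1, fderiv ℝ g y (Pi.single i (1:ℝ)) = ∫ y in Set.Icc (fun _ => (0:ℝ)) (fun _ => 2*π), fderiv ℝ g y (Pi.single i (1:ℝ)) :=
    setIntegral_congr_set Measure.univ_pi_Ico_ae_eq_Icc
  rw [e2, h]
  refine Finset.sum_eq_zero fun l _ => ?_
  rw [sub_eq_zero]
  congr 1
  funext x
  by_cases hl : l = i
  · simp only [hl, if_true]
    have := hp (i.insertNth (0:ℝ) x) (Pi.single i 1)
    rw [← this]
    congr 1
    funext j
    rcases eq_or_ne j i with rfl | hj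
    · simp
    · obtain ⟨j', rfl⟩ := Fin.exists_succAbove_eq hj
      simp [Pi.single_apply]
  · simp [hl]

theorem ek_line1 (p : Fin 3 → ℤ) (x) (i : Fin 3) (t : ℝ) :
    ek p (x + t • (Pi.single i (1:ℝ) : Fin 3 → ℝ)) = ek p x * Complex.exp (Complex.I * (p i : ℂ) * t) := by
  unfold ek
  rw [← Complex.exp_add]
  congr 1
  have : ∑ j, (p j : ℝ) * (x + t • (Pi.single i (1:ℝ) : Fin 3 → ℝ)) j = ∑ j, (p j : ℝ) * x j + p i * t := by
    simp only [Pi.add_apply, Pi.smul_apply, smul_eq_mul, mul_add, Finset.sum_add_distrib]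
    congr 1
    rw [Finset.sum_eq_single i (fun l _ hl => by simp [hl]) (by simp)]
    simp
  rw [this]; push_cast; ring

theorem ek_fderiv (p : Fin 3 → ℤ) (x) (i : Fin 3) :
    fderiv ℝ (ek p) x (Pi.single i (1:ℝ)) = Complex.I * (p i : ℂ) * ek p x := by
  have hd : DifferentiableAt ℝ (ek p) x := ((ek_contDiff p).differentiable (by simp)) x
  rw [← hd.lineDeriv_eq_fderiv]
  unfold lineDeriv
  simp_rw [ek_line1]
  have h1 : HasDerivAt (fun t : ℝ => Complex.exp (Complex.I * (p i : ℂ) * t)) (Complex.exp (Complex.I * (p i : ℂ) * (0:ℝ)) * (Complex.I * (p i : ℂ))) 0 := by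
    have h2 : HasDerivAt (fun t : ℝ => Complex.I * (p i : ℂ) * (t:ℂ)) (Complex.I * (p i : ℂ)) 0 := by
      simpa using (Complex.ofRealCLM.hasDerivAt (x := (0:ℝ))).const_mul (Complex.I * (p i : ℂ))
    exact h2.cexp
  rw [(h1.const_mul (ek p x)).deriv]
  simp; ring

/-- partial derivative as continuous map -/
def pd (f : (Fin 3 → ℝ) → ℂ) (hf : ContDiff ℝ (⊤ : ℕ∞) f) (i : Fin 3) : C(Fin 3 → ℝ, ℂ) :=
  ⟨fun y => fderiv ℝ f y (Pi.single i (1:ℝ)), (hf.continuous_fderiv (by simp)).clm_apply continuous_const⟩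

theorem pd_inner (f : (Fin 3 → ℝ) → ℂ) (hf : ContDiff ℝ (⊤ : ℕ∞) f) (hp : Per f) (i : Fin 3) (p : Fin 3 → ℤ) :
    inner ℂ (eL (wk p)) (eL (pd f hf i)) = Complex.I * (p i : ℂ) * inner ℂ (eL (wk p)) (eL ⟨f, hf.continuous⟩) := by
  have hg : ContDiff ℝ (⊤ : ℕ∞) (fun y => ek (-p) y * f y) := (ek_contDiff (-p)).mul hf
  have h0 := int_pderiv _ hg (fun y m => by beta_reduce; rw [ek_periodic, hp]) i
  have e : ∀ y, fderiv ℝ (fun y => ek (-p) y * f y) y (Pi.single i (1:ℝ)) =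
      ek (-p) y * fderiv ℝ f y (Pi.single i (1:ℝ)) + (-(Complex.I * (p i : ℂ))) * (ek (-p) y * f y) := by
    intro y
    have := fderiv_fun_mul (((ek_contDiff (-p)).differentiable (by simp)) y) ((hf.differentiable (by simp)) y)
    rw [this]
    simp only [ContinuousLinearMap.add_apply, ContinuousLinearMap.smul_apply, smul_eq_mul, ek_fderiv]
    simp; ring
  simp_rw [e] at h0
  have c1 : Continuous fun y => ek (-p) y * fderiv ℝ f y (Pi.single i (1:ℝ)) :=
    (ek_cont _).mul ((hf.continuous_fderiv (by simp)).clm_apply continuous_const)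
  have c2 : Continuous fun y => ek (-p) y * f y := (ek_cont _).mul hf.continuous
  rw [integral_add (box1_cint _ c1) ((box1_cint _ c2).const_mul _), integral_const_mul] at h0
  rw [eL_inner, eL_inner]
  have e4 : ∀ (g : C(Fin 3 → ℝ, ℂ)) y, (starRingEnd ℂ) (wk p y) * g y = (nrmc 1 : ℂ) * (ek (-p) y * g y) := by
    intro g y; rw [wk_apply, map_mul, Complex.conj_ofReal, ek_conj]; ring
  simp_rw [e4]
  rw [integral_const_mul, integral_const_mul]
  change (nrmc 1 : ℂ) * (∫ y in box1, ek (-p) y * fderiv ℝ f y (Pi.single i (1:ℝ))) = _ * (_ * ∫ y in box1, ek (-p) y * f y)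
  linear_combination (nrmc 1 : ℂ) * h0

/-- kinetic energy dominates the Fourier side on any finite set -/
theorem kin_fourier (f : (Fin 3 → ℝ) → ℂ) (hf : ContDiff ℝ (⊤ : ℕ∞) f) (hp : Per f) (F : Finset (Fin 3 → ℤ)) :
    ∑ p ∈ F, znorm p ^ 2 * ‖inner ℂ (eL (wk p)) (eL ⟨f, hf.continuous⟩)‖ ^ 2 ≤
      ∑ i, ∫ y in box1, ‖fderiv ℝ f y (Pi.single i (1:ℝ))‖ ^ 2 := by
  have h : ∀ i, ∑ p ∈ F, (p i : ℝ) ^ 2 * ‖inner ℂ (eL (wk p)) (eL ⟨f, hf.continuous⟩)‖ ^ 2 ≤ ∫ y in box1, ‖fderiv ℝ f y (Pi.single i (1:ℝ))‖ ^ 2 := by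
    intro i
    have := wk_orth.sum_inner_products_le (s := F) (x := eL (pd f hf i))
    rw [eL_norm] at this
    refine le_trans (le_of_eq ?_) this
    refine Finset.sum_congr rfl fun p _ => ?_
    rw [pd_inner f hf hp]
    simp [mul_pow]
  refine le_trans (le_of_eq ?_) (Finset.sum_le_sum fun i _ => h i)
  rw [Finset.sum_comm]
  refine Finset.sum_congr rfl fun p _ => ?_
  rw [← Finset.sum_mul]
  congr 1
  unfold znorm
  rw [Real.sq_sqrt (Finset.sum_nonneg fun i _ => sq_nonneg _)]

end

/-! ### Slater determinants -/

noncomputable section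

variable {N : ℕ}

abbrev C3 := C(Fin 3 → ℝ, ℂ)

def slg (F : Fin N → Fin N → C3) (x : Fin N → Fin 3 → ℝ) : ℂ :=
  ∑ σ : Equiv.Perm (Fin N), ((Equiv.Perm.sign σ : ℤ) : ℂ) * ∏ l, F (σ l) l (x (σ l))

theorem slg_cont (F : Fin N → Fin N → C3) : Continuous (slg F) := by
  unfold slg
  refine continuous_finset_sum _ fun σ _ => continuous_const.mul (continuous_finset_prod _ fun l _ => ?_)
  exact (F (σ l) l).continuous.comp (continuous_apply _)

theorem slg_inner (F G : Fin N → Fin N → C3) :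
    ∫ x in boxN N, (starRingEnd ℂ) (slg F x) * slg G x = ∑ σ : Equiv.Perm (Fin N), ∑ τ : Equiv.Perm (Fin N),
      ((Equiv.Perm.sign σ : ℤ) : ℂ) * ((Equiv.Perm.sign τ : ℤ) : ℂ) * ∏ m, inner ℂ (eL (F m (σ⁻¹ m))) (eL (G m (τ⁻¹ m))) := by
  have e : ∀ x, (starRingEnd ℂ) (slg F x) * slg G x = ∑ σ : Equiv.Perm (Fin N), ∑ τ : Equiv.Perm (Fin N),
      ((Equiv.Perm.sign σ : ℤ) : ℂ) * ((Equiv.Perm.sign τ : ℤ) : ℂ) * ∏ m, ((starRingEnd ℂ) (F m (σ⁻¹ m) (x m)) * (G m (τ⁻¹ m) (x m))) := by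
    intro x
    unfold slg
    rw [map_sum, Finset.sum_mul_sum]
    refine Finset.sum_congr rfl fun σ _ => Finset.sum_congr rfl fun τ _ => ?_
    rw [map_mul, Finset.prod_mul_distrib, map_prod]
    have e1 : ∏ l, (starRingEnd ℂ) (F (σ l) l (x (σ l))) = ∏ m, (starRingEnd ℂ) (F m (σ⁻¹ m) (x m)) := by
      rw [← Equiv.prod_comp σ (fun m => (starRingEnd ℂ) (F m (σ⁻¹ m) (x m)))]
      simp
    have e2 : ∏ l, (G (τ l) l (x (τ l))) = ∏ m, (G m (τ⁻¹ m) (x m)) := by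
      rw [← Equiv.prod_comp τ (fun m => (G m (τ⁻¹ m) (x m)))]
      simp
    rw [e1, e2]
    simp; ring
  simp_rw [e]
  have hc : ∀ σ τ : Equiv.Perm (Fin N), Continuous fun x : Fin N → Fin 3 → ℝ => ((Equiv.Perm.sign σ : ℤ) : ℂ) * ((Equiv.Perm.sign τ : ℤ) : ℂ) * ∏ m, ((starRingEnd ℂ) (F m (σ⁻¹ m) (x m)) * (G m (τ⁻¹ m) (x m))) := by
    intro σ τ
    refine continuous_const.mul (continuous_finset_prod _ fun m _ => ?_)
    exact (Complex.continuous_conj.comp ((F m (σ⁻¹ m)).continuous.comp (continuous_apply _))).mul ((G m (τ⁻¹ m)).continuous.comp (continuous_apply _))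
  rw [integral_finsetSum _ fun σ _ => boxN_cint _ (continuous_finset_sum _ fun τ _ => hc σ τ)]
  refine Finset.sum_congr rfl fun σ _ => ?_
  rw [integral_finsetSum _ fun τ _ => boxN_cint _ (hc σ τ)]
  refine Finset.sum_congr rfl fun τ _ => ?_
  rw [integral_const_mul, prodint (fun m y => (starRingEnd ℂ) (F m (σ⁻¹ m) y) * (G m (τ⁻¹ m) y))]
  simp_rw [eL_inner]

theorem sign_sq (σ : Equiv.Perm (Fin N)) : ((Equiv.Perm.sign σ : ℤ) : ℂ) * ((Equiv.Perm.sign σ : ℤ) : ℂ) = 1 := by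
  rw [← Int.cast_mul, ← Units.val_mul, Int.units_mul_self]; simp

/-- normalized Slater determinant -/
def sl (g : Fin N → C3) (x : Fin N → Fin 3 → ℝ) : ℂ :=
  ((Real.sqrt (Nat.factorial N) : ℂ))⁻¹ * slg (fun _ l => g l) x

theorem sl_cont (g : Fin N → C3) : Continuous (sl g) := continuous_const.mul (slg_cont _)

theorem sl_det (g : Fin N → C3) (x) : sl g x = ((Real.sqrt (Nat.factorial N) : ℂ))⁻¹ * (Matrix.of fun a b => g b (x a)).det := by
  unfold sl slg; rw [Matrix.det_apply']; rfl

theorem sfac : ((Real.sqrt (Nat.factorial N) : ℂ))⁻¹ * ((Real.sqrt (Nat.factorial N) : ℂ))⁻¹ * (Nat.factorial N : ℂ) = 1 := by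
  have h : ((Real.sqrt (Nat.factorial N) : ℂ)) * (Real.sqrt (Nat.factorial N) : ℂ) = (Nat.factorial N : ℂ) := by
    rw [← Complex.ofReal_mul, Real.mul_self_sqrt (by positivity)]; simp
  rw [← h]
  have : (Real.sqrt (Nat.factorial N) : ℂ) ≠ 0 := by
    have : (0:ℝ) < Real.sqrt (Nat.factorial N) := Real.sqrt_pos.2 (by exact_mod_cast Nat.factorial_pos N)
    exact_mod_cast this.ne'
  field_simp

theorem sl_inner (g h : Fin N → C3) :
    ∫ x in boxN N, (starRingEnd ℂ) (sl g x) * sl h x = (Matrix.of fun i j => inner ℂ (eL (g i)) (eL (h j))).det := by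
  have e : ∀ x, (starRingEnd ℂ) (sl g x) * sl h x = (((Real.sqrt (Nat.factorial N) : ℂ))⁻¹ * ((Real.sqrt (Nat.factorial N) : ℂ))⁻¹) *
     ((starRingEnd ℂ) (slg (fun _ l => g l) x) * slg (fun _ l => h l) x) := by
    intro x; unfold sl; rw [map_mul, map_inv₀, Complex.conj_ofReal]; ring
  simp_rw [e]
  rw [integral_const_mul, slg_inner]
  have h1 : ∀ σ : Equiv.Perm (Fin N), ∑ τ : Equiv.Perm (Fin N), ((Equiv.Perm.sign σ : ℤ) : ℂ) * ((Equiv.Perm.sign τ : ℤ) : ℂ) * ∏ m, inner ℂ (eL (g (σ⁻¹ m))) (eL (h (τ⁻¹ m)))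
      = (Matrix.of fun i j => inner ℂ (eL (g i)) (eL (h j))).det := by
    intro σ
    rw [Matrix.det_apply', ← Equiv.sum_comp (Equiv.mulLeft σ)]
    refine Finset.sum_congr rfl fun ρ _ => ?_
    simp only [Equiv.coe_mulLeft, Equiv.Perm.sign_mul, Units.val_mul, Int.cast_mul, mul_inv_rev]
    rw [← mul_assoc, sign_sq, one_mul]
    congr 1
    rw [← Equiv.prod_comp (σ * ρ)]
    simp
  simp_rw [h1]
  rw [Finset.sum_const, Finset.card_univ, Fintype.card_perm, Fintype.card_fin, nsmul_eq_mul, ← mul_assoc, sfac, one_mul]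

/-- kinetic terms -/
theorem slg_single (j : Fin N) (f d : Fin N → C3) (ho : Orthonormal ℂ fun l => eL (f l)) :
    ∫ x in boxN N, (starRingEnd ℂ) (slg (fun m l => if m = j then d l else f l) x) * slg (fun m l => if m = j then d l else f l) x
      = ∑ σ : Equiv.Perm (Fin N), ((‖eL (d (σ⁻¹ j))‖ ^ 2 : ℝ) : ℂ) := by
  rw [slg_inner]
  refine Finset.sum_congr rfl fun σ _ => ?_
  rw [Finset.sum_eq_single σ]
  · rw [sign_sq, one_mul, Finset.prod_eq_single j]
    · simp only [if_true]
      rw [inner_self_eq_norm_sq_to_K]; norm_cast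
    · intro m _ hm
      simp only [if_neg hm]
      rw [inner_self_eq_norm_sq_to_K, ho.1]; simp
    · simp
  · intro τ _ hτ
    have : ∃ m, m ≠ j ∧ σ⁻¹ m ≠ τ⁻¹ m := by
      by_contra hcon
      push Not at hcon
      apply hτ
      have h2 : τ⁻¹ = σ⁻¹ := by
        have h3 : ∀ m, m ≠ j → (σ * τ⁻¹) m = m := by
          intro m hm
          rw [Equiv.Perm.mul_apply, ← hcon m hm]; simp
        have h4 : (σ * τ⁻¹) j = j := by
          by_contra h5
          have := h3 _ h5
          exact h5 ((σ * τ⁻¹).injective this)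
        have h6 : σ * τ⁻¹ = 1 := by
          ext m; by_cases hm : m = j
          · subst hm; simp only [h4]; rfl
          · rw [h3 m hm]; rfl
        rw [eq_comm]; exact inv_eq_of_mul_eq_one_right h6
      exact inv_injective h2
    obtain ⟨m, hm, hne⟩ := this
    have : ∏ m, inner ℂ (eL (if m = j then d (σ⁻¹ m) else f (σ⁻¹ m))) (eL (if m = j then d (τ⁻¹ m) else f (τ⁻¹ m))) = 0 := by
      refine Finset.prod_eq_zero (Finset.mem_univ m) ?_
      rw [if_neg hm, if_neg hm]
      exact ho.2 hne
    rw [this, mul_zero]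
  · simp

end

/-! ### Energy of Slater determinants -/

noncomputable section

variable {N : ℕ}

theorem norm_int_eq {N : ℕ} (u : (Fin N → Fin 3 → ℝ) → ℂ) : ((∫ x in boxN N, ‖u x‖ ^ 2 : ℝ) : ℂ) = ∫ x in boxN N, (starRingEnd ℂ) (u x) * u x := by
  rw [← integral_complex_ofReal]
  congr 1; funext x
  rw [← Complex.normSq_eq_conj_mul_self, Complex.normSq_eq_norm_sq]

/-- derivative of a Slater determinant -/
theorem sl_fderiv (f : Fin N → (Fin 3 → ℝ) → ℂ) (hf : ∀ l, ContDiff ℝ (⊤ : ℕ∞) (f l)) (hd : ContDiff ℝ (⊤ : ℕ∞) (sl fun l => ⟨f l, (hf l).continuous⟩))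
    (x) (j : Fin N) (i : Fin 3) :
    fderiv ℝ (sl fun l => ⟨f l, (hf l).continuous⟩) x (Pi.single j (Pi.single i (1 : ℝ))) =
      ((Real.sqrt (Nat.factorial N) : ℂ))⁻¹ * slg (fun m l => if m = j then pd (f l) (hf l) i else ⟨f l, (hf l).continuous⟩) x := by
  have hdx : DifferentiableAt ℝ (sl fun l => (⟨f l, (hf l).continuous⟩ : C3)) x := (hd.differentiable (by simp)) x
  rw [← hdx.lineDeriv_eq_fderiv]
  unfold lineDeriv
  refine HasDerivAt.deriv ?_
  unfold sl slg
  refine HasDerivAt.const_mul _ (HasDerivAt.fun_sum fun σ _ => HasDerivAt.const_mul _ ?_)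
  have e1 : ∀ t : ℝ, ∏ l, (⟨f l, (hf l).continuous⟩ : C3) ((x + t • (Pi.single j (Pi.single i (1:ℝ)) : Fin N → Fin 3 → ℝ)) (σ l))
      = f (σ⁻¹ j) (x j + t • (Pi.single i (1:ℝ) : Fin 3 → ℝ)) * ∏ l ∈ Finset.univ.erase (σ⁻¹ j), f l (x (σ l)) := by
    intro t
    rw [← Finset.mul_prod_erase _ _ (Finset.mem_univ (σ⁻¹ j))]
    congr 1
    · simp
    · refine Finset.prod_congr rfl fun l hl => ?_
      have : σ l ≠ j := by
        intro h; apply (Finset.mem_erase.1 hl).1; rw [← h]; simp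
      simp [Pi.single_eq_of_ne this]
  have e2 : ∏ l, (if σ l = j then pd (f l) (hf l) i else (⟨f l, (hf l).continuous⟩ : C3)) (x (σ l))
      = fderiv ℝ (f (σ⁻¹ j)) (x j) (Pi.single i (1:ℝ)) * ∏ l ∈ Finset.univ.erase (σ⁻¹ j), f l (x (σ l)) := by
    rw [← Finset.mul_prod_erase _ _ (Finset.mem_univ (σ⁻¹ j))]
    congr 1
    · simp [pd]
    · refine Finset.prod_congr rfl fun l hl => ?_
      have : σ l ≠ j := by
        intro h; apply (Finset.mem_erase.1 hl).1; rw [← h]; simp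
      simp [this]
  rw [funext e1, e2]
  refine HasDerivAt.mul_const ?_ _
  have h1 : DifferentiableAt ℝ (f (σ⁻¹ j)) (x j) := ((hf _).differentiable (by simp)) _
  have := h1.hasFDerivAt.hasLineDerivAt (Pi.single i (1:ℝ))
  exact this

theorem sl_kin (f : Fin N → (Fin 3 → ℝ) → ℂ) (hf : ∀ l, ContDiff ℝ (⊤ : ℕ∞) (f l)) (hd : ContDiff ℝ (⊤ : ℕ∞) (sl fun l => ⟨f l, (hf l).continuous⟩))
    (ho : Orthonormal ℂ fun l => eL (⟨f l, (hf l).continuous⟩ : C3)) :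
    ∑ j, ∫ x in boxN N, ∑ i, ‖fderiv ℝ (sl fun l => ⟨f l, (hf l).continuous⟩) x (Pi.single j (Pi.single i (1 : ℝ)))‖ ^ 2
      = ∑ l, ∑ i, ∫ y in box1, ‖fderiv ℝ (f l) y (Pi.single i (1:ℝ))‖ ^ 2 := by
  have h1 : ∀ j i, ∫ x in boxN N, ‖fderiv ℝ (sl fun l => ⟨f l, (hf l).continuous⟩) x (Pi.single j (Pi.single i (1 : ℝ)))‖ ^ 2
      = (Nat.factorial N : ℝ)⁻¹ * ∑ σ : Equiv.Perm (Fin N), ‖eL (pd (f (σ⁻¹ j)) (hf _) i)‖ ^ 2 := by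
    intro j i
    have h2 := slg_single j (fun l => (⟨f l, (hf l).continuous⟩ : C3)) (fun l => pd (f l) (hf l) i) ho
    rw [← norm_int_eq] at h2
    simp_rw [sl_fderiv f hf hd, norm_mul, mul_pow]
    rw [integral_const_mul]
    congr 1
    · rw [norm_inv, Complex.norm_real, Real.norm_of_nonneg (Real.sqrt_nonneg _), inv_pow, Real.sq_sqrt (by positivity)]
    · exact_mod_cast h2
  have hc : ∀ j i, Continuous fun x => ‖fderiv ℝ (sl fun l => (⟨f l, (hf l).continuous⟩ : C3)) x (Pi.single j (Pi.single i (1 : ℝ)))‖ ^ 2 := fun j i =>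
    ((hd.continuous_fderiv (by simp)).clm_apply continuous_const).norm.pow 2
  have h3 : ∀ j, ∫ x in boxN N, ∑ i, ‖fderiv ℝ (sl fun l => (⟨f l, (hf l).continuous⟩ : C3)) x (Pi.single j (Pi.single i (1 : ℝ)))‖ ^ 2
      = ∑ i, (Nat.factorial N : ℝ)⁻¹ * ∑ σ : Equiv.Perm (Fin N), ‖eL (pd (f (σ⁻¹ j)) (hf _) i)‖ ^ 2 := by
    intro j
    rw [integral_finsetSum _ fun i _ => boxN_cint _ (hc j i)]
    exact Finset.sum_congr rfl fun i _ => h1 j i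
  simp_rw [h3]
  rw [Finset.sum_comm, Finset.sum_comm (s := Finset.univ (α := Fin N))]
  refine Finset.sum_congr rfl fun i _ => ?_
  rw [← Finset.mul_sum, Finset.sum_comm]
  have h4 : ∀ σ : Equiv.Perm (Fin N), ∑ j, ‖eL (pd (f (σ⁻¹ j)) (hf _) i)‖ ^ 2 = ∑ l, ∫ y in box1, ‖fderiv ℝ (f l) y (Pi.single i (1:ℝ))‖ ^ 2 := by
    intro σ
    rw [Equiv.sum_comp σ⁻¹ (fun l => ‖eL (pd (f l) (hf l) i)‖ ^ 2)]
    refine Finset.sum_congr rfl fun l _ => ?_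
    rw [eL_norm]; rfl
  simp_rw [h4]
  rw [Finset.sum_const, Finset.card_univ, Fintype.card_perm, Fintype.card_fin, nsmul_eq_mul, ← mul_assoc, inv_mul_cancel₀, one_mul]
  exact_mod_cast (Nat.factorial_pos N).ne'

/-- multiplication by plane wave -/
def ekm (k : Fin 3 → ℤ) (f : C3) : C3 := ⟨fun y => ek k y * f y, (ek_cont k).mul f.continuous⟩

theorem ekm_inner (k) (f g : C3) : inner ℂ (eL (ekm k f)) (eL (ekm k g)) = inner ℂ (eL f) (eL g) := by
  rw [eL_inner, eL_inner]
  congr 1; funext y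
  change (starRingEnd ℂ) (ek k y * f y) * (ek k y * g y) = _
  have : (starRingEnd ℂ) (ek k y) * ek k y = 1 := by
    rw [ek_conj, ← ek_add, neg_add_cancel, ek_zero]
  rw [map_mul]
  linear_combination (starRingEnd ℂ) (f y) * g y * this

/-- remainder -/
def rml (k : Fin 3 → ℤ) (f : Fin N → C3) (l : Fin N) : C3 := ekm k (f l) - ∑ j, inner ℂ (eL (f j)) (eL (ekm k (f l))) • f j

theorem rml_orth (k) (f : Fin N → C3) (ho : Orthonormal ℂ fun l => eL (f l)) (i l : Fin N) :
    inner ℂ (eL (f i)) (eL (rml k f l)) = 0 := by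
  unfold rml
  rw [map_sub, map_sum, inner_sub_right, inner_sum]
  simp_rw [map_smul, inner_smul_right]
  rw [Finset.sum_eq_single i]
  · have := orthonormal_iff_ite.1 ho i i
    rw [this]; simp
  · intro j _ hj
    rw [ho.2 hj.symm, mul_zero]
  · simp

theorem sl_mul_ek (k) (f : Fin N → C3) (x) : (∑ j, ek k (x j)) * sl f x = ∑ l, sl (Function.update f l (ekm k (f l))) x := by
  have h : ∀ l, sl (Function.update f l (ekm k (f l))) x = ((Real.sqrt (Nat.factorial N) : ℂ))⁻¹ *
      ∑ σ : Equiv.Perm (Fin N), ((Equiv.Perm.sign σ : ℤ) : ℂ) * (ek k (x (σ l)) * ∏ j, f j (x (σ j))) := by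
    intro l
    unfold sl slg
    congr 1
    refine Finset.sum_congr rfl fun σ _ => ?_
    congr 1
    rw [← Finset.mul_prod_erase _ _ (Finset.mem_univ l), ← Finset.mul_prod_erase (a := l) _ _ (Finset.mem_univ l), ← mul_assoc]
    beta_reduce
    rw [Function.update_self]
    congr 1
    refine Finset.prod_congr rfl fun j hj => ?_
    rw [Function.update_of_ne (Finset.ne_of_mem_erase hj)]
  simp_rw [h]
  rw [← Finset.mul_sum, Finset.sum_comm]
  unfold sl slg
  rw [mul_left_comm, Finset.mul_sum]
  congr 1
  refine Finset.sum_congr rfl fun σ _ => ?_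
  rw [← Finset.mul_sum, ← Finset.sum_mul, Equiv.sum_comp σ (fun j => ek k (x j))]
  ring

theorem sl_update (k) (f : Fin N → C3) (l) (x) :
    sl (Function.update f l (ekm k (f l))) x = inner ℂ (eL (f l)) (eL (ekm k (f l))) * sl f x + sl (Function.update f l (rml k f l)) x := by
  set m : Fin N → ℂ := fun j => inner ℂ (eL (f j)) (eL (ekm k (f l))) with hm
  have hu : ∀ g : C3, (Matrix.of fun a b => (Function.update f l g) b (x a)) = (Matrix.of fun a b => f b (x a)).updateCol l fun a => g (x a) := by
    intro g; ext a b
    rw [Matrix.updateCol_apply]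
    by_cases h : b = l
    · subst h; simp
    · simp [h]
  have h1 : ∀ y, ekm k (f l) y = ∑ j, m j • f j y + rml k f l y := by
    intro y
    simp [rml, hm]
  rw [sl_det, sl_det, sl_det, hu, hu]
  have h2 : (fun a => ekm k (f l) (x a)) = (fun a => ∑ j, m j • (Matrix.of fun a b => f b (x a)) a j) + fun a => rml k f l (x a) := by
    funext a; exact h1 _
  rw [h2, Matrix.det_updateCol_add, Matrix.det_updateCol_sum, smul_eq_mul]
  ring

/-- pair term lower bound -/
theorem sl_pair (k) (f : Fin N → C3) (ho : Orthonormal ℂ fun l => eL (f l)) :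
    ∑ l, ‖eL (rml k f l)‖ ^ 2 ≤ ∫ x in boxN N, ‖(∑ j, ek k (x j)) * sl f x‖ ^ 2 := by
  classical
  let T : ℂ := ∑ l, inner ℂ (eL (f l)) (eL (ekm k (f l)))
  let a : Option (Fin N) → ℂ := fun o => o.elim T (fun _ => 1)
  let h : Option (Fin N) → Fin N → C3 := fun o => o.elim f (fun l => Function.update f l (rml k f l))
  have e : ∀ x, (∑ j, ek k (x j)) * sl f x = ∑ o, a o * sl (h o) x := by
    intro x
    rw [sl_mul_ek, Fintype.sum_option, Finset.sum_congr rfl fun l _ => sl_update k f l x, Finset.sum_add_distrib, ← Finset.sum_mul]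
    simp [a, h, T]
  have hinn : ∀ i j : Fin N, inner ℂ (eL (f i)) (eL (f j)) = if i = j then (1:ℂ) else 0 := orthonormal_iff_ite.1 ho
  have hr := rml_orth k f ho
  have hr' : ∀ i l, inner ℂ (eL (rml k f l)) (eL (f i)) = (0:ℂ) := fun i l => by
    rw [← inner_conj_symm, hr i l, map_zero]
  have hdet : ∀ o o', o ≠ o' → (Matrix.of fun i j => inner ℂ (eL (h o i)) (eL (h o' j))).det = (0:ℂ) := by
    intro o o' hoo
    rcases o with _ | l <;> rcases o' with _ | l'
    · exact absurd rfl hoo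
    · refine Matrix.det_eq_zero_of_column_eq_zero l' fun i => ?_
      simp [h, hr]
    · refine Matrix.det_eq_zero_of_row_eq_zero l fun j => ?_
      simp [h, hr']
    · have hl : l' ≠ l := fun hh => hoo (by rw [hh])
      refine Matrix.det_eq_zero_of_row_eq_zero l' fun j => ?_
      by_cases hj : j = l'
      · subst hj
        simp [h, Function.update_of_ne hl, hr]
      · simp [h, Function.update_of_ne hl, Function.update_of_ne hj, hinn, Ne.symm hj]
  have hdiag : ∀ l, (Matrix.of fun i j => inner ℂ (eL (h (some l) i)) (eL (h (some l) j))).det = ((‖eL (rml k f l)‖ ^ 2 : ℝ) : ℂ) := by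
    intro l
    have : (Matrix.of fun i j => inner ℂ (eL (h (some l) i)) (eL (h (some l) j))) = Matrix.diagonal fun i => if i = l then ((‖eL (rml k f l)‖ ^ 2 : ℝ) : ℂ) else 1 := by
      ext i j
      rw [Matrix.diagonal_apply]
      by_cases hi : i = l
      · subst hi
        by_cases hj : i = j
        · subst hj
          simp only [h, Option.elim, Matrix.of_apply, Function.update_self, if_true]
          rw [inner_self_eq_norm_sq_to_K]; norm_cast
        · simp [h, hj, Function.update_of_ne (Ne.symm hj), hr']
      · by_cases hj : j = l
        · subst hj
          simp [h, hi, Function.update_of_ne hi, hr]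
        · simp [h, hi, Function.update_of_ne hi, Function.update_of_ne hj, hinn]
    rw [this, Matrix.det_diagonal, Finset.prod_ite_eq']
    simp
  have h0 : (Matrix.of fun i j => inner ℂ (eL (h none i)) (eL (h none j))).det = (1:ℂ) := by
    have : (Matrix.of fun i j => inner ℂ (eL (h none i)) (eL (h none j))) = (1 : Matrix (Fin N) (Fin N) ℂ) := by
      ext i j
      rw [Matrix.one_apply]; exact hinn i j
    rw [this, Matrix.det_one]
  have key : ((∫ x in boxN N, ‖(∑ j, ek k (x j)) * sl f x‖ ^ 2 : ℝ) : ℂ) = ((‖T‖ ^ 2 + ∑ l, ‖eL (rml k f l)‖ ^ 2 : ℝ) : ℂ) := by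
    rw [norm_int_eq]
    have e2 : ∀ x, (starRingEnd ℂ) ((∑ j, ek k (x j)) * sl f x) * ((∑ j, ek k (x j)) * sl f x) =
        ∑ o, ∑ o', ((starRingEnd ℂ) (a o) * a o') * ((starRingEnd ℂ) (sl (h o) x) * sl (h o') x) := by
      intro x
      rw [e, map_sum, Finset.sum_mul_sum]
      refine Finset.sum_congr rfl fun o _ => Finset.sum_congr rfl fun o' _ => ?_
      rw [map_mul]; ring
    simp_rw [e2]
    have hc : ∀ o o', Continuous fun x => ((starRingEnd ℂ) (a o) * a o') * ((starRingEnd ℂ) (sl (h o) x) * sl (h o') x) := fun o o' =>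
      continuous_const.mul ((Complex.continuous_conj.comp (sl_cont _)).mul (sl_cont _))
    rw [integral_finsetSum _ fun o _ => boxN_cint _ (continuous_finset_sum _ fun o' _ => hc o o')]
    have e3 : ∀ o, ∫ x in boxN N, ∑ o', ((starRingEnd ℂ) (a o) * a o') * ((starRingEnd ℂ) (sl (h o) x) * sl (h o') x)
        = ((starRingEnd ℂ) (a o) * a o) * (Matrix.of fun i j => inner ℂ (eL (h o i)) (eL (h o j))).det := by
      intro o
      rw [integral_finsetSum _ fun o' _ => boxN_cint _ (hc o o'), Finset.sum_eq_single o]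
      · rw [integral_const_mul, sl_inner]
      · intro o' _ hne
        rw [integral_const_mul, sl_inner, hdet o o' hne.symm, mul_zero]
      · simp
    rw [Finset.sum_congr rfl fun o _ => e3 o, Fintype.sum_option, h0]
    simp_rw [hdiag]
    simp only [a, Option.elim, map_one, one_mul, mul_one]
    rw [← Complex.normSq_eq_conj_mul_self, Complex.normSq_eq_norm_sq]
    push_cast; rfl
  have key' : ∫ x in boxN N, ‖(∑ j, ek k (x j)) * sl f x‖ ^ 2 = ‖T‖ ^ 2 + ∑ l, ‖eL (rml k f l)‖ ^ 2 := by exact_mod_cast key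
  rw [key']
  have := sq_nonneg ‖T‖
  linarith

end

/-! ### One-body bounds for Slater determinants -/

noncomputable section

variable {N : ℕ}

/-- momentum distribution -/
def nocc (f : Fin N → C3) (p : Fin 3 → ℤ) : ℝ := ∑ j, ‖inner ℂ (eL (wk p)) (eL (f j))‖ ^ 2

theorem nocc_nonneg (f : Fin N → C3) (p) : 0 ≤ nocc f p := Finset.sum_nonneg fun _ _ => sq_nonneg _

theorem nocc_le_one (f : Fin N → C3) (ho : Orthonormal ℂ fun l => eL (f l)) (p) : nocc f p ≤ 1 := by
  have := ho.sum_inner_products_le (s := Finset.univ) (x := eL (wk p))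
  have h1 : ‖eL (wk p)‖ = 1 := wk_orth.1 p
  rw [h1] at this
  unfold nocc
  simp_rw [norm_inner_symm (𝕜 := ℂ) (eL (wk p))]
  simpa using this

theorem nocc_hasSum (f : Fin N → C3) (ho : Orthonormal ℂ fun l => eL (f l)) : HasSum (nocc f) N := by
  have h : HasSum (nocc f) (∑ j, ‖eL (f j)‖ ^ 2) := hasSum_sum fun j _ => parseval (f j)
  have h2 : ∑ j, ‖eL (f j)‖ ^ 2 = (N:ℝ) := by
    rw [Finset.sum_congr rfl fun j _ => by rw [ho.1 j]]; simp
  rwa [h2] at h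

theorem wk_add (q k) : wk (q + k) = ekm k (wk q) := by
  ext y
  change (nrmc 1 : ℂ) * ek (q + k) y = ek k y * ((nrmc 1 : ℂ) * ek q y)
  rw [ek_add]; ring

theorem cs_norm (a b : Fin N → ℂ) : ‖∑ j, a j * b j‖ ≤ √(∑ j, ‖a j‖ ^ 2) * √(∑ j, ‖b j‖ ^ 2) := by
  refine (norm_sum_le _ _).trans ?_
  simp_rw [norm_mul]
  exact Real.sum_mul_le_sqrt_mul_sqrt _ _ _

theorem exch_one (k) (f : Fin N → C3) (ho : Orthonormal ℂ fun l => eL (f l)) (q) :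
    1 - 2 * (1 - nocc f q) - 2 * √(nocc f (q + k)) ≤ ∑ l, ‖inner ℂ (eL (wk (q + k))) (eL (rml k f l))‖ ^ 2 := by
  set p := q + k with hp
  set Y := ∑ l, ‖inner ℂ (eL (wk p)) (eL (rml k f l))‖ ^ 2 with hY
  have hY0 : 0 ≤ Y := Finset.sum_nonneg fun _ _ => sq_nonneg _
  let c : Fin N → ℂ := fun l => inner ℂ (eL (wk q)) (eL (f l))
  let v : Fin N → ℂ := fun l => (starRingEnd ℂ) (c l)
  have hv : ∑ l, ‖v l‖ ^ 2 = nocc f q := by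
    unfold nocc
    refine Finset.sum_congr rfl fun l _ => ?_
    simp only [v, c, RCLike.norm_conj]
  have hok : Orthonormal ℂ fun l => eL (ekm k (f l)) := by
    rw [orthonormal_iff_ite]; intro i j
    rw [ekm_inner]; exact orthonormal_iff_ite.1 ho i j
  set g := ∑ l, v l • eL (ekm k (f l)) with hg
  have hgn : ‖g‖ ^ 2 ≤ 1 := by
    have h1 : ((‖g‖ ^ 2 : ℝ) : ℂ) = ((nocc f q : ℝ) : ℂ) := by
      have := inner_self_eq_norm_sq_to_K (𝕜 := ℂ) g
      have h2 : ((‖g‖ ^ 2 : ℝ) : ℂ) = inner ℂ g g := by rw [this]; norm_cast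
      rw [h2, hg, hok.inner_sum, ← hv]
      push_cast
      refine Finset.sum_congr rfl fun l _ => ?_
      rw [← Complex.normSq_eq_conj_mul_self, Complex.normSq_eq_norm_sq]
      norm_cast
    have h3 : ‖g‖ ^ 2 = nocc f q := by exact_mod_cast h1
    rw [h3]; exact nocc_le_one f ho q
  have hX : ∑ l, v l * inner ℂ (eL (wk p)) (eL (rml k f l)) = (nocc f q : ℂ) - ∑ j, inner ℂ (eL (wk p)) (eL (f j)) * inner ℂ (eL (f j)) g := by
    have e1 : ∀ l, inner ℂ (eL (wk p)) (eL (rml k f l)) = c l - ∑ j, inner ℂ (eL (wk p)) (eL (f j)) * inner ℂ (eL (f j)) (eL (ekm k (f l))) := by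
      intro l
      unfold rml
      rw [map_sub, map_sum, inner_sub_right, inner_sum]
      congr 1
      · rw [hp, wk_add, ekm_inner]
      · refine Finset.sum_congr rfl fun j _ => ?_
        rw [map_smul, inner_smul_right, mul_comm]
    simp_rw [e1, mul_sub]
    rw [Finset.sum_sub_distrib]
    congr 1
    · rw [← hv]; push_cast
      refine Finset.sum_congr rfl fun l _ => ?_
      have h5 : ((‖v l‖ : ℝ) : ℂ) ^ 2 = (starRingEnd ℂ) (v l) * v l := by
        rw [← Complex.normSq_eq_conj_mul_self, Complex.normSq_eq_norm_sq]; push_cast; rfl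
      rw [h5]; simp only [v, Complex.conj_conj]; ring
    · simp_rw [hg, inner_sum, inner_smul_right, Finset.mul_sum]
      rw [Finset.sum_comm]
      refine Finset.sum_congr rfl fun j _ => Finset.sum_congr rfl fun l _ => ?_
      ring
  have h1 : ‖∑ l, v l * inner ℂ (eL (wk p)) (eL (rml k f l))‖ ≤ √Y := by
    refine (cs_norm _ _).trans ?_
    rw [hv]
    have : √(nocc f q) ≤ 1 := by rw [Real.sqrt_le_one]; exact nocc_le_one f ho q
    calc √(nocc f q) * √Y ≤ 1 * √Y := by gcongr
      _ = √Y := one_mul _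
  have h2 : ‖∑ j, inner ℂ (eL (wk p)) (eL (f j)) * inner ℂ (eL (f j)) g‖ ≤ √(nocc f p) := by
    refine (cs_norm _ _).trans ?_
    have h3 : √(∑ j, ‖inner ℂ (eL (f j)) g‖ ^ 2) ≤ 1 := by
      rw [Real.sqrt_le_one]
      exact (ho.sum_inner_products_le (s := Finset.univ) (x := g)).trans hgn
    calc √(nocc f p) * _ ≤ √(nocc f p) * 1 := by gcongr
      _ = _ := mul_one _
  have h3 : nocc f q - √(nocc f p) ≤ √Y := by
    have h4 := norm_sub_norm_le ((nocc f q : ℝ) : ℂ) (∑ j, inner ℂ (eL (wk p)) (eL (f j)) * inner ℂ (eL (f j)) g)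
    rw [← hX, Complex.norm_real, Real.norm_of_nonneg (nocc_nonneg f q)] at h4
    linarith
  have h5 := Real.sq_sqrt hY0
  nlinarith [sq_nonneg (√Y - 1)]

section bounds

variable (R : ℝ) (hN : (ballF R).card = N) (f : Fin N → C3) (ho : Orthonormal ℂ fun l => eL (f l))

def depl (R : ℝ) (f : Fin N → C3) : ℝ := ∑ p ∈ ballF R, (1 - nocc f p)

theorem depl_nonneg {R : ℝ} {f : Fin N → C3} (ho : Orthonormal ℂ fun l => eL (f l)) : 0 ≤ depl R f :=
  Finset.sum_nonneg fun p _ => sub_nonneg.2 (nocc_le_one f ho p)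

theorem depl_eq {R : ℝ} (hN : (ballF R).card = N) {f : Fin N → C3} : depl R f = N - ∑ p ∈ ballF R, nocc f p := by
  unfold depl
  rw [Finset.sum_sub_distrib]; simp [hN]

theorem out_le {R : ℝ} (hN : (ballF R).card = N) {f : Fin N → C3} (ho : Orthonormal ℂ fun l => eL (f l)) (F : Finset (Fin 3 → ℤ))
    (hF : ∀ p ∈ F, p ∉ ballF R) : ∑ p ∈ F, nocc f p ≤ depl R f := by
  rw [depl_eq hN]
  have h := sum_le_hasSum (ballF R ∪ F) (fun p _ => nocc_nonneg f p) (nocc_hasSum f ho)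
  rw [Finset.sum_union (Finset.disjoint_right.2 hF)] at h
  linarith

theorem exch_bound {R : ℝ} (hN : (ballF R).card = N) {f : Fin N → C3} (ho : Orthonormal ℂ fun l => eL (f l)) (k) :
    ((Lset R k).card : ℝ) - 2 * depl R f - 2 * √((Lset R k).card * depl R f) ≤ ∑ l, ‖eL (rml k f l)‖ ^ 2 := by
  have h1 : ∑ p ∈ Lset R k, ∑ l, ‖inner ℂ (eL (wk p)) (eL (rml k f l))‖ ^ 2 ≤ ∑ l, ‖eL (rml k f l)‖ ^ 2 := by
    rw [Finset.sum_comm]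
    exact Finset.sum_le_sum fun l _ => wk_orth.sum_inner_products_le _
  refine le_trans ?_ h1
  have h2 : ∑ p ∈ Lset R k, (1 - 2 * (1 - nocc f (p - k)) - 2 * √(nocc f p)) ≤ ∑ p ∈ Lset R k, ∑ l, ‖inner ℂ (eL (wk p)) (eL (rml k f l))‖ ^ 2 := by
    refine Finset.sum_le_sum fun p _ => ?_
    have := exch_one k f ho (p - k)
    rwa [sub_add_cancel] at this
  refine le_trans ?_ h2
  rw [Finset.sum_sub_distrib, Finset.sum_sub_distrib, ← Finset.mul_sum, ← Finset.mul_sum]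
  have h3 : ∑ p ∈ Lset R k, (1 - nocc f (p - k)) ≤ depl R f := by
    have e : ∑ p ∈ Lset R k, (1 - nocc f (p - k)) = ∑ q ∈ (Lset R k).image (fun p => p - k), (1 - nocc f q) := by
      rw [Finset.sum_image]
      intro a _ b _ hab; exact sub_left_injective hab
    rw [e]
    refine Finset.sum_le_sum_of_subset_of_nonneg ?_ fun p _ _ => sub_nonneg.2 (nocc_le_one f ho p)
    intro q hq
    obtain ⟨p, hp, rfl⟩ := Finset.mem_image.1 hq
    exact (mem_Lset.1 hp).1
  have h4 : ∑ p ∈ Lset R k, √(nocc f p) ≤ √((Lset R k).card * depl R f) := by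
    have h5 := Real.sum_mul_le_sqrt_mul_sqrt (Lset R k) (fun _ => (1:ℝ)) (fun p => √(nocc f p))
    simp only [one_mul, one_pow, Finset.sum_const, nsmul_eq_mul, mul_one, Real.sq_sqrt (nocc_nonneg f _)] at h5
    refine h5.trans ?_
    rw [← Real.sqrt_mul (by positivity)]
    refine Real.sqrt_le_sqrt (mul_le_mul_of_nonneg_left ?_ (by positivity))
    exact out_le hN ho _ fun p hp => (mem_Lset.1 hp).2
  simp only [Finset.sum_const, nsmul_eq_mul, mul_one]
  linarith

theorem znorm_sq_int (p : Fin 3 → ℤ) : znorm p ^ 2 = ((∑ i, p i ^ 2 : ℤ) : ℝ) := by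
  unfold znorm
  rw [Real.sq_sqrt (Finset.sum_nonneg fun i _ => sq_nonneg _)]; push_cast; rfl

theorem kin_bound {R : ℝ} (hR : 0 ≤ R) (hN : (ballF R).card = N) {f : Fin N → C3} (ho : Orthonormal ℂ fun l => eL (f l)) (K : ℝ)
    (hK : ∀ F : Finset (Fin 3 → ℤ), ∑ p ∈ F, znorm p ^ 2 * nocc f p ≤ K) :
    ∑ p ∈ ballF R, znorm p ^ 2 + depl R f ≤ K := by
  classical
  set μ : ℝ := (⌊R ^ 2⌋ : ℝ) + 1 / 2 with hμ
  have hin : ∀ p ∈ ballF R, znorm p ^ 2 ≤ μ - 1 / 2 := by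
    intro p hp
    have h1 : znorm p ^ 2 ≤ R ^ 2 := by
      have := mem_ballF.1 hp
      have h0 : 0 ≤ znorm p := Real.sqrt_nonneg _
      gcongr
    rw [znorm_sq_int] at h1 ⊢
    have := Int.le_floor.2 h1
    have : ((∑ i, p i ^ 2 : ℤ) : ℝ) ≤ (⌊R ^ 2⌋ : ℝ) := by exact_mod_cast this
    linarith
  have hout : ∀ p, p ∉ ballF R → μ + 1 / 2 ≤ znorm p ^ 2 := by
    intro p hp
    rw [mem_ballF, not_le] at hp
    have h1 : R ^ 2 < znorm p ^ 2 := by gcongr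
    rw [znorm_sq_int] at h1 ⊢
    have := Int.floor_lt.2 h1
    have : (⌊R ^ 2⌋ : ℝ) + 1 ≤ ((∑ i, p i ^ 2 : ℤ) : ℝ) := by exact_mod_cast this
    linarith
  have hμ0 : 0 ≤ μ := by
    have : (0:ℝ) ≤ (⌊R ^ 2⌋ : ℝ) := by exact_mod_cast Int.floor_nonneg.2 (sq_nonneg R)
    positivity
  have hn0 := nocc_nonneg f
  have hn1 := nocc_le_one f ho
  -- for finite F
  have hfin : ∀ F : Finset (Fin 3 → ℤ), ballF R ⊆ F →
      ∑ p ∈ ballF R, znorm p ^ 2 + depl R f + (μ + 1 / 2) * (∑ p ∈ F, nocc f p - N) ≤ K := by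
    intro F hF
    refine le_trans ?_ (hK F)
    rw [← Finset.sum_sdiff hF, ← Finset.sum_sdiff (f := fun p => znorm p ^ 2 * nocc f p) hF]
    have a1 : (μ + 1 / 2) * ∑ p ∈ F \ ballF R, nocc f p ≤ ∑ p ∈ F \ ballF R, znorm p ^ 2 * nocc f p := by
      rw [Finset.mul_sum]
      refine Finset.sum_le_sum fun p hp => mul_le_mul_of_nonneg_right (hout p (Finset.mem_sdiff.1 hp).2) (hn0 p)
    have a2 : ∑ p ∈ ballF R, znorm p ^ 2 - (μ - 1 / 2) * depl R f ≤ ∑ p ∈ ballF R, znorm p ^ 2 * nocc f p := by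
      unfold depl
      rw [Finset.mul_sum, ← Finset.sum_sub_distrib]
      refine Finset.sum_le_sum fun p hp => ?_
      nlinarith [mul_le_mul_of_nonneg_right (hin p hp) (sub_nonneg.2 (hn1 p))]
    have a3 := depl_eq (f := f) hN
    nlinarith
  have ht : Filter.Tendsto (fun F : Finset (Fin 3 → ℤ) => ∑ p ∈ ballF R, znorm p ^ 2 + depl R f + (μ + 1 / 2) * (∑ p ∈ F, nocc f p - N)) Filter.atTop
      (nhds (∑ p ∈ ballF R, znorm p ^ 2 + depl R f + (μ + 1 / 2) * ((N:ℝ) - N))) :=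
    (((nocc_hasSum f ho).sub_const (N:ℝ)).const_mul _).const_add _
  rw [sub_self, mul_zero, add_zero] at ht
  exact le_of_tendsto ht (Filter.eventually_atTop.2 ⟨ballF R, hfin⟩)

end bounds

end

/-! ### Lower bound on the Hartree-Fock energy -/

noncomputable section

theorem slater_low (V : (Fin 3 → ℤ) → ℝ) (hnn : ∀ k, 0 ≤ V k) (hfin : (Function.support V).Finite) {R : ℝ} (hR : 100 ≤ R)
    (ψ : (Fin (numParticles R) → Fin 3 → ℝ) → ℂ) (hψ : IsAdmissible _ ψ) (hs : IsSlater _ ψ) :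
    ∃ D : ℝ, 0 ≤ D ∧ hb R ^ 2 * (∑ p ∈ ballF R, znorm p ^ 2 + D) + Dat.Epot V hfin R
      - 1 / (2 * nR R) * ∑ k ∈ SV V hfin, V k * (2 * D + 2 * √((Lset R k).card * D)) ≤ energy V (numParticles R) ψ := by
  classical
  obtain ⟨f, hf, hp, hon, hsl⟩ := hs
  set g : Fin (numParticles R) → C3 := fun l => ⟨f l, (hf l).continuous⟩ with hg
  have ho : Orthonormal ℂ fun l => eL (g l) := by
    rw [orthonormal_iff_ite]; intro i j
    rw [eL_inner]; exact hon i j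
  have hψe : ψ = sl g := funext hsl
  have hN : (ballF R).card = numParticles R := card_ballF R
  have hn0 := nR_pos hR
  refine ⟨depl R g, depl_nonneg ho, ?_⟩
  rw [energy_eq V hfin ψ hψ]
  have hkin : ∑ p ∈ ballF R, znorm p ^ 2 + depl R g ≤ ∑ j, ∫ x in boxN (numParticles R), ∑ i, ‖fderiv ℝ ψ x (Pi.single j (Pi.single i (1:ℝ)))‖ ^ 2 := by
    refine kin_bound (by linarith) hN ho _ fun F => ?_
    have hd : ContDiff ℝ (⊤ : ℕ∞) (sl fun l => (⟨f l, (hf l).continuous⟩ : C3)) := by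
      have := hψ.smooth; rw [hψe] at this; exact this
    rw [hψe, hg, sl_kin f hf hd ho]
    calc ∑ p ∈ F, znorm p ^ 2 * nocc g p = ∑ l, ∑ p ∈ F, znorm p ^ 2 * ‖inner ℂ (eL (wk p)) (eL (g l))‖ ^ 2 := by
          unfold nocc; simp_rw [Finset.mul_sum]; rw [Finset.sum_comm]
      _ ≤ _ := Finset.sum_le_sum fun l _ => kin_fourier (f l) (hf l) (hp l) F
  have hpot : Dat.Epot V hfin R - 1 / (2 * nR R) * ∑ k ∈ SV V hfin, V k * (2 * depl R g + 2 * √((Lset R k).card * depl R g))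
      ≤ 1 / (2 * (numParticles R : ℝ)) * ∑ k ∈ hfin.toFinset, V k * ((∫ x in boxN (numParticles R), ‖(∑ j, ek k (x j)) * ψ x‖ ^ 2) - (numParticles R : ℝ)) := by
    unfold Dat.Epot
    rw [← mul_sub]
    refine mul_le_mul_of_nonneg_left ?_ (by positivity)
    rw [SV, Finset.sum_filter, ← Finset.sum_sub_distrib]
    refine Finset.sum_le_sum fun k _ => ?_
    by_cases hk : k = 0
    · subst hk
      have e : (∫ x in boxN (numParticles R), ‖(∑ j, ek 0 (x j)) * ψ x‖ ^ 2) = nR R ^ 2 := by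
        have : ∀ x, ‖(∑ j, ek 0 (x j)) * ψ x‖ ^ 2 = nR R ^ 2 * ‖ψ x‖ ^ 2 := by
          intro x; simp [ek_zero, nR, mul_pow]
        simp_rw [this]
        rw [integral_const_mul, hψ.normalized, mul_one]
      rw [e]; simp [nR]
    · simp only [if_neg hk, if_pos (show k ≠ 0 from hk)]
      rw [← mul_sub]
      refine mul_le_mul_of_nonneg_left ?_ (hnn k)
      have h1 := sl_pair k g ho
      have h2 := exch_bound hN ho k
      rw [hψe]
      change _ ≤ _ - nR R
      linarith
  have h3 := mul_le_mul_of_nonneg_left hkin (sq_nonneg (hb R))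
  change _ ≤ hb R ^ 2 * _ + _
  linarith

theorem hf_low (V : (Fin 3 → ℤ) → ℝ) (hnn : ∀ k, 0 ≤ V k) (hfin : (Function.support V).Finite) :
    ∃ C R0 : ℝ, 0 ≤ C ∧ ∀ R, R0 ≤ R → ∀ ψ, IsAdmissible (numParticles R) ψ → IsSlater _ ψ →
      hb R ^ 2 * ∑ p ∈ ballF R, znorm p ^ 2 + Dat.Epot V hfin R - C * hb R ^ 2 ≤ energy V (numParticles R) ψ := by
  set vs := ∑ k ∈ SV V hfin, V k with hvs
  have hv0 : 0 ≤ vs := Finset.sum_nonneg fun k _ => hnn k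
  set m := mV V hfin with hm
  have hm0 : 0 ≤ m := Finset.sum_nonneg fun k _ => Real.sqrt_nonneg _
  set A := √(30 * m + 350) * vs with hA
  have hA0 : 0 ≤ A := mul_nonneg (Real.sqrt_nonneg _) hv0
  refine ⟨A ^ 2 / 2, 100 + m + 2 * vs, by positivity, fun R hR ψ hψ hs => ?_⟩
  have hR1 : 100 ≤ R := by linarith
  obtain ⟨D, hD0, hD⟩ := slater_low V hnn hfin hR1 ψ hψ hs
  refine le_trans ?_ hD
  have h0 := hb_pos hR1
  have hhR := hbR_hi hR1
  have hN : 1 / (2 * nR R) = hb R ^ 3 / 2 := by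
    rw [div_eq_iff (by have := nR_pos hR1; positivity)]
    have := hb_cube hR1; linear_combination -this
  have hsum : ∑ k ∈ SV V hfin, V k * (2 * D + 2 * √((Lset R k).card * D)) ≤ vs * (2 * D + 2 * (√(30 * m + 350) * R * √D)) := by
    rw [hvs, Finset.sum_mul]
    refine Finset.sum_le_sum fun k hk => mul_le_mul_of_nonneg_left ?_ (hnn k)
    have hkm : znorm k ≤ m := Finset.single_le_sum (f := fun k => znorm k) (fun k _ => Real.sqrt_nonneg _) hk
    have hc := Lset_card R k (by linarith) (by linarith)
    have h1 : √((Lset R k).card * D) ≤ √(30 * m + 350) * R * √D := by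
      calc √((Lset R k).card * D) ≤ √((30 * m + 350) * R ^ 2 * D) := by
            apply Real.sqrt_le_sqrt
            refine mul_le_mul_of_nonneg_right (hc.trans ?_) hD0
            gcongr
        _ = _ := by
            rw [Real.sqrt_mul (by positivity), Real.sqrt_mul (by positivity), Real.sqrt_sq (by linarith)]
    linarith
  rw [hN]
  have h2 := mul_le_mul_of_nonneg_left hsum (show 0 ≤ hb R ^ 3 / 2 by positivity)
  have hsq : √D ^ 2 = D := Real.sq_sqrt hD0
  have hs0 := Real.sqrt_nonneg D
  have h3 : hb R ^ 3 / 2 * (vs * (2 * D + 2 * (√(30 * m + 350) * R * √D))) = hb R ^ 2 * (hb R * vs * D + hb R * R * (A * √D)) := by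
    rw [hA]; ring
  have h4 : hb R * vs ≤ 1 / 2 := by nlinarith
  have h5 : hb R * vs * D ≤ 1 / 2 * D := mul_le_mul_of_nonneg_right h4 hD0
  have h6 : hb R * R * (A * √D) ≤ 1 * (A * √D) := mul_le_mul_of_nonneg_right hhR (by positivity)
  have h7 : hb R * vs * D + hb R * R * (A * √D) ≤ D + A ^ 2 / 2 := by nlinarith [sq_nonneg (√D - A)]
  have h8 := mul_le_mul_of_nonneg_left h7 (sq_nonneg (hb R))
  rw [h3] at h2
  linarith

/-- the plane wave Slater determinant is admissible -/
theorem slater_exists (R : ℝ) : ∃ ψ, IsAdmissible (numParticles R) ψ ∧ IsSlater (numParticles R) ψ := by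
  classical
  set e : Fin (numParticles R) ≃ ballF R := (Finset.equivFinOfCardEq (card_ballF R)).symm with he
  set g : Fin (numParticles R) → C3 := fun l => wk (e l).1 with hg
  have ho : Orthonormal ℂ fun l => eL (g l) := wk_orth.comp (fun l => (e l).1) (Subtype.val_injective.comp e.injective)
  have hgd : ∀ l, ContDiff ℝ (⊤ : ℕ∞) (g l) := fun l => contDiff_const.mul (ek_contDiff _)
  have hgp : ∀ l (y : Fin 3 → ℝ) (m : Fin 3 → ℤ), g l (y + fun i => 2 * π * (m i : ℝ)) = g l y := by
    intro l y m
    simp only [hg, wk_apply]; rw [ek_periodic]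
  refine ⟨sl g, ⟨?_, ?_, ?_, ?_⟩, ⟨fun l => g l, hgd, hgp, ?_, fun x => rfl⟩⟩
  · unfold sl slg
    refine contDiff_const.mul (ContDiff.sum fun σ _ => contDiff_const.mul (contDiff_prod fun l _ => ?_))
    exact (hgd l).comp (contDiff_apply ℝ (Fin 3 → ℝ) (σ l))
  · intro x j m
    rw [sl_det, sl_det]
    congr 2
    ext a b
    simp only [Matrix.of_apply]
    by_cases h : a = j
    · subst h; simp only [Function.update_self]; exact hgp b _ m
    · rw [Function.update_of_ne h]
  · intro x σ
    rw [sl_det, sl_det]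
    have : (Matrix.of fun a b => g b ((x ∘ σ) a)) = (Matrix.of fun a b => g b (x a)).submatrix σ id := rfl
    rw [this, Matrix.det_permute]; ring
  · have h := norm_int_eq (sl g)
    rw [sl_inner] at h
    have h1 : (Matrix.of fun i j => inner ℂ (eL (g i)) (eL (g j))) = (1 : Matrix _ _ ℂ) := by
      ext i j
      rw [Matrix.of_apply, orthonormal_iff_ite.1 ho, Matrix.one_apply]
    rw [h1, Matrix.det_one] at h
    exact_mod_cast h
  · intro j l
    have := orthonormal_iff_ite.1 ho j l
    rw [eL_inner] at this; exact this

theorem hf_bound (V : (Fin 3 → ℤ) → ℝ) (hnn : ∀ k, 0 ≤ V k) (hfin : (Function.support V).Finite) :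
    ∃ C R0 : ℝ, 0 ≤ C ∧ ∀ R, R0 ≤ R →
      hb R ^ 2 * ∑ p ∈ ballF R, znorm p ^ 2 + Dat.Epot V hfin R - C * hb R ^ 2 ≤ hartreeFockEnergy V (numParticles R) := by
  obtain ⟨C, R0, hC, h⟩ := hf_low V hnn hfin
  refine ⟨C, R0, hC, fun R hR => ?_⟩
  obtain ⟨ψ, h1, h2⟩ := slater_exists R
  refine le_csInf ⟨_, ψ, h1, h2, rfl⟩ ?_
  rintro E ⟨φ, h3, h4, rfl⟩
  exact h R hR φ h3 h4

theorem rpa_eq (V : (Fin 3 → ℤ) → ℝ) (hfin : (Function.support V).Finite) (hev : ∀ k, V (-k) = V k) :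
    rpaEnergy V = ∑ k ∈ SVp V hfin, 2 * (κ * rpaK (V k) (znorm k)) := by
  classical
  have h0 : rpaEnergy V = κ * ∑ᶠ k, rpaK (V k) (znorm k) := rfl
  have hz : znorm 0 = 0 := by simp [znorm]
  rw [h0, finsum_eq_sum_of_support_subset (s := SV V hfin) _ ?_]
  · rw [← Finset.sum_filter_add_sum_filter_not (SV V hfin) posZ]
    have h1 : ∑ k ∈ (SV V hfin).filter (fun k => ¬ posZ k), rpaK (V k) (znorm k) = ∑ k ∈ SVp V hfin, rpaK (V k) (znorm k) := by
      refine Finset.sum_bij' (fun k _ => -k) (fun k _ => -k) ?_ ?_ ?_ ?_ ?_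
      · intro k hk
        rw [Finset.mem_filter, mem_SV] at hk
        rw [mem_SVp, hev]
        exact ⟨⟨hk.1.1, neg_ne_zero.2 hk.1.2⟩, posZ_or hk.1.2 hk.2⟩
      · intro k hk
        rw [mem_SVp] at hk
        rw [Finset.mem_filter, mem_SV, hev]
        exact ⟨⟨hk.1.1, neg_ne_zero.2 hk.1.2⟩, posZ_neg hk.2⟩
      · intro k _; exact neg_neg k
      · intro k _; exact neg_neg k
      · intro k _; rw [hev, znorm_neg]
    rw [h1]
    have h2 : (SV V hfin).filter posZ = SVp V hfin := by ext k; rw [Finset.mem_filter, mem_SV, mem_SVp]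
    rw [h2, ← Finset.mul_sum, ← Finset.mul_sum]; ring
  · intro k hk
    rw [Finset.mem_coe, mem_SV]
    rw [Function.mem_support] at hk
    refine ⟨fun h => hk ?_, fun h => hk ?_⟩
    · rw [h]; simp [rpaK]
    · rw [h, hz]; simp [rpaK]

end

theorem random_phase_approximation_upper_bound
    (Vhat : (Fin 3 → ℤ) → ℝ)
    (hnn : ∀ k, 0 ≤ Vhat k)
    (heven : ∀ k, Vhat (-k) = Vhat k)
    (hfin : (Function.support Vhat).Finite) :
    ∃ C : ℝ, 0 < C ∧ ∃ K₀ : ℝ, ∀ kF : ℝ, K₀ ≤ kF →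
      (groundEnergy Vhat (numParticles kF)
          - hartreeFockEnergy Vhat (numParticles kF)) /
        (((numParticles kF : ℝ) ^ ((1 : ℝ) / 3))⁻¹) ≤
      rpaEnergy Vhat + C * (numParticles kF : ℝ) ^ (-(1 : ℝ) / 27) := by
  obtain ⟨C1, R1, h1⟩ := ground_upper Vhat hnn hfin heven
  obtain ⟨C2, R2, hC2, h2⟩ := hf_bound Vhat hnn hfin
  refine ⟨|C1| + C2 + 1, by positivity, max 100 (max R1 R2), fun R hR => ?_⟩
  have hR0 : 100 ≤ R := (le_max_left _ _).trans hR
  have hR1 : R1 ≤ R := ((le_max_left _ _).trans (le_max_right _ _)).trans hR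
  have hR2 : R2 ≤ R := ((le_max_right _ _).trans (le_max_right _ _)).trans hR
  have h3 := h1 R hR1
  have h4 := h2 R hR2
  have hb0 := hb_pos hR0
  have ht0 := th_pos hR0
  have ht := hb_le_th hR0
  change _ / hb R ≤ rpaEnergy Vhat + _ * th R
  rw [div_le_iff₀ hb0, rpa_eq Vhat hfin heven]
  have h5 : C1 * (hb R * th R) ≤ |C1| * (hb R * th R) := mul_le_mul_of_nonneg_right (le_abs_self _) (by positivity)
  have h6 : C2 * hb R ^ 2 ≤ C2 * (hb R * th R) := mul_le_mul_of_nonneg_left (by nlinarith) hC2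
  have h7 : 0 ≤ hb R * th R := by positivity
  linarith
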